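/- Let f_1, …, f_r be restricted power series over ℤ_p in the s+m variables (λ_1,…,λ_s,x_1,…,x_m) (i.e., power series with coefficients in ℤ_p whose coefficients tend to 0, so that they converge on ℤ_p^{s+m}). Define I : ℤ_p^s → ℚ by I(λ) = ∫_{ℤ_p^m} |f(λ,x)| |dx|, where |f(λ,x)| denotes max_{1≤i≤r} |f_i(λ,x)|. Then I is the restriction to ℤ_p^s of a subanalytic constructible function on ℚ_p^s. -/

import Mathlib

open Filter MeasureTheory
open scoped ENNReal

namespace PadicSub

variable (p : ℕ) [Fact p.Prime]

/-- The coefficients (indexed by multi-indices) of a restricted power series: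
they tend to `0` along the cofinite filter. -/
def IsRestrictedCoeffs {m : ℕ} (a : (Fin m → ℕ) → ℚ_[p]) : Prop :=
  Filter.Tendsto a Filter.cofinite (nhds 0)

/-- The restricted analytic function associated to a family of coefficients:
the sum of the power series on `ℤ_p^m`, and `0` outside `ℤ_p^m`. -/
noncomputable def ranalFn {m : ℕ} (a : (Fin m → ℕ) → ℚ_[p]) (x : Fin m → ℚ_[p]) : ℚ_[p] :=
  if ∀ j, ‖x j‖ ≤ 1 then ∑' i : (Fin m → ℕ), a i * ∏ j, x j ^ i j else 0

/-- `D`-functions: the functions obtained from restricted analytic functions, polynomial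
maps, and the inverse function (with the convention `0⁻¹ = 0`) by repeated composition. -/
inductive IsDFunction : {m : ℕ} → ((Fin m → ℚ_[p]) → ℚ_[p]) → Prop where
  | ranal {m : ℕ} (a : (Fin m → ℕ) → ℚ_[p]) (ha : IsRestrictedCoeffs p a) :
      IsDFunction (ranalFn p a)
  | poly {m : ℕ} (q : MvPolynomial (Fin m) ℚ_[p]) :
      IsDFunction (fun x => MvPolynomial.eval x q)
  | inv : IsDFunction (fun x : Fin 1 → ℚ_[p] => (x 0)⁻¹)
  | comp {m n : ℕ} (f : (Fin n → ℚ_[p]) → ℚ_[p]) (g : Fin n → (Fin m → ℚ_[p]) → ℚ_[p]) :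
      IsDFunction f → (∀ i, IsDFunction (g i)) →
      IsDFunction (fun x => f (fun i => g i x))

/-- `P_n`: the set of nonzero `n`-th powers in `ℚ_p`. -/
def Pset (n : ℕ) : Set ℚ_[p] := {x | ∃ y : ℚ_[p], y ≠ 0 ∧ y ^ n = x}

/-- The coset `μ P_n`. -/
def cosetP (μ : ℚ_[p]) (n : ℕ) : Set ℚ_[p] := {x | ∃ y ∈ Pset p n, x = μ * y}

/-- A (globally) subanalytic subset of `ℚ_p^m`: a finite union of finite intersections of
sets of the form `{x | f x = 0}` and `{x | f x ∈ P_n}`, `f` a `D`-function, `n > 0`. -/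
def IsSubanalytic {m : ℕ} (X : Set (Fin m → ℚ_[p])) : Prop :=
  ∃ (r s : ℕ) (F : Fin r → Fin s → Set (Fin m → ℚ_[p])),
    (∀ i j, (∃ f, IsDFunction p f ∧ F i j = {x | f x = 0}) ∨
            (∃ f n, IsDFunction p f ∧ 0 < n ∧ F i j = {x | f x ∈ Pset p n})) ∧
    X = ⋃ i, ⋂ j, F i j

/-- A semialgebraic subset of `ℚ_p^m`: a finite union of finite intersections of
sets of the form `{x | f x = 0}` and `{x | f x ∈ P_n}`, `f` a polynomial, `n > 0`. -/
def IsSemialgebraic {m : ℕ} (X : Set (Fin m → ℚ_[p])) : Prop :=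
  ∃ (r s : ℕ) (F : Fin r → Fin s → Set (Fin m → ℚ_[p])),
    (∀ i j, (∃ f : MvPolynomial (Fin m) ℚ_[p], F i j = {x | MvPolynomial.eval x f = 0}) ∨
            (∃ (f : MvPolynomial (Fin m) ℚ_[p]) (n : ℕ), 0 < n ∧
              F i j = {x | MvPolynomial.eval x f ∈ Pset p n})) ∧
    X = ⋃ i, ⋂ j, F i j

/-- The graph of the restriction to `X` of a map `ℚ_p^m → ℚ_p^n`, inside `ℚ_p^(m+n)`. -/
def graphMap {m n : ℕ} (X : Set (Fin m → ℚ_[p])) (F : (Fin m → ℚ_[p]) → (Fin n → ℚ_[p])) :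
    Set (Fin (m + n) → ℚ_[p]) :=
  {z | (fun i => z (Fin.castAdd n i)) ∈ X ∧
    F (fun i => z (Fin.castAdd n i)) = fun j => z (Fin.natAdd m j)}

/-- The graph of the restriction to `X` of a function `ℚ_p^m → ℚ_p`, inside `ℚ_p^(m+1)`. -/
def graphFun {m : ℕ} (X : Set (Fin m → ℚ_[p])) (f : (Fin m → ℚ_[p]) → ℚ_[p]) :
    Set (Fin (m + 1) → ℚ_[p]) :=
  {z | (fun i : Fin m => z i.castSucc) ∈ X ∧ f (fun i : Fin m => z i.castSucc) = z (Fin.last m)}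

/-- A function `ℚ_p^m → ℚ_p` is subanalytic on `X` if its graph over `X` is subanalytic. -/
def IsSubanalyticFnOn {m : ℕ} (X : Set (Fin m → ℚ_[p])) (f : (Fin m → ℚ_[p]) → ℚ_[p]) : Prop :=
  IsSubanalytic p (graphFun p X f)

/-- A (totally defined) subanalytic function `ℚ_p^m → ℚ_p`. -/
def IsSubanalyticFn {m : ℕ} (f : (Fin m → ℚ_[p]) → ℚ_[p]) : Prop :=
  IsSubanalyticFnOn p Set.univ f

/-- A function `ℚ_p^m → ℚ_p` is semialgebraic on `X` if its graph over `X` is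
semialgebraic. -/
def IsSemialgebraicFnOn {m : ℕ} (X : Set (Fin m → ℚ_[p])) (f : (Fin m → ℚ_[p]) → ℚ_[p]) :
    Prop :=
  IsSemialgebraic p (graphFun p X f)

/-- A subanalytic subset of `ℚ_p` (one-variable version). -/
def IsSubanalytic1 (X : Set ℚ_[p]) : Prop :=
  IsSubanalytic p {z : Fin 1 → ℚ_[p] | z 0 ∈ X}

/-- A semialgebraic subset of `ℚ_p` (one-variable version). -/
def IsSemialgebraic1 (X : Set ℚ_[p]) : Prop :=
  IsSemialgebraic p {z : Fin 1 → ℚ_[p] | z 0 ∈ X}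

/-- A function `ℚ_p → ℚ_p` subanalytic on `X ⊆ ℚ_p`: its graph over `X` is a subanalytic
subset of `ℚ_p²`. -/
def IsSubanalyticFnOn1 (X : Set ℚ_[p]) (f : ℚ_[p] → ℚ_[p]) : Prop :=
  IsSubanalytic p {z : Fin 2 → ℚ_[p] | z 0 ∈ X ∧ f (z 0) = z 1}

/-- A function `ℚ_p → ℚ_p` semialgebraic on `X ⊆ ℚ_p`: its graph over `X` is a
semialgebraic subset of `ℚ_p²`. -/
def IsSemialgebraicFnOn1 (X : Set ℚ_[p]) (f : ℚ_[p] → ℚ_[p]) : Prop :=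
  IsSemialgebraic p {z : Fin 2 → ℚ_[p] | z 0 ∈ X ∧ f (z 0) = z 1}

/-- Interpretation of the symbols `□ᵢ` in the definition of cells: `true` means `<` and
`false` means "no condition". -/
def sqRel (b : Bool) (x y : ℝ) : Prop := b = true → x < y

/-- A cell in `ℚ_p`, presented with its center `γ` and coset data `μ`, `n`. -/
def IsCell1 (A : Set ℚ_[p]) (γ μ : ℚ_[p]) (n : ℕ) : Prop :=
  0 < n ∧ A.Nonempty ∧
  ∃ (α β : ℚ_[p]) (b₁ b₂ : Bool), α ≠ 0 ∧ β ≠ 0 ∧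
    A = {t | sqRel b₁ ‖α‖ ‖t - γ‖ ∧ sqRel b₂ ‖t - γ‖ ‖β‖ ∧ t - γ ∈ cosetP p μ n}

/-- Subanalytic cells in `ℚ_p^(m+1)`, defined inductively, presented with their center
`γ : ℚ_p^m → ℚ_p` and coset data `μ`, `n`.  The projection of the cell onto the first `m`
coordinates is required to be a cell. -/
inductive IsCell : {m : ℕ} → Set (Fin (m + 1) → ℚ_[p]) →
    ((Fin m → ℚ_[p]) → ℚ_[p]) → ℚ_[p] → ℕ → Prop where
  | base (n : ℕ) (hn : 0 < n) (μ γ0 α β : ℚ_[p]) (hα : α ≠ 0) (hβ : β ≠ 0)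
      (b₁ b₂ : Bool) (A : Set (Fin 1 → ℚ_[p])) (hne : A.Nonempty)
      (hA : A = {z | sqRel b₁ ‖α‖ ‖z 0 - γ0‖ ∧ sqRel b₂ ‖z 0 - γ0‖ ‖β‖ ∧
        z 0 - γ0 ∈ cosetP p μ n}) :
      IsCell A (fun _ => γ0) μ n
  | succ {m : ℕ} {D : Set (Fin (m + 1) → ℚ_[p])} {γD : (Fin m → ℚ_[p]) → ℚ_[p]}
      {μD : ℚ_[p]} {nD : ℕ} (hD : IsCell D γD μD nD)
      (n : ℕ) (hn : 0 < n) (μ : ℚ_[p]) (α β γ : (Fin (m + 1) → ℚ_[p]) → ℚ_[p])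
      (hα : IsSubanalyticFn p α) (hβ : IsSubanalyticFn p β) (hγ : IsSubanalyticFn p γ)
      (hα0 : ∀ x, α x ≠ 0) (hβ0 : ∀ x, β x ≠ 0)
      (b₁ b₂ : Bool) (A : Set (Fin (m + 2) → ℚ_[p]))
      (hA : A = {z | (fun i : Fin (m + 1) => z i.castSucc) ∈ D ∧
          sqRel b₁ ‖α (fun i : Fin (m + 1) => z i.castSucc)‖
            ‖z (Fin.last (m + 1)) - γ (fun i : Fin (m + 1) => z i.castSucc)‖ ∧
          sqRel b₂ ‖z (Fin.last (m + 1)) - γ (fun i : Fin (m + 1) => z i.castSucc)‖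
            ‖β (fun i : Fin (m + 1) => z i.castSucc)‖ ∧
          z (Fin.last (m + 1)) - γ (fun i : Fin (m + 1) => z i.castSucc) ∈ cosetP p μ n})
      (hproj : (fun (z : Fin (m + 2) → ℚ_[p]) (i : Fin (m + 1)) => z i.castSucc) '' A = D) :
      IsCell A γ μ n

/-- Analytic cells in `ℚ_p^(m+1)`: as subanalytic cells, but at each stage of the inductive
definition the functions `α`, `β`, `γ` are moreover analytic on the projection of the cell. -/
inductive IsAnalyticCell : {m : ℕ} → Set (Fin (m + 1) → ℚ_[p]) →
    ((Fin m → ℚ_[p]) → ℚ_[p]) → ℚ_[p] → ℕ → Prop where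
  | base (n : ℕ) (hn : 0 < n) (μ γ0 α β : ℚ_[p]) (hα : α ≠ 0) (hβ : β ≠ 0)
      (b₁ b₂ : Bool) (A : Set (Fin 1 → ℚ_[p])) (hne : A.Nonempty)
      (hA : A = {z | sqRel b₁ ‖α‖ ‖z 0 - γ0‖ ∧ sqRel b₂ ‖z 0 - γ0‖ ‖β‖ ∧
        z 0 - γ0 ∈ cosetP p μ n}) :
      IsAnalyticCell A (fun _ => γ0) μ n
  | succ {m : ℕ} {D : Set (Fin (m + 1) → ℚ_[p])} {γD : (Fin m → ℚ_[p]) → ℚ_[p]}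
      {μD : ℚ_[p]} {nD : ℕ} (hD : IsAnalyticCell D γD μD nD)
      (n : ℕ) (hn : 0 < n) (μ : ℚ_[p]) (α β γ : (Fin (m + 1) → ℚ_[p]) → ℚ_[p])
      (hα : IsSubanalyticFn p α) (hβ : IsSubanalyticFn p β) (hγ : IsSubanalyticFn p γ)
      (hαan : AnalyticOn ℚ_[p] α D) (hβan : AnalyticOn ℚ_[p] β D)
      (hγan : AnalyticOn ℚ_[p] γ D)
      (hα0 : ∀ x, α x ≠ 0) (hβ0 : ∀ x, β x ≠ 0)
      (b₁ b₂ : Bool) (A : Set (Fin (m + 2) → ℚ_[p]))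
      (hA : A = {z | (fun i : Fin (m + 1) => z i.castSucc) ∈ D ∧
          sqRel b₁ ‖α (fun i : Fin (m + 1) => z i.castSucc)‖
            ‖z (Fin.last (m + 1)) - γ (fun i : Fin (m + 1) => z i.castSucc)‖ ∧
          sqRel b₂ ‖z (Fin.last (m + 1)) - γ (fun i : Fin (m + 1) => z i.castSucc)‖
            ‖β (fun i : Fin (m + 1) => z i.castSucc)‖ ∧
          z (Fin.last (m + 1)) - γ (fun i : Fin (m + 1) => z i.castSucc) ∈ cosetP p μ n})
      (hproj : (fun (z : Fin (m + 2) → ℚ_[p]) (i : Fin (m + 1)) => z i.castSucc) '' A = D) :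
      IsAnalyticCell A γ μ n

/-- Generators of the algebra of subanalytic constructible functions on `ℚ_p^m`:
`ℤ`-valued valuations of nonvanishing subanalytic functions, and (`ℚ`-valued) norms of
subanalytic functions. -/
def constructibleGens (m : ℕ) : Set ((Fin m → ℚ_[p]) → ℚ) :=
  {g | ∃ h : (Fin m → ℚ_[p]) → ℚ_[p], IsSubanalyticFn p h ∧ (∀ x, h x ≠ 0) ∧
        g = fun x => ((h x).valuation : ℚ)} ∪
  {g | ∃ h : (Fin m → ℚ_[p]) → ℚ_[p], IsSubanalyticFn p h ∧
        g = fun x => (padicNormE (h x) : ℚ)}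

/-- The `ℚ`-algebra `C(ℚ_p^m)` of subanalytic constructible functions on `ℚ_p^m`. -/
noncomputable def ConstructibleAlg (m : ℕ) : Subalgebra ℚ ((Fin m → ℚ_[p]) → ℚ) :=
  Algebra.adjoin ℚ (constructibleGens p m)

/-- `ℤ_p^m` as a subset of `ℚ_p^m`. -/
def ZpSet (m : ℕ) : Set (Fin m → ℚ_[p]) := {x | ∀ j, ‖x j‖ ≤ 1}

/-- A simple subset of `ℤ^n × ℚ_p^m`. -/
def IsSimpleSet (n m : ℕ) (A : Set ((Fin n → ℤ) × (Fin m → ℚ_[p]))) : Prop :=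
  IsSubanalytic p {z : Fin (n + m) → ℚ_[p] |
    (∀ i : Fin n, z (Fin.castAdd m i) ≠ 0) ∧
    ((fun i : Fin n => (z (Fin.castAdd m i)).valuation),
      fun j : Fin m => z (Fin.natAdd n j)) ∈ A}

/-- A simple function `ℤ^n × ℚ_p^m → ℤ`: one whose graph is a simple set. -/
def IsSimpleFn (n m : ℕ) (h : (Fin n → ℤ) × (Fin m → ℚ_[p]) → ℤ) : Prop :=
  IsSimpleSet p (n + 1) m
    {w | w.1 (Fin.last n) = h (fun i : Fin n => w.1 i.castSucc, w.2)}

/-- Generators of `C_simple(ℤ^n × ℚ_p^m)`: simple functions, and `p^h` for `h` simple. -/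
def simpleGens (n m : ℕ) : Set ((Fin n → ℤ) × (Fin m → ℚ_[p]) → ℚ) :=
  {g | ∃ h, IsSimpleFn p n m h ∧ g = fun w => (h w : ℚ)} ∪
  {g | ∃ h, IsSimpleFn p n m h ∧ g = fun w => (p : ℚ) ^ (h w)}

/-- The `ℚ`-algebra `C_simple(ℤ^n × ℚ_p^m)`. -/
noncomputable def SimpleAlg (n m : ℕ) : Subalgebra ℚ ((Fin n → ℤ) × (Fin m → ℚ_[p]) → ℚ) :=
  Algebra.adjoin ℚ (simpleGens p n m)

noncomputable instance : MeasurableSpace ℚ_[p] := borel _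
instance : BorelSpace ℚ_[p] := ⟨rfl⟩

end PadicSub



open Filter MeasureTheory

namespace DC

variable {p : ℕ} [hp : Fact p.Prime]

theorem p1 : (1:ℝ) < p := by exact_mod_cast hp.out.one_lt
theorem p0 : (0:ℝ) < p := lt_trans one_pos p1
theorem p2 : (2:ℝ) ≤ p := by exact_mod_cast hp.out.two_le
theorem pK0 : (p:ℚ_[p]) ≠ 0 := by exact_mod_cast hp.out.ne_zero

theorem npow (k : ℤ) : ‖(p:ℚ_[p])^k‖ = (p:ℝ)^(-k) := by
  rw [norm_zpow, Padic.norm_p, inv_zpow, zpow_neg]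

theorem nv {x : ℚ_[p]} (hx : x ≠ 0) : ‖x‖ = (p:ℝ)^(-x.valuation) :=
  Padic.norm_eq_zpow_neg_valuation hx

theorem norm_le_iff {x y : ℚ_[p]} (hx : x ≠ 0) (hy : y ≠ 0) :
    ‖x‖ ≤ ‖y‖ ↔ y.valuation ≤ x.valuation := by
  rw [nv hx, nv hy, zpow_le_zpow_iff_right₀ p1]; omega

theorem norm_lt_iff {x y : ℚ_[p]} (hx : x ≠ 0) (hy : y ≠ 0) :
    ‖x‖ < ‖y‖ ↔ y.valuation < x.valuation := by
  rw [nv hx, nv hy, zpow_lt_zpow_iff_right₀ p1]; omega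

theorem norm_eq_iff {x y : ℚ_[p]} (hx : x ≠ 0) (hy : y ≠ 0) :
    ‖x‖ = ‖y‖ ↔ x.valuation = y.valuation := by
  rw [nv hx, nv hy, zpow_right_inj₀ p0 p1.ne']; omega

theorem v_eq_of_norm {x y : ℚ_[p]} (h : ‖x‖ = ‖y‖) : x.valuation = y.valuation := by
  by_cases hx : x = 0
  · subst hx
    have : y = 0 := by simpa [eq_comm] using h
    rw [this]
  · have hy : y ≠ 0 := by
      rintro rfl
      simp at h; exact hx h
    exact (norm_eq_iff hx hy).1 h

theorem v_pow_p (k : ℤ) : ((p:ℚ_[p])^k).valuation = k := by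
  have h := nv (zpow_ne_zero k (pK0 (p := p)))
  rw [npow, zpow_right_inj₀ p0 p1.ne'] at h
  omega

theorem v_mul {x y : ℚ_[p]} (hx : x ≠ 0) (hy : y ≠ 0) :
    (x*y).valuation = x.valuation + y.valuation := Padic.valuation_mul hx hy

theorem v_inv (x : ℚ_[p]) : (x⁻¹).valuation = -x.valuation := Padic.valuation_inv x

/-- angular component as element of K -/
noncomputable def ac (x : ℚ_[p]) : ℚ_[p] := x * (p:ℚ_[p])^(-x.valuation)

theorem ac_zero : ac (0 : ℚ_[p]) = 0 := by simp [ac]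

theorem norm_ac {x : ℚ_[p]} (hx : x ≠ 0) : ‖ac x‖ = 1 := by
  rw [ac, norm_mul, npow, nv hx, ← zpow_add₀ p0.ne']; simp

theorem norm_ac_le (x : ℚ_[p]) : ‖ac x‖ ≤ 1 := by
  by_cases hx : x = 0
  · subst hx; simp [ac_zero]
  · exact (norm_ac hx).le

theorem ac_spec (x : ℚ_[p]) : x = ac x * (p:ℚ_[p])^(x.valuation) := by
  rw [ac, mul_assoc, ← zpow_add₀ pK0]; simp

/-- angular component in `ℤ_p` -/
noncomputable def acI (x : ℚ_[p]) : ℤ_[p] := ⟨ac x, norm_ac_le x⟩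

/-- angular component modulo `p^N` -/
noncomputable def acz (N : ℕ) (x : ℚ_[p]) : ℤ := ((PadicInt.toZModPow N (acI x)).val : ℤ)

theorem acz_nonneg (N : ℕ) (x : ℚ_[p]) : 0 ≤ acz N x := Int.natCast_nonneg _

theorem acz_lt (N : ℕ) (x : ℚ_[p]) : acz N x < p^N := by
  have : NeZero (p^N) := ⟨pow_ne_zero _ hp.out.ne_zero⟩
  have := ZMod.val_lt (PadicInt.toZModPow N (acI x))
  rw [acz]; exact_mod_cast this

theorem acz_eq_iff (N : ℕ) (x y : ℚ_[p]) :
    acz N x = acz N y ↔ ‖ac x - ac y‖ ≤ (p:ℝ)^(-(N:ℤ)) := by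
  have : NeZero (p^N) := ⟨pow_ne_zero _ hp.out.ne_zero⟩
  rw [acz, acz, Nat.cast_inj, (ZMod.val_injective _).eq_iff, ← sub_eq_zero, ← map_sub,
    ← RingHom.mem_ker, PadicInt.ker_toZModPow, ← PadicInt.norm_le_pow_iff_mem_span_pow]
  rfl

theorem acz_zero (N : ℕ) : acz N (0:ℚ_[p]) = 0 := by
  have : acI (0:ℚ_[p]) = 0 := Subtype.ext ac_zero
  simp [acz, this]

theorem acz_eq_zero {N : ℕ} (hN : 1 ≤ N) {x : ℚ_[p]} : acz N x = 0 ↔ x = 0 := by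
  constructor
  · intro h
    by_contra hx
    rw [← acz_zero (p := p) N, acz_eq_iff, ac_zero, sub_zero, norm_ac hx] at h
    have : (p:ℝ)^(-(N:ℤ)) < 1 := zpow_lt_one_of_neg₀ p1 (by omega)
    linarith
  · rintro rfl; exact acz_zero N

/-- multiplicative approximation -/
def Apx (N : ℕ) (x y : ℚ_[p]) : Prop := ‖x - y‖ ≤ (p:ℝ)^(-(N:ℤ)) * ‖y‖

theorem pN_lt {N : ℕ} (hN : 1 ≤ N) : (p:ℝ)^(-(N:ℤ)) < 1 :=
  zpow_lt_one_of_neg₀ p1 (by omega)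

theorem pN_le (N : ℕ) : (p:ℝ)^(-(N:ℤ)) ≤ 1 := zpow_le_one_of_nonpos₀ p1.le (by omega)

theorem pN_pos (N : ℤ) : 0 < (p:ℝ)^N := zpow_pos p0 _

theorem norm_eq_of_sub_lt {x y : ℚ_[p]} (h : ‖x - y‖ < ‖y‖) : ‖x‖ = ‖y‖ := by
  have : x = (x - y) + y := by ring
  rw [this, Padic.add_eq_max_of_ne h.ne, max_eq_right h.le]

theorem Apx.rfl' {N : ℕ} {x : ℚ_[p]} : Apx N x x := by
  simp only [Apx, sub_self, norm_zero]
  exact mul_nonneg (pN_pos _).le (norm_nonneg _)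

theorem Apx.zero_of {N : ℕ} {x : ℚ_[p]} (h : Apx N x 0) : x = 0 := by
  simpa [Apx] using h

theorem Apx.norm_eq {N : ℕ} (hN : 1 ≤ N) {x y : ℚ_[p]} (h : Apx N x y) : ‖x‖ = ‖y‖ := by
  by_cases hy : y = 0
  · subst hy; rw [h.zero_of]
  · apply norm_eq_of_sub_lt
    refine lt_of_le_of_lt h ?_
    have := norm_pos_iff.2 hy
    nlinarith [pN_lt (p := p) hN]

theorem Apx.symm {N : ℕ} (hN : 1 ≤ N) {x y : ℚ_[p]} (h : Apx N x y) : Apx N y x := by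
  rw [Apx, h.norm_eq hN, norm_sub_rev]; exact h

theorem Apx.mono {N M : ℕ} (hN : M ≤ N) {x y : ℚ_[p]} (h : Apx N x y) : Apx M x y := by
  refine h.trans ?_
  gcongr
  exact p1.le

theorem nadd_le {x y : ℚ_[p]} {r : ℝ} (hx : ‖x‖ ≤ r) (hy : ‖y‖ ≤ r) : ‖x + y‖ ≤ r :=
  (Padic.nonarchimedean x y).trans (max_le hx hy)

theorem nsub_le {x y : ℚ_[p]} {r : ℝ} (hx : ‖x‖ ≤ r) (hy : ‖y‖ ≤ r) : ‖x - y‖ ≤ r := by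
  rw [sub_eq_add_neg]; exact nadd_le hx (by rwa [norm_neg])

theorem ntri {x y z : ℚ_[p]} {r : ℝ} (hx : ‖x - y‖ ≤ r) (hy : ‖y - z‖ ≤ r) : ‖x - z‖ ≤ r := by
  have : x - z = (x - y) + (y - z) := by ring
  rw [this]; exact nadd_le hx hy

theorem nsum_le {ι : Type*} {s : Finset ι} {f : ι → ℚ_[p]} {r : ℝ} (hr : 0 ≤ r)
    (h : ∀ i ∈ s, ‖f i‖ ≤ r) : ‖∑ i ∈ s, f i‖ ≤ r := by
  classical
  induction s using Finset.induction_on with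
  | empty => simpa using hr
  | insert a s ha ih =>
    rw [Finset.sum_insert ha]
    exact nadd_le (h a (by simp)) (ih fun i hi => h i (by simp [hi]))

theorem Apx.trans {N : ℕ} (hN : 1 ≤ N) {x y z : ℚ_[p]} (h : Apx N x y) (h' : Apx N y z) :
    Apx N x z := by
  have e := h'.norm_eq hN
  rw [Apx] at *
  rw [e] at h
  exact ntri h h'

theorem Apx.mul {N : ℕ} {x y x' y' : ℚ_[p]} (h : Apx N x y) (h' : Apx N x' y') :
    Apx N (x*x') (y*y') := by
  have e : x*x' - y*y' = (x-y)*(x'-y') + ((x-y)*y' + y*(x'-y')) := by ring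
  have ha : ‖(x-y)*y'‖ ≤ (p:ℝ)^(-(N:ℤ)) * ‖y*y'‖ := by
    rw [norm_mul, norm_mul, ← mul_assoc]; exact mul_le_mul_of_nonneg_right h (norm_nonneg _)
  have hb : ‖y*(x'-y')‖ ≤ (p:ℝ)^(-(N:ℤ)) * ‖y*y'‖ := by
    rw [norm_mul, norm_mul, mul_left_comm]; exact mul_le_mul_of_nonneg_left h' (norm_nonneg _)
  have hc : ‖(x-y)*(x'-y')‖ ≤ (p:ℝ)^(-(N:ℤ)) * ‖y*y'‖ := by
    rw [norm_mul]
    calc ‖x-y‖*‖x'-y'‖ ≤ ((p:ℝ)^(-(N:ℤ)) * ‖y‖) * ((p:ℝ)^(-(N:ℤ)) * ‖y'‖) :=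
          mul_le_mul h h' (norm_nonneg _) (mul_nonneg (pN_pos _).le (norm_nonneg _))
      _ ≤ ((p:ℝ)^(-(N:ℤ)) * ‖y‖) * (1 * ‖y'‖) := by
          gcongr
          exact pN_le N
      _ = _ := by rw [norm_mul]; ring
  rw [Apx, e]
  exact nadd_le hc (nadd_le ha hb)

theorem Apx.inv {N : ℕ} (hN : 1 ≤ N) {x y : ℚ_[p]} (h : Apx N x y) : Apx N x⁻¹ y⁻¹ := by
  by_cases hy : y = 0
  · subst hy; rw [h.zero_of]; exact Apx.rfl'
  have e := h.norm_eq hN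
  have hx : x ≠ 0 := by rw [← norm_pos_iff, e]; exact norm_pos_iff.2 hy
  rw [Apx, inv_sub_inv hx hy, norm_div, norm_mul, norm_inv, e, norm_sub_rev]
  have := norm_pos_iff.2 hy
  rw [div_le_iff₀ (by positivity)]
  refine le_trans h (le_of_eq ?_)
  field_simp

theorem Apx.neg {N : ℕ} {x y : ℚ_[p]} (h : Apx N x y) : Apx N (-x) (-y) := by
  rw [Apx, ← neg_sub', norm_neg, norm_neg]; exact h

theorem Apx.pow {N : ℕ} {x y : ℚ_[p]} (h : Apx N x y) (k : ℕ) : Apx N (x^k) (y^k) := by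
  induction k with
  | zero => simpa using Apx.rfl'
  | succ k ih => rw [pow_succ, pow_succ]; exact ih.mul h

theorem Apx.v_eq {N : ℕ} (hN : 1 ≤ N) {x y : ℚ_[p]} (h : Apx N x y) :
    x.valuation = y.valuation := v_eq_of_norm (h.norm_eq hN)

theorem apx_iff {N : ℕ} (hN : 1 ≤ N) {x y : ℚ_[p]} :
    Apx N x y ↔ x.valuation = y.valuation ∧ acz N x = acz N y := by
  by_cases hy : y = 0
  · subst hy
    rw [acz_zero, acz_eq_zero hN]
    constructor
    · intro h; have := h.zero_of; subst this; simp
    · rintro ⟨-, rfl⟩; exact Apx.rfl'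
  · have key : x.valuation = y.valuation → (Apx N x y ↔ acz N x = acz N y) := by
      intro hv
      rw [acz_eq_iff, ac, ac, hv, ← sub_mul, norm_mul, npow, neg_neg, Apx, nv hy, zpow_neg _ y.valuation,
        ← div_eq_mul_inv, le_div_iff₀ (pN_pos _)]
    constructor
    · intro h; exact ⟨h.v_eq hN, (key (h.v_eq hN)).1 h⟩
    · rintro ⟨h1, h2⟩; exact (key h1).2 h2

theorem Apx.acz_eq {N : ℕ} (hN : 1 ≤ N) {x y : ℚ_[p]} (h : Apx N x y) :
    acz N x = acz N y := ((apx_iff hN).1 h).2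

theorem acz_apx {N : ℕ} (hN : 1 ≤ N) (x : ℚ_[p]) :
    Apx N x ((acz N x : ℚ_[p]) * (p:ℚ_[p])^(x.valuation)) := by
  have : NeZero (p^N) := ⟨pow_ne_zero _ hp.out.ne_zero⟩
  by_cases hx : x = 0
  · subst hx; simp [acz_zero, Apx]
  have h1 : ‖ac x - (acz N x : ℚ_[p])‖ ≤ (p:ℝ)^(-(N:ℤ)) := by
    have h : acI x - (acz N x : ℤ_[p]) ∈ RingHom.ker (PadicInt.toZModPow (p := p) N) := by
      rw [RingHom.mem_ker, map_sub, sub_eq_zero, acz]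
      simp
    rw [PadicInt.ker_toZModPow, ← PadicInt.norm_le_pow_iff_mem_span_pow] at h
    convert h using 1
    rw [← PadicInt.padic_norm_e_of_padicInt]
    congr 1
  have h2 : ‖(acz N x : ℚ_[p])‖ = 1 := by
    rw [← norm_ac hx]
    apply norm_eq_of_sub_lt
    rw [norm_ac hx, norm_sub_rev]
    exact lt_of_le_of_lt h1 (pN_lt hN)
  rw [Apx]
  nth_rw 1 [ac_spec x]
  rw [← sub_mul, norm_mul, norm_mul, h2, one_mul]
  gcongr

end DC


open Filter MeasureTheory Polynomial

namespace DC

variable {p : ℕ} [hp : Fact p.Prime]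

/-- `t` is at distance at least `R` from all roots of all nonzero derivatives of `q`. -/
def Far (q : ℚ_[p][X]) (t : ℚ_[p]) (R : ℝ) : Prop :=
  ∀ (i : ℕ) (c : ℚ_[p]), derivative^[i] q ≠ 0 → (derivative^[i] q).eval c = 0 → R ≤ ‖t - c‖

theorem Far.deriv {q : ℚ_[p][X]} {t : ℚ_[p]} {R : ℝ} (h : Far q t R) : Far (derivative q) t R := by
  intro i c h1 h2
  rw [← Function.iterate_succ_apply] at h1 h2
  exact h (i+1) c h1 h2

theorem Far.mono {q : ℚ_[p][X]} {t : ℚ_[p]} {R R' : ℝ} (h : Far q t R) (hR : R' ≤ R) : Far q t R' :=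
  fun i c h1 h2 => hR.trans (h i c h1 h2)

theorem Far.shift {q : ℚ_[p][X]} {t t' : ℚ_[p]} {R : ℝ} (h : Far q t R) (ht : ‖t - t'‖ < R) :
    Far q t' R := by
  intro i c h1 h2
  have h3 := h i c h1 h2
  by_contra h4
  push Not at h4
  have : ‖t - c‖ ≤ max ‖t - t'‖ ‖t' - c‖ := by
    have e : t - c = (t - t') + (t' - c) := by ring
    rw [e]; exact Padic.nonarchimedean _ _
  have := max_lt ht h4
  linarith

theorem eval_taylor (q : ℚ_[p][X]) (t t' : ℚ_[p]) :
    q.eval t' = ∑ i ∈ Finset.range (q.natDegree + 1), (hasseDeriv i q).eval t * (t' - t)^i := by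
  have h : q.eval t' = (taylor t q).eval (t' - t) := by rw [taylor_eval]; ring_nf
  rw [h, eval_eq_sum_range, natDegree_taylor]
  simp [taylor_coeff]

theorem norm_nat_ge (j : ℕ) (hj : j ≠ 0) : (p:ℝ)^(-(j:ℤ)) ≤ ‖(j:ℚ_[p])‖ := by
  have hj' : (j:ℚ_[p]) ≠ 0 := by exact_mod_cast hj
  rw [nv hj', zpow_le_zpow_iff_right₀ p1, Padic.valuation_natCast]
  have h1 : p ^ padicValNat p j ≤ j := Nat.le_of_dvd (Nat.pos_of_ne_zero hj) pow_padicValNat_dvd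
  have h2 : padicValNat p j < p ^ padicValNat p j := Nat.lt_pow_self hp.out.one_lt
  omega

/-- bounds for Hasse derivatives of `q` from those of `q'` -/
theorem hasse_succ_bound (q : ℚ_[p][X]) (t : ℚ_[p]) (i d : ℕ) (hd : q.natDegree ≤ d) :
    ‖(hasseDeriv (i+1) q).eval t‖ ≤ (p:ℝ)^(d:ℤ) * ‖(hasseDeriv i (derivative q)).eval t‖ := by
  by_cases hi : d < i + 1
  · rw [hasseDeriv_eq_zero_of_lt_natDegree _ _ (by omega)]
    simp only [eval_zero, norm_zero]
    have := pN_pos (p := p) (d:ℤ)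
    positivity
  · have e : hasseDeriv i (derivative q) = (i+1 : ℕ) • hasseDeriv (i+1) q := by
      rw [← hasseDeriv_one, ← LinearMap.comp_apply, hasseDeriv_comp]
      simp [add_mul]
    rw [e, nsmul_eq_mul, eval_mul, norm_mul, ← mul_assoc]
    have h1 := norm_nat_ge (p := p) (i+1) (by omega)
    have h3 : ‖eval t (((i+1:ℕ):ℚ_[p][X]))‖ = ‖((i+1:ℕ):ℚ_[p])‖ := by
      rw [eval_natCast]
    rw [h3]
    have h2 : 1 ≤ (p:ℝ)^(d:ℤ) * ‖((i+1:ℕ):ℚ_[p])‖ := by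
      calc (1:ℝ) = (p:ℝ)^(d:ℤ) * (p:ℝ)^(-(d:ℤ)) := by
            rw [← zpow_add₀ p0.ne']; simp
        _ ≤ (p:ℝ)^(d:ℤ) * ‖((i+1:ℕ):ℚ_[p])‖ := by
            gcongr
            refine le_trans ?_ h1
            gcongr
            · exact p1.le
            · omega
    nlinarith [norm_nonneg (eval t (hasseDeriv (i+1) q))]

/-- Hensel's lemma in a ball. -/
theorem hensel_ball (q : ℚ_[p][X]) (t ρ : ℚ_[p]) (hρ : ρ ≠ 0)
    (hd : (derivative q).eval t ≠ 0)
    (h2 : ∀ i ≥ 2, ‖(hasseDeriv i q).eval t‖ * ‖ρ‖^i ≤ ‖(derivative q).eval t‖ * ‖ρ‖)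
    (h0 : ‖q.eval t‖ < ‖(derivative q).eval t‖ * ‖ρ‖) :
    ∃ c, q.eval c = 0 ∧ ‖c - t‖ ≤ ‖ρ‖ := by
  set A := (derivative q).eval t * ρ with hA
  have hA0 : A ≠ 0 := mul_ne_zero hd hρ
  set G : ℚ_[p][X] := C A⁻¹ * (taylor t q).comp (C ρ * X) with hG
  have hGc : ∀ i, G.coeff i = A⁻¹ * ((hasseDeriv i q).eval t * ρ^i) := by
    intro i
    rw [hG, coeff_C_mul, comp_C_mul_X_coeff, taylor_coeff]
  have hGn : ∀ i, ‖G.coeff i‖ ≤ 1 := by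
    intro i
    rw [hGc, norm_mul, norm_inv, inv_mul_le_iff₀ (norm_pos_iff.2 hA0), mul_one, norm_mul, norm_pow,
      hA, norm_mul]
    rcases i with _ | _ | i
    · simpa using h0.le
    · simp [hasseDeriv_one]
    · exact h2 _ (by omega)
  have hl : G ∈ Polynomial.lifts (PadicInt.Coe.ringHom (p := p)) := by
    rw [lifts_iff_coeff_lifts]
    intro i
    exact ⟨⟨G.coeff i, hGn i⟩, rfl⟩
  obtain ⟨F, hF⟩ := (mem_lifts _).1 hl
  have hFc : ∀ i, ((F.coeff i : ℤ_[p]) : ℚ_[p]) = G.coeff i := by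
    intro i; rw [← hF, coeff_map]; rfl
  have e0 : F.eval 0 = F.coeff 0 := by rw [← coeff_zero_eq_eval_zero]
  have e1 : (derivative F).eval 0 = F.coeff 1 := by
    rw [← coeff_zero_eq_eval_zero, coeff_derivative]; simp
  have c1 : F.coeff 1 = 1 := by
    apply Subtype.ext
    change ((F.coeff 1 : ℤ_[p]) : ℚ_[p]) = 1
    rw [hFc, hGc, hasseDeriv_one, pow_one, ← hA, inv_mul_cancel₀ hA0]
  have c0 : ‖F.coeff 0‖ < 1 := by
    change ‖((F.coeff 0 : ℤ_[p]) : ℚ_[p])‖ < 1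
    rw [hFc, hGc, norm_mul, norm_inv, inv_mul_lt_iff₀ (norm_pos_iff.2 hA0), mul_one]
    simpa [hA] using h0
  obtain ⟨z, hz, -⟩ := hensels_lemma (F := F) (a := 0) (by
    rw [Polynomial.coe_aeval_eq_eval, e0, e1, c1]; simpa using c0)
  rw [Polynomial.coe_aeval_eq_eval] at hz
  refine ⟨t + ρ * z, ?_, ?_⟩
  · have h3 : G.eval (z:ℚ_[p]) = 0 := by
      have := congrArg (PadicInt.Coe.ringHom (p := p)) hz
      rw [map_zero, ← eval_map_apply, hF] at this
      exact this
    rw [hG, eval_mul, eval_C, eval_comp, taylor_eval] at h3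
    have := (mul_eq_zero.1 h3).resolve_left (inv_ne_zero hA0)
    simp only [eval_mul, eval_C, eval_X] at this
    rw [add_comm]; exact this
  · rw [add_sub_cancel_left, norm_mul]
    exact mul_le_of_le_one_right (norm_nonneg _) (PadicInt.norm_le_one z)

theorem exists_norm_between {R : ℝ} (hR : 0 < R) : ∃ ρ : ℚ_[p], ρ ≠ 0 ∧ ‖ρ‖ ≤ R ∧ R < p * ‖ρ‖ := by
  obtain ⟨n, h1, h2⟩ := exists_mem_Ico_zpow hR (p1 (p := p))
  refine ⟨(p:ℚ_[p])^(-n), zpow_ne_zero _ pK0, ?_, ?_⟩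
  · rw [npow, neg_neg]; exact h1
  · rw [npow, neg_neg, mul_comm, ← zpow_add_one₀ p0.ne']; exact h2

theorem hasse_far (d : ℕ) : ∃ k : ℕ, ∀ (q : ℚ_[p][X]) (t : ℚ_[p]) (R : ℝ), q.natDegree ≤ d → 0 < R →
    Far q t R → ∀ i, ‖(hasseDeriv i q).eval t‖ * R^i ≤ (p:ℝ)^(k:ℤ) * ‖q.eval t‖ := by
  induction d with
  | zero =>
    refine ⟨0, fun q t R hq hR hF i => ?_⟩
    rcases i with _ | i
    · simp
    · rw [hasseDeriv_eq_zero_of_lt_natDegree _ _ (by omega)]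
      simp
  | succ d ih =>
    obtain ⟨k, hk⟩ := ih
    refine ⟨(k + (d+1)) + (k + (d+1)) + 1, fun q t R hq hR hF i => ?_⟩
    by_cases hq' : derivative q = 0
    · have hq0 := derivative_eq_zero.1 hq'
      rcases i with _ | i
      · simp only [hasseDeriv_zero', pow_zero, mul_one]
        exact le_mul_of_one_le_left (norm_nonneg _) (one_le_zpow₀ p1.le (by omega))
      · rw [hasseDeriv_eq_zero_of_lt_natDegree _ _ (by omega)]
        have := pN_pos (p := p)
        simp only [eval_zero, norm_zero, zero_mul]
        positivity
    have hnd : (derivative q).natDegree ≤ d := (natDegree_derivative_le q).trans (by omega)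
    have hk' := hk (derivative q) t R hnd hR hF.deriv
    have hdt : (derivative q).eval t ≠ 0 := by
      intro h0
      have := hF 1 t (by simpa using hq') (by simpa using h0)
      simp at this; linarith
    have key : ∀ i, ‖(hasseDeriv (i+1) q).eval t‖ * R^(i+1) ≤
        (p:ℝ)^((k+(d+1) : ℕ):ℤ) * (‖(derivative q).eval t‖ * R) := by
      intro i
      have h1 := hasse_succ_bound q t i (d+1) hq
      calc ‖(hasseDeriv (i+1) q).eval t‖ * R^(i+1)
          ≤ ((p:ℝ)^((d+1:ℕ):ℤ) * ‖(hasseDeriv i (derivative q)).eval t‖) * R^(i+1) := by gcongr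
        _ = (p:ℝ)^((d+1:ℕ):ℤ) * (‖(hasseDeriv i (derivative q)).eval t‖ * R^i) * R := by ring
        _ ≤ (p:ℝ)^((d+1:ℕ):ℤ) * ((p:ℝ)^(k:ℤ) * ‖(derivative q).eval t‖) * R := by
            exact mul_le_mul_of_nonneg_right (mul_le_mul_of_nonneg_left (hk' i) (pN_pos _).le) hR.le
        _ = _ := by
            push_cast
            rw [zpow_add₀ p0.ne' (k:ℤ)]; ring
    have main : ‖(derivative q).eval t‖ * R ≤ (p:ℝ)^((k+(d+1)+1:ℕ):ℤ) * ‖q.eval t‖ := by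
      by_contra hcon
      push Not at hcon
      obtain ⟨ρ, hρ0, hρ1, hρ2⟩ := exists_norm_between (p := p)
        (R := (p:ℝ)^(-((k+(d+1):ℕ):ℤ)) * R) (mul_pos (pN_pos _) hR)
      have hρR : ‖ρ‖ ≤ R := hρ1.trans (mul_le_of_le_one_left hR.le (pN_le _))
      have hinv : (p:ℝ)^((k+(d+1):ℕ):ℤ) * (p:ℝ)^(-((k+(d+1):ℕ):ℤ)) = 1 := by
        rw [← zpow_add₀ p0.ne', add_neg_cancel, zpow_zero]
      have hPP := pN_pos (p := p) ((k+(d+1):ℕ):ℤ)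
      obtain ⟨c, hc1, hc2⟩ := hensel_ball q t ρ hρ0 hdt (by
        intro i hi
        obtain ⟨j, rfl⟩ : ∃ j, i = (j + 1) + 1 := ⟨i - 2, by omega⟩
        have h1 := key (j+1)
        have hrat : ‖ρ‖ ^ (j+1) * R ≤ (p:ℝ)^(-((k+(d+1):ℕ):ℤ)) * R^(j+1+1) := by
          calc ‖ρ‖ ^ (j+1) * R = ‖ρ‖^j * ‖ρ‖ * R := by ring
            _ ≤ R^j * ((p:ℝ)^(-((k+(d+1):ℕ):ℤ)) * R) * R := by gcongr
            _ = _ := by ring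
        have h3 : ‖(hasseDeriv (j+1+1) q).eval t‖ * (‖ρ‖^(j+1) * R) ≤ ‖(derivative q).eval t‖ * R := by
          calc ‖(hasseDeriv (j+1+1) q).eval t‖ * (‖ρ‖^(j+1) * R)
              ≤ ‖(hasseDeriv (j+1+1) q).eval t‖ * ((p:ℝ)^(-((k+(d+1):ℕ):ℤ)) * R^(j+1+1)) := by gcongr
            _ = (p:ℝ)^(-((k+(d+1):ℕ):ℤ)) * (‖(hasseDeriv (j+1+1) q).eval t‖ * R^(j+1+1)) := by ring
            _ ≤ (p:ℝ)^(-((k+(d+1):ℕ):ℤ)) * ((p:ℝ)^((k+(d+1) : ℕ):ℤ) * (‖(derivative q).eval t‖ * R)) := by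
                gcongr
            _ = ((p:ℝ)^((k+(d+1):ℕ):ℤ) * (p:ℝ)^(-((k+(d+1):ℕ):ℤ))) * (‖(derivative q).eval t‖ * R) := by ring
            _ = _ := by rw [hinv, one_mul]
        have h4 : ‖(hasseDeriv (j+1+1) q).eval t‖ * ‖ρ‖^(j+1) ≤ ‖(derivative q).eval t‖ := by
          rw [← mul_assoc] at h3
          exact le_of_mul_le_mul_right h3 hR
        calc ‖(hasseDeriv (j+1+1) q).eval t‖ * ‖ρ‖^(j+1+1)
            = (‖(hasseDeriv (j+1+1) q).eval t‖ * ‖ρ‖^(j+1)) * ‖ρ‖ := by ring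
          _ ≤ _ := by gcongr) (by
        have e2 : (p:ℝ)^((k+(d+1)+1:ℕ):ℤ) = (p:ℝ)^((k+(d+1):ℕ):ℤ) * p := by
          rw [← zpow_add_one₀ p0.ne']; push_cast; rfl
        rw [e2] at hcon
        have h5 : R < (p:ℝ)^((k+(d+1):ℕ):ℤ) * (p * ‖ρ‖) := by
          calc R = (p:ℝ)^((k+(d+1):ℕ):ℤ) * ((p:ℝ)^(-((k+(d+1):ℕ):ℤ)) * R) := by
                rw [← mul_assoc, hinv, one_mul]
            _ < _ := by gcongr
        have h6 : (p:ℝ)^((k+(d+1):ℕ):ℤ) * p * ‖q.eval t‖ <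
            (p:ℝ)^((k+(d+1):ℕ):ℤ) * p * (‖(derivative q).eval t‖ * ‖ρ‖) := by
          refine hcon.trans ?_
          have := mul_lt_mul_of_pos_left h5 (norm_pos_iff.2 hdt)
          calc _ < _ := this
            _ = _ := by ring
        exact lt_of_mul_lt_mul_left h6 (mul_pos hPP p0).le)
      have hq0 : q ≠ 0 := by rintro rfl; simp at hq'
      have h7 := hF 0 c hq0 hc1
      rw [norm_sub_rev] at h7
      have h8 : (p:ℝ)^(-((k+(d+1):ℕ):ℤ)) * R < 1 * R := by
        gcongr
        exact pN_lt (by omega)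
      linarith
    rcases i with _ | i
    · simp only [hasseDeriv_zero', pow_zero, mul_one]
      exact le_mul_of_one_le_left (norm_nonneg _) (one_le_zpow₀ p1.le (by omega))
    · refine (key i).trans ?_
      calc _ ≤ (p:ℝ)^((k+(d+1) : ℕ):ℤ) * ((p:ℝ)^((k+(d+1)+1:ℕ):ℤ) * ‖q.eval t‖) := by gcongr
        _ = _ := by
          rw [← mul_assoc, ← zpow_add₀ p0.ne']
          push_cast
          ring_nf

/-- preparation: `q` is multiplicatively almost constant away from critical points -/
theorem prep (d N : ℕ) : ∃ M : ℕ, ∀ (q : ℚ_[p][X]) (t t' : ℚ_[p]), q.natDegree ≤ d →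
    (∀ (i : ℕ) (c : ℚ_[p]), derivative^[i] q ≠ 0 → (derivative^[i] q).eval c = 0 →
      ‖t - t'‖ ≤ (p:ℝ)^(-(M:ℤ)) * ‖t - c‖) → Apx N (q.eval t') (q.eval t) := by
  obtain ⟨k, hk⟩ := hasse_far (p := p) d
  refine ⟨k + N, fun q t t' hq h => ?_⟩
  by_cases htt : t = t'
  · subst htt; exact Apx.rfl'
  have hpos : 0 < ‖t - t'‖ := norm_pos_iff.2 (sub_ne_zero.2 htt)
  set R : ℝ := (p:ℝ)^((k+N:ℕ):ℤ) * ‖t - t'‖ with hR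
  have hRpos : 0 < R := mul_pos (pN_pos _) hpos
  have hF : Far q t R := by
    intro i c h1 h2
    have := h i c h1 h2
    rw [hR]
    calc _ ≤ (p:ℝ)^((k+N:ℕ):ℤ) * ((p:ℝ)^(-((k+N:ℕ):ℤ)) * ‖t - c‖) := by gcongr
      _ = _ := by rw [← mul_assoc, ← zpow_add₀ p0.ne']; simp
  have hb := hk q t R hq hRpos hF
  rw [Apx, eval_taylor q t t', Finset.sum_range_succ']
  simp only [hasseDeriv_zero', pow_zero, mul_one, add_sub_cancel_right]
  apply nsum_le (mul_nonneg (pN_pos _).le (norm_nonneg _))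
  intro i _
  rw [norm_mul, norm_pow, norm_sub_rev]
  have e : ‖t - t'‖ = (p:ℝ)^(-((k+N:ℕ):ℤ)) * R := by
    rw [hR, ← mul_assoc, ← zpow_add₀ p0.ne']; simp
  have hp0 := pN_pos (p := p) (-((k+N:ℕ):ℤ))
  calc ‖(hasseDeriv (i+1) q).eval t‖ * ‖t - t'‖^(i+1)
      = ((p:ℝ)^(-((k+N:ℕ):ℤ)))^(i+1) * (‖(hasseDeriv (i+1) q).eval t‖ * R^(i+1)) := by
        rw [e, mul_pow]; ring
    _ ≤ (p:ℝ)^(-((k+N:ℕ):ℤ)) * ((p:ℝ)^(k:ℤ) * ‖q.eval t‖) := by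
        refine mul_le_mul ?_ (hb _) (by positivity) hp0.le
        rw [pow_succ]
        exact mul_le_of_le_one_left hp0.le (pow_le_one₀ hp0.le (pN_le _))
    _ = _ := by
        rw [← mul_assoc, ← zpow_add₀ p0.ne']; push_cast; ring_nf

/-- domination of the linear term on the ball of radius `ρ` around `t` -/
def Dom (q : ℚ_[p][X]) (t : ℚ_[p]) (ρ : ℝ) : Prop :=
  (derivative q).eval t ≠ 0 ∧
  ∀ i ≥ 2, ‖(hasseDeriv i q).eval t‖ * ρ^i ≤ (p:ℝ)^(-1:ℤ) * (‖(derivative q).eval t‖ * ρ)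

theorem dom_of_far (d : ℕ) : ∃ M : ℕ, ∀ (q : ℚ_[p][X]) (t : ℚ_[p]) (R ρ : ℝ), q.natDegree ≤ d →
    derivative q ≠ 0 → 0 < R → Far (derivative q) t R → 0 < ρ → ρ ≤ (p:ℝ)^(-(M:ℤ)) * R →
    Dom q t ρ := by
  obtain ⟨k, hk⟩ := hasse_far (p := p) d
  refine ⟨k + d + 1, fun q t R ρ hq hq' hR hF hρ hρR => ⟨?_, ?_⟩⟩
  · intro h0
    have := hF 0 t (by simpa using hq') (by simpa using h0)
    simp at this; linarith
  · intro i hi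
    obtain ⟨j, rfl⟩ : ∃ j, i = (j + 1) + 1 := ⟨i - 2, by omega⟩
    have h1 := hasse_succ_bound q t (j+1) d hq
    have h2 := hk (derivative q) t R ((natDegree_derivative_le q).trans (by omega)) hR hF (j+1)
    have hρR' : ρ ≤ R := hρR.trans (mul_le_of_le_one_left hR.le (pN_le _))
    have hpd := pN_pos (p := p) (d:ℤ)
    have h3 : ρ^(j+1) ≤ (p:ℝ)^(-((k+d+1:ℕ):ℤ)) * R^(j+1) := by
      calc ρ^(j+1) = ρ^j * ρ := by ring
        _ ≤ R^j * ((p:ℝ)^(-((k+d+1:ℕ):ℤ)) * R) := by gcongr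
        _ = _ := by ring
    calc ‖(hasseDeriv (j+1+1) q).eval t‖ * ρ^(j+1+1)
        ≤ ((p:ℝ)^(d:ℤ) * ‖(hasseDeriv (j+1) (derivative q)).eval t‖) * ρ^(j+1+1) := by gcongr
      _ = (p:ℝ)^(d:ℤ) * ‖(hasseDeriv (j+1) (derivative q)).eval t‖ * ρ^(j+1) * ρ := by ring
      _ ≤ (p:ℝ)^(d:ℤ) * ‖(hasseDeriv (j+1) (derivative q)).eval t‖ *
            ((p:ℝ)^(-((k+d+1:ℕ):ℤ)) * R^(j+1)) * ρ := by gcongr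
      _ = (p:ℝ)^(d:ℤ) * (p:ℝ)^(-((k+d+1:ℕ):ℤ)) * ρ *
            (‖(hasseDeriv (j+1) (derivative q)).eval t‖ * R^(j+1)) := by ring
      _ ≤ (p:ℝ)^(d:ℤ) * (p:ℝ)^(-((k+d+1:ℕ):ℤ)) * ρ * ((p:ℝ)^(k:ℤ) * ‖(derivative q).eval t‖) := by
          have := pN_pos (p := p) (-((k+d+1:ℕ):ℤ))
          gcongr
      _ = ((p:ℝ)^(d:ℤ) * (p:ℝ)^(-((k+d+1:ℕ):ℤ)) * (p:ℝ)^(k:ℤ)) * (‖(derivative q).eval t‖ * ρ) := by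
          ring
      _ = _ := by
          rw [← zpow_add₀ p0.ne', ← zpow_add₀ p0.ne']
          congr 2
          push_cast; ring

/-- Jacobian property -/
theorem Dom.jac {q : ℚ_[p][X]} {t : ℚ_[p]} {ρ : ℝ} (h : Dom q t ρ) (t' : ℚ_[p]) {ε : ℝ}
    (hε : ε ≤ 1) (ht : ‖t' - t‖ ≤ ε * ρ) (hρ : 0 < ρ) :
    ‖q.eval t' - q.eval t - (derivative q).eval t * (t' - t)‖ ≤
      (p:ℝ)^(-1:ℤ) * ε * ‖(derivative q).eval t * (t' - t)‖ := by
  have hε0 : 0 ≤ ε := by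
    by_contra hc
    push Not at hc
    have := norm_nonneg (t' - t)
    nlinarith
  have hnn : 0 ≤ (p:ℝ)^(-1:ℤ) * ε * ‖(derivative q).eval t * (t' - t)‖ :=
    mul_nonneg (mul_nonneg (pN_pos _).le hε0) (norm_nonneg _)
  have e : q.eval t' - q.eval t - (derivative q).eval t * (t' - t) =
      ∑ i ∈ (Finset.range (q.natDegree + 1)).filter (2 ≤ ·), (hasseDeriv i q).eval t * (t' - t)^i := by
    have hs : q.eval t' = ∑ i ∈ Finset.range (q.natDegree + 1 + 2),
        (hasseDeriv i q).eval t * (t' - t)^i := by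
      rw [eval_taylor q t t']
      apply Finset.sum_subset
      · intro i; simp; omega
      · intro i _ hi
        rw [hasseDeriv_eq_zero_of_lt_natDegree _ _ (by simpa [Nat.lt_succ_iff] using hi)]; simp
    have hs2 : ∑ i ∈ (Finset.range (q.natDegree + 1)).filter (2 ≤ ·), (hasseDeriv i q).eval t * (t' - t)^i
      = ∑ i ∈ Finset.range (q.natDegree + 1), (hasseDeriv (i+2) q).eval t * (t' - t)^(i+2) := by
      symm
      apply Finset.sum_bij_ne_zero (fun i _ _ => i + 2)
      · intro i hi hne
        simp only [Finset.mem_filter, Finset.mem_range]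
        refine ⟨?_, by omega⟩
        by_contra hc
        apply hne
        rw [hasseDeriv_eq_zero_of_lt_natDegree _ _ (by omega)]; simp
      · intro a _ _ b _ _ hab; omega
      · intro b hb hne
        simp only [Finset.mem_filter, Finset.mem_range] at hb
        refine ⟨b - 2, by simp; omega, ?_, by omega⟩
        rw [show b - 2 + 2 = b by omega]; exact hne
      · intro i _ _; rfl
    rw [hs2, hs, Finset.sum_range_succ', Finset.sum_range_succ']
    simp [hasseDeriv_one]
  rw [e]
  apply nsum_le hnn
  intro i hi
  have hi2 : 2 ≤ i := (Finset.mem_filter.1 hi).2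
  obtain ⟨j, rfl⟩ : ∃ j, i = (j + 1) + 1 := ⟨i - 2, by omega⟩
  have hdm := h.2 (j+1+1) hi2
  have hx : ‖t' - t‖ ≤ ρ := ht.trans (mul_le_of_le_one_left hρ.le hε)
  have h1 : ‖(hasseDeriv (j+1+1) q).eval t‖ * ρ^(j+1) ≤ (p:ℝ)^(-1:ℤ) * ‖(derivative q).eval t‖ := by
    have : (‖(hasseDeriv (j+1+1) q).eval t‖ * ρ^(j+1)) * ρ ≤
      ((p:ℝ)^(-1:ℤ) * ‖(derivative q).eval t‖) * ρ := by
      calc _ = ‖(hasseDeriv (j+1+1) q).eval t‖ * ρ^(j+1+1) := by ring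
        _ ≤ _ := hdm
        _ = _ := by ring
    exact le_of_mul_le_mul_right this hρ
  have h2 : ‖t' - t‖^(j+1) ≤ ε * ρ^(j+1) := by
    calc ‖t' - t‖^(j+1) = ‖t' - t‖^j * ‖t'-t‖ := by ring
      _ ≤ ρ^j * (ε * ρ) := by gcongr
      _ = _ := by ring
  rw [norm_mul, norm_pow, norm_mul]
  calc ‖(hasseDeriv (j+1+1) q).eval t‖ * ‖t' - t‖^(j+1+1)
      = ‖(hasseDeriv (j+1+1) q).eval t‖ * ‖t' - t‖^(j+1) * ‖t' - t‖ := by ring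
    _ ≤ ‖(hasseDeriv (j+1+1) q).eval t‖ * (ε * ρ^(j+1)) * ‖t' - t‖ := by gcongr
    _ = ε * (‖(hasseDeriv (j+1+1) q).eval t‖ * ρ^(j+1)) * ‖t' - t‖ := by ring
    _ ≤ ε * ((p:ℝ)^(-1:ℤ) * ‖(derivative q).eval t‖) * ‖t' - t‖ := by gcongr
    _ = _ := by ring

/-- existence of a root in a ball where the linear term dominates -/
theorem Dom.root {q : ℚ_[p][X]} {t ρ : ℚ_[p]} (hρ : ρ ≠ 0) (h : Dom q t ‖ρ‖)
    (h0 : ‖q.eval t‖ < ‖(derivative q).eval t‖ * ‖ρ‖) :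
    ∃ c, q.eval c = 0 ∧ ‖c - t‖ ≤ ‖ρ‖ := by
  refine hensel_ball q t ρ hρ h.1 (fun i hi => (h.2 i hi).trans ?_) h0
  exact mul_le_of_le_one_left (mul_nonneg (norm_nonneg _) (norm_nonneg _)) (by
    have := pN_le (p := p) 1; simpa using this)

end DC


open Filter MeasureTheory Polynomial

set_option linter.unusedVariables false
set_option linter.unusedSectionVars false

namespace DC

/-- A tame structure on `B`: a class of integer valued functions with the closure properties
of Presburger-definable operations without quantifiers. -/
structure Tame (B : Type*) where
  V : Set (B → ℤ)
  const' : ∀ n : ℤ, (fun _ => n) ∈ V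
  add' : ∀ κ₁ κ₂, κ₁ ∈ V → κ₂ ∈ V → (fun b => κ₁ b + κ₂ b) ∈ V
  neg' : ∀ κ, κ ∈ V → (fun b => - κ b) ∈ V
  ite' : ∀ κ₁ κ₂ κ₃, κ₁ ∈ V → κ₂ ∈ V → κ₃ ∈ V → (fun b => if 0 ≤ κ₁ b then κ₂ b else κ₃ b) ∈ V
  div' : ∀ κ (n : ℕ), κ ∈ V → 0 < n → (fun b => κ b / (n:ℤ)) ∈ V

namespace Tame

variable {B : Type*} (T : Tame B)

/-- definable predicates -/
def S (P : B → Prop) : Prop := ∃ κ ∈ T.V, ∀ b, P b ↔ 0 ≤ κ b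

variable {T}

theorem mem_congr {κ κ' : B → ℤ} (h : κ ∈ T.V) (e : ∀ b, κ' b = κ b) : κ' ∈ T.V := by
  have : κ' = κ := funext e
  rw [this]; exact h

theorem sub' {κ₁ κ₂ : B → ℤ} (h1 : κ₁ ∈ T.V) (h2 : κ₂ ∈ T.V) : (fun b => κ₁ b - κ₂ b) ∈ T.V :=
  mem_congr (T.add' _ _ h1 (T.neg' _ h2)) (fun b => sub_eq_add_neg _ _)

theorem nsmul' {κ : B → ℤ} (h : κ ∈ T.V) (n : ℕ) : (fun b => (n:ℤ) * κ b) ∈ T.V := by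
  induction n with
  | zero => exact mem_congr (T.const' 0) (fun b => by simp)
  | succ n ih => exact mem_congr (T.add' _ _ ih h) (fun b => by push_cast; ring)

theorem zsmul' {κ : B → ℤ} (h : κ ∈ T.V) (n : ℤ) : (fun b => n * κ b) ∈ T.V := by
  rcases Int.eq_nat_or_neg n with ⟨k, rfl | rfl⟩
  · exact nsmul' h k
  · exact mem_congr (T.neg' _ (nsmul' h k)) (fun b => by ring)

theorem sum' {ι : Type*} (s : Finset ι) {κ : ι → B → ℤ} (h : ∀ i ∈ s, κ i ∈ T.V) :
    (fun b => ∑ i ∈ s, κ i b) ∈ T.V := by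
  classical
  induction s using Finset.induction_on with
  | empty => simpa using T.const' 0
  | insert a s ha ih =>
    exact mem_congr (T.add' _ _ (h a (by simp)) (ih fun i hi => h i (by simp [hi])))
      (fun b => Finset.sum_insert ha)

theorem S.congr {P Q : B → Prop} (h : T.S P) (e : ∀ b, Q b ↔ P b) : T.S Q := by
  obtain ⟨κ, hκ, h⟩ := h
  exact ⟨κ, hκ, fun b => (e b).trans (h b)⟩

theorem S_le {κ₁ κ₂ : B → ℤ} (h1 : κ₁ ∈ T.V) (h2 : κ₂ ∈ T.V) : T.S (fun b => κ₁ b ≤ κ₂ b) :=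
  ⟨_, sub' h2 h1, fun b => by omega⟩

theorem S.not {P : B → Prop} (h : T.S P) : T.S (fun b => ¬ P b) := by
  obtain ⟨κ, hκ, h⟩ := h
  exact ⟨_, sub' (T.const' (-1)) hκ, fun b => by
    change ¬ P b ↔ _
    rw [h b]; omega⟩

theorem S_lt {κ₁ κ₂ : B → ℤ} (h1 : κ₁ ∈ T.V) (h2 : κ₂ ∈ T.V) : T.S (fun b => κ₁ b < κ₂ b) :=
  (S_le h2 h1).not.congr (fun b => by omega)

theorem S.and {P Q : B → Prop} (h : T.S P) (h' : T.S Q) : T.S (fun b => P b ∧ Q b) := by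
  obtain ⟨κ, hκ, h⟩ := h
  obtain ⟨κ', hκ', h'⟩ := h'
  refine ⟨_, T.ite' _ _ _ hκ hκ' (T.const' (-1)), fun b => ?_⟩
  change (P b ∧ Q b) ↔ _
  rw [h b, h' b]
  split_ifs with hc <;> simp [hc]

theorem S.or {P Q : B → Prop} (h : T.S P) (h' : T.S Q) : T.S (fun b => P b ∨ Q b) :=
  (h.not.and h'.not).not.congr (fun b => by tauto)

theorem S.imp {P Q : B → Prop} (h : T.S P) (h' : T.S Q) : T.S (fun b => P b → Q b) :=
  (h.not.or h').congr (fun b => by tauto)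

theorem S_eq {κ₁ κ₂ : B → ℤ} (h1 : κ₁ ∈ T.V) (h2 : κ₂ ∈ T.V) : T.S (fun b => κ₁ b = κ₂ b) :=
  ((S_le h1 h2).and (S_le h2 h1)).congr (fun b => le_antisymm_iff)

theorem S_const (P : Prop) : T.S (fun _ => P) := by
  by_cases h : P
  · exact ⟨_, T.const' 0, fun b => by simp [h]⟩
  · exact ⟨_, T.const' (-1), fun b => by simp [h]⟩

theorem S_dvd {κ : B → ℤ} (h : κ ∈ T.V) {n : ℕ} (hn : 0 < n) : T.S (fun b => (n:ℤ) ∣ κ b) :=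
  (S_eq (nsmul' (T.div' _ n h hn) n) h).congr
    (fun b => ⟨fun hd => Int.mul_ediv_cancel' hd, fun hd => ⟨_, hd.symm⟩⟩)

theorem S_exists {ι : Type*} [Finite ι] {P : ι → B → Prop} (h : ∀ i, T.S (P i)) :
    T.S (fun b => ∃ i, P i b) := by
  classical
  cases nonempty_fintype ι
  have : ∀ s : Finset ι, T.S (fun b => ∃ i ∈ s, P i b) := by
    intro s
    induction s using Finset.induction_on with
    | empty => exact (S_const False).congr (fun b => by simp)
    | insert a s ha ih => exact ((h a).or ih).congr (fun b => by simp)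
  exact (this Finset.univ).congr (fun b => by simp)

theorem S_forall {ι : Type*} [Finite ι] {P : ι → B → Prop} (h : ∀ i, T.S (P i)) :
    T.S (fun b => ∀ i, P i b) :=
  (S_exists fun i => (h i).not).not.congr (fun b => by simp)

open Classical in
theorem S.ite {P : B → Prop} (h : T.S P) {κ₁ κ₂ : B → ℤ} (h1 : κ₁ ∈ T.V) (h2 : κ₂ ∈ T.V) :
    (fun b => if P b then κ₁ b else κ₂ b) ∈ T.V := by
  obtain ⟨κ, hκ, h⟩ := h
  exact mem_congr (T.ite' _ _ _ hκ h1 h2) (fun b => by simp only [h b])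

/-- gluing along a finite definable cover -/
theorem glue {ι : Type*} [Finite ι] {X : ι → B → Prop} (hX : ∀ i, T.S (X i))
    (hc : ∀ b, ∃ i, X i b) {κ : B → ℤ} (h : ∀ i, ∃ κ' ∈ T.V, ∀ b, X i b → κ b = κ' b) :
    κ ∈ T.V := by
  classical
  cases nonempty_fintype ι
  choose κ' h1 h2 using h
  have : ∀ s : Finset ι, (fun b => if ∃ i ∈ s, X i b then κ b else 0) ∈ T.V := by
    intro s
    induction s using Finset.induction_on with
    | empty => exact mem_congr (T.const' 0) (fun b => by simp)
    | insert a s ha ih =>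
      refine mem_congr ((hX a).ite (h1 a) ih) (fun b => ?_)
      by_cases hb : X a b
      · simp [hb, h2 a b hb]
      · simp [hb]
  refine mem_congr (this Finset.univ) (fun b => ?_)
  rw [if_pos]; simpa using hc b

theorem S_glue {ι : Type*} [Finite ι] {X : ι → B → Prop} (hX : ∀ i, T.S (X i))
    (hc : ∀ b, ∃ i, X i b) {P : B → Prop} (h : ∀ i, ∃ Q, T.S Q ∧ ∀ b, X i b → (P b ↔ Q b)) :
    T.S P := by
  choose Q h1 h2 using h
  refine (S_exists fun i => (hX i).and (h1 i)).congr (fun b => ?_)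
  constructor
  · intro hb
    obtain ⟨i, hi⟩ := hc b
    exact ⟨i, hi, (h2 i b hi).1 hb⟩
  · rintro ⟨i, hi, hq⟩
    exact (h2 i b hi).2 hq

/-- indicator functions -/
theorem finRange_comp {κ : B → ℤ} (h : κ ∈ T.V) (L U : ℤ) (hr : ∀ b, L ≤ κ b ∧ κ b < U) (φ : ℤ → ℤ) :
    (fun b => φ (κ b)) ∈ T.V := by
  apply glue (ι := Set.Ico L U) (X := fun i b => κ b = i)
  · intro i; exact S_eq h (T.const' _)
  · intro b; exact ⟨⟨κ b, hr b⟩, rfl⟩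
  · intro i
    exact ⟨_, T.const' (φ i), fun b hb => by rw [hb]⟩

theorem max' {κ₁ κ₂ : B → ℤ} (h1 : κ₁ ∈ T.V) (h2 : κ₂ ∈ T.V) : (fun b => max (κ₁ b) (κ₂ b)) ∈ T.V := by
  classical
  refine mem_congr ((S_le h1 h2).ite h2 h1) (fun b => ?_)
  split_ifs with h
  · exact max_eq_right h
  · exact max_eq_left (by omega)

theorem min' {κ₁ κ₂ : B → ℤ} (h1 : κ₁ ∈ T.V) (h2 : κ₂ ∈ T.V) : (fun b => min (κ₁ b) (κ₂ b)) ∈ T.V := by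
  classical
  refine mem_congr ((S_le h1 h2).ite h1 h2) (fun b => ?_)
  split_ifs with h
  · exact min_eq_left h
  · exact min_eq_right (by omega)

instance : LE (Tame B) := ⟨fun T T' => T.V ⊆ T'.V⟩

theorem S.mono {T' : Tame B} (h : T ≤ T') {P : B → Prop} (hP : T.S P) : T'.S P := by
  obtain ⟨κ, h1, h2⟩ := hP
  exact ⟨κ, h h1, h2⟩

/-- The tame structure of functions whose pullback is in `T`. -/
def pull {B' : Type*} (T : Tame B) (φ : B → B') : Tame B' where
  V := {κ | (fun b => κ (φ b)) ∈ T.V}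
  const' n := T.const' n
  add' _ _ h1 h2 := T.add' _ _ h1 h2
  neg' _ h := T.neg' _ h
  ite' _ _ _ h1 h2 h3 := T.ite' _ _ _ h1 h2 h3
  div' _ n h hn := T.div' _ n h hn

/-- generated tame structure -/
inductive GenV (Q : Set (B → ℤ)) : (B → ℤ) → Prop where
  | of (κ) : κ ∈ Q → GenV Q κ
  | const (n : ℤ) : GenV Q (fun _ => n)
  | add (κ₁ κ₂) : GenV Q κ₁ → GenV Q κ₂ → GenV Q (fun b => κ₁ b + κ₂ b)
  | neg (κ) : GenV Q κ → GenV Q (fun b => - κ b)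
  | ite (κ₁ κ₂ κ₃) : GenV Q κ₁ → GenV Q κ₂ → GenV Q κ₃ →
      GenV Q (fun b => if 0 ≤ κ₁ b then κ₂ b else κ₃ b)
  | div (κ) (n : ℕ) : GenV Q κ → 0 < n → GenV Q (fun b => κ b / (n:ℤ))

def Gen (Q : Set (B → ℤ)) : Tame B where
  V := {κ | GenV Q κ}
  const' := GenV.const
  add' := GenV.add
  neg' := GenV.neg
  ite' := GenV.ite
  div' := GenV.div

theorem Gen_le {Q : Set (B → ℤ)} {T : Tame B} (h : Q ⊆ T.V) : Gen Q ≤ T := by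
  intro κ hκ
  induction hκ with
  | of κ hk => exact h hk
  | const n => exact T.const' n
  | add _ _ _ _ h1 h2 => exact T.add' _ _ h1 h2
  | neg _ _ h1 => exact T.neg' _ h1
  | ite _ _ _ _ _ _ h1 h2 h3 => exact T.ite' _ _ _ h1 h2 h3
  | div _ n _ hn h1 => exact T.div' _ n h1 hn

theorem subset_Gen (Q : Set (B → ℤ)) : Q ⊆ (Gen Q).V := fun κ h => GenV.of κ h

theorem Gen_mono {Q Q' : Set (B → ℤ)} (h : Q ⊆ Q') : Gen Q ≤ Gen Q' :=
  Gen_le (h.trans (subset_Gen Q'))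

theorem Gen_fin {Q : Set (B → ℤ)} {κ : B → ℤ} (h : κ ∈ (Gen Q).V) :
    ∃ Q' : Set (B → ℤ), Q'.Finite ∧ Q' ⊆ Q ∧ κ ∈ (Gen Q').V := by
  induction h with
  | of κ hk => exact ⟨{κ}, Set.finite_singleton _, by simpa using hk, subset_Gen _ rfl⟩
  | const n => exact ⟨∅, Set.finite_empty, by simp, (Gen _).const' n⟩
  | add _ _ _ _ h1 h2 =>
    obtain ⟨Q1, f1, s1, h1⟩ := h1
    obtain ⟨Q2, f2, s2, h2⟩ := h2
    exact ⟨Q1 ∪ Q2, f1.union f2, Set.union_subset s1 s2, (Gen _).add' _ _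
      (Gen_mono Set.subset_union_left h1) (Gen_mono Set.subset_union_right h2)⟩
  | neg _ _ h1 =>
    obtain ⟨Q1, f1, s1, h1⟩ := h1
    exact ⟨Q1, f1, s1, (Gen _).neg' _ h1⟩
  | ite _ _ _ _ _ _ h1 h2 h3 =>
    obtain ⟨Q1, f1, s1, h1⟩ := h1
    obtain ⟨Q2, f2, s2, h2⟩ := h2
    obtain ⟨Q3, f3, s3, h3⟩ := h3
    exact ⟨Q1 ∪ (Q2 ∪ Q3), f1.union (f2.union f3),
      Set.union_subset s1 (Set.union_subset s2 s3), (Gen _).ite' _ _ _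
      (Gen_mono Set.subset_union_left h1)
      (Gen_mono (Set.subset_union_left.trans Set.subset_union_right) h2)
      (Gen_mono (Set.subset_union_right.trans Set.subset_union_right) h3)⟩
  | div _ n _ hn h1 =>
    obtain ⟨Q1, f1, s1, h1⟩ := h1
    exact ⟨Q1, f1, s1, (Gen _).div' _ n h1 hn⟩

variable {p : ℕ} [hp : Fact p.Prime]

/-- measurable `K`-valued functions -/
def Meas (T : Tame B) (f : B → ℚ_[p]) : Prop :=
  (fun b => (f b).valuation) ∈ T.V ∧ ∀ N : ℕ, (fun b => acz N (f b)) ∈ T.V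

theorem Meas.mono {T' : Tame B} (h : T ≤ T') {f : B → ℚ_[p]} (hf : T.Meas f) : T'.Meas f :=
  ⟨h hf.1, fun N => h (hf.2 N)⟩

theorem Meas.congr {f g : B → ℚ_[p]} (hf : T.Meas f) (e : ∀ b, g b = f b) : T.Meas g := by
  have : g = f := funext e
  rw [this]; exact hf

theorem Meas_const (c : ℚ_[p]) : T.Meas (fun _ => c) := ⟨T.const' _, fun _ => T.const' _⟩

theorem Meas.S_acz {f : B → ℚ_[p]} (hf : T.Meas f) (N : ℕ) (c : ℤ) : T.S (fun b => acz N (f b) = c) :=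
  S_eq (hf.2 N) (T.const' c)

theorem Meas.S_zero {f : B → ℚ_[p]} (hf : T.Meas f) : T.S (fun b => f b = 0) :=
  (hf.S_acz 1 0).congr (fun b => (acz_eq_zero le_rfl).symm)

theorem Meas.S_le {f g : B → ℚ_[p]} (hf : T.Meas f) (hg : T.Meas g) : T.S (fun b => ‖f b‖ ≤ ‖g b‖) := by
  refine (hf.S_zero.or (hg.S_zero.not.and (Tame.S_le hg.1 hf.1))).congr (fun b => ?_)
  by_cases h1 : f b = 0
  · simp [h1]
  by_cases h2 : g b = 0
  · simp [h1, h2]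
  simp [h1, h2, norm_le_iff h1 h2]

theorem Meas.S_lt {f g : B → ℚ_[p]} (hf : T.Meas f) (hg : T.Meas g) : T.S (fun b => ‖f b‖ < ‖g b‖) :=
  (hg.S_le hf).not.congr (fun b => not_le.symm)

/-- approximation with arbitrary relative precision by piecewise measurable functions -/
theorem Meas_of_apx {f : B → ℚ_[p]}
    (h : ∀ N : ℕ, 1 ≤ N → ∃ (n : ℕ) (X : Fin n → B → Prop) (g : Fin n → B → ℚ_[p]),
      (∀ i, T.S (X i)) ∧ (∀ i, T.Meas (g i)) ∧ (∀ b, ∃ i, X i b) ∧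
      ∀ i b, X i b → Apx N (f b) (g i b)) : T.Meas f := by
  refine ⟨?_, fun N => ?_⟩
  · obtain ⟨n, X, g, h1, h2, h3, h4⟩ := h 1 le_rfl
    exact glue h1 h3 (fun i => ⟨_, (h2 i).1, fun b hb => (h4 i b hb).v_eq le_rfl⟩)
  · obtain ⟨n, X, g, h1, h2, h3, h4⟩ := h (N+1) (by omega)
    rcases Nat.eq_zero_or_pos N with rfl | hN
    · refine mem_congr (T.const' 0) (fun b => ?_)
      have := acz_lt 0 (f b); have := acz_nonneg 0 (f b); simp at *; omega
    exact glue h1 h3 (fun i => ⟨_, (h2 i).2 N,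
      fun b hb => ((h4 i b hb).mono (by omega)).acz_eq hN⟩)

theorem Meas_glue {ι : Type*} [Finite ι] {X : ι → B → Prop} (hX : ∀ i, T.S (X i))
    (hc : ∀ b, ∃ i, X i b) {f : B → ℚ_[p]} (h : ∀ i, ∃ g, T.Meas g ∧ ∀ b, X i b → f b = g b) :
    T.Meas f := by
  choose g h1 h2 using h
  exact ⟨glue hX hc fun i => ⟨_, (h1 i).1, fun b hb => by rw [h2 i b hb]⟩,
    fun N => glue hX hc fun i => ⟨_, (h1 i).2 N, fun b hb => by rw [h2 i b hb]⟩⟩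

open Classical in
theorem Meas.ite {P : B → Prop} (h : T.S P) {f g : B → ℚ_[p]} (h1 : T.Meas f) (h2 : T.Meas g) :
    T.Meas (fun b => if P b then f b else g b) := by
  apply Meas_glue (ι := Bool) (X := fun i b => if i then P b else ¬ P b)
  · intro i; cases i
    · simpa using h.not
    · simpa using h
  · intro b
    by_cases hb : P b
    · exact ⟨true, by simpa using hb⟩
    · exact ⟨false, by simpa using hb⟩
  · intro i
    cases i
    · exact ⟨g, h2, fun b hb => by simp at hb; simp [hb]⟩
    · exact ⟨f, h1, fun b hb => by simp at hb; simp [hb]⟩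

/-- function determined up to precision by the residues of a finite family of functions -/
theorem acz_cases {m : ℕ} {f : Fin m → B → ℚ_[p]} (hf : ∀ i, T.Meas (f i)) (N : ℕ) {κ : B → ℤ}
    (h : ∀ c : Fin m → ℤ, ∃ κ' ∈ T.V, ∀ b, (∀ i, acz N (f i b) = c i) → κ b = κ' b) : κ ∈ T.V := by
  apply glue (ι := (i : Fin m) → Set.Ico (0:ℤ) (p^N)) (X := fun c b => ∀ i, acz N (f i b) = c i)
  · intro c; exact S_forall fun i => (hf i).S_acz N _
  · intro b
    exact ⟨fun i => ⟨acz N (f i b), acz_nonneg _ _, acz_lt _ _⟩, fun i => rfl⟩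
  · intro c
    exact h (fun i => c i)

theorem ac_mul (x y : ℚ_[p]) : ac (x*y) = ac x * ac y := by
  by_cases hx : x = 0
  · subst hx; simp [ac_zero]
  by_cases hy : y = 0
  · subst hy; simp [ac_zero]
  rw [ac, ac, ac, v_mul hx hy, neg_add, zpow_add₀ pK0]; ring

theorem acz_mul (N : ℕ) (x y : ℚ_[p]) : acz N (x*y) = (acz N x * acz N y) % (p^N : ℕ) := by
  have h : acI (x*y) = acI x * acI y := Subtype.ext (ac_mul x y)
  have : NeZero (p^N) := ⟨pow_ne_zero _ hp.out.ne_zero⟩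
  rw [acz, acz, acz, h, map_mul, ZMod.val_mul]
  push_cast; rfl

theorem Meas.mul {f g : B → ℚ_[p]} (hf : T.Meas f) (hg : T.Meas g) : T.Meas (fun b => f b * g b) := by
  constructor
  · classical
    refine mem_congr ((hf.S_zero.or hg.S_zero).ite (T.const' 0) (T.add' _ _ hf.1 hg.1)) (fun b => ?_)
    split_ifs with h
    · rcases h with h | h <;> simp [h]
    · push Not at h
      exact v_mul h.1 h.2
  · intro N
    refine acz_cases (f := ![f, g]) (m := 2) ?_ N ?_
    · intro i; fin_cases i
      · exact hf
      · exact hg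
    · intro c
      refine ⟨_, T.const' ((c 0 * c 1) % (p^N : ℕ)), fun b hb => ?_⟩
      have h0 := hb 0; have h1 := hb 1
      simp at h0 h1
      rw [acz_mul, h0, h1]

theorem Meas.inv {f : B → ℚ_[p]} (hf : T.Meas f) : T.Meas (fun b => (f b)⁻¹) := by
  constructor
  · exact mem_congr (T.neg' _ hf.1) (fun b => v_inv _)
  · intro N
    rcases Nat.eq_zero_or_pos N with rfl | hN
    · refine mem_congr (T.const' 0) (fun b => ?_)
      have := acz_lt 0 ((f b)⁻¹); have := acz_nonneg 0 ((f b)⁻¹); simp at *; omega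
    refine acz_cases (f := ![f]) (m := 1) ?_ N ?_
    · intro i; fin_cases i; exact hf
    · intro c
      refine ⟨_, T.const' (acz N ((c 0 : ℚ_[p])⁻¹)), fun b hb => ?_⟩
      have h0 := hb 0
      simp at h0
      have h1 := (acz_apx hN (f b)).inv hN
      rw [h1.acz_eq hN, h0, mul_inv, acz_eq_iff]
      have : ac ((c 0 : ℚ_[p])⁻¹ * ((p:ℚ_[p]) ^ (f b).valuation)⁻¹) = ac ((c 0 : ℚ_[p])⁻¹) := by
        rw [ac_mul]
        rw [show ac ((p:ℚ_[p]) ^ (f b).valuation)⁻¹ = 1 from ?_, mul_one]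
        rw [ac, v_inv, v_pow_p, neg_neg, inv_mul_cancel₀ (zpow_ne_zero _ pK0)]
      rw [this]; simp only [sub_self, norm_zero]; exact (pN_pos _).le

theorem Meas.pow {f : B → ℚ_[p]} (hf : T.Meas f) (n : ℕ) : T.Meas (fun b => f b ^ n) := by
  induction n with
  | zero => exact (Meas_const 1).congr (fun b => by simp)
  | succ n ih => exact (ih.mul hf).congr (fun b => pow_succ _ _)

theorem Meas.neg {f : B → ℚ_[p]} (hf : T.Meas f) : T.Meas (fun b => - f b) :=
  ((Meas_const (-1)).mul hf).congr (fun b => by simp)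

/-- relative approximation of measurable functions is definable -/
theorem Meas.S_apx {f g : B → ℚ_[p]} (hf : T.Meas f) (hg : T.Meas g) {N : ℕ} (hN : 1 ≤ N) :
    T.S (fun b => Apx N (f b) (g b)) :=
  ((S_eq hf.1 hg.1).and (S_eq (hf.2 N) (hg.2 N))).congr (fun b => apx_iff hN)

variable (p) in
/-- the algebra of constructible functions of a tame structure -/
noncomputable def Cn (T : Tame B) : Subalgebra ℚ (B → ℚ) :=
  Algebra.adjoin ℚ ({g | ∃ κ ∈ T.V, g = fun b => (κ b : ℚ)} ∪ {g | ∃ κ ∈ T.V, g = fun b => (p:ℚ)^(κ b)})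

theorem Cn_int {κ : B → ℤ} (h : κ ∈ T.V) : (fun b => (κ b : ℚ)) ∈ T.Cn p :=
  Algebra.subset_adjoin (Or.inl ⟨κ, h, rfl⟩)

theorem Cn_pow {κ : B → ℤ} (h : κ ∈ T.V) : (fun b => (p:ℚ)^(κ b)) ∈ T.Cn p :=
  Algebra.subset_adjoin (Or.inr ⟨κ, h, rfl⟩)

theorem Cn_const (c : ℚ) : (fun _ => c) ∈ T.Cn p := (T.Cn p).algebraMap_mem c

open Classical in
theorem Cn_ind {P : B → Prop} (h : T.S P) : (fun b => if P b then (1:ℚ) else 0) ∈ T.Cn p := by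
  convert Cn_int (p := p) (h.ite (T.const' 1) (T.const' 0)) using 2 with b
  split_ifs <;> simp

theorem Cn_sum {ι : Type*} (s : Finset ι) {f : ι → B → ℚ} (h : ∀ i ∈ s, f i ∈ T.Cn p) :
    (fun b => ∑ i ∈ s, f i b) ∈ T.Cn p := by
  have := (T.Cn p).sum_mem h
  convert this using 1
  ext b; simp

open Classical in
theorem Cn_ite {P : B → Prop} (h : T.S P) {f g : B → ℚ} (hf : f ∈ T.Cn p) (hg : g ∈ T.Cn p) :
    (fun b => if P b then f b else g b) ∈ T.Cn p := by
  have h1 := (T.Cn p).add_mem ((T.Cn p).mul_mem (Cn_ind (p := p) h) hf)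
    ((T.Cn p).mul_mem (Cn_ind (p := p) h.not) hg)
  convert h1 using 1
  ext b
  by_cases hb : P b <;> simp [hb]

theorem Cn_glue {ι : Type*} [Finite ι] {X : ι → B → Prop} (hX : ∀ i, T.S (X i))
    (hc : ∀ b, ∃ i, X i b) {κ : B → ℚ} (h : ∀ i, ∃ κ' ∈ T.Cn p, ∀ b, X i b → κ b = κ' b) :
    κ ∈ T.Cn p := by
  classical
  cases nonempty_fintype ι
  choose κ' h1 h2 using h
  have : ∀ s : Finset ι, (fun b => if ∃ i ∈ s, X i b then κ b else 0) ∈ T.Cn p := by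
    intro s
    induction s using Finset.induction_on with
    | empty => simpa using Cn_const 0
    | insert a s ha ih =>
      convert Cn_ite (hX a) (h1 a) ih using 2 with b
      by_cases hb : X a b
      · simp [hb, h2 a b hb]
      · simp [hb]
  convert this Finset.univ using 2 with b
  rw [if_pos]; simpa using hc b

theorem Cn_induct {C : (B → ℚ) → Prop} (hi : ∀ κ ∈ T.V, C (fun b => (κ b : ℚ)))
    (hpw : ∀ κ ∈ T.V, C (fun b => (p:ℚ)^(κ b))) (hcst : ∀ c : ℚ, C (fun _ => c))
    (hadd : ∀ f g, C f → C g → C (fun b => f b + g b))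
    (hmul : ∀ f g, C f → C g → C (fun b => f b * g b)) {f : B → ℚ} (hf : f ∈ T.Cn p) : C f := by
  refine Algebra.adjoin_induction ?_ ?_ ?_ ?_ hf
  · rintro f (⟨κ, hκ, rfl⟩ | ⟨κ, hκ, rfl⟩)
    · exact hi κ hκ
    · exact hpw κ hκ
  · intro r; exact hcst r
  · intro f g _ _ h1 h2; exact hadd f g h1 h2
  · intro f g _ _ h1 h2; exact hmul f g h1 h2

theorem Cn_pull {B' : Type*} {T' : Tame B'} {φ : B' → B} (h : ∀ κ ∈ T.V, (fun b => κ (φ b)) ∈ T'.V)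
    {f : B → ℚ} (hf : f ∈ T.Cn p) : (fun b => f (φ b)) ∈ T'.Cn p := by
  refine Cn_induct (C := fun f => (fun b => f (φ b)) ∈ T'.Cn p) ?_ ?_ ?_ ?_ ?_ hf
  · intro κ hκ; exact Cn_int (h κ hκ)
  · intro κ hκ; exact Cn_pow (h κ hκ)
  · intro c; exact Cn_const c
  · intro f g h1 h2; exact (T'.Cn p).add_mem h1 h2
  · intro f g h1 h2; exact (T'.Cn p).mul_mem h1 h2

theorem Cn_mono {T' : Tame B} (h : T ≤ T') : T.Cn p ≤ T'.Cn p :=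
  fun _ hf => Cn_pull (φ := id) (fun _ hκ => h hκ) hf

theorem Cn_Gen_fin {Q : Set (B → ℤ)} {f : B → ℚ} (hf : f ∈ (Gen Q).Cn p) :
    ∃ Q' : Set (B → ℤ), Q'.Finite ∧ Q' ⊆ Q ∧ f ∈ (Gen Q').Cn p := by
  refine Cn_induct (C := fun f => ∃ Q' : Set (B → ℤ), Q'.Finite ∧ Q' ⊆ Q ∧ f ∈ (Gen Q').Cn p)
    ?_ ?_ ?_ ?_ ?_ hf
  · intro κ hκ
    obtain ⟨Q', h1, h2, h3⟩ := Gen_fin hκ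
    exact ⟨Q', h1, h2, Cn_int h3⟩
  · intro κ hκ
    obtain ⟨Q', h1, h2, h3⟩ := Gen_fin hκ
    exact ⟨Q', h1, h2, Cn_pow h3⟩
  · intro c; exact ⟨∅, Set.finite_empty, by simp, Cn_const c⟩
  · rintro f g ⟨Q1, f1, s1, h1⟩ ⟨Q2, f2, s2, h2⟩
    exact ⟨Q1 ∪ Q2, f1.union f2, Set.union_subset s1 s2, ((Gen _).Cn p).add_mem
      (Cn_mono (Gen_mono Set.subset_union_left) h1) (Cn_mono (Gen_mono Set.subset_union_right) h2)⟩
  · rintro f g ⟨Q1, f1, s1, h1⟩ ⟨Q2, f2, s2, h2⟩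
    exact ⟨Q1 ∪ Q2, f1.union f2, Set.union_subset s1 s2, ((Gen _).Cn p).mul_mem
      (Cn_mono (Gen_mono Set.subset_union_left) h1) (Cn_mono (Gen_mono Set.subset_union_right) h2)⟩

end Tame

end DC


open Filter MeasureTheory Polynomial

set_option linter.unusedVariables false
set_option linter.unusedSectionVars false

namespace DC

open Tame

variable {p : ℕ} [hp : Fact p.Prime] {B : Type*}

/-- families of polynomials with coefficients in `R` -/
def IsP (R : Subring (B → ℚ_[p])) (d : ℕ) (q : B → ℚ_[p][X]) : Prop :=
  (∀ i, (fun b => (q b).coeff i) ∈ R) ∧ ∀ b, (q b).natDegree ≤ d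

section
variable {R : Subring (B → ℚ_[p])} {d : ℕ} {q : B → ℚ_[p][X]}

theorem sum_mem_R {ι : Type*} (s : Finset ι) {f : ι → B → ℚ_[p]} (h : ∀ i ∈ s, f i ∈ R) :
    (fun b => ∑ i ∈ s, f i b) ∈ R := by
  have := R.sum_mem h
  convert this using 1
  ext b; simp

theorem natCast_mem_R (n : ℕ) : (fun _ => (n:ℚ_[p])) ∈ R := natCast_mem R n
theorem intCast_mem_R (n : ℤ) : (fun _ => (n:ℚ_[p])) ∈ R := intCast_mem R n

theorem IsP.eval_mem (hq : IsP R d q) {s : B → ℚ_[p]} (hs : s ∈ R) :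
    (fun b => (q b).eval (s b)) ∈ R := by
  have : (fun b => (q b).eval (s b)) = fun b => ∑ i ∈ Finset.range (d+1), (q b).coeff i * s b ^ i := by
    ext b; rw [eval_eq_sum_range' (Nat.lt_succ_of_le (hq.2 b))]
  rw [this]
  exact sum_mem_R _ fun i _ => R.mul_mem (hq.1 i) (R.pow_mem hs i)

theorem IsP.mono {d' : ℕ} (hq : IsP R d q) (h : d ≤ d') : IsP R d' q :=
  ⟨hq.1, fun b => (hq.2 b).trans h⟩

theorem IsP.monoR {R' : Subring (B → ℚ_[p])} (hq : IsP R d q) (h : R ≤ R') : IsP R' d q :=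
  ⟨fun i => h (hq.1 i), hq.2⟩

theorem IsP.deriv (hq : IsP R d q) : IsP R (d-1) (fun b => derivative (q b)) := by
  refine ⟨fun i => ?_, fun b => (natDegree_derivative_le _).trans (Nat.sub_le_sub_right (hq.2 b) 1)⟩
  have : (fun b => (derivative (q b)).coeff i) = fun b => (q b).coeff (i+1) * ((i+1:ℕ):ℚ_[p]) := by
    ext b; rw [coeff_derivative]; push_cast; rfl
  rw [this]
  exact R.mul_mem (hq.1 _) (natCast_mem_R _)

theorem IsP.iter (hq : IsP R d q) (i : ℕ) : IsP R (d-i) (fun b => derivative^[i] (q b)) := by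
  induction i with
  | zero => exact hq
  | succ i ih =>
    have := ih.deriv
    simp only [← Function.iterate_succ_apply' (f := derivative)] at this
    rwa [Nat.sub_sub] at this

theorem IsP.hasse (hq : IsP R d q) (i : ℕ) : IsP R d (fun b => hasseDeriv i (q b)) := by
  refine ⟨fun j => ?_, fun b => (natDegree_hasseDeriv_le _ _).trans (by have := hq.2 b; omega)⟩
  have : (fun b => (hasseDeriv i (q b)).coeff j) = fun b => (((j+i).choose i : ℕ):ℚ_[p]) * (q b).coeff (j+i) := by
    ext b; rw [hasseDeriv_coeff]
  rw [this]
  exact R.mul_mem (natCast_mem_R _) (hq.1 _)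

theorem IsP.lift (hq : IsP R d q) : ∃ Q : R[X], Q.natDegree ≤ d ∧
    ∀ b, Q.map ((Pi.evalRingHom _ b).comp R.subtype) = q b := by
  refine ⟨∑ i ∈ Finset.range (d+1), monomial i ⟨_, hq.1 i⟩, ?_, fun b => ?_⟩
  · apply natDegree_sum_le_of_forall_le
    intro i hi
    exact (natDegree_monomial_le _).trans (by simp at hi; omega)
  · rw [Polynomial.map_sum]
    conv_rhs => rw [(q b).as_sum_range' (d+1) (Nat.lt_succ_of_le (hq.2 b))]
    apply Finset.sum_congr rfl
    intro i _
    rw [map_monomial]; rfl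

theorem isP_of_poly (Q : R[X]) : IsP R Q.natDegree (fun b => Q.map ((Pi.evalRingHom _ b).comp R.subtype)) := by
  refine ⟨fun i => ?_, fun b => natDegree_map_le⟩
  have : (fun b => (Q.map ((Pi.evalRingHom (fun _ : B => ℚ_[p]) b).comp R.subtype)).coeff i) = (Q.coeff i : B → ℚ_[p]) := by
    ext b; rw [coeff_map]; rfl
  rw [this]
  exact (Q.coeff i).2

theorem IsP.mod {e : ℕ} {P : B → ℚ_[p][X]} (hP : IsP R e P) (hq : IsP R d q) (hm : ∀ b, (q b).coeff d = 1)
    (hd : 0 < d) : IsP R (d-1) (fun b => P b %ₘ q b) := by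
  obtain ⟨P', -, hP'⟩ := hP.lift
  by_cases hB : IsEmpty B
  · refine ⟨fun i => ?_, fun b => (hB.false b).elim⟩
    have : (fun b => (P b %ₘ q b).coeff i) = 0 := by ext b; exact (hB.false b).elim
    rw [this]; exact R.zero_mem
  rw [not_isEmpty_iff] at hB
  obtain ⟨Q, hQd, hQ⟩ := hq.lift
  have hmon : Q.Monic := by
    refine monic_of_natDegree_le_of_coeff_eq_one d hQd ?_
    apply Subtype.ext
    ext b
    have := congrArg (fun f => f.coeff d) (hQ b)
    simp only [coeff_map, hm b] at this
    exact this
  have key : ∀ b, P b %ₘ q b = (P' %ₘ Q).map ((Pi.evalRingHom (fun _ : B => ℚ_[p]) b).comp R.subtype) := by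
    intro b
    rw [map_modByMonic _ hmon, hP', hQ]
  refine ⟨fun i => ?_, fun b => ?_⟩
  · have := (isP_of_poly (P' %ₘ Q)).1 i
    simp only [← key] at this
    exact this
  · have hqm : (q b).Monic := monic_of_natDegree_le_of_coeff_eq_one d (hq.2 b) (hm b)
    have hdeg : (q b).natDegree = d :=
      le_antisymm (hq.2 b) (le_natDegree_of_ne_zero (by rw [hm b]; exact one_ne_zero))
    have h1 : q b ≠ 1 := by
      intro h; rw [h] at hdeg; simp at hdeg; omega
    have := natDegree_modByMonic_lt (P b) hqm h1
    change (P b %ₘ q b).natDegree ≤ d - 1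
    omega

end

/-- a ring of measurable functions which is maximal -/
structure Full (T : Tame B) (R : Subring (B → ℚ_[p])) : Prop where
  meas : ∀ f ∈ R, T.Meas f
  full : ∀ g : B → ℚ_[p], (∀ d q, IsP R d q → T.Meas (fun b => (q b).eval (g b))) → g ∈ R

theorem exists_full (T : Tame B) (R₀ : Subring (B → ℚ_[p])) (h : ∀ f ∈ R₀, T.Meas f) :
    ∃ R, R₀ ≤ R ∧ Full T R := by
  obtain ⟨R, hR0, hR⟩ := zorn_le_nonempty₀ {R : Subring (B → ℚ_[p]) | ∀ f ∈ R, T.Meas f} (by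
    intro c hc hch y hy
    refine ⟨sSup c, ?_, fun z hz => le_sSup hz⟩
    intro f hf
    rw [Subring.mem_sSup_of_directedOn ⟨y, hy⟩ hch.directedOn] at hf
    obtain ⟨S, hS, hfS⟩ := hf
    exact hc hS f hfS) R₀ h
  refine ⟨R, hR0, hR.prop, fun g hg => ?_⟩
  set φ := Polynomial.eval₂RingHom R.subtype g
  have hle : R ≤ φ.range := by
    intro f hf
    refine ⟨C ⟨f, hf⟩, ?_⟩
    simp [φ]
  have hmem : φ.range ∈ {R : Subring (B → ℚ_[p]) | ∀ f ∈ R, T.Meas f} := by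
    rintro _ ⟨Q, rfl⟩
    refine (hg _ _ (isP_of_poly Q)).congr (fun b => ?_)
    rw [eval_map]
    simp only [φ, coe_eval₂RingHom]
    rw [eval₂_eq_sum_range, eval₂_eq_sum_range]
    simp
  have := hR.le_of_ge hmem hle
  exact this ⟨X, by simp [φ]⟩

namespace Full

variable {T : Tame B} {R : Subring (B → ℚ_[p])}

open Classical in
theorem ite (hR : Full T R) {P : B → Prop} (h : T.S P) {f g : B → ℚ_[p]} (hf : f ∈ R) (hg : g ∈ R) :
    (fun b => if P b then f b else g b) ∈ R := by
  apply hR.full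
  intro d q hq
  refine (Meas.ite h (hR.meas _ (hq.eval_mem hf)) (hR.meas _ (hq.eval_mem hg))).congr (fun b => ?_)
  split_ifs <;> rfl

theorem inv (hR : Full T R) {f : B → ℚ_[p]} (hf : f ∈ R) : (fun b => (f b)⁻¹) ∈ R := by
  classical
  apply hR.full
  intro d q hq
  have h1 : (fun b => ∑ i ∈ Finset.range (d+1), (q b).coeff i * f b ^ (d - i)) ∈ R :=
    sum_mem_R _ fun i _ => R.mul_mem (hq.1 i) (R.pow_mem hf _)
  refine (Meas.ite (hR.meas _ hf).S_zero (hR.meas _ (hq.1 0))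
    ((hR.meas _ h1).mul ((hR.meas _ hf).pow d).inv)).congr (fun b => ?_)
  split_ifs with h
  · rw [h, inv_zero, coeff_zero_eq_eval_zero]
  · rw [eval_eq_sum_range' (Nat.lt_succ_of_le (hq.2 b)), Finset.sum_mul]
    apply Finset.sum_congr rfl
    intro i hi
    have hi' : i ≤ d := by simp at hi; omega
    rw [mul_assoc, pow_sub₀ _ h hi', inv_pow]
    have h1 := pow_ne_zero i h
    have h2 := pow_ne_zero d h
    field_simp

theorem div (hR : Full T R) {f g : B → ℚ_[p]} (hf : f ∈ R) (hg : g ∈ R) : (fun b => f b / g b) ∈ R := by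
  have := R.mul_mem hf (hR.inv hg)
  convert this using 1
  ext b; simp [div_eq_mul_inv]

theorem ppow (hR : Full T R) (k : ℤ) : (fun _ => (p:ℚ_[p])^k) ∈ R := by
  rcases Int.eq_nat_or_neg k with ⟨n, rfl | rfl⟩
  · have := R.pow_mem (natCast_mem_R (R := R) (p := p) p) n
    convert this using 1
    ext b; simp
  · have := hR.inv (R.pow_mem (natCast_mem_R (R := R) (p := p) p) n)
    convert this using 1
    ext b; simp

theorem glue_choose (hR : Full T R) {ι : Type*} [Finite ι] {X : ι → B → Prop} (hX : ∀ i, T.S (X i))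
    (hc : ∀ b, ∃ i, X i b) {s : ι → B → ℚ_[p]} (hs : ∀ i, s i ∈ R) :
    ∃ g ∈ R, ∀ b, ∃ i, X i b ∧ g b = s i b := by
  classical
  cases nonempty_fintype ι
  have : ∀ t : Finset ι, ∃ g ∈ R, ∀ b, (∃ i ∈ t, X i b) → ∃ i, X i b ∧ g b = s i b := by
    intro t
    induction t using Finset.induction_on with
    | empty => exact ⟨0, R.zero_mem, fun b h => by simp at h⟩
    | insert a t ha ih =>
      obtain ⟨g, hg, h⟩ := ih
      refine ⟨_, hR.ite (hX a) (hs a) hg, fun b hb => ?_⟩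
      by_cases hab : X a b
      · exact ⟨a, hab, by simp [hab]⟩
      · obtain ⟨i, hi, hib⟩ := hb
        rcases Finset.mem_insert.1 hi with rfl | hi
        · exact (hab hib).elim
        · obtain ⟨j, hj, hgj⟩ := h b ⟨i, hi, hib⟩
          exact ⟨j, hj, by simp [hab, hgj]⟩
  obtain ⟨g, hg, h⟩ := this Finset.univ
  exact ⟨g, hg, fun b => h b (by simpa using hc b)⟩

end Full

/-- approximable by elements of `R` -/
def Appr (R : Subring (B → ℚ_[p])) (g : B → ℚ_[p]) : Prop :=
  ∀ N : ℕ, 1 ≤ N → ∃ s ∈ R, ∀ b, Apx N (g b) (s b)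

section
variable {T : Tame B} {R : Subring (B → ℚ_[p])}

theorem Appr.meas (hR : Full T R) {g : B → ℚ_[p]} (h : Appr R g) : T.Meas g := by
  apply Meas_of_apx
  intro N hN
  obtain ⟨s, hs, h⟩ := h N hN
  exact ⟨1, fun _ _ => True, fun _ => s, fun _ => S_const True, fun _ => hR.meas _ hs,
    fun b => ⟨0, trivial⟩, fun _ b _ => h b⟩

theorem apx_cover (hR : Full T R) {g : B → ℚ_[p]} {N : ℕ} {ι : Type*} [Finite ι] {X : ι → B → Prop}
    (hX : ∀ i, T.S (X i)) (hc : ∀ b, ∃ i, X i b)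
    (hs : ∀ i, ∃ s ∈ R, ∀ b, X i b → Apx N (g b) (s b)) :
    ∃ s ∈ R, ∀ b, Apx N (g b) (s b) := by
  choose s hs1 hs2 using hs
  obtain ⟨s', h1, h2⟩ := hR.glue_choose hX hc hs1
  refine ⟨s', h1, fun b => ?_⟩
  obtain ⟨i, hi, e⟩ := h2 b
  rw [e]; exact hs2 i b hi

/-- finite covers of roots -/
def Rt (R : Subring (B → ℚ_[p])) (d : ℕ) : Prop :=
  ∀ q, IsP R d q → ∃ L : Set (B → ℚ_[p]), L.Finite ∧ (∀ c ∈ L, c ∈ R) ∧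
    ∀ b, q b ≠ 0 → ∀ x, (q b).eval x = 0 → ∃ c ∈ L, c b = x

/-- roots of valuations -/
def Sec (R : Subring (B → ℚ_[p])) (N : ℕ) : Prop :=
  ∀ f ∈ R, ∃ w ∈ R, ∀ b, f b ≠ 0 → (N:ℤ) ∣ (f b).valuation →
    w b ≠ 0 ∧ N * (w b).valuation = (f b).valuation

theorem Rt.mono {d d' : ℕ} (h : Rt R d) (hd : d' ≤ d) : Rt R d' := fun q hq => h q (hq.mono hd)

/-- roots of all derivatives (with zero added) -/
theorem Rt.all {d : ℕ} (h : Rt R d) {q : B → ℚ_[p][X]} (hq : IsP R d q) :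
    ∃ L : Set (B → ℚ_[p]), L.Finite ∧ (∀ c ∈ L, c ∈ R) ∧ 0 ∈ L ∧
    ∀ b i, derivative^[i] (q b) ≠ 0 → ∀ x, (derivative^[i] (q b)).eval x = 0 → ∃ c ∈ L, c b = x := by
  have h1 : ∀ i, ∃ L : Set (B → ℚ_[p]), L.Finite ∧ (∀ c ∈ L, c ∈ R) ∧
    ∀ b, derivative^[i] (q b) ≠ 0 → ∀ x, (derivative^[i] (q b)).eval x = 0 → ∃ c ∈ L, c b = x :=
    fun i => h _ ((hq.iter i).mono (by omega))
  choose L hL1 hL2 hL3 using h1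
  refine ⟨{0} ∪ ⋃ i ∈ Finset.range (d+1), L i, ?_, ?_, ?_, ?_⟩
  · exact (Set.finite_singleton _).union ((Finset.finite_toSet _).biUnion fun i _ => hL1 i)
  · rintro c (rfl | hc)
    · exact R.zero_mem
    · simp only [Set.mem_iUnion] at hc
      obtain ⟨i, _, hc⟩ := hc
      exact hL2 i c hc
  · left; rfl
  · intro b i hi x hx
    obtain ⟨c, hc, e⟩ := hL3 i b hi x hx
    refine ⟨c, Or.inr ?_, e⟩
    simp only [Set.mem_iUnion]
    refine ⟨i, ?_, hc⟩
    simp only [Finset.mem_range]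
    by_contra hc
    exact hi (iterate_derivative_eq_zero ((hq.2 b).trans_lt (by omega)))

/-- nearest element of a finite family -/
theorem exists_nearest {L : Set (B → ℚ_[p])} (hL : L.Finite) (h0 : L.Nonempty) (x : ℚ_[p]) (b : B) :
    ∃ c ∈ L, ∀ c' ∈ L, ‖x - c b‖ ≤ ‖x - c' b‖ :=
  Set.exists_min_image L (fun c => ‖x - c b‖) hL h0

theorem appr_poly (hR : Full T R) {d : ℕ} (hRt : Rt R d) {g : B → ℚ_[p]}
    (hg : ∀ c ∈ R, Appr R (fun b => g b - c b)) {F : B → ℚ_[p][X]} (hF : IsP R d F) :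
    Appr R (fun b => (F b).eval (g b)) := by
  intro N hN
  obtain ⟨M, hM⟩ := prep (p := p) d N
  obtain ⟨L, hL1, hL2, hL0, hL3⟩ := hRt.all hF
  have : Finite L := hL1
  refine apx_cover hR (ι := L) (X := fun c b => ∀ c' : L, ‖g b - c.1 b‖ ≤ ‖g b - c'.1 b‖) ?_ ?_ ?_
  · intro c
    exact S_forall fun c' => ((hg _ (hL2 _ c.2)).meas hR).S_le ((hg _ (hL2 _ c'.2)).meas hR)
  · intro b
    obtain ⟨c, hc, h⟩ := exists_nearest hL1 ⟨_, hL0⟩ (g b) b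
    exact ⟨⟨c, hc⟩, fun c' => h c'.1 c'.2⟩
  · intro c
    obtain ⟨s, hs, h⟩ := hg _ (hL2 _ c.2) (M+1) (by omega)
    refine ⟨_, hF.eval_mem (R.add_mem (hL2 _ c.2) hs), fun b hb => ?_⟩
    refine Apx.symm hN ?_
    apply hM (F b) (g b) _ (hF.2 b)
    intro i x h1 h2
    obtain ⟨c', hc', rfl⟩ := hL3 b i h1 x h2
    have h3 := h b
    have h4 := h3.norm_eq (by omega)
    have h5 := hb ⟨c', hc'⟩
    have h6 := h3.mono (show M ≤ M+1 by omega)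
    rw [Apx, ← h4] at h6
    have e : g b - (c.1 + s) b = g b - c.1 b - s b := by simp; ring
    rw [e]
    refine h6.trans ?_
    exact mul_le_mul_of_nonneg_left h5 (pN_pos _).le

/-- Newton approximation: roots in balls where the linear term dominates belong to `R`. -/
theorem newton_mem (hR : Full T R) {d : ℕ} (hd : 0 < d) (hRt : Rt R (d-1)) {q : B → ℚ_[p][X]} (hq : IsP R d q)
    (hm : ∀ b, (q b).coeff d = 1) {s r θ : B → ℚ_[p]} (hs : s ∈ R) (hr : r ∈ R) {E : B → Prop}
    (hE : T.S E) (h1 : ∀ b, E b → r b ≠ 0) (h2 : ∀ b, E b → (q b).eval (θ b) = 0)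
    (h3 : ∀ b, E b → ‖θ b - s b‖ ≤ ‖r b‖)
    (h4 : ∀ b, E b → ∀ t, ‖t - s b‖ ≤ ‖r b‖ → Dom (q b) t ‖r b‖) (h5 : ∀ b, ¬ E b → θ b = s b) :
    θ ∈ R := by
  classical
  -- Newton sequence
  have newt : ∀ k : ℕ, ∃ σ ∈ R, ∀ b, E b → ‖σ b - s b‖ ≤ ‖r b‖ ∧
      ‖θ b - σ b‖ ≤ (p:ℝ)^(-(k:ℤ)) * ‖r b‖ := by
    intro k
    induction k with
    | zero => exact ⟨s, hs, fun b hb => ⟨by simp, by simpa using h3 b hb⟩⟩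
    | succ k ih =>
      obtain ⟨σ, hσ, h⟩ := ih
      have hq' := hq.deriv.eval_mem hσ
      refine ⟨_, R.sub_mem hσ (hR.div (hq.eval_mem hσ) hq'), fun b hb => ?_⟩
      obtain ⟨ha, hb'⟩ := h b hb
      have hD := h4 b hb (σ b) ha
      have hj := hD.jac (θ b) (pN_le k) hb' (norm_pos_iff.2 (h1 b hb))
      rw [h2 b hb] at hj
      have hne := hD.1
      have key : ‖θ b - (σ b - (q b).eval (σ b) / (derivative (q b)).eval (σ b))‖ ≤
          (p:ℝ)^(-((k+1:ℕ):ℤ)) * ‖r b‖ := by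
        have e : θ b - (σ b - (q b).eval (σ b) / (derivative (q b)).eval (σ b)) =
          -(0 - (q b).eval (σ b) - (derivative (q b)).eval (σ b) * (θ b - σ b)) /
            (derivative (q b)).eval (σ b) := by field_simp; ring
        rw [e, norm_div, norm_neg, div_le_iff₀ (norm_pos_iff.2 hne)]
        refine hj.trans ?_
        rw [norm_mul]
        have hlt : ‖θ b - σ b‖ ≤ ‖r b‖ :=
          hb'.trans (mul_le_of_le_one_left (norm_nonneg _) (pN_le k))
        have e2 : (p:ℝ)^(-((k+1:ℕ):ℤ)) = (p:ℝ)^(-1:ℤ) * (p:ℝ)^(-(k:ℤ)) := by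
          rw [← zpow_add₀ p0.ne']; congr 1; push_cast; ring
        rw [e2]
        calc _ = (p:ℝ)^(-1:ℤ) * (p:ℝ)^(-(k:ℤ)) * ‖θ b - σ b‖ * ‖(derivative (q b)).eval (σ b)‖ := by ring
          _ ≤ _ := by
            have := pN_pos (p := p) (-1:ℤ); have := pN_pos (p := p) (-(k:ℤ))
            gcongr
      refine ⟨?_, key⟩
      have h6 : ‖θ b - (σ b - (q b).eval (σ b) / (derivative (q b)).eval (σ b))‖ ≤ ‖r b‖ :=
        key.trans (mul_le_of_le_one_left (norm_nonneg _) (pN_le (k+1)))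
      have h7 := h3 b hb
      rw [norm_sub_rev] at h6
      exact ntri h6 h7
  have happr : ∀ c ∈ R, Appr R (fun b => θ b - c b) := by
    intro c hc N hN
    obtain ⟨σ, hσ, hσ'⟩ := newt N
    obtain ⟨τ, hτ, hτ'⟩ := newt (N+N)
    have hpr : (fun b => (p:ℚ_[p])^(N:ℤ) * r b) ∈ R := R.mul_mem (hR.ppow N) hr
    have hA : T.S (fun b => ‖c b - σ b‖ ≤ ‖(p:ℚ_[p])^(N:ℤ) * r b‖) :=
      (hR.meas _ (R.sub_mem hc hσ)).S_le (hR.meas _ hpr)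
    refine apx_cover hR (ι := Fin 3) (X := ![fun b => E b ∧ ‖c b - σ b‖ ≤ ‖(p:ℚ_[p])^(N:ℤ) * r b‖,
      fun b => E b ∧ ¬ ‖c b - σ b‖ ≤ ‖(p:ℚ_[p])^(N:ℤ) * r b‖, fun b => ¬ E b]) ?_ ?_ ?_
    · intro i; fin_cases i
      · exact hE.and hA
      · exact hE.and hA.not
      · exact hE.not
    · intro b
      by_cases hb : E b
      · by_cases ha : ‖c b - σ b‖ ≤ ‖(p:ℚ_[p])^(N:ℤ) * r b‖
        · exact ⟨0, hb, ha⟩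
        · exact ⟨1, hb, ha⟩
      · exact ⟨2, hb⟩
    · intro i; fin_cases i
      · refine ⟨_, R.neg_mem (hR.div (hq.eval_mem hc) (hq.deriv.eval_mem hc)), ?_⟩
        rintro b ⟨hb, ha⟩
        rw [norm_mul, npow] at ha
        obtain ⟨g1, g2⟩ := hσ' b hb
        have hcs : ‖c b - s b‖ ≤ ‖r b‖ :=
          ntri (ha.trans (mul_le_of_le_one_left (norm_nonneg _) (pN_le N))) g1
        have hθc : ‖θ b - c b‖ ≤ (p:ℝ)^(-(N:ℤ)) * ‖r b‖ := by
          rw [norm_sub_rev] at ha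
          exact ntri g2 ha
        have hD := h4 b hb (c b) hcs
        have hj := hD.jac (θ b) (pN_le N) hθc (norm_pos_iff.2 (h1 b hb))
        rw [h2 b hb] at hj
        have hne := hD.1
        refine Apx.symm hN ?_
        rw [Apx]
        have e : (-(fun b => (q b).eval (c b) / (derivative (q b)).eval (c b))) b - (θ b - c b) =
          (0 - (q b).eval (c b) - (derivative (q b)).eval (c b) * (θ b - c b)) /
            (derivative (q b)).eval (c b) := by
          simp only [Pi.neg_apply]
          field_simp; ring
        rw [e, norm_div, div_le_iff₀ (norm_pos_iff.2 hne)]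
        refine hj.trans ?_
        rw [norm_mul]
        have : (p:ℝ)^(-1:ℤ) ≤ 1 := by simpa using pN_le (p := p) 1
        calc _ = (p:ℝ)^(-1:ℤ) * ((p:ℝ)^(-(N:ℤ)) * ‖θ b - c b‖ * ‖(derivative (q b)).eval (c b)‖) := by ring
          _ ≤ _ := mul_le_of_le_one_left (by have := pN_pos (p := p) (-(N:ℤ)); positivity) this
      · refine ⟨_, R.sub_mem hτ hc, ?_⟩
        rintro b ⟨hb, ha⟩
        rw [norm_mul, npow] at ha
        push Not at ha
        obtain ⟨g1, g2⟩ := hσ' b hb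
        obtain ⟨g3, g4⟩ := hτ' b hb
        have hn : ‖θ b - c b‖ = ‖c b - σ b‖ := by
          rw [norm_sub_rev]
          apply norm_eq_of_sub_lt
          have : c b - θ b - (c b - σ b) = -(θ b - σ b) := by ring
          rw [this, norm_neg]
          exact lt_of_le_of_lt g2 ha
        refine Apx.symm hN ?_
        rw [Apx, hn]
        have e : (τ - c) b - (θ b - c b) = -(θ b - τ b) := by simp
        rw [e, norm_neg]
        refine g4.trans ?_
        have e2 : (p:ℝ)^(-((N+N:ℕ):ℤ)) = (p:ℝ)^(-(N:ℤ)) * (p:ℝ)^(-(N:ℤ)) := by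
          rw [← zpow_add₀ p0.ne']; congr 1; push_cast; ring
        rw [e2, mul_assoc]
        exact mul_le_mul_of_nonneg_left ha.le (pN_pos _).le
      · refine ⟨_, R.sub_mem hs hc, ?_⟩
        intro b hb
        simp only [Pi.sub_apply]
        rw [h5 b hb]
        exact Apx.rfl'
  apply hR.full
  intro e P hP
  have hmod := hP.mod hq hm hd
  have := (appr_poly hR hRt happr hmod).meas hR
  refine (Meas.ite hE this (hR.meas _ (hP.eval_mem hs))).congr (fun b => ?_)
  split_ifs with hb
  · have hqm : (q b).Monic := monic_of_natDegree_le_of_coeff_eq_one d (hq.2 b) (hm b)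
    have := modByMonic_add_div (P b) (q b)
    conv_lhs => rw [← this]
    rw [eval_add, eval_mul, h2 b hb, zero_mul, add_zero]
  · rw [h5 b hb]

end

end DC


open Filter MeasureTheory Polynomial

set_option linter.unusedVariables false
set_option linter.unusedSectionVars false

namespace DC

open Tame

variable {p : ℕ} [hp : Fact p.Prime] {B : Type*}

section
variable {T : Tame B} {R : Subring (B → ℚ_[p])}

theorem Meas_of_apx_fin {f : B → ℚ_[p]}
    (h : ∀ N : ℕ, 1 ≤ N → ∃ (ι : Type) (_ : Finite ι) (X : ι → B → Prop) (g : ι → B → ℚ_[p]),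
      (∀ i, T.S (X i)) ∧ (∀ b, ∃ i, X i b) ∧ (∀ i, T.Meas (g i)) ∧
      ∀ i b, X i b → Apx N (f b) (g i b)) : T.Meas f := by
  apply Meas_of_apx
  intro N hN
  obtain ⟨ι, hι, X, g, h1, h2, h3, h4⟩ := h N hN
  obtain ⟨n, ⟨e⟩⟩ := Finite.exists_equiv_fin ι
  refine ⟨n, fun i => X (e.symm i), fun i => g (e.symm i), fun i => h1 _, fun i => h3 _, fun b => ?_,
    fun i b => h4 _ b⟩
  obtain ⟨i, hi⟩ := h2 b
  exact ⟨e i, by simpa using hi⟩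

theorem Full.acz_mem (hR : Full T R) {f : B → ℚ_[p]} (hf : T.Meas f) (N : ℕ) :
    (fun b => ((acz N (f b) : ℤ) : ℚ_[p])) ∈ R := by
  obtain ⟨g, hg, h⟩ := hR.glue_choose (ι := Fin (p^N)) (X := fun i b => acz N (f b) = (i:ℕ))
    (fun i => hf.S_acz N _) (fun b => by
      have h1 := acz_nonneg N (f b)
      have h2 := acz_lt N (f b)
      refine ⟨⟨(acz N (f b)).toNat, ?_⟩, ?_⟩
      · zify; rw [Int.toNat_of_nonneg h1]; exact h2
      · simp [h1]) (s := fun i b => ((i:ℕ):ℚ_[p])) (fun i => natCast_mem_R _)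
  convert hg using 1
  ext b
  obtain ⟨i, hi, e⟩ := h b
  rw [hi, e]; simp

theorem ac_one : ac (1:ℚ_[p]) = 1 := by
  simp [ac]

theorem ac_pow (x : ℚ_[p]) (n : ℕ) : ac (x^n) = ac x ^ n := by
  induction n with
  | zero => simp [ac_one]
  | succ n ih => rw [pow_succ, ac_mul, ih, pow_succ]

theorem near_mul {u v : ℚ_[p]} {r : ℝ} (hr : r ≤ 1) (hu : ‖u - 1‖ ≤ r) (hv : ‖v - 1‖ ≤ r) : ‖u * v - 1‖ ≤ r := by
  have e : u * v - 1 = (u - 1) * v + (v - 1) := by ring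
  have hv1 : ‖v‖ ≤ 1 := by
    have : v = (v - 1) + 1 := by ring
    rw [this]; exact nadd_le (hv.trans hr) (by simp)
  rw [e]
  refine nadd_le ?_ hv
  rw [norm_mul]
  exact (mul_le_of_le_one_right (norm_nonneg _) hv1).trans hu

theorem near_pow {u : ℚ_[p]} {r : ℝ} (hr : r ≤ 1) (hr0 : 0 ≤ r) (hu : ‖u - 1‖ ≤ r) (n : ℕ) : ‖u^n - 1‖ ≤ r := by
  induction n with
  | zero => simpa using hr0
  | succ n ih => rw [pow_succ]; exact near_mul hr ih hu

theorem pow_near {d : ℕ} (hd : d ≠ 0) {u u' : ℚ_[p]} (hu : ‖u - 1‖ ≤ (p:ℝ)^(-((d+1:ℕ):ℤ)))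
    (hu' : ‖u' - 1‖ ≤ (p:ℝ)^(-((d+1:ℕ):ℤ))) : (p:ℝ)^(-(d:ℤ)) * ‖u - u'‖ ≤ ‖u^d - u'^d‖ := by
  have hr := pN_le (p := p) (d+1)
  have hr0 := (pN_pos (p := p) (-((d+1:ℕ):ℤ))).le
  rw [← (Commute.all u u').geom_sum₂_mul d, norm_mul]
  refine mul_le_mul_of_nonneg_right ?_ (norm_nonneg _)
  have h1 : ‖∑ i ∈ Finset.range d, u ^ i * u' ^ (d - 1 - i) - (d:ℚ_[p])‖ ≤ (p:ℝ)^(-((d+1:ℕ):ℤ)) := by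
    have : ∑ i ∈ Finset.range d, u ^ i * u' ^ (d - 1 - i) - (d:ℚ_[p]) =
      ∑ i ∈ Finset.range d, (u ^ i * u' ^ (d - 1 - i) - 1) := by
      simp [Finset.sum_sub_distrib]
    rw [this]
    exact nsum_le hr0 fun i _ => near_mul hr (near_pow hr hr0 hu _) (near_pow hr hr0 hu' _)
  have h2 := norm_nat_ge (p := p) d hd
  rw [norm_eq_of_sub_lt (h1.trans_lt (lt_of_lt_of_le ?_ h2))]
  · exact h2
  · exact zpow_lt_zpow_right₀ p1 (by push_cast; omega)

theorem root_near {d : ℕ} (hd : d ≠ 0) {M : ℕ} (hM : d + 1 ≤ M) {u : ℚ_[p]}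
    (hu : ‖u - 1‖ ≤ (p:ℝ)^(-((M+d+1:ℕ):ℤ))) : ∃ w, w^d = u ∧ ‖w - 1‖ ≤ (p:ℝ)^(-(M:ℤ)) := by
  have h2 := norm_nat_ge (p := p) d hd
  have hd0 : (derivative (X^d - C u : ℚ_[p][X])).eval 1 = d := by simp [derivative_X_pow]
  obtain ⟨c, h, h'⟩ := hensel_ball (X^d - C u : ℚ_[p][X]) 1 ((p:ℚ_[p])^(M:ℤ)) (zpow_ne_zero _ pK0)
    (by rw [hd0]; exact_mod_cast hd) (by
      intro i hi
      rw [hd0, map_sub, eval_sub, hasseDeriv_C i u (by omega), eval_zero, sub_zero, npow,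
        X_pow_eq_monomial, hasseDeriv_monomial, eval_monomial, one_pow, mul_one, mul_one]
      have h3 : ‖((d.choose i : ℕ):ℚ_[p])‖ ≤ 1 := by
        simpa using Padic.norm_int_le_one (p := p) (d.choose i : ℤ)
      have h4 : ((p:ℝ)^(-(M:ℤ)))^i ≤ (p:ℝ)^(-(M:ℤ)) * (p:ℝ)^(-(M:ℤ)) := by
        rw [← pow_two]
        exact pow_le_pow_of_le_one (pN_pos _).le (pN_le M) hi
      have h5 : (p:ℝ)^(-(M:ℤ)) ≤ ‖(d:ℚ_[p])‖ :=
        le_trans (zpow_le_zpow_right₀ p1.le (by omega)) h2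
      calc _ ≤ 1 * ((p:ℝ)^(-(M:ℤ)) * (p:ℝ)^(-(M:ℤ))) :=
            mul_le_mul h3 h4 (by have := pN_pos (p := p) (-(M:ℤ)); positivity) zero_le_one
        _ ≤ _ := by rw [one_mul]; exact mul_le_mul_of_nonneg_right h5 (pN_pos _).le) (by
      rw [hd0, npow]
      simp only [eval_sub, eval_pow, eval_X, one_pow, eval_C]
      rw [norm_sub_rev]
      refine lt_of_le_of_lt hu (lt_of_lt_of_le ?_ (mul_le_mul_of_nonneg_right h2 (pN_pos _).le))
      rw [← zpow_add₀ p0.ne']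
      exact zpow_lt_zpow_right₀ p1 (by push_cast; omega))
  refine ⟨c, ?_, by rwa [npow] at h'⟩
  simpa [sub_eq_zero] using h

theorem norm_acz {N : ℕ} (hN : 1 ≤ N) {x : ℚ_[p]} (hx : x ≠ 0) : ‖((acz N x : ℤ):ℚ_[p])‖ = 1 := by
  have h := (acz_apx hN x).norm_eq hN
  rw [norm_mul, npow, nv hx] at h
  have := pN_pos (p := p) (-x.valuation)
  have h' : 1 * (p:ℝ)^(-x.valuation) = ‖((acz N x : ℤ):ℚ_[p])‖ * (p:ℝ)^(-x.valuation) := by rw [one_mul]; exact h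
  exact (mul_right_cancel₀ this.ne' h').symm

theorem ac_sub_acz {N : ℕ} (hN : 1 ≤ N) (x : ℚ_[p]) : ‖ac x - (acz N x : ℤ)‖ ≤ (p:ℝ)^(-(N:ℤ)) := by
  by_cases hx : x = 0
  · subst hx; simp [ac_zero, acz_zero]
  have h := acz_apx hN x
  rw [Apx] at h
  have e : x - (acz N x : ℤ) * (p:ℚ_[p])^x.valuation = (ac x - (acz N x : ℤ)) * (p:ℚ_[p])^x.valuation := by
    conv_lhs => rw [ac_spec x]
    rw [sub_mul, ← ac_spec]
  rw [e, norm_mul, norm_mul, norm_acz hN hx, one_mul] at h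
  exact le_of_mul_le_mul_right h (norm_pos_iff.2 (zpow_ne_zero _ pK0))

/-- root with normalized angular component -/
theorem exists_root {d : ℕ} (hd : d ≠ 0) {M : ℕ} (hM : d + 1 ≤ M) {x : ℚ_[p]} (hx : x ≠ 0)
    (hv : (d:ℤ) ∣ x.valuation) : ∃ θ : ℚ_[p], θ ≠ 0 ∧ θ^d = x / (acz (M+d+1) x : ℤ) ∧
      ‖ac θ - 1‖ ≤ (p:ℝ)^(-(M:ℤ)) := by
  have h1 := ac_sub_acz (N := M+d+1) (by omega) x
  have h2 := norm_acz (N := M+d+1) (by omega) hx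
  have h3 : ((acz (M+d+1) x : ℤ):ℚ_[p]) ≠ 0 := by rw [← norm_pos_iff, h2]; norm_num
  obtain ⟨w, hw, hw'⟩ := root_near hd hM (u := ac x / ((acz (M+d+1) x : ℤ) : ℚ_[p])) (by
    have : ac x / (acz (M+d+1) x : ℤ) - 1 = (ac x - (acz (M+d+1) x : ℤ)) / (acz (M+d+1) x : ℤ) := by
      field_simp
    rw [this, norm_div, h2, div_one]; exact h1)
  have hw1 : ‖w‖ = 1 := by
    rw [← norm_one (α := ℚ_[p])]
    apply norm_eq_of_sub_lt
    rw [norm_one]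
    exact hw'.trans_lt (pN_lt (by omega))
  have hw0 : w ≠ 0 := by rw [← norm_pos_iff, hw1]; norm_num
  obtain ⟨k, hk⟩ := hv
  refine ⟨w * (p:ℚ_[p])^k, mul_ne_zero hw0 (zpow_ne_zero _ pK0), ?_, ?_⟩
  · rw [mul_pow, hw, ← zpow_natCast, ← zpow_mul, mul_comm k, ← hk]
    have := ac_spec x
    linear_combination (-1 / ((acz (M+d+1) x : ℤ) : ℚ_[p])) * this
  · have hv : (w * (p:ℚ_[p])^k).valuation = k := by
      rw [v_mul hw0 (zpow_ne_zero _ pK0), v_pow_p]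
      have := v_eq_of_norm (hw1.trans (norm_one (α := ℚ_[p])).symm)
      rw [this]; simp
    have : ac (w * (p:ℚ_[p])^k) = w := by
      rw [ac, hv, mul_assoc, ← zpow_add₀ pK0]; simp
    rw [this]; exact hw'

theorem Far_pow {d : ℕ} {a t : ℚ_[p]} (e : ℕ) : Far (C a * X^e) t ‖t‖ := by
  intro i c h1 h2
  rw [iterate_derivative_C_mul, iterate_derivative_X_pow_eq_natCast_mul] at h1 h2
  simp only [eval_mul, eval_C, eval_natCast, eval_pow, eval_X] at h2
  have : c = 0 := by
    rcases mul_eq_zero.1 h2 with h | h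
    · rw [h] at h1; simp at h1
    rcases mul_eq_zero.1 h with h | h
    · exfalso; apply h1
      have : (((e.descFactorial i : ℕ)) : ℚ_[p][X]) = C ((e.descFactorial i : ℕ):ℚ_[p]) := by simp
      rw [this, h]; simp
    · exact eq_zero_of_pow_eq_zero h
  rw [this, sub_zero]

theorem sec_step (hR : Full T R) {d : ℕ} (hd : d ≠ 0) (hRt : Rt R (d-1))
    (hS : ∀ n, 1 ≤ n → n < d → Sec R n) : Sec R d := by
  classical
  intro f hf
  obtain ⟨M', hM'⟩ := dom_of_far (p := p) d
  set M2 := M' + 1 with hM2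
  set M := M2 + d + 1 with hMd
  -- normalize f
  have hf1' : T.S (fun b => f b ≠ 0 ∧ (d:ℤ) ∣ (f b).valuation) :=
    (hR.meas _ hf).S_zero.not.and (S_dvd (hR.meas _ hf).1 (Nat.pos_of_ne_zero hd))
  set f1 : B → ℚ_[p] := fun b => if f b ≠ 0 ∧ (d:ℤ) ∣ (f b).valuation then f b else 1 with hf1
  have hf1R : f1 ∈ R := by
    convert hR.ite hf1' hf (g := fun _ => 1) (R.one_mem)
  have hf1v : ∀ b, f1 b ≠ 0 ∧ (d:ℤ) ∣ (f1 b).valuation := by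
    intro b
    simp only [hf1]
    split_ifs with h
    · exact h
    · simp
  set f2 : B → ℚ_[p] := fun b => f1 b / (acz (M+d+1) (f1 b) : ℤ) with hf2
  have hf2R : f2 ∈ R := hR.div hf1R (hR.acz_mem (hR.meas _ hf1R) _)
  choose θ hθ0 hθd hθ1 using fun b => exists_root (M := M) hd (by omega) (hf1v b).1 (hf1v b).2
  change ∀ b, θ b ^ d = f2 b at hθd
  have hvθ' : ∀ b, (f2 b).valuation = d * (θ b).valuation := by
    intro b
    rw [← hθd b]; simp
  have hvθ : (fun b => (θ b).valuation) ∈ T.V := by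
    refine mem_congr (T.div' _ d (hR.meas _ hf2R).1 (Nat.pos_of_ne_zero hd)) (fun b => ?_)
    rw [hvθ' b, Int.mul_ediv_cancel_left _ (by exact_mod_cast hd)]
  have hθ1' : ∀ b, ‖ac (θ b) - 1‖ ≤ (p:ℝ)^(-((d+1:ℕ):ℤ)) := fun b =>
    (hθ1 b).trans (zpow_le_zpow_right₀ p1.le (by push_cast; omega))
  have hθM : T.Meas θ := by
    refine ⟨hvθ, fun N => ?_⟩
    refine acz_cases (m := 1) (f := fun _ => f2) (fun _ => hR.meas _ hf2R) (N+d) (fun c => ?_)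
    by_cases hc : ∃ b0, acz (N+d) (f2 b0) = c 0
    · obtain ⟨b0, hb0⟩ := hc
      refine ⟨_, T.const' (acz N (θ b0)), fun b hb => ?_⟩
      have hb := hb 0
      rw [← hb0, acz_eq_iff, ← hθd, ← hθd, ac_pow, ac_pow] at hb
      have := (pow_near hd (hθ1' b) (hθ1' b0)).trans hb
      change acz N (θ b) = acz N (θ b0)
      rw [acz_eq_iff]
      have e : (p:ℝ)^(-((N+d:ℕ):ℤ)) = (p:ℝ)^(-(d:ℤ)) * (p:ℝ)^(-(N:ℤ)) := by
        rw [← zpow_add₀ p0.ne']; congr 1; push_cast; ring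
      rw [e] at this
      exact le_of_mul_le_mul_left this (pN_pos _)
    · exact ⟨_, T.const' 0, fun b hb => (hc ⟨b, hb 0⟩).elim⟩
  refine ⟨θ, ?_, ?_⟩
  swap
  · intro b h1 h2
    refine ⟨hθ0 b, ?_⟩
    rw [← hvθ' b]
    have hne := (hf1v b).1
    have h3 : ((acz (M+d+1) (f1 b) : ℤ):ℚ_[p]) ≠ 0 := by
      rw [← norm_pos_iff, norm_acz (by omega) hne]; norm_num
    have : f2 b = f1 b / (acz (M+d+1) (f1 b) : ℤ) := rfl
    have e : f1 b = f b := by simp only [hf1]; rw [if_pos ⟨h1, h2⟩]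
    rw [← e]
    apply v_eq_of_norm
    rw [this, norm_div, norm_acz (by omega) hne, div_one]
  -- membership
  set q : B → ℚ_[p][X] := fun b => X^d - C (f2 b) with hq
  have hqP : IsP R d q := by
    refine ⟨fun i => ?_, fun b => ?_⟩
    · have : (fun b => (q b).coeff i) = fun b => (if i = d then 1 else 0) - (if i = 0 then f2 b else 0) := by
        ext b; simp [q, coeff_X_pow, coeff_C]
      rw [this]
      apply R.sub_mem (x := fun b => if i = d then 1 else 0)
      · split_ifs
        · exact R.one_mem
        · exact R.zero_mem
      · split_ifs
        · exact hf2R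
        · exact R.zero_mem
    · simp only [q]
      rw [natDegree_X_pow_sub_C]
  have hqm : ∀ b, (q b).coeff d = 1 := by
    intro b; simp [q, coeff_C, hd]
  have hder : ∀ b, derivative (q b) = C (d:ℚ_[p]) * X^(d-1) := by
    intro b; simp [q, derivative_X_pow]
  have hqθ : ∀ b, (q b).eval (θ b) = 0 := by
    intro b; simp [q, hθd b]
  apply hR.full
  intro e P hP
  have hmod := hP.mod hqP hqm (Nat.pos_of_ne_zero hd)
  set F := fun b => P b %ₘ q b with hF
  have hPF : ∀ b, (P b).eval (θ b) = (F b).eval (θ b) := by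
    intro b
    have hqmm : (q b).Monic := monic_of_natDegree_le_of_coeff_eq_one d (hqP.2 b) (hqm b)
    have := modByMonic_add_div (P b) (q b)
    conv_lhs => rw [← this]
    rw [eval_add, eval_mul, hqθ b, zero_mul, add_zero]
  have hmm : ∀ i, T.Meas (fun b => (F b).coeff i * θ b ^ i) := fun i =>
    (hR.meas _ (hmod.1 i)).mul (hθM.pow i)
  apply Meas_of_apx_fin
  intro N hN
  have tie : ∀ i j : ℕ, i < j → j < d → ∀ e : ℤ, ∃ g ∈ R, ∀ b,
      ((F b).coeff i * θ b ^ i ≠ 0 ∧ (F b).coeff j * θ b ^ j ≠ 0 ∧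
      ((F b).coeff i * θ b ^ i).valuation - ((F b).coeff j * θ b ^ j).valuation = e) →
      (P b).eval (θ b) = g b := by
    intro i j hij hjd e
    set E : B → Prop := fun b => ((F b).coeff i * θ b ^ i ≠ 0 ∧ (F b).coeff j * θ b ^ j ≠ 0 ∧
      ((F b).coeff i * θ b ^ i).valuation - ((F b).coeff j * θ b ^ j).valuation = e) with hEdef
    have hE : T.S E := (hmm i).S_zero.not.and ((hmm j).S_zero.not.and
      (S_eq (T := T) (T.sub' (hmm i).1 (hmm j).1) (T.const' e)))
    have hgR : (fun b => (F b).coeff i / ((F b).coeff j * (p:ℚ_[p])^e)) ∈ R :=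
      hR.div (hmod.1 i) (R.mul_mem (hmod.1 j) (hR.ppow e))
    obtain ⟨w, hwR, hw⟩ := hS (j-i) (by omega) (by omega) _ hgR
    have hwE : ∀ b, E b → w b ≠ 0 ∧ (w b).valuation = (θ b).valuation := by
      rintro b ⟨h1, h2, h3⟩
      have a1 := left_ne_zero_of_mul h1
      have a2 := left_ne_zero_of_mul h2
      have a3 := right_ne_zero_of_mul h1
      have a4 := right_ne_zero_of_mul h2
      rw [v_mul a1 a3, v_mul a2 a4] at h3
      simp only [Padic.valuation_pow] at h3
      have hv : ((F b).coeff i / ((F b).coeff j * (p:ℚ_[p])^e)).valuation = ((j-i:ℕ):ℤ) * (θ b).valuation := by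
        have a5 := zpow_ne_zero e (pK0 (p := p))
        rw [div_eq_mul_inv, v_mul a1 (inv_ne_zero (mul_ne_zero a2 a5)), v_inv, v_mul a2 a5, v_pow_p]
        push_cast [hij.le]
        linarith
      obtain ⟨b1, b2⟩ := hw b (div_ne_zero a1 (mul_ne_zero a2 (zpow_ne_zero e pK0))) ⟨_, hv⟩
      rw [hv] at b2
      exact ⟨b1, mul_left_cancel₀ (by exact_mod_cast (by omega : j - i ≠ 0)) b2⟩
    set s : B → ℚ_[p] := fun b => w b / (acz M2 (w b) : ℤ) with hs
    have hsR : s ∈ R := hR.div hwR (hR.acz_mem (hR.meas _ hwR) _)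
    set r : B → ℚ_[p] := fun b => (p:ℚ_[p])^(M2:ℤ) * w b with hr
    have hrR : r ∈ R := R.mul_mem (hR.ppow _) hwR
    have hnr : ∀ b, ‖r b‖ = (p:ℝ)^(-(M2:ℤ)) * ‖w b‖ := fun b => by
      simp only [hr]; rw [norm_mul, npow]
    have hns : ∀ b, E b → ‖s b‖ = ‖w b‖ := by
      intro b hb
      simp only [hs]
      rw [norm_div, norm_acz (by omega) (hwE b hb).1, div_one]
    have hθs : ∀ b, E b → ‖θ b - s b‖ ≤ ‖r b‖ := by
      intro b hb
      obtain ⟨h1, h2⟩ := hwE b hb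
      have e1 : s b = (ac (w b) / (acz M2 (w b) : ℤ)) * (p:ℚ_[p])^(w b).valuation := by
        simp only [hs]
        have := ac_spec (w b)
        linear_combination (1 / ((acz M2 (w b) : ℤ) : ℚ_[p])) * this
      have e2 : θ b - s b = (ac (θ b) - (ac (w b) / (acz M2 (w b) : ℤ))) * (p:ℚ_[p])^(w b).valuation := by
        conv_lhs => rw [ac_spec (θ b)]
        rw [e1, h2, sub_mul]
      rw [e2, norm_mul, hnr, npow, nv h1]
      refine mul_le_mul_of_nonneg_right ?_ (pN_pos _).le
      refine ntri (y := 1) ((hθ1 b).trans (zpow_le_zpow_right₀ p1.le (by push_cast [hMd]; omega))) ?_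
      have h3 := norm_acz (N := M2) (by omega) h1
      have h4 : ((acz M2 (w b) : ℤ):ℚ_[p]) ≠ 0 := by rw [← norm_pos_iff, h3]; norm_num
      have e3 : 1 - ac (w b) / (acz M2 (w b) : ℤ) = -(ac (w b) - (acz M2 (w b) : ℤ)) / (acz M2 (w b) : ℤ) := by
        field_simp; ring
      rw [e3, norm_div, norm_neg, h3, div_one]
      exact ac_sub_acz (by omega) _
    have hmem : (fun b => if E b then θ b else s b) ∈ R := by
      refine newton_mem hR (Nat.pos_of_ne_zero hd) hRt hqP hqm hsR hrR hE ?_ ?_ ?_ ?_ ?_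
      · intro b hb
        exact mul_ne_zero (zpow_ne_zero _ pK0) (hwE b hb).1
      · intro b hb; simp only [if_pos hb]; exact hqθ b
      · intro b hb; simp only [if_pos hb]; exact hθs b hb
      · intro b hb t ht
        have hw0 : 0 < ‖w b‖ := norm_pos_iff.2 (hwE b hb).1
        have hlt : ‖r b‖ < ‖w b‖ := by
          rw [hnr]; exact mul_lt_of_lt_one_left hw0 (pN_lt (by omega))
        have hnt : ‖t‖ = ‖w b‖ := by
          rw [← hns b hb]
          apply norm_eq_of_sub_lt
          rw [hns b hb]
          exact ht.trans_lt hlt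
        apply hM' (q b) t ‖w b‖ ‖r b‖ (hqP.2 b)
        · rw [hder]
          exact mul_ne_zero (C_ne_zero.2 (by exact_mod_cast hd)) (pow_ne_zero _ X_ne_zero)
        · exact hw0
        · rw [hder, ← hnt]; exact Far_pow (d := d) _
        · rw [hnr]; exact mul_pos (pN_pos _) hw0
        · rw [hnr]
          refine mul_le_mul_of_nonneg_right ?_ hw0.le
          exact zpow_le_zpow_right₀ p1.le (by push_cast [hM2]; omega)
      · intro b hb; simp only [if_neg hb]
    refine ⟨_, hP.eval_mem hmem, fun b hb => ?_⟩
    have hb' : E b := hb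
    simp only [if_pos hb']
  choose! gt hgt1 hgt2 using tie
  -- the cover
  refine ⟨Fin d ⊕ {x : Fin d × Fin d // x.1 < x.2} × Fin (2*N+1), inferInstance,
    Sum.elim (fun i b => ∀ j : Fin d, j ≠ i →
        ‖(F b).coeff j * θ b ^ (j:ℕ)‖ ≤ ‖(p:ℚ_[p])^(N:ℤ) * ((F b).coeff i * θ b ^ (i:ℕ))‖)
      (fun x b => (F b).coeff x.1.1.1 * θ b ^ (x.1.1.1:ℕ) ≠ 0 ∧ (F b).coeff x.1.1.2 * θ b ^ (x.1.1.2:ℕ) ≠ 0 ∧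
      ((F b).coeff x.1.1.1 * θ b ^ (x.1.1.1:ℕ)).valuation - ((F b).coeff x.1.1.2 * θ b ^ (x.1.1.2:ℕ)).valuation = (x.2:ℤ) - N),
    Sum.elim (fun i b => (F b).coeff i * θ b ^ (i:ℕ)) (fun x => gt x.1.1.1 x.1.1.2 ((x.2:ℤ) - N)), ?_, ?_, ?_, ?_⟩
  · rintro (i | x)
    · exact S_forall fun j => (S_const _).imp ((hmm j).S_le ((Meas_const _).mul (hmm i)))
    · exact (hmm _).S_zero.not.and ((hmm _).S_zero.not.and
        (S_eq (T := T) (T.sub' (hmm _).1 (hmm _).1) (T.const' _)))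
  · intro b
    have : Nonempty (Fin d) := ⟨⟨0, Nat.pos_of_ne_zero hd⟩⟩
    obtain ⟨i, hi⟩ := Finite.exists_max (fun i : Fin d => ‖(F b).coeff i * θ b ^ (i:ℕ)‖)
    by_cases h : ∀ j : Fin d, j ≠ i →
        ‖(F b).coeff j * θ b ^ (j:ℕ)‖ ≤ ‖(p:ℚ_[p])^(N:ℤ) * ((F b).coeff i * θ b ^ (i:ℕ))‖
    · exact ⟨Sum.inl i, h⟩
    push Not at h
    obtain ⟨j, hji, hj⟩ := h
    have hij := hi j
    have hj0 : (F b).coeff j * θ b ^ (j:ℕ) ≠ 0 := by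
      rw [← norm_pos_iff]; exact lt_of_le_of_lt (norm_nonneg _) hj
    have hi0 : (F b).coeff i * θ b ^ (i:ℕ) ≠ 0 := by
      rw [← norm_pos_iff]; exact lt_of_lt_of_le (norm_pos_iff.2 hj0) hij
    rw [norm_le_iff hj0 hi0] at hij
    rw [norm_lt_iff (mul_ne_zero (zpow_ne_zero _ pK0) hi0) hj0, v_mul (zpow_ne_zero _ pK0) hi0, v_pow_p] at hj
    rcases lt_or_gt_of_ne hji with h | h
    · refine ⟨Sum.inr ⟨⟨(j, i), h⟩, ⟨(((F b).coeff j * θ b ^ (j:ℕ)).valuation - ((F b).coeff i * θ b ^ (i:ℕ)).valuation + N).toNat, by omega⟩⟩, hj0, hi0, ?_⟩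
      simp only
      omega
    · refine ⟨Sum.inr ⟨⟨(i, j), h⟩, ⟨(((F b).coeff i * θ b ^ (i:ℕ)).valuation - ((F b).coeff j * θ b ^ (j:ℕ)).valuation + N).toNat, by omega⟩⟩, hi0, hj0, ?_⟩
      simp only
      omega
  · rintro (i | x)
    · exact hmm i
    · exact hR.meas _ (hgt1 _ _ x.1.2 x.1.1.2.2 _)
  · rintro (i | x) b hb
    · simp only [Sum.elim_inl] at hb ⊢
      rw [hPF b, Apx, eval_eq_sum_range' (lt_of_le_of_lt (hmod.2 b) (by omega : d - 1 < d)), Finset.sum_range,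
        ← Finset.sum_erase_add _ _ (Finset.mem_univ i), add_sub_cancel_right]
      refine nsum_le (by have := pN_pos (p := p) (-(N:ℤ)); positivity) fun j hj => ?_
      have := hb j (Finset.ne_of_mem_erase hj)
      rwa [norm_mul (_ ^ (N:ℤ)), npow] at this
    · simp only [Sum.elim_inr] at hb ⊢
      rw [hgt2 _ _ x.1.2 x.1.1.2.2 _ b hb]
      exact Apx.rfl'

end

end DC


open Filter MeasureTheory Polynomial

set_option linter.unusedVariables false
set_option linter.unusedSectionVars false

namespace DC

open Tame

variable {p : ℕ} [hp : Fact p.Prime] {B : Type*}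

section
variable {T : Tame B} {R : Subring (B → ℚ_[p])}

theorem two_max {n : ℕ} {f : ℕ → ℚ_[p]} (h : ∑ i ∈ Finset.range n, f i = 0) {j : ℕ} (hj : j < n)
    (hj0 : f j ≠ 0) : ∃ i k, i < k ∧ k < n ∧ f i ≠ 0 ∧ f k ≠ 0 ∧ ‖f i‖ = ‖f k‖ := by
  obtain ⟨i, hi, hmax⟩ := Finset.exists_max_image (Finset.range n) (fun i => ‖f i‖) ⟨j, Finset.mem_range.2 hj⟩
  have hi0 : f i ≠ 0 := by
    rw [← norm_pos_iff]; exact lt_of_lt_of_le (norm_pos_iff.2 hj0) (hmax j (Finset.mem_range.2 hj))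
  by_contra hc
  push Not at hc
  have hlt : ∀ k ∈ (Finset.range n).erase i, ‖f k‖ ≤ (p:ℝ)^(-1:ℤ) * ‖f i‖ := by
    intro k hk
    have hk1 := Finset.ne_of_mem_erase hk
    have hk2 := Finset.mem_of_mem_erase hk
    by_cases hk0 : f k = 0
    · rw [hk0, norm_zero]; have := pN_pos (p := p) (-1); positivity
    have hne : ‖f k‖ ≠ ‖f i‖ := by
      rcases lt_or_gt_of_ne hk1 with h1 | h1
      · exact hc k i h1 (Finset.mem_range.1 hi) hk0 hi0
      · exact fun h => hc i k h1 (Finset.mem_range.1 hk2) hi0 hk0 h.symm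
    have := lt_of_le_of_ne (hmax k hk2) hne
    rw [norm_lt_iff hk0 hi0] at this
    rw [nv hk0, nv hi0, ← zpow_add₀ p0.ne']
    exact zpow_le_zpow_right₀ p1.le (by omega)
  have h2 := nsum_le (by have := pN_pos (p := p) (-1); positivity) hlt
  rw [← Finset.add_sum_erase _ _ hi] at h
  have h3 : f i = -∑ k ∈ (Finset.range n).erase i, f k := eq_neg_of_add_eq_zero_left h
  rw [← norm_neg, ← h3] at h2
  have h4 : (p:ℝ)^(-1:ℤ) < 1 := by simpa using pN_lt (p := p) (N := 1) le_rfl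
  have := norm_pos_iff.2 hi0
  nlinarith

theorem rt_monic (hR : Full T R) {d : ℕ} (hd : d ≠ 0) (hRt : Rt R (d-1))
    (hS : ∀ n, 1 ≤ n → n ≤ d → Sec R n) {q : B → ℚ_[p][X]} (hq : IsP R d q) (hm : ∀ b, (q b).coeff d = 1) :
    ∃ L : Set (B → ℚ_[p]), L.Finite ∧ (∀ c ∈ L, c ∈ R) ∧
    ∀ b, ∀ x, (q b).eval x = 0 → ∃ c ∈ L, c b = x := by
  classical
  obtain ⟨M, hM⟩ := dom_of_far (p := p) d
  obtain ⟨L, hL1, hL2, hL0, hL3⟩ := hRt.all hq.deriv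
  have : Finite L := hL1
  set k0 := M + 1 with hk0
  set M2 := k0 + 1 with hM2
  have hdne : ∀ b, derivative (q b) ≠ 0 := by
    intro b h
    have h1 := coeff_derivative (q b) (d-1)
    rw [h, Nat.sub_add_cancel (Nat.pos_of_ne_zero hd), hm b, coeff_zero, one_mul] at h1
    have : ((d:ℕ):ℚ_[p]) = 0 := by
      have e : ((d-1:ℕ):ℚ_[p]) + 1 = ((d - 1 + 1 : ℕ) : ℚ_[p]) := by push_cast; rfl
      rw [e, Nat.sub_add_cancel (Nat.pos_of_ne_zero hd)] at h1
      exact h1.symm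
    exact hd (by exact_mod_cast this)
  have main : ∀ c : L, ∀ i k : ℕ, i < k → k ≤ d → ∀ e : ℤ, ∃ θ ∈ R, ∀ b x, (q b).eval x = 0 →
      x - c.1 b ≠ 0 → (∀ c' ∈ L, ‖x - c.1 b‖ ≤ ‖x - c' b‖) →
      (hasseDeriv i (q b)).eval (c.1 b) * (x - c.1 b)^i ≠ 0 →
      (hasseDeriv k (q b)).eval (c.1 b) * (x - c.1 b)^k ≠ 0 →
      ‖(hasseDeriv i (q b)).eval (c.1 b) * (x - c.1 b)^i‖ = ‖(hasseDeriv k (q b)).eval (c.1 b) * (x - c.1 b)^k‖ →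
      acz M2 (x - c.1 b) = e → θ b = x := by
    intro c i k hik hkd e
    have hcR := hL2 _ c.2
    obtain ⟨w, hwR, hw⟩ := hS (k-i) (by omega) (by omega) _
      (hR.div ((hq.hasse i).eval_mem hcR) ((hq.hasse k).eval_mem hcR))
    set s : B → ℚ_[p] := fun b => c.1 b + e * (w b / (acz M2 (w b) : ℤ)) with hs
    have hsR : s ∈ R := R.add_mem hcR (R.mul_mem (intCast_mem_R e) (hR.div hwR (hR.acz_mem (hR.meas _ hwR) _)))
    set r : B → ℚ_[p] := fun b => (p:ℚ_[p])^(k0:ℤ) * w b with hr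
    have hrR : r ∈ R := R.mul_mem (hR.ppow _) hwR
    have hnr : ∀ b, ‖r b‖ = (p:ℝ)^(-(k0:ℤ)) * ‖w b‖ := fun b => by
      simp only [hr]; rw [norm_mul, npow]
    set E : B → Prop := fun b => w b ≠ 0 ∧ (∀ c' : L, ‖w b‖ ≤ ‖s b - c'.1 b‖) ∧
      ‖(q b).eval (s b)‖ < ‖(derivative (q b)).eval (s b) * r b‖ with hEdef
    have hE : T.S E := (hR.meas _ hwR).S_zero.not.and
      ((S_forall fun c' => (hR.meas _ hwR).S_le (hR.meas _ (R.sub_mem hsR (hL2 _ c'.2)))).and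
      ((hR.meas _ (hq.eval_mem hsR)).S_lt (hR.meas _ (R.mul_mem (hq.deriv.eval_mem hsR) hrR))))
    have hDom : ∀ b, w b ≠ 0 → (∀ c' : L, ‖w b‖ ≤ ‖s b - c'.1 b‖) → ∀ t, ‖t - s b‖ ≤ ‖r b‖ →
        Dom (q b) t ‖r b‖ := by
      intro b h1 h2 t ht
      have hw0 := norm_pos_iff.2 h1
      have hlt : ‖r b‖ < ‖w b‖ := by
        rw [hnr]; exact mul_lt_of_lt_one_left hw0 (pN_lt (by omega))
      apply hM (q b) t ‖w b‖ ‖r b‖ (hq.2 b) (hdne b) hw0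
      · apply Far.shift (t := s b)
        · intro i x hx1 hx2
          obtain ⟨c', hc', rfl⟩ := hL3 b i hx1 x hx2
          exact h2 ⟨c', hc'⟩
        · rw [norm_sub_rev]; exact ht.trans_lt hlt
      · rw [hnr]; exact mul_pos (pN_pos _) hw0
      · rw [hnr]
        exact mul_le_mul_of_nonneg_right (zpow_le_zpow_right₀ p1.le (by push_cast [hk0]; omega)) hw0.le
    have hrt : ∀ b, E b → ∃ x, (q b).eval x = 0 ∧ ‖x - s b‖ ≤ ‖r b‖ := by
      rintro b ⟨h1, h2, h3⟩
      rw [norm_mul] at h3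
      exact Dom.root (mul_ne_zero (zpow_ne_zero _ pK0) h1) (hDom b h1 h2 (s b) (by simp)) h3
    choose! θ' hθ1 hθ2 using hrt
    have hmem : (fun b => if E b then θ' b else s b) ∈ R := by
      refine newton_mem hR (Nat.pos_of_ne_zero hd) hRt hq hm hsR hrR hE ?_ ?_ ?_ ?_ ?_
      · intro b hb
        exact mul_ne_zero (zpow_ne_zero _ pK0) hb.1
      · intro b hb; simp only [if_pos hb]; exact hθ1 b hb
      · intro b hb; simp only [if_pos hb]; exact hθ2 b hb
      · intro b hb t ht; exact hDom b hb.1 hb.2.1 t ht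
      · intro b hb; simp only [if_neg hb]
    refine ⟨_, hmem, fun b x hx hx0 hnear hi0 hk0' hik' hacz => ?_⟩
    have a1 := left_ne_zero_of_mul hi0
    have a2 := left_ne_zero_of_mul hk0'
    have a3 := right_ne_zero_of_mul hi0
    have a4 := right_ne_zero_of_mul hk0'
    have hvw : w b ≠ 0 ∧ (w b).valuation = (x - c.1 b).valuation := by
      have h3 := v_eq_of_norm hik'
      rw [v_mul a1 a3, v_mul a2 a4] at h3
      simp only [Padic.valuation_pow] at h3
      have hv : ((hasseDeriv i (q b)).eval (c.1 b) / (hasseDeriv k (q b)).eval (c.1 b)).valuation =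
          ((k-i:ℕ):ℤ) * (x - c.1 b).valuation := by
        rw [div_eq_mul_inv, v_mul a1 (inv_ne_zero a2), v_inv]
        push_cast [hik.le]
        linarith
      obtain ⟨b1, b2⟩ := hw b (div_ne_zero a1 a2) ⟨_, hv⟩
      rw [hv] at b2
      exact ⟨b1, mul_left_cancel₀ (by exact_mod_cast (by omega : k - i ≠ 0)) b2⟩
    obtain ⟨hw0, hwv⟩ := hvw
    have hnw : ‖w b‖ = ‖x - c.1 b‖ := by rw [norm_eq_iff hw0 hx0, hwv]
    have hxs : ‖x - s b‖ ≤ (p:ℝ)^(-(M2:ℤ)) * ‖w b‖ := by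
      have e1 : s b = c.1 b + (e * (ac (w b) / (acz M2 (w b) : ℤ))) * (p:ℚ_[p])^(w b).valuation := by
        simp only [hs]
        have := ac_spec (w b)
        linear_combination (e / ((acz M2 (w b) : ℤ) : ℚ_[p])) * this
      have e2 : x - s b = (ac (x - c.1 b) - (e * (ac (w b) / (acz M2 (w b) : ℤ)))) * (p:ℚ_[p])^(w b).valuation := by
        have := ac_spec (x - c.1 b)
        rw [e1, hwv]
        linear_combination this
      rw [e2, norm_mul, npow, nv hw0]
      refine mul_le_mul_of_nonneg_right ?_ (pN_pos _).le
      refine ntri (y := (e:ℚ_[p])) (by rw [← hacz]; exact ac_sub_acz (by omega) _) ?_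
      have h3 := norm_acz (N := M2) (by omega) hw0
      have h4 : ((acz M2 (w b) : ℤ):ℚ_[p]) ≠ 0 := by rw [← norm_pos_iff, h3]; norm_num
      have e3 : e - e * (ac (w b) / (acz M2 (w b) : ℤ)) = -e * (ac (w b) - (acz M2 (w b) : ℤ)) / (acz M2 (w b) : ℤ) := by
        field_simp; ring
      rw [e3, norm_div, h3, div_one, norm_mul, norm_neg]
      exact (mul_le_of_le_one_left (norm_nonneg _) (Padic.norm_int_le_one e)).trans (ac_sub_acz (by omega) _)
    have hwpos := norm_pos_iff.2 hw0
    have hsc : ∀ c' : L, ‖w b‖ ≤ ‖s b - c'.1 b‖ := by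
      intro c'
      have h1 := hnear c'.1 c'.2
      rw [← hnw] at h1
      have : ‖s b - c'.1 b‖ = ‖x - c'.1 b‖ := by
        apply norm_eq_of_sub_lt
        have e : s b - c'.1 b - (x - c'.1 b) = -(x - s b) := by ring
        rw [e, norm_neg]
        refine lt_of_le_of_lt hxs (lt_of_lt_of_le ?_ h1)
        exact mul_lt_of_lt_one_left hwpos (pN_lt (by omega))
      rw [this]; exact h1
    have hD := hDom b hw0 hsc (s b) (by simp)
    have hxr' : ‖x - s b‖ ≤ (p:ℝ)^(-(1:ℕ):ℤ) * ‖r b‖ := by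
      rw [hnr, ← mul_assoc, ← zpow_add₀ p0.ne']
      refine hxs.trans (mul_le_mul_of_nonneg_right (zpow_le_zpow_right₀ p1.le ?_) hwpos.le)
      push_cast [hM2]; omega
    have hrpos : 0 < ‖r b‖ := by rw [hnr]; exact mul_pos (pN_pos _) hwpos
    have hlt1 : (p:ℝ)^(-1:ℤ) < 1 := by simpa using pN_lt (p := p) (N := 1) le_rfl
    have hb : E b := by
      refine ⟨hw0, hsc, ?_⟩
      have hj := hD.jac x (pN_le 1) hxr' hrpos
      rw [hx] at hj
      have hD0 := norm_pos_iff.2 hD.1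
      have h1 : ‖(q b).eval (s b)‖ ≤ ‖(derivative (q b)).eval (s b) * (x - s b)‖ := by
        have e : (q b).eval (s b) = -(0 - (q b).eval (s b) - (derivative (q b)).eval (s b) * (x - s b)) -
          (derivative (q b)).eval (s b) * (x - s b) := by ring
        rw [e]
        refine nsub_le ?_ le_rfl
        rw [norm_neg]
        refine hj.trans (mul_le_of_le_one_left (norm_nonneg _) ?_)
        have := pN_le (p := p) 1
        have := pN_pos (p := p) (-(1:ℕ):ℤ)
        nlinarith
      refine lt_of_le_of_lt h1 ?_
      rw [norm_mul, norm_mul]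
      refine mul_lt_mul_of_pos_left (lt_of_le_of_lt hxr' ?_) hD0
      exact mul_lt_of_lt_one_left hrpos (pN_lt le_rfl)
    simp only [if_pos hb]
    have hD' := hDom b hw0 hsc (θ' b) (hθ2 b hb)
    have hxr : ‖x - s b‖ ≤ ‖r b‖ := hxr'.trans (mul_le_of_le_one_left hrpos.le (pN_le 1))
    have hx' : ‖x - θ' b‖ ≤ 1 * ‖r b‖ := by
      have := hθ2 b hb
      rw [norm_sub_rev] at this
      rw [one_mul]
      exact ntri hxr this
    have hj := hD'.jac x le_rfl hx' hrpos
    rw [hx, hθ1 b hb, sub_zero, zero_sub, norm_neg, mul_one] at hj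
    by_contra hne
    have : 0 < ‖(derivative (q b)).eval (θ' b) * (x - θ' b)‖ :=
      norm_pos_iff.2 (mul_ne_zero hD'.1 (sub_ne_zero.2 (Ne.symm hne)))
    nlinarith
  choose! θ hθ1 hθ2 using main
  refine ⟨L ∪ Set.range (fun x : L × {y : Fin (d+1) × Fin (d+1) // y.1 < y.2} × Fin (p^M2) =>
    θ x.1 x.2.1.1.1 x.2.1.1.2 (x.2.2:ℕ)), hL1.union (Set.finite_range _), ?_, ?_⟩
  · rintro c (hc | ⟨x, rfl⟩)
    · exact hL2 c hc
    · exact hθ1 _ _ _ x.2.1.2 (by have := x.2.1.1.2.2; omega) _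
  · intro b x hx
    obtain ⟨c, hc, hnear⟩ := exists_nearest hL1 ⟨_, hL0⟩ x b
    by_cases h0 : x - c b = 0
    · exact ⟨c, Or.inl hc, (sub_eq_zero.1 h0).symm⟩
    have hdeg : (q b).natDegree = d :=
      le_antisymm (hq.2 b) (le_natDegree_of_ne_zero (by rw [hm b]; exact one_ne_zero))
    have ht := eval_taylor (q b) (c b) x
    rw [hx, hdeg] at ht
    have hdd : (hasseDeriv d (q b)).eval (c b) * (x - c b)^d ≠ 0 := by
      refine mul_ne_zero ?_ (pow_ne_zero _ h0)
      have : hasseDeriv d (q b) = C 1 := by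
        rw [eq_C_of_natDegree_eq_zero (p := hasseDeriv d (q b))]
        · rw [hasseDeriv_coeff]; simp [hm b]
        · have := natDegree_hasseDeriv_le (q b) d; omega
      rw [this]; simp
    obtain ⟨i, k, hik, hk, hi0, hk0', he⟩ := two_max ht.symm (Nat.lt_succ_self d) hdd
    have g1 := acz_nonneg M2 (x - c b)
    have g2 := acz_lt M2 (x - c b)
    refine ⟨_, Or.inr ⟨⟨⟨c, hc⟩, ⟨(⟨i, by omega⟩, ⟨k, by omega⟩), hik⟩, ⟨(acz M2 (x - c b)).toNat, ?_⟩⟩, rfl⟩, ?_⟩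
    · zify; rw [Int.toNat_of_nonneg g1]; exact g2
    · apply hθ2 ⟨c, hc⟩ i k hik (by omega) _ b x hx h0 hnear hi0 hk0' he
      simp [g1]

theorem rt_step (hR : Full T R) {d : ℕ} (hd : d ≠ 0) (hRt : Rt R (d-1))
    (hS : ∀ n, 1 ≤ n → n ≤ d → Sec R n) : Rt R d := by
  classical
  intro q hq
  have hA := (hR.meas _ (hq.1 d)).S_zero
  obtain ⟨L1, h1, h2, h3⟩ := rt_monic hR hd hRt hS
    (q := fun b => if (q b).coeff d = 0 then X^d else C ((q b).coeff d)⁻¹ * q b) (by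
      refine ⟨fun i => ?_, fun b => ?_⟩
      · have := hR.ite hA (f := fun b => if i = d then 1 else 0) (by
          split_ifs
          · exact R.one_mem
          · exact R.zero_mem) (R.mul_mem (hR.inv (hq.1 d)) (hq.1 i))
        convert this using 1
        ext b
        by_cases h : (q b).coeff d = 0 <;> simp [h, coeff_X_pow]
      · dsimp only
        split_ifs
        · simp
        · exact (natDegree_C_mul_le _ _).trans (hq.2 b)) (by
      intro b
      split_ifs with h
      · simp
      · simp [h])
  obtain ⟨L2, g1, g2, g3⟩ := hRt (fun b => if (q b).coeff d = 0 then q b else 0) (by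
      refine ⟨fun i => ?_, fun b => ?_⟩
      · have := hR.ite hA (hq.1 i) R.zero_mem
        convert this using 1
        ext b
        by_cases h : (q b).coeff d = 0 <;> simp [h]
      · dsimp only
        split_ifs with h
        · rw [natDegree_le_iff_coeff_eq_zero]
          intro N hN
          rcases eq_or_ne N d with rfl | hne
          · exact h
          · exact coeff_eq_zero_of_natDegree_lt ((hq.2 b).trans_lt (by omega))
        · simp)
  refine ⟨L1 ∪ L2, h1.union g1, ?_, ?_⟩
  · rintro c (hc | hc)
    exacts [h2 c hc, g2 c hc]
  · intro b hb x hx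
    by_cases h : (q b).coeff d = 0
    · obtain ⟨c, hc, e⟩ := g3 b (by simpa [h] using hb) x (by simpa [h] using hx)
      exact ⟨c, Or.inr hc, e⟩
    · obtain ⟨c, hc, e⟩ := h3 b x (by simp [h, hx])
      exact ⟨c, Or.inl hc, e⟩

theorem Full.rt_sec (hR : Full T R) (d : ℕ) : Rt R d ∧ ∀ n, 1 ≤ n → n ≤ d → Sec R n := by
  induction d with
  | zero =>
    refine ⟨fun q hq => ⟨∅, Set.finite_empty, by simp, fun b hb x hx => ?_⟩, fun n h1 h2 => by omega⟩
    have := eq_C_of_natDegree_le_zero (hq.2 b)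
    rw [this, eval_C] at hx
    rw [this, hx, C_0] at hb
    exact (hb rfl).elim
  | succ d ih =>
    have hS : ∀ n, 1 ≤ n → n ≤ d + 1 → Sec R n := by
      intro n h1 h2
      rcases Nat.lt_or_ge n (d+1) with h | h
      · exact ih.2 n h1 (by omega)
      · obtain rfl : n = d + 1 := by omega
        exact sec_step hR (by omega) ih.1 fun n h1 h2 => ih.2 n h1 (by omega)
    exact ⟨rt_step hR (by omega) ih.1 hS, hS⟩

theorem Full.rt (hR : Full T R) (d : ℕ) : Rt R d := (hR.rt_sec d).1
theorem Full.sec (hR : Full T R) {n : ℕ} (hn : 1 ≤ n) : Sec R n := (hR.rt_sec n).2 n hn le_rfl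

end

end DC


open Filter MeasureTheory Polynomial

set_option linter.unusedVariables false
set_option linter.unusedSectionVars false

namespace DC

open Tame

variable {B : Type*}

section PLsec
variable {T : Tame B}

/-- basic sets in `B × ℕ` -/
inductive PLS (T : Tame B) : (B × ℕ → Prop) → Prop
  | base (X : B → Prop) (h : T.S X) : PLS T (fun z => X z.1)
  | lt (β : B → ℤ) (h : β ∈ T.V) : PLS T (fun z => (z.2:ℤ) < β z.1)
  | and (P Q : B × ℕ → Prop) : PLS T P → PLS T Q → PLS T (fun z => P z ∧ Q z)
  | not (P : B × ℕ → Prop) : PLS T P → PLS T (fun z => ¬ P z)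

theorem PLS.congr {P Q : B × ℕ → Prop} (h : PLS T P) (e : ∀ z, Q z ↔ P z) : PLS T Q := by
  have : Q = P := by ext z; exact e z
  rwa [this]

theorem PLS.dil {P : B × ℕ → Prop} (h : PLS T P) {N : ℕ} (hN : 0 < N) (l0 : ℕ) :
    PLS T (fun z => P (z.1, N * z.2 + l0)) := by
  induction h with
  | base X h => exact PLS.base X h
  | lt β h =>
    refine (PLS.lt (T := T) (fun b => -((l0 - β b) / (N:ℤ))) (T.neg' _ (T.div' _ N
      (T.sub' (T.const' l0) h) hN))).congr (fun z => ?_)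
    have hN' : (0:ℤ) < N := by exact_mod_cast hN
    push_cast
    constructor
    · intro h
      have : (l0 - β z.1) / (N:ℤ) < -z.2 := by
        rw [Int.ediv_lt_iff_lt_mul hN']; nlinarith
      omega
    · intro h
      have : (l0 - β z.1) / (N:ℤ) < -z.2 := by omega
      rw [Int.ediv_lt_iff_lt_mul hN'] at this; nlinarith
  | and P Q _ _ h1 h2 => exact PLS.and _ _ h1 h2
  | not P _ h => exact PLS.not _ h

/-- piecewise linear functions -/
def PL (T : Tame B) (κ : B × ℕ → ℤ) : Prop :=
  ∃ (ι : Type) (_ : Finite ι) (Y : ι → B × ℕ → Prop) (κ0 : ι → B → ℤ) (a : ι → ℤ),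
    (∀ i, PLS T (Y i)) ∧ (∀ i, κ0 i ∈ T.V) ∧ (∀ z, ∃ i, Y i z) ∧
    ∀ i z, Y i z → κ z = κ0 i z.1 + a i * z.2

theorem PL.dil {κ : B × ℕ → ℤ} (h : PL T κ) {N : ℕ} (hN : 0 < N) (l0 : ℕ) :
    PL T (fun z => κ (z.1, N * z.2 + l0)) := by
  obtain ⟨ι, hι, Y, κ0, a, h1, h2, h3, h4⟩ := h
  refine ⟨ι, hι, fun i z => Y i (z.1, N * z.2 + l0), fun i b => κ0 i b + a i * l0, fun i => a i * N,
    fun i => (h1 i).dil hN l0, fun i => T.add' _ _ (h2 i) (T.const' _), fun z => h3 _, fun i z hz => ?_⟩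
  have := h4 i _ hz
  simp only at this ⊢
  rw [this]; push_cast; ring

theorem PL.fst {κ : B → ℤ} (h : κ ∈ T.V) : PL T (fun z => κ z.1) :=
  ⟨Unit, inferInstance, fun _ _ => True, fun _ => κ, fun _ => 0, fun _ => PLS.base _ (S_const True), fun _ => h,
    fun z => ⟨(), trivial⟩, fun i z _ => by simp⟩

theorem PL.snd : PL T (fun z => (z.2:ℤ)) :=
  ⟨Unit, inferInstance, fun _ _ => True, fun _ _ => 0, fun _ => 1, fun _ => PLS.base _ (S_const True),
    fun _ => T.const' 0, fun z => ⟨(), trivial⟩, fun i z _ => by simp⟩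

theorem PL.add {κ κ' : B × ℕ → ℤ} (h : PL T κ) (h' : PL T κ') : PL T (fun z => κ z + κ' z) := by
  obtain ⟨ι, hι, Y, κ0, a, h1, h2, h3, h4⟩ := h
  obtain ⟨ι', hι', Y', κ0', a', h1', h2', h3', h4'⟩ := h'
  refine ⟨ι × ι', inferInstance, fun i z => Y i.1 z ∧ Y' i.2 z, fun i b => κ0 i.1 b + κ0' i.2 b, fun i => a i.1 + a' i.2,
    fun i => PLS.and _ _ (h1 _) (h1' _), fun i => T.add' _ _ (h2 _) (h2' _), fun z => ?_, fun i z hz => ?_⟩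
  · obtain ⟨i, hi⟩ := h3 z
    obtain ⟨j, hj⟩ := h3' z
    exact ⟨(i, j), hi, hj⟩
  · show κ z + κ' z = _
    rw [h4 _ _ hz.1, h4' _ _ hz.2]; ring

theorem PL.neg {κ : B × ℕ → ℤ} (h : PL T κ) : PL T (fun z => - κ z) := by
  obtain ⟨ι, hι, Y, κ0, a, h1, h2, h3, h4⟩ := h
  refine ⟨ι, inferInstance, Y, fun i b => - κ0 i b, fun i => - a i,
    h1, fun i => T.neg' _ (h2 _), h3, fun i z hz => ?_⟩
  show - κ z = _
  rw [h4 _ _ hz]; ring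

theorem PLS_lin {κ0 : B → ℤ} (h : κ0 ∈ T.V) (a : ℤ) : PLS T (fun z => 0 ≤ κ0 z.1 + a * z.2) := by
  rcases lt_trichotomy a 0 with ha | rfl | ha
  · refine (PLS.lt (T := T) (fun b => κ0 b / ((-a).toNat:ℤ) + 1) (T.add' _ _ (T.div' _ _ h (by omega)) (T.const' 1))).congr
      (fun z => ?_)
    have e : ((-a).toNat:ℤ) = -a := by omega
    rw [e, Int.lt_add_one_iff, Int.le_ediv_iff_mul_le (by omega)]
    constructor <;> intro h <;> nlinarith
  · refine (PLS.base (T := T) (fun b => 0 ≤ κ0 b) (T.S_le (T.const' 0) h)).congr (fun z => by simp)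
  · have e : (a.toNat:ℤ) = a := by omega
    refine ((PLS.lt (T := T) (fun b => -(κ0 b / (a.toNat:ℤ))) (T.neg' _ (T.div' _ _ h (by omega)))).not).congr
      (fun z => ?_)
    rw [e, not_lt, neg_le, Int.le_ediv_iff_mul_le ha]
    constructor <;> intro h <;> nlinarith

theorem PL.ite {κ₁ κ₂ κ₃ : B × ℕ → ℤ} (h1 : PL T κ₁) (h2 : PL T κ₂) (h3 : PL T κ₃) :
    PL T (fun z => if 0 ≤ κ₁ z then κ₂ z else κ₃ z) := by
  obtain ⟨ι, hι, Y, κ0, a, p1, p2, p3, p4⟩ := h1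
  obtain ⟨ι', hι', Y', κ0', a', q1, q2, q3, q4⟩ := h2
  obtain ⟨ι'', hι'', Y'', κ0'', a'', r1, r2, r3, r4⟩ := h3
  refine ⟨(ι × ι') ⊕ (ι × ι''), inferInstance,
    Sum.elim (fun i z => (Y i.1 z ∧ Y' i.2 z) ∧ 0 ≤ κ0 i.1 z.1 + a i.1 * z.2)
      (fun i z => (Y i.1 z ∧ Y'' i.2 z) ∧ ¬ 0 ≤ κ0 i.1 z.1 + a i.1 * z.2),
    Sum.elim (fun i => κ0' i.2) (fun i => κ0'' i.2), Sum.elim (fun i => a' i.2) (fun i => a'' i.2), ?_, ?_, ?_, ?_⟩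
  · rintro (i | i)
    · exact PLS.and _ _ (PLS.and _ _ (p1 _) (q1 _)) (PLS_lin (p2 _) _)
    · exact PLS.and _ _ (PLS.and _ _ (p1 _) (r1 _)) (PLS.not _ (PLS_lin (p2 _) _))
  · rintro (i | i)
    · exact q2 _
    · exact r2 _
  · intro z
    obtain ⟨i, hi⟩ := p3 z
    obtain ⟨j, hj⟩ := q3 z
    obtain ⟨k, hk⟩ := r3 z
    by_cases h : 0 ≤ κ0 i z.1 + a i * z.2
    · exact ⟨Sum.inl (i, j), ⟨hi, hj⟩, h⟩
    · exact ⟨Sum.inr (i, k), ⟨hi, hk⟩, h⟩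
  · rintro (i | i) z ⟨⟨hz1, hz2⟩, hz3⟩
    · show (if 0 ≤ κ₁ z then κ₂ z else κ₃ z) = _
      rw [if_pos (by rw [p4 _ _ hz1]; exact hz3)]; exact q4 _ _ hz2
    · show (if 0 ≤ κ₁ z then κ₂ z else κ₃ z) = _
      rw [if_neg (by rw [p4 _ _ hz1]; exact hz3)]; exact r4 _ _ hz2

theorem PL.div {κ : B × ℕ → ℤ} (h : PL T κ) {N : ℕ} (hN : 0 < N) (l0 : ℕ) :
    PL T (fun z => κ (z.1, N * z.2 + l0) / (N:ℤ)) := by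
  obtain ⟨ι, hι, Y, κ0, a, h1, h2, h3, h4⟩ := h
  refine ⟨ι, hι, fun i z => Y i (z.1, N * z.2 + l0), fun i b => (κ0 i b + a i * l0) / (N:ℤ), fun i => a i,
    fun i => (h1 i).dil hN l0, fun i => T.div' _ _ (T.add' _ _ (h2 i) (T.const' _)) hN, fun z => h3 _, fun i z hz => ?_⟩
  have := h4 i _ hz
  simp only at this ⊢
  rw [this]
  have e : κ0 i z.1 + a i * ((N * z.2 + l0 : ℕ):ℤ) = κ0 i z.1 + a i * l0 + N * (a i * z.2) := by push_cast; ring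
  rw [e, Int.add_mul_ediv_left _ _ (by positivity)]

/-- piecewise linear after dilation -/
def NF (T : Tame B) (κ : B × ℕ → ℤ) : Prop := ∃ n, 0 < n ∧ ∀ l0 : ℕ, PL T (fun z => κ (z.1, n * z.2 + l0))

theorem NF.mul {κ : B × ℕ → ℤ} {n : ℕ} (h : ∀ l0 : ℕ, PL T (fun z => κ (z.1, n * z.2 + l0))) {N : ℕ} (hN : 0 < N)
    (l0 : ℕ) : PL T (fun z => κ (z.1, n * N * z.2 + l0)) := by
  have := (h l0).dil hN 0
  simpa [mul_assoc] using this

/-- the structure on `B × ℕ` -/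
def T2 (T : Tame B) : Tame (B × ℕ) where
  V := {κ | NF T κ}
  const' n := ⟨1, one_pos, fun l0 => PL.fst (T.const' n)⟩
  add' := by
    rintro κ₁ κ₂ ⟨n, hn, h⟩ ⟨m, hm, h'⟩
    refine ⟨n * m, Nat.mul_pos hn hm, fun l0 => ?_⟩
    have h2 := NF.mul h' hn l0
    rw [mul_comm m n] at h2
    exact (NF.mul h hm l0).add h2
  neg' := by
    rintro κ ⟨n, hn, h⟩
    exact ⟨n, hn, fun l0 => (h l0).neg⟩
  ite' := by
    rintro κ₁ κ₂ κ₃ ⟨n, hn, h⟩ ⟨m, hm, h'⟩ ⟨k, hk, h''⟩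
    refine ⟨n * m * k, Nat.mul_pos (Nat.mul_pos hn hm) hk, fun l0 => ?_⟩
    have e1 := NF.mul h (Nat.mul_pos hm hk) l0
    have e2 := NF.mul h' (Nat.mul_pos hn hk) l0
    have e3 := NF.mul h'' (Nat.mul_pos hn hm) l0
    rw [show n * (m * k) = n * m * k by ring] at e1
    rw [show m * (n * k) = n * m * k by ring] at e2
    rw [show k * (n * m) = n * m * k by ring] at e3
    exact e1.ite e2 e3
  div' := by
    rintro κ N ⟨n, hn, h⟩ hN
    refine ⟨n * N, Nat.mul_pos hn hN, fun l0 => ?_⟩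
    have := (h l0).div hN 0
    simpa [mul_assoc] using this

theorem T2_fst {κ : B → ℤ} (h : κ ∈ T.V) : (fun z : B × ℕ => κ z.1) ∈ (T2 T).V :=
  ⟨1, one_pos, fun l0 => PL.fst h⟩

theorem T2_snd : (fun z : B × ℕ => (z.2:ℤ)) ∈ (T2 T).V :=
  ⟨1, one_pos, fun l0 => by
    have := (PL.snd (T := T)).add (PL.fst (T.const' (l0:ℤ)))
    simpa using this⟩

theorem T2_S_fst {X : B → Prop} (h : T.S X) : (T2 T).S (fun z => X z.1) := by
  obtain ⟨κ, h1, h2⟩ := h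
  exact ⟨_, T2_fst h1, fun z => h2 _⟩

end PLsec

end DC


open Filter MeasureTheory Polynomial

set_option linter.unusedVariables false
set_option linter.unusedSectionVars false

namespace DC

open Tame

variable {p : ℕ} [hp : Fact p.Prime] {B : Type*}

section SumSec
variable {T : Tame B}

/-- antiderivative of exponential polynomials -/
theorem antideriv (x : ℚ) (hx : 0 < x) (P : ℚ[X]) : ∃ U : ℚ[X], C x * U.comp (X + 1) - U = P := by
  classical
  induction P using Polynomial.induction_on' with
  | add P Q h1 h2 =>
    obtain ⟨U, rfl⟩ := h1
    obtain ⟨W, rfl⟩ := h2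
    exact ⟨U + W, by rw [add_comp]; ring⟩
  | monomial n a =>
    induction n using Nat.strong_induction_on generalizing a with
    | _ n ih =>
    have low : ∀ Q : ℚ[X], Q.degree < n → ∃ U : ℚ[X], C x * U.comp (X + 1) - U = Q := by
      intro Q hQ
      have : ∀ s : Finset ℕ, (∀ i ∈ s, i < n) → ∃ U : ℚ[X], C x * U.comp (X + 1) - U = ∑ i ∈ s, monomial i (Q.coeff i) := by
        intro s
        induction s using Finset.induction_on with
        | empty => intro _; exact ⟨0, by simp⟩
        | insert i s hi ih2 =>
          intro h
          obtain ⟨U, hU⟩ := ih2 (fun j hj => h j (Finset.mem_insert_of_mem hj))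
          obtain ⟨W, hW⟩ := ih i (h i (Finset.mem_insert_self _ _)) (Q.coeff i)
          refine ⟨W + U, ?_⟩
          rw [Finset.sum_insert hi, ← hU, ← hW, add_comp]; ring
      obtain ⟨U, hU⟩ := this (Finset.range n) (fun i hi => Finset.mem_range.1 hi)
      refine ⟨U, hU.trans ?_⟩
      rcases Nat.eq_zero_or_pos n with rfl | hn
      · have : Q = 0 := by
          rw [← Polynomial.degree_eq_bot]; exact Nat.WithBot.lt_zero_iff.1 (by simpa using hQ)
        simp [this]
      · have := Polynomial.as_sum_range' Q n (by
          by_cases h0 : Q = 0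
          · simpa [h0] using hn
          · exact (Polynomial.natDegree_lt_iff_degree_lt h0).2 hQ)
        exact this.symm
    have dX : ∀ k : ℕ, ((X + 1 : ℚ[X])^k - X^k).degree < (k : WithBot ℕ) := by
      intro k
      have h1 : ((X + 1 : ℚ[X])^k).degree = k := by
        have := degree_X_add_C (1:ℚ)
        rw [degree_pow, ← C_1, this]; simp
      have := degree_sub_lt_left (p := (X + 1 : ℚ[X])^k) (q := X^k) (by rw [h1, degree_X_pow])
        (pow_ne_zero _ (by simpa using X_add_C_ne_zero (1:ℚ)))
        (by rw [leadingCoeff_pow, ← C_1, leadingCoeff_X_add_C]; simp)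
      rwa [h1] at this
    by_cases h1 : x = 1
    · subst h1
      -- leading part a/(n+1) X^(n+1)
      obtain ⟨U, hU⟩ := low (monomial n a - C (a / (n+1)) * ((X + 1 : ℚ[X])^(n+1) - X^(n+1))) (by
        rw [degree_lt_iff_coeff_zero]
        intro m hm
        rw [coeff_sub, coeff_C_mul, coeff_monomial]
        rcases Nat.eq_or_lt_of_le hm with rfl | hm
        · rw [if_pos rfl, coeff_sub, ← C_1, coeff_X_add_C_pow, coeff_X_pow, if_neg (by omega)]
          have : ((n:ℚ) + 1) ≠ 0 := by positivity
          simp; field_simp; simp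
        · rw [if_neg (by omega), coeff_eq_zero_of_degree_lt ((dX _).trans_le (by exact_mod_cast hm))]; simp)
      refine ⟨U + C (a / (n+1)) * X^(n+1), ?_⟩
      simp only [C_1, one_mul, add_comp, mul_comp, C_comp, pow_comp, X_comp] at hU ⊢
      linear_combination hU
    · have hx1 : x - 1 ≠ 0 := sub_ne_zero.2 h1
      obtain ⟨U, hU⟩ := low (- (C x * C (a / (x-1)) * ((X + 1 : ℚ[X])^n - X^n))) (by
        rw [degree_neg, ← C_mul]
        refine lt_of_le_of_lt ?_ (dX n)
        by_cases h : x * (a / (x-1)) = 0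
        · rw [h]; simp
        · rw [degree_C_mul h])
      refine ⟨U + C (a / (x-1)) * X^n, ?_⟩
      simp only [add_comp, mul_comp, C_comp, pow_comp, X_comp]
      have : (monomial n a : ℚ[X]) = (C x - 1) * C (a / (x-1)) * X^n := by
        rw [← C_1, ← C_sub, ← C_mul, mul_div_cancel₀ _ hx1, C_mul_X_pow_eq_monomial]
      rw [this]
      linear_combination hU

theorem exp_poly_zero (s : Finset ℤ) : ∀ (P : ℤ → ℝ[X]),
    Tendsto (fun N : ℕ => ∑ j ∈ s, (P j).eval (N:ℝ) * (p:ℝ)^(j * N)) atTop (nhds 0) → ∀ j ∈ s, 0 ≤ j → P j = 0 := by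
  classical
  have hp1 : (1:ℝ) < p := by exact_mod_cast hp.out.one_lt
  have neg : ∀ (j : ℤ) (Q : ℝ[X]), j < 0 → Tendsto (fun N : ℕ => Q.eval (N:ℝ) * (p:ℝ)^(j * N)) atTop (nhds 0) := by
    intro j Q hj
    have hr : |(p:ℝ)^j| < 1 := by
      rw [abs_of_pos (by positivity)]
      exact zpow_lt_one_of_neg₀ hp1 hj
    induction Q using Polynomial.induction_on' with
    | add P Q h1 h2 => simpa [add_mul] using h1.add h2
    | monomial n a =>
      have := (tendsto_pow_const_mul_const_pow_of_abs_lt_one n hr).const_mul a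
      simp only [mul_zero] at this
      refine this.congr (fun N => ?_)
      rw [eval_monomial, zpow_mul, zpow_natCast]; ring
  induction s using Finset.strongInduction with
  | _ s ih =>
  intro P hP j hj hj0
  have hne : s.Nonempty := ⟨j, hj⟩
  set m := s.max' hne with hm
  have hms : m ∈ s := s.max'_mem hne
  have hm0 : 0 ≤ m := hj0.trans (s.le_max' _ hj)
  have key : P m = 0 := by
    have h1 : Tendsto (fun N : ℕ => (p:ℝ)^(-m * N) * ∑ j ∈ s, (P j).eval (N:ℝ) * (p:ℝ)^(j * N)) atTop (nhds 0) := by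
      refine squeeze_zero_norm (fun N => ?_) (tendsto_zero_iff_norm_tendsto_zero.1 hP)
      rw [norm_mul]
      refine mul_le_of_le_one_left (norm_nonneg _) ?_
      rw [Real.norm_eq_abs, abs_of_pos (by positivity)]
      exact zpow_le_one_of_nonpos₀ hp1.le (by nlinarith)
    have h2 : Tendsto (fun N : ℕ => ∑ j ∈ s.erase m, (P j).eval (N:ℝ) * (p:ℝ)^((j - m) * N)) atTop (nhds 0) := by
      have := tendsto_finsetSum (s.erase m) (f := fun j (N:ℕ) => (P j).eval (N:ℝ) * (p:ℝ)^((j - m) * N))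
        (a := fun _ => 0) (x := atTop) (fun j hj => neg _ _ (by
          have h1 := s.le_max' j (Finset.mem_of_mem_erase hj)
          have h2 := Finset.ne_of_mem_erase hj
          have : j < m := lt_of_le_of_ne h1 h2
          omega))
      simpa using this
    have h3 := h1.sub h2
    simp only [sub_zero] at h3
    have h4 : Tendsto (fun N : ℕ => (P m).eval (N:ℝ)) atTop (nhds 0) := by
      refine h3.congr (fun N => ?_)
      rw [← Finset.add_sum_erase s _ hms, mul_add, Finset.mul_sum, add_sub_assoc, ← Finset.sum_sub_distrib,
        Finset.sum_eq_zero, add_zero]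
      · rw [mul_left_comm, ← zpow_add₀ (by positivity)]; simp
      · intro j _
        rw [mul_left_comm, ← zpow_add₀ (by positivity)]
        rw [show -m * (N:ℤ) + j * N = (j - m) * N by ring, sub_self]
    by_contra h0
    by_cases hd : 0 < (P m).degree
    · have := (P m).tendsto_norm_atTop hd (tendsto_norm_atTop_atTop.comp (tendsto_natCast_atTop_atTop (R := ℝ)))
      exact not_tendsto_nhds_of_tendsto_atTop this _ (by simpa using h4.norm)
    · have e := eq_C_of_degree_le_zero (not_lt.1 hd)
      rw [e] at h4
      simp only [eval_C] at h4
      have := tendsto_nhds_unique h4 tendsto_const_nhds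
      rw [e, ← this] at h0; simp at h0
  by_cases hjm : j = m
  · rw [hjm, key]
  · refine ih (s.erase m) (Finset.erase_ssubset hms) P ?_ j (Finset.mem_erase.2 ⟨hjm, hj⟩) hj0
    refine hP.congr (fun N => ?_)
    rw [← Finset.add_sum_erase s _ hms, key]; simp

theorem exp_poly_lim (s : Finset ℤ) (h0 : (0:ℤ) ∈ s) (P : ℤ → ℝ[X]) (c : ℝ)
    (h : Tendsto (fun N : ℕ => ∑ j ∈ s, (P j).eval (N:ℝ) * (p:ℝ)^(j * N)) atTop (nhds c)) : c = (P 0).coeff 0 := by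
  classical
  have := exp_poly_zero (p := p) s (fun j => if j = 0 then P 0 - C c else P j) (by
    have h' := h.sub (tendsto_const_nhds (x := c))
    rw [sub_self] at h'
    refine h'.congr (fun N => ?_)
    rw [← Finset.add_sum_erase s _ h0, ← Finset.add_sum_erase s _ h0]
    simp only [if_true, eval_sub, eval_C, zero_mul, zpow_zero, mul_one]
    rw [add_sub_right_comm]
    congr 1
    refine Finset.sum_congr rfl (fun j hj => ?_)
    rw [if_neg (Finset.ne_of_mem_erase hj)]) 0 h0 le_rfl
  simp only [if_true] at this
  rw [sub_eq_zero.1 this]; simp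


/-- generating terms -/
def gterm (p : ℕ) (A : B → ℚ) (k : ℕ) (j : ℤ) : B × ℕ → ℚ := fun z => A z.1 * (z.2:ℚ)^k * (p:ℚ)^(j * z.2)

/-- truncated generating terms -/
def tterm (p : ℕ) (A : B → ℚ) (k : ℕ) (j : ℤ) (β : B → ℤ) : B × ℕ → ℚ :=
  fun z => if (z.2:ℤ) < β z.1 then gterm p A k j z else 0

theorem gterm_mul (A A' : B → ℚ) (k k' : ℕ) (j j' : ℤ) (z : B × ℕ) :
    gterm p A k j z * gterm p A' k' j' z = gterm p (A * A') (k + k') (j + j') z := by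
  have : (p:ℚ) ≠ 0 := by exact_mod_cast hp.out.ne_zero
  simp only [gterm, Pi.mul_apply, add_mul, zpow_add₀ this, pow_add]
  ring

/-- the monoid of terms -/
def Gm (p : ℕ) [hp : Fact p.Prime] (T : Tame B) : Submonoid (B × ℕ → ℚ) where
  carrier := {f | ∃ A ∈ T.Cn p, ∃ k j, f = gterm p A k j ∨ ∃ β ∈ T.V, f = tterm p A k j β}
  one_mem' := ⟨1, (T.Cn p).one_mem, 0, 0, Or.inl (by ext z; simp [gterm])⟩
  mul_mem' := by
    rintro f f' ⟨A, hA, k, j, h⟩ ⟨A', hA', k', j', h'⟩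
    refine ⟨A * A', (T.Cn p).mul_mem hA hA', k + k', j + j', ?_⟩
    rcases h with rfl | ⟨β, hβ, rfl⟩ <;> rcases h' with rfl | ⟨β', hβ', rfl⟩
    · left; ext z; exact gterm_mul _ _ _ _ _ _ z
    · right; refine ⟨β', hβ', ?_⟩
      ext z; simp only [Pi.mul_apply, tterm]
      split_ifs
      · exact gterm_mul _ _ _ _ _ _ z
      · simp
    · right; refine ⟨β, hβ, ?_⟩
      ext z; simp only [Pi.mul_apply, tterm]
      split_ifs
      · exact gterm_mul _ _ _ _ _ _ z
      · simp
    · right; refine ⟨_, T.min' hβ hβ', ?_⟩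
      ext z; simp only [Pi.mul_apply, tterm, lt_min_iff]
      by_cases h1 : (z.2:ℤ) < β z.1 <;> by_cases h2 : (z.2:ℤ) < β' z.1 <;> simp [h1, h2]
      exact gterm_mul _ _ _ _ _ _ z

/-- the algebra of terms -/
noncomputable def Cls (p : ℕ) [hp : Fact p.Prime] (T : Tame B) : Subalgebra ℚ (B × ℕ → ℚ) :=
  Algebra.adjoin ℚ (Gm p T : Set (B × ℕ → ℚ))

theorem Cls_g {A : B → ℚ} (hA : A ∈ T.Cn p) (k : ℕ) (j : ℤ) : gterm p A k j ∈ Cls p T :=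
  Algebra.subset_adjoin ⟨A, hA, k, j, Or.inl rfl⟩

open Classical in
theorem Cls_ind {Y : B × ℕ → Prop} (h : PLS T Y) : (fun z => if Y z then (1:ℚ) else 0) ∈ Cls p T := by
  induction h with
  | base X h =>
    have := Cls_g (p := p) (T.Cn_ind (p := p) h) 0 0
    convert this using 1
    ext z; simp [gterm]
  | lt β h =>
    have : tterm p 1 0 0 β ∈ Cls p T := Algebra.subset_adjoin ⟨1, (T.Cn p).one_mem, 0, 0, Or.inr ⟨β, h, rfl⟩⟩
    convert this using 1
    ext z; simp [gterm, tterm]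
  | and P Q _ _ h1 h2 =>
    convert (Cls p T).mul_mem h1 h2 using 1
    ext z; by_cases h : P z <;> simp [h]
  | not P _ h =>
    convert (Cls p T).sub_mem (Cls p T).one_mem h using 1
    ext z; by_cases h : P z <;> simp [h]

theorem Cls_glue {ι : Type} [Finite ι] {Y : ι → B × ℕ → Prop} (hY : ∀ i, PLS T (Y i)) (hc : ∀ z, ∃ i, Y i z)
    {f : B × ℕ → ℚ} {g : ι → B × ℕ → ℚ} (hg : ∀ i, g i ∈ Cls p T) (e : ∀ i z, Y i z → f z = g i z) : f ∈ Cls p T := by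
  classical
  have : ∀ s : Finset ι, (fun z => if ∃ i ∈ s, Y i z then f z else 0) ∈ Cls p T := by
    intro s
    induction s using Finset.induction_on with
    | empty => convert (Cls p T).zero_mem using 1; ext z; simp
    | insert i s hi ih =>
      have h1 := Cls_ind (p := p) (hY i)
      convert (Cls p T).add_mem ((Cls p T).mul_mem h1 (hg i))
        ((Cls p T).mul_mem ((Cls p T).sub_mem (Cls p T).one_mem h1) ih) using 1
      ext z
      by_cases h : Y i z
      · simp [h, e i z h]
      · simp [h]
  cases nonempty_fintype ι
  convert this Finset.univ using 1
  ext z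
  obtain ⟨i, hi⟩ := hc z
  rw [if_pos ⟨i, Finset.mem_univ _, hi⟩]

theorem Cls_PL {κ : B × ℕ → ℤ} (h : PL T κ) : (fun z => (κ z : ℚ)) ∈ Cls p T ∧ (fun z => (p:ℚ)^(κ z)) ∈ Cls p T := by
  obtain ⟨ι, hι, Y, κ0, a, h1, h2, h3, h4⟩ := h
  have hp0 : (p:ℚ) ≠ 0 := by exact_mod_cast hp.out.ne_zero
  constructor
  · refine Cls_glue h1 h3 (g := fun i => gterm p (fun b => (κ0 i b : ℚ)) 0 0 + gterm p (fun _ => (a i:ℚ)) 1 0)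
      (fun i => (Cls p T).add_mem (Cls_g (T.Cn_int (h2 i)) _ _) (Cls_g (T.Cn_const _) _ _)) (fun i z hz => ?_)
    simp [gterm, h4 i z hz]
  · refine Cls_glue h1 h3 (g := fun i => gterm p (fun b => (p:ℚ)^(κ0 i b)) 0 (a i))
      (fun i => (Cls_g (T.Cn_pow (h2 i)) _ _)) (fun i z hz => ?_)
    simp [gterm, h4 i z hz, zpow_add₀ hp0]

theorem Cls_dil {f : B × ℕ → ℚ} (h : f ∈ Cls p T) {N : ℕ} (hN : 0 < N) :
    (fun z => f (z.1, N * z.2)) ∈ Cls p T := by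
  unfold Cls at h
  induction h using Algebra.adjoin_induction with
  | mem f hf =>
    have hp0 : (p:ℚ) ≠ 0 := by exact_mod_cast hp.out.ne_zero
    obtain ⟨A, hA, k, j, h⟩ := hf
    have hg : (fun z : B × ℕ => gterm p A k j (z.1, N * z.2)) ∈ Cls p T := by
      have := (Cls p T).smul_mem (Cls_g (p := p) hA k (j * N)) ((N:ℚ)^k)
      convert this using 1
      ext z
      simp only [gterm, Pi.smul_apply, smul_eq_mul]
      push_cast
      rw [mul_pow, mul_assoc j]; ring
    rcases h with rfl | ⟨β, hβ, rfl⟩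
    · exact hg
    · have h2 := Cls_ind (p := p) ((PLS.lt β hβ).dil hN 0)
      convert (Cls p T).mul_mem h2 hg using 1
      ext z
      simp [tterm]
  | algebraMap r => exact (Cls p T).algebraMap_mem r
  | add f g _ _ h1 h2 => exact (Cls p T).add_mem h1 h2
  | mul f g _ _ h1 h2 => exact (Cls p T).mul_mem h1 h2

theorem Cn_T2 {Ψ : B × ℕ → ℚ} (h : Ψ ∈ (T2 T).Cn p) :
    ∃ n, 0 < n ∧ ∀ l0 : ℕ, (fun z : B × ℕ => Ψ (z.1, n * z.2 + l0)) ∈ Cls p T := by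
  have mul : ∀ {Ψ : B × ℕ → ℚ} {n : ℕ}, (∀ l0 : ℕ, (fun z : B × ℕ => Ψ (z.1, n * z.2 + l0)) ∈ Cls p T) →
      ∀ {N : ℕ}, 0 < N → ∀ l0 : ℕ, (fun z : B × ℕ => Ψ (z.1, n * N * z.2 + l0)) ∈ Cls p T := by
    intro Ψ n h N hN l0
    have := Cls_dil (h l0) hN
    simpa [mul_assoc] using this
  refine Cn_induct (p := p) (T := T2 T) (C := fun Ψ => ∃ n, 0 < n ∧ ∀ l0 : ℕ, (fun z : B × ℕ => Ψ (z.1, n * z.2 + l0)) ∈ Cls p T)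
    ?_ ?_ ?_ ?_ ?_ h
  · rintro κ ⟨n, hn, h⟩
    exact ⟨n, hn, fun l0 => (Cls_PL (h l0)).1⟩
  · rintro κ ⟨n, hn, h⟩
    exact ⟨n, hn, fun l0 => (Cls_PL (h l0)).2⟩
  · intro c
    exact ⟨1, one_pos, fun l0 => (Cls p T).algebraMap_mem c⟩
  · rintro f g ⟨n, hn, h⟩ ⟨m, hm, h'⟩
    refine ⟨n * m, Nat.mul_pos hn hm, fun l0 => ?_⟩
    have h2 := mul h' hn l0
    rw [mul_comm m n] at h2
    exact (Cls p T).add_mem (mul h hm l0) h2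
  · rintro f g ⟨n, hn, h⟩ ⟨m, hm, h'⟩
    refine ⟨n * m, Nat.mul_pos hn hm, fun l0 => ?_⟩
    have h2 := mul h' hn l0
    rw [mul_comm m n] at h2
    exact (Cls p T).mul_mem (mul h hm l0) h2

/-- eventual exponential polynomial form of partial sums -/
def Ev (p : ℕ) [hp : Fact p.Prime] (T : Tame B) (f : B × ℕ → ℚ) : Prop :=
  ∃ (s : Finset ℤ) (P : ℤ → B → ℚ[X]), (fun b => (P 0 b).coeff 0) ∈ T.Cn p ∧
    ∀ s', s ⊆ s' → ∀ b, ∀ᶠ N : ℕ in atTop, ∑ l ∈ Finset.range N, f (b, l) = ∑ j ∈ s', (P j b).eval (N:ℚ) * (p:ℚ)^(j * N)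

theorem Ev.add {f g : B × ℕ → ℚ} (h : Ev p T f) (h' : Ev p T g) : Ev p T (f + g) := by
  classical
  obtain ⟨s, P, h1, h2⟩ := h
  obtain ⟨s', P', h1', h2'⟩ := h'
  refine ⟨s ∪ s', fun j b => P j b + P' j b, ?_, fun u hu b => ?_⟩
  · convert (T.Cn p).add_mem h1 h1' using 1
    ext b; simp
  · filter_upwards [h2 u (Finset.union_subset_left hu) b, h2' u (Finset.union_subset_right hu) b] with N e e'
    simp only [Pi.add_apply, Finset.sum_add_distrib, e, e', eval_add, add_mul]

theorem Ev.smul {f : B × ℕ → ℚ} (h : Ev p T f) (c : ℚ) : Ev p T (c • f) := by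
  obtain ⟨s, P, h1, h2⟩ := h
  refine ⟨s, fun j b => C c * P j b, ?_, fun u hu b => ?_⟩
  · convert (T.Cn p).smul_mem h1 c using 1
    ext b; simp
  · filter_upwards [h2 u hu b] with N e
    simp only [Pi.smul_apply, smul_eq_mul, ← Finset.mul_sum, e, eval_mul, eval_C, mul_assoc]

theorem Ev_zero : Ev p T (0 : B × ℕ → ℚ) :=
  ⟨∅, 0, by convert (T.Cn p).zero_mem using 1; ext b; simp, fun u hu b => Eventually.of_forall (fun N => by simp)⟩

theorem gsum {A : B → ℚ} {k : ℕ} {j : ℤ} {U : ℚ[X]} (hU : C ((p:ℚ)^j) * U.comp (X + 1) - U = X^k) (b : B) (N : ℕ) :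
    ∑ l ∈ Finset.range N, gterm p A k j (b, l) = A b * (U.eval (N:ℚ) * (p:ℚ)^(j * N) - U.eval 0) := by
  have hp0 : (p:ℚ) ≠ 0 := by exact_mod_cast hp.out.ne_zero
  induction N with
  | zero => simp
  | succ N ih =>
    rw [Finset.sum_range_succ, ih]
    have := congrArg (eval (N:ℚ)) hU
    simp only [eval_sub, eval_mul, eval_C, eval_comp, eval_add, eval_X, eval_one, eval_pow] at this
    simp only [gterm]
    push_cast
    rw [← this, mul_add j, zpow_add₀ hp0, mul_one]; ring

theorem Cn_poly {κ : B → ℚ} (h : κ ∈ T.Cn p) (U : ℚ[X]) : (fun b => U.eval (κ b)) ∈ T.Cn p := by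
  induction U using Polynomial.induction_on' with
  | add P Q h1 h2 =>
    convert (T.Cn p).add_mem h1 h2 using 1
    ext b; simp
  | monomial n a =>
    convert (T.Cn p).smul_mem ((T.Cn p).pow_mem h n) a using 1
    ext b; simp

theorem Ev_of_Cls {f : B × ℕ → ℚ} (h : f ∈ Cls p T) : Ev p T f := by
  classical
  have h' : f ∈ (Algebra.adjoin ℚ (Gm p T : Set (B × ℕ → ℚ))).toSubmodule := h
  rw [Algebra.adjoin_eq_span, Submonoid.closure_eq] at h'
  induction h' using Submodule.span_induction with
  | zero => exact Ev_zero
  | add f g hf hg h1 h2 =>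
    refine Ev.add (h1 ?_) (h2 ?_)
    · show f ∈ (Algebra.adjoin ℚ (Gm p T : Set (B × ℕ → ℚ))).toSubmodule
      rwa [Algebra.adjoin_eq_span, Submonoid.closure_eq]
    · show g ∈ (Algebra.adjoin ℚ (Gm p T : Set (B × ℕ → ℚ))).toSubmodule
      rwa [Algebra.adjoin_eq_span, Submonoid.closure_eq]
  | smul c f hf h1 =>
    refine Ev.smul (h1 ?_) c
    show f ∈ (Algebra.adjoin ℚ (Gm p T : Set (B × ℕ → ℚ))).toSubmodule
    rwa [Algebra.adjoin_eq_span, Submonoid.closure_eq]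
  | mem f hf =>
    have hp0 : (p:ℚ) ≠ 0 := by exact_mod_cast hp.out.ne_zero
    obtain ⟨A, hA, k, j, h⟩ := hf
    obtain ⟨U, hU⟩ := antideriv ((p:ℚ)^j) (zpow_pos (by exact_mod_cast hp.out.pos) _) (X^k)
    rcases h with rfl | ⟨β, hβ, rfl⟩
    · refine ⟨{0, j}, fun i b => (if i = j then C (A b) * U else 0) + if i = 0 then C (- A b * U.eval 0) else 0, ?_, ?_⟩
      · have h1 := (T.Cn p).smul_mem hA (if 0 = j then U.coeff 0 else 0)
        have h2 := (T.Cn p).smul_mem hA (- U.eval 0)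
        convert (T.Cn p).add_mem h1 h2 using 1
        ext b
        by_cases h0 : 0 = j
        · simp [h0]; ring
        · simp [h0]; ring
      · intro s hs b
        refine Eventually.of_forall (fun N => ?_)
        simp only [gsum hU, eval_add, add_mul, Finset.sum_add_distrib]
        rw [Finset.sum_eq_single_of_mem j (hs (by simp)) (fun i _ hi => by simp [hi]),
          Finset.sum_eq_single_of_mem 0 (hs (by simp)) (fun i _ hi => by simp [hi])]
        simp; ring
    · refine ⟨{0}, fun i b => if i = 0 then
        C (A b * (U.eval (((max (β b) 0 : ℤ)):ℚ) * ((p:ℚ)^(j * max (β b) 0)) - U.eval 0)) else 0, ?_, ?_⟩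
      · have hm := T.max' hβ (T.const' 0)
        have h1 := Cn_poly (T.Cn_int (p := p) hm) U
        have h2 := T.Cn_pow (p := p) (T.zsmul' hm j)
        convert (T.Cn p).mul_mem hA ((T.Cn p).sub_mem ((T.Cn p).mul_mem h1 h2) (T.Cn_const (U.eval 0))) using 1
        ext b
        simp
      · intro s hs b
        filter_upwards [eventually_ge_atTop (max (β b) 0).toNat] with N hN
        rw [Finset.sum_eq_single_of_mem 0 (hs (by simp)) (fun i _ hi => by simp [hi])]
        have e : (((max (β b) 0).toNat : ℕ) : ℤ) = max (β b) 0 := Int.toNat_of_nonneg (le_max_right _ _)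
        have := gsum (A := A) hU b (max (β b) 0).toNat
        rw [e] at this
        have e' : (((max (β b) 0).toNat : ℕ) : ℚ) = ((max (β b) 0 : ℤ) : ℚ) := by exact_mod_cast e
        rw [e'] at this
        simp only [if_true, eval_C, zero_mul, zpow_zero, mul_one]
        rw [← this]
        rw [← Finset.sum_subset (Finset.range_subset_range.2 hN)]
        · refine Finset.sum_congr rfl (fun l hl => ?_)
          have : (l:ℤ) < β b := by
            have := Finset.mem_range.1 hl
            omega
          simp [tterm, this]
        · intro l _ hl
          have : ¬ (l:ℤ) < β b := by
            have := mt Finset.mem_range.2 hl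
            omega
          simp [tterm, this]

theorem sum_Cls {f : B × ℕ → ℚ} (h : f ∈ Cls p T) (hs : ∀ b, Summable (fun l => ((f (b, l) : ℚ):ℝ))) :
    ∃ G ∈ T.Cn p, ∀ b, HasSum (fun l => ((f (b, l) : ℚ):ℝ)) (G b) := by
  obtain ⟨s, P, h1, h2⟩ := Ev_of_Cls h
  refine ⟨_, h1, fun b => ?_⟩
  have h3 := (hs b).hasSum
  have h4 := h3.tendsto_sum_nat
  have h5 := exp_poly_lim (p := p) (insert 0 s) (by simp) (fun j => (P j b).map (algebraMap ℚ ℝ)) _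
    (h4.congr' (by
      filter_upwards [h2 (insert 0 s) (by simp) b] with N e
      have := congrArg (fun x : ℚ => (x:ℝ)) e
      push_cast at this
      rw [this]
      refine Finset.sum_congr rfl (fun j _ => ?_)
      congr 1
      rw [eval_natCast_map]
      simp))
  rw [h5] at h3
  simpa using h3

theorem sum_T2 {Ψ : B × ℕ → ℚ} (h : Ψ ∈ (T2 T).Cn p) (hs : ∀ b, Summable (fun l => ((Ψ (b, l) : ℚ):ℝ))) :
    ∃ G ∈ T.Cn p, ∀ b, HasSum (fun l => ((Ψ (b, l) : ℚ):ℝ)) (G b) := by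
  obtain ⟨n, hn, h1⟩ := Cn_T2 h
  have inj : ∀ l0 : ℕ, Function.Injective (fun l : ℕ => n * l + l0) := fun l0 x y hxy => by
    have : n * x = n * y := by simpa using hxy
    exact Nat.eq_of_mul_eq_mul_left hn this
  choose G hG hGs using fun l0 : ℕ => sum_Cls (h1 l0) (fun b => (hs b).comp_injective (inj l0))
  refine ⟨fun b => ∑ l0 ∈ Finset.range n, G l0 b, Cn_sum _ (fun i _ => hG i), fun b => ?_⟩
  have : NeZero n := ⟨hn.ne'⟩
  have h3 := Nat.sumByResidueClasses (hs b) n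
  have h4 := (hs b).hasSum
  rw [h3] at h4
  convert h4 using 1
  push_cast
  rw [← Fin.sum_univ_eq_sum_range (fun l0 => ((G l0 b : ℚ):ℝ))]
  refine (Finset.sum_equiv (ZMod.finEquiv n).toEquiv (by simp) (fun i _ => ?_))
  have := (hGs i b).tsum_eq
  rw [← this]
  refine tsum_congr (fun l => ?_)
  have : ((ZMod.finEquiv n) i).val = i := by
    cases n with
    | zero => omega
    | succ n => rfl
  simp only [RingEquiv.toEquiv_eq_coe, EquivLike.coe_coe]
  rw [this, add_comm]

end SumSec
end DC


open Filter MeasureTheory Polynomial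

set_option linter.unusedVariables false
set_option linter.unusedSectionVars false

namespace DC

variable {p : ℕ} [hp : Fact p.Prime] {B : Type*}

noncomputable instance instMSZp : MeasurableSpace ℤ_[p] := borel _
instance instBSZp : BorelSpace ℤ_[p] := ⟨rfl⟩

/-- the Haar probability on `ℤ_p` -/
noncomputable def nu (p : ℕ) [hp : Fact p.Prime] : Measure ℤ_[p] :=
  Measure.addHaarMeasure (⊤ : TopologicalSpace.PositiveCompacts ℤ_[p])

instance : (nu p).IsAddHaarMeasure := by unfold nu; infer_instance

instance instProbNu : IsProbabilityMeasure (nu p) := ⟨by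
  have := Measure.addHaarMeasure_self (G := ℤ_[p]) (K₀ := ⊤)
  simpa [nu] using this⟩

theorem toZModPow_iff (k : ℕ) (x y : ℤ_[p]) :
    PadicInt.toZModPow k x = PadicInt.toZModPow k y ↔ ‖x - y‖ ≤ (p:ℝ)^(-(k:ℤ)) := by
  rw [PadicInt.norm_le_pow_iff_mem_span_pow, ← PadicInt.ker_toZModPow, RingHom.mem_ker, map_sub, sub_eq_zero]

theorem toZModPow_nat (k : ℕ) (i : ZMod (p^k)) : PadicInt.toZModPow k ((i.val : ℕ) : ℤ_[p]) = i := by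
  have : NeZero (p^k) := ⟨pow_ne_zero _ hp.out.ne_zero⟩
  rw [map_natCast, ZMod.natCast_val, ZMod.cast_id]

theorem meas_ball (a : ℤ_[p]) (r : ℝ) : MeasurableSet {x : ℤ_[p] | ‖x - a‖ ≤ r} :=
  (isClosed_le (by fun_prop) (by fun_prop)).measurableSet

theorem nu_ball (a : ℤ_[p]) (k : ℕ) : (nu p).real {x | ‖x - a‖ ≤ (p:ℝ)^(-(k:ℤ))} = (p:ℝ)^(-(k:ℤ)) := by
  have hne : NeZero (p^k) := ⟨pow_ne_zero _ hp.out.ne_zero⟩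
  have tr : ∀ a : ℤ_[p], (nu p).real {x | ‖x - a‖ ≤ (p:ℝ)^(-(k:ℤ))} = (nu p).real {x | ‖x‖ ≤ (p:ℝ)^(-(k:ℤ))} := by
    intro a
    have := measure_preimage_add_right (nu p) (-a) {x | ‖x‖ ≤ (p:ℝ)^(-(k:ℤ))}
    simp only [Measure.real]
    rw [← this]
    simp only [Set.preimage_ofPred_eq, sub_eq_add_neg]
  rw [tr]
  have h1 : (nu p).real (⋃ i : ZMod (p^k), {x | ‖x - ((i.val:ℕ):ℤ_[p])‖ ≤ (p:ℝ)^(-(k:ℤ))}) = 1 := by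
    have : (⋃ i : ZMod (p^k), {x : ℤ_[p] | ‖x - ((i.val:ℕ):ℤ_[p])‖ ≤ (p:ℝ)^(-(k:ℤ))}) = Set.univ := by
      ext x
      simp only [Set.mem_iUnion, Set.mem_univ, iff_true, Set.mem_ofPred_eq]
      exact ⟨PadicInt.toZModPow k x, (toZModPow_iff _ _ _).1 (toZModPow_nat _ _).symm⟩
    rw [this]; simp
  rw [measureReal_iUnion_fintype] at h1
  · rw [Finset.sum_congr rfl (fun i _ => tr _)] at h1
    rw [Finset.sum_const, Finset.card_univ, ZMod.card, nsmul_eq_mul] at h1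
    push_cast at h1
    rw [eq_inv_of_mul_eq_one_right h1, zpow_neg, zpow_natCast]
  · intro i j hij
    rw [Function.onFun, Set.disjoint_left]
    intro x hx hx'
    apply hij
    have h1 := (toZModPow_iff _ _ _).2 hx
    have h2 := (toZModPow_iff _ _ _).2 hx'
    rw [toZModPow_nat] at h1 h2
    exact h1.symm.trans h2
  · intro i; exact meas_ball _ _

theorem nu_zero : (nu p) {0} = 0 := by
  rw [← measureReal_eq_zero_iff]
  refine le_antisymm (le_of_forall_pos_le_add (fun ε hε => ?_)) measureReal_nonneg
  obtain ⟨k, hk⟩ := exists_pow_lt_of_lt_one hε (show ((p:ℝ)⁻¹) < 1 from inv_lt_one_of_one_lt₀ (by exact_mod_cast hp.out.one_lt))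
  have h1 : (nu p).real {0} ≤ (nu p).real {x | ‖x - 0‖ ≤ (p:ℝ)^(-(k:ℤ))} := measureReal_mono (by
    intro x hx; simp at hx; subst hx; simp)
  rw [nu_ball, zpow_neg, zpow_natCast, ← inv_pow] at h1
  linarith

/-- representatives of units mod `p^M` -/
def UU (p M : ℕ) : Finset ℕ := (Finset.range (p^M)).filter (fun u => ¬ p ∣ u)

theorem norm_unit_nat {u : ℕ} (h : ¬ p ∣ u) : ‖(u:ℤ_[p])‖ = 1 := by
  refine le_antisymm (PadicInt.norm_le_one _) (not_lt.1 (fun h' => h ?_))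
  have := (PadicInt.norm_int_lt_one_iff_dvd (p := p) (u:ℤ)).1 (by simpa using h')
  exact_mod_cast this

theorem norm_pl (l : ℕ) {u : ℕ} (h : ¬ p ∣ u) : ‖(p:ℤ_[p])^l * (u:ℤ_[p])‖ = (p:ℝ)^(-(l:ℤ)) := by
  rw [norm_mul, norm_unit_nat h, mul_one, PadicInt.norm_p_pow]

theorem lt_of_shell {l M : ℕ} (hM : 1 ≤ M) : (p:ℝ)^(-((l+M:ℕ):ℤ)) < (p:ℝ)^(-(l:ℤ)) :=
  zpow_lt_zpow_right₀ (by exact_mod_cast hp.out.one_lt) (by push_cast; omega)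

theorem norm_shell {l M : ℕ} (hM : 1 ≤ M) {s s' : ℤ_[p]} (hs : ‖s'‖ = (p:ℝ)^(-(l:ℤ)))
    (h : ‖s - s'‖ ≤ (p:ℝ)^(-((l+M:ℕ):ℤ))) : ‖s‖ = (p:ℝ)^(-(l:ℤ)) := by
  have h1 : ‖(s:ℚ_[p]) - s'‖ < ‖(s':ℚ_[p])‖ := by
    rw [PadicInt.padic_norm_e_of_padicInt, hs, ← PadicInt.coe_sub, PadicInt.padic_norm_e_of_padicInt]
    exact h.trans_lt (lt_of_shell hM)
  have := norm_eq_of_sub_lt h1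
  simpa [hs] using this

theorem exists_shell (M : ℕ) (hM : 1 ≤ M) {s : ℤ_[p]} (hs : s ≠ 0) :
    ∃ u ∈ UU p M, ‖s - (p:ℤ_[p])^s.valuation * (u:ℤ_[p])‖ ≤ (p:ℝ)^(-((s.valuation+M:ℕ):ℤ)) := by
  have hne : NeZero (p^M) := ⟨pow_ne_zero _ hp.out.ne_zero⟩
  have e := PadicInt.unitCoeff_spec hs
  obtain ⟨w, hw⟩ : ∃ w : ℤ_[p], w = ((PadicInt.unitCoeff hs : ℤ_[p]ˣ) : ℤ_[p]) := ⟨_, rfl⟩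
  rw [← hw] at e
  have hw1 : ‖w‖ = 1 := by rw [hw]; exact PadicInt.norm_units _
  set i := PadicInt.toZModPow M w with hi
  have h1 : ‖w - ((i.val:ℕ):ℤ_[p])‖ ≤ (p:ℝ)^(-(M:ℤ)) := (toZModPow_iff _ _ _).1 (by rw [toZModPow_nat])
  have hlt : (p:ℝ)^(-(M:ℤ)) < 1 := by
    have := lt_of_shell (p := p) (l := 0) hM
    simpa using this
  refine ⟨i.val, Finset.mem_filter.2 ⟨Finset.mem_range.2 (ZMod.val_lt i), fun h => ?_⟩, ?_⟩
  · have h2 : ‖(((i.val:ℕ)):ℤ_[p])‖ < 1 := by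
      have := (PadicInt.norm_int_lt_one_iff_dvd (p := p) ((i.val:ℕ):ℤ)).2 (by exact_mod_cast h)
      simpa using this
    have h3 := PadicInt.nonarchimedean (w - ((i.val:ℕ):ℤ_[p])) ((i.val:ℕ):ℤ_[p])
    rw [sub_add_cancel, hw1] at h3
    exact absurd h3 (not_le.2 (max_lt (h1.trans_lt hlt) h2))
  · have : s - (p:ℤ_[p])^s.valuation * ((i.val:ℕ):ℤ_[p]) = (p:ℤ_[p])^s.valuation * (w - ((i.val:ℕ):ℤ_[p])) := by
      linear_combination e
    rw [this, norm_mul, PadicInt.norm_p_pow]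
    push_cast
    rw [neg_add, zpow_add₀ (by exact_mod_cast hp.out.ne_zero)]
    gcongr

theorem norm_sub_le_of_ultra (x y : ℤ_[p]) {r : ℝ} (hx : ‖x‖ ≤ r) (hy : ‖y‖ ≤ r) : ‖x - y‖ ≤ r := by
  have := PadicInt.nonarchimedean x (-y)
  rw [← sub_eq_add_neg, norm_neg] at this
  exact this.trans (max_le hx hy)

theorem shell_sum {G : ℤ_[p] → ℝ} {C : ℝ} (hC : ∀ s, |G s| ≤ C) {M : ℕ} (hM : 1 ≤ M)
    (h : ∀ (l : ℕ) (s s' : ℤ_[p]), ‖s‖ = (p:ℝ)^(-(l:ℤ)) → ‖s - s'‖ ≤ (p:ℝ)^(-((l+M:ℕ):ℤ)) → G s = G s') :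
    Integrable G (nu p) ∧
    HasSum (fun l : ℕ => ∑ u ∈ UU p M, (p:ℝ)^(-((l+M:ℕ):ℤ)) * G ((p:ℤ_[p])^l * (u:ℤ_[p]))) (∫ s, G s ∂(nu p)) := by
  have hmeas : Measurable G := by
    refine measurable_of_continuousOn_compl_singleton 0 (fun s hs => ?_)
    have hs0 : s ≠ 0 := hs
    have hn := PadicInt.norm_eq_zpow_neg_valuation hs0
    refine ContinuousAt.continuousWithinAt ?_
    have : ∀ᶠ s' in nhds s, G s' = G s := by
      have hpos : (0:ℝ) < (p:ℝ)^(-((s.valuation+M:ℕ):ℤ)) := zpow_pos (by exact_mod_cast hp.out.pos) _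
      filter_upwards [Metric.ball_mem_nhds s hpos] with s' hs'
      refine (h s.valuation s s' hn ?_).symm
      rw [norm_sub_rev, ← dist_eq_norm]; exact (Metric.mem_ball.1 hs').le
    exact (continuousAt_const (y := G s)).congr (this.mono (fun _ h => h.symm))
  have hintG : Integrable G (nu p) := Integrable.of_bound hmeas.aestronglyMeasurable C
    (Eventually.of_forall (fun s => by simpa using hC s))
  refine ⟨hintG, ?_⟩
  set A : ℕ × UU p M → Set ℤ_[p] := fun z => {s | ‖s - (p:ℤ_[p])^z.1 * ((z.2:ℕ):ℤ_[p])‖ ≤ (p:ℝ)^(-((z.1+M:ℕ):ℤ))} with hA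
  have hU : ∀ u : UU p M, ¬ p ∣ (u:ℕ) := fun u => (Finset.mem_filter.1 u.2).2
  have hdisj : Pairwise (Function.onFun Disjoint A) := by
    rintro ⟨l, u⟩ ⟨l', u'⟩ hne
    rw [Function.onFun, Set.disjoint_left]
    intro s hs hs'
    apply hne
    have h1 := norm_shell hM (norm_pl l (hU u)) hs
    have h2 := norm_shell hM (norm_pl l' (hU u')) hs'
    rw [h1] at h2
    have h3 := zpow_right_injective₀ (by exact_mod_cast hp.out.pos) (by exact_mod_cast hp.out.one_lt.ne') h2
    have hl : l = l' := by simpa using h3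
    subst hl
    have h4 : ‖(p:ℤ_[p])^l * (((u:ℕ):ℤ_[p]) - ((u':ℕ):ℤ_[p]))‖ ≤ (p:ℝ)^(-((l+M:ℕ):ℤ)) := by
      have e : (p:ℤ_[p])^l * (((u:ℕ):ℤ_[p]) - ((u':ℕ):ℤ_[p])) = (s - (p:ℤ_[p])^l * ((u':ℕ):ℤ_[p])) - (s - (p:ℤ_[p])^l * ((u:ℕ):ℤ_[p])) := by ring
      rw [e]
      exact (norm_sub_le_of_ultra _ _ hs' hs)
    rw [norm_mul, PadicInt.norm_p_pow] at h4
    push_cast at h4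
    rw [neg_add, zpow_add₀ (by exact_mod_cast hp.out.ne_zero)] at h4
    have h5 := le_of_mul_le_mul_left h4 (zpow_pos (by exact_mod_cast hp.out.pos) _)
    have h6 := (toZModPow_iff _ _ _).2 h5
    rw [map_natCast, map_natCast, ZMod.natCast_eq_natCast_iff'] at h6
    rw [Nat.mod_eq_of_lt (Finset.mem_range.1 (Finset.mem_filter.1 u.2).1),
      Nat.mod_eq_of_lt (Finset.mem_range.1 (Finset.mem_filter.1 u'.2).1)] at h6
    simp [Subtype.ext_iff, h6]
  have hun : (⋃ z, A z) =ᵐ[nu p] Set.univ := by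
    rw [ae_eq_univ]
    refine measure_mono_null (fun s hs => ?_) nu_zero
    by_contra h0
    apply hs
    obtain ⟨u, hu, h⟩ := exists_shell M hM (s := s) h0
    exact Set.mem_iUnion.2 ⟨(s.valuation, ⟨u, hu⟩), h⟩
  have h1 := hasSum_integral_iUnion (μ := nu p) (f := G) (s := A) (fun z => meas_ball _ _) hdisj hintG.integrableOn
  rw [Measure.restrict_congr_set hun, Measure.restrict_univ] at h1
  have h2 := h1.prod_fiberwise (fun l => hasSum_fintype _)
  suffices key : (fun l : ℕ => ∑ u ∈ UU p M, (p:ℝ)^(-((l+M:ℕ):ℤ)) * G ((p:ℤ_[p])^l * (u:ℤ_[p]))) =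
      fun l => ∑ b, ∫ x in A (l, b), G x ∂(nu p) by rw [key]; exact h2
  ext l
  rw [← Finset.sum_coe_sort (UU p M)]
  refine Finset.sum_congr rfl (fun u _ => ?_)
  have h3 : ∫ s in A (l, u), G s ∂(nu p) = ∫ s in A (l, u), G ((p:ℤ_[p])^l * ((u:ℕ):ℤ_[p])) ∂(nu p) :=
    setIntegral_congr_fun (meas_ball _ _) (fun s hs => (h l s _ (norm_shell hM (norm_pl l (hU u)) hs) hs))
  rw [h3, setIntegral_const, smul_eq_mul]
  congr 1
  exact (nu_ball _ _).symm

end DC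


open Filter MeasureTheory Polynomial

set_option linter.unusedVariables false
set_option linter.unusedSectionVars false

namespace DC

open Tame

variable {p : ℕ} [hp : Fact p.Prime] {B : Type*}

def mkZp (x : ℚ_[p]) (hx : ‖x‖ ≤ 1) : ℤ_[p] := ⟨x, hx⟩

theorem mkZp_coe (x : ℚ_[p]) (hx : ‖x‖ ≤ 1) : ((mkZp x hx : ℤ_[p]) : ℚ_[p]) = x := rfl

open Classical in
/-- truncation to `ℤ_p` -/
noncomputable def toZp (x : ℚ_[p]) : ℤ_[p] := if hx : ‖x‖ ≤ 1 then mkZp x hx else 0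

theorem toZp_of_le {x : ℚ_[p]} (hx : ‖x‖ ≤ 1) : ((toZp x : ℤ_[p]) : ℚ_[p]) = x := by
  unfold toZp; rw [dif_pos hx, mkZp_coe]

open Classical in
theorem toZp_coe (x : ℚ_[p]) : ((toZp x : ℤ_[p]) : ℚ_[p]) = if ‖x‖ ≤ 1 then x else 0 := by
  split_ifs with h
  · exact toZp_of_le h
  · unfold toZp; rw [dif_neg h]; simp

section
variable {T : Tame B} {R : Subring (B → ℚ_[p])}

theorem Meas_T2 {f : B → ℚ_[p]} (h : T.Meas f) : (T2 T).Meas (fun z : B × ℕ => f z.1) :=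
  ⟨T2_fst h.1, fun N => T2_fst (h.2 N)⟩

theorem ac_ppow (k : ℤ) : ac ((p:ℚ_[p])^k) = 1 := by
  rw [ac, v_pow_p, ← zpow_add₀ pK0]; simp

theorem Meas_pl (u : ℕ) : (T2 T).Meas (fun z : B × ℕ => (p:ℚ_[p])^z.2 * (u:ℚ_[p])) := by
  refine Meas.mul ⟨?_, fun N => ?_⟩ (Meas_const _)
  · refine mem_congr T2_snd (fun z => ?_)
    dsimp only
    rw [← zpow_natCast, v_pow_p]
  · refine mem_congr ((T2 T).const' (acz N (1:ℚ_[p]))) (fun z => ?_)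
    dsimp only
    rw [acz_eq_iff, ← zpow_natCast, ac_ppow, ac_one]; simpa using (pN_pos _).le

variable {n : ℕ}

/-- point at level `z.2` around the center -/
noncomputable def pt (c : B → ℤ_[p]) (u : ℕ) (z : B × ℕ) : ℤ_[p] :=
  c z.1 + (p:ℤ_[p])^z.2 * (u:ℤ_[p])

/-- region where the center `j` is nearest -/
def Rg (c : Fin n → B → ℤ_[p]) (j : Fin n) (u : ℕ) (z : B × ℕ) : Prop :=
  ∀ i, (p:ℝ)^(-(z.2:ℤ)) ≤ ‖pt (c j) u z - c i z.1‖

theorem norm_plK (l : ℕ) {u : ℕ} (h : ¬ p ∣ u) : ‖(p:ℚ_[p])^l * (u:ℚ_[p])‖ = (p:ℝ)^(-(l:ℤ)) := by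
  have := norm_pl (p := p) l h
  rw [← this, ← PadicInt.padic_norm_e_of_padicInt]
  push_cast; rfl

theorem S_Rg (hR : Full T R) {c : Fin n → B → ℤ_[p]} (hc : ∀ i, (fun b => ((c i b : ℤ_[p]):ℚ_[p])) ∈ R)
    (j : Fin n) {u : ℕ} (hu : ¬ p ∣ u) : (T2 T).S (Rg c j u) := by
  unfold Rg
  refine S_forall (fun i => ?_)
  have h1 : (T2 T).Meas (fun z : B × ℕ => ((c j z.1 : ℤ_[p]):ℚ_[p]) - ((c i z.1 : ℤ_[p]):ℚ_[p])) :=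
    Meas_T2 (hR.meas _ (R.sub_mem (hc j) (hc i)))
  refine (h1.S_apx (Meas_pl u).neg le_rfl).not.congr (fun z => ?_)
  rw [Apx, norm_neg, norm_plK _ hu, ← PadicInt.padic_norm_e_of_padicInt, pt]
  push_cast
  have e : (((c j z.1 : ℤ_[p]):ℚ_[p]) - ((c i z.1 : ℤ_[p]):ℚ_[p])) - -((p:ℚ_[p])^z.2 * (u:ℚ_[p])) =
    ((c j z.1 : ℤ_[p]):ℚ_[p]) + (p:ℚ_[p])^z.2 * (u:ℚ_[p]) - ((c i z.1 : ℤ_[p]):ℚ_[p]) := by ring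
  rw [e, not_le]
  set x := ((c j z.1 : ℤ_[p]):ℚ_[p]) + (p:ℚ_[p])^z.2 * (u:ℚ_[p]) - ((c i z.1 : ℤ_[p]):ℚ_[p])
  rw [← zpow_add₀ p0.ne']
  have h0 : (0:ℝ) < (p:ℝ)^(-1 + -(z.2:ℤ)) := pN_pos _
  by_cases hx : x = 0
  · rw [hx]; simp; 
    constructor
    · intro h; exact absurd h (not_le.2 (by have := pN_pos (p := p) (-(z.2:ℤ)); simpa using this))
    · intro h; exact absurd h (not_lt.2 (by simpa using h0.le))
  · rw [nv hx, zpow_le_zpow_iff_right₀ p1, zpow_lt_zpow_iff_right₀ p1]; omega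

open Classical in
/-- tame structure on `B × ℤ_p` attached to a finite list of centers -/
noncomputable def That (hR : Full T R) (c : Fin n → B → ℤ_[p])
    (hc : ∀ i, (fun b => ((c i b : ℤ_[p]):ℚ_[p])) ∈ R) : Tame (B × ℤ_[p]) where
  V := {κ | (∃ M : ℕ, 1 ≤ M ∧ ∀ b t t', (∀ i, ‖t' - t‖ ≤ (p:ℝ)^(-(M:ℤ)) * ‖t - c i b‖) → κ (b, t') = κ (b, t)) ∧
    ∀ (j : Fin n) (u : ℕ), ¬ p ∣ u → (fun z : B × ℕ => if Rg c j u z then κ (z.1, pt (c j) u z) else 0) ∈ (T2 T).V}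
  const' m := ⟨⟨1, le_rfl, fun _ _ _ _ => rfl⟩, fun j u hu =>
    (S_Rg hR hc j hu).ite ((T2 T).const' m) ((T2 T).const' 0)⟩
  add' κ₁ κ₂ := by
    rintro ⟨⟨M1, l1, h1⟩, g1⟩ ⟨⟨M2, l2, h2⟩, g2⟩
    refine ⟨⟨max M1 M2, by omega, fun b t t' h => ?_⟩, fun j u hu => ?_⟩
    · dsimp only
      rw [h1 b t t' (fun i => (h i).trans ?_), h2 b t t' (fun i => (h i).trans ?_)] <;>
      · gcongr
        · exact p1.le
        · omega
    · refine mem_congr ((T2 T).add' _ _ (g1 j u hu) (g2 j u hu)) (fun z => ?_)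
      dsimp only; split_ifs <;> simp
  neg' κ := by
    rintro ⟨⟨M1, l1, h1⟩, g1⟩
    refine ⟨⟨M1, l1, fun b t t' h => ?_⟩, fun j u hu => ?_⟩
    · dsimp only; rw [h1 b t t' h]
    · refine mem_congr ((T2 T).neg' _ (g1 j u hu)) (fun z => ?_)
      dsimp only; split_ifs <;> simp
  ite' κ₁ κ₂ κ₃ := by
    rintro ⟨⟨M1, l1, h1⟩, g1⟩ ⟨⟨M2, l2, h2⟩, g2⟩ ⟨⟨M3, l3, h3⟩, g3⟩
    refine ⟨⟨max M1 (max M2 M3), by omega, fun b t t' h => ?_⟩, fun j u hu => ?_⟩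
    · dsimp only
      rw [h1 b t t' (fun i => (h i).trans ?_), h2 b t t' (fun i => (h i).trans ?_),
        h3 b t t' (fun i => (h i).trans ?_)] <;>
      · gcongr
        · exact p1.le
        · omega
    · refine mem_congr ((T2 T).ite' _ _ _ (g1 j u hu) (g2 j u hu) (g3 j u hu)) (fun z => ?_)
      dsimp only; split_ifs <;> simp_all
  div' κ m := by
    rintro ⟨⟨M1, l1, h1⟩, g1⟩ hm
    refine ⟨⟨M1, l1, fun b t t' h => ?_⟩, fun j u hu => ?_⟩
    · dsimp only; rw [h1 b t t' h]
    · refine mem_congr ((T2 T).div' _ m (g1 j u hu) hm) (fun z => ?_)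
      dsimp only; split_ifs <;> simp

theorem That_fst (hR : Full T R) (c : Fin n → B → ℤ_[p])
    (hc : ∀ i, (fun b => ((c i b : ℤ_[p]):ℚ_[p])) ∈ R) {κ : B → ℤ} (h : κ ∈ T.V) :
    (fun z : B × ℤ_[p] => κ z.1) ∈ (That hR c hc).V :=
  ⟨⟨1, le_rfl, fun _ _ _ _ => rfl⟩, fun j u hu => (S_Rg hR hc j hu).ite (T2_fst h) ((T2 T).const' 0)⟩

theorem exists_w (hR : Full T R) {a a' : B → ℚ_[p]} (ha : a ∈ R) (ha' : a' ∈ R) {i k : ℕ} (hik : i ≠ k) (e : ℤ) :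
    ∃ w ∈ R, ∀ b (l : ℕ), a b ≠ 0 → a' b ≠ 0 → (a' b).valuation + k * l = (a b).valuation + i * l + e →
      w b ≠ 0 ∧ (w b).valuation = l := by
  have key : ∀ (x y : ℚ_[p]), x ≠ 0 → y ≠ 0 → ((p:ℚ_[p])^e * x / y).valuation = e + x.valuation - y.valuation := by
    intro x y hx hy
    rw [div_eq_mul_inv, v_mul (mul_ne_zero (zpow_ne_zero _ pK0) hx) (inv_ne_zero hy),
      v_mul (zpow_ne_zero _ pK0) hx, v_pow_p, v_inv]; ring
  have hf : (fun b => (p:ℚ_[p])^e * a b / a' b) ∈ R := hR.div (R.mul_mem (hR.ppow e) ha) ha'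
  rcases lt_or_gt_of_ne hik with h | h
  · obtain ⟨w, hw, hw'⟩ := hR.sec (n := k - i) (by omega) _ hf
    refine ⟨w, hw, fun b l h1 h2 h3 => ?_⟩
    have e1 : ((p:ℚ_[p])^e * a b / a' b).valuation = ((k - i : ℕ):ℤ) * l := by
      rw [key _ _ h1 h2]; push_cast [h.le]; linarith
    have := hw' b (div_ne_zero (mul_ne_zero (zpow_ne_zero _ pK0) h1) h2) (by rw [e1]; exact dvd_mul_right _ _)
    refine ⟨this.1, ?_⟩
    have h4 := this.2
    rw [e1] at h4
    exact mul_left_cancel₀ (by omega) h4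
  · obtain ⟨w, hw, hw'⟩ := hR.sec (n := i - k) (by omega) _ (hR.inv hf)
    refine ⟨w, hw, fun b l h1 h2 h3 => ?_⟩
    have e1 : ((p:ℚ_[p])^e * a b / a' b)⁻¹.valuation = ((i - k : ℕ):ℤ) * l := by
      rw [v_inv, key _ _ h1 h2]; push_cast [h.le]; linarith
    have := hw' b (inv_ne_zero (div_ne_zero (mul_ne_zero (zpow_ne_zero _ pK0) h1) h2)) (by rw [e1]; exact dvd_mul_right _ _)
    refine ⟨this.1, ?_⟩
    have h4 := this.2
    rw [e1] at h4
    exact mul_left_cancel₀ (by omega) h4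

/-- the centers contain all integral roots of all derivatives -/
def Cov (c : Fin n → B → ℤ_[p]) (q : B → ℚ_[p][X]) : Prop :=
  ∀ b k x, derivative^[k] (q b) ≠ 0 → (derivative^[k] (q b)).eval x = 0 → ‖x‖ ≤ 1 → ∃ i, ((c i b : ℤ_[p]):ℚ_[p]) = x

theorem poly_prep (c : Fin n → B → ℤ_[p]) (d N : ℕ) : ∃ M : ℕ, 1 ≤ M ∧ ∀ q : B → ℚ_[p][X], (∀ b, (q b).natDegree ≤ d) →
    Cov c q → ∀ b (t : ℤ_[p]) (t' : ℚ_[p]), ‖(t:ℚ_[p]) - t'‖ ≤ (p:ℝ)^(-(M:ℤ)) →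
    (∀ i, ‖(t:ℚ_[p]) - t'‖ ≤ (p:ℝ)^(-(M:ℤ)) * ‖t - c i b‖) → Apx N ((q b).eval t') ((q b).eval (t:ℚ_[p])) := by
  obtain ⟨M, hM⟩ := prep (p := p) d N
  refine ⟨M+1, by omega, fun q hq hc b t t' h0 h => hM _ _ _ (hq b) (fun k x hk hx => ?_)⟩
  have hle : (p:ℝ)^(-((M+1:ℕ):ℤ)) ≤ (p:ℝ)^(-(M:ℤ)) := zpow_le_zpow_right₀ p1.le (by push_cast; omega)
  by_cases hx1 : ‖x‖ ≤ 1
  · obtain ⟨i, hi⟩ := hc b k x hk hx hx1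
    refine (h i).trans ?_
    rw [← hi, ← PadicInt.coe_sub, PadicInt.padic_norm_e_of_padicInt]
    gcongr
  · push Not at hx1
    have ht : ‖(t:ℚ_[p])‖ ≤ 1 := t.2
    have : ‖(t:ℚ_[p]) - x‖ = ‖x‖ := by
      rw [← norm_neg x]
      apply norm_eq_of_sub_lt
      rw [sub_neg_eq_add, sub_add_cancel, norm_neg]; linarith
    rw [this]
    refine h0.trans (hle.trans ?_)
    have := pN_pos (p := p) (-(M:ℤ))
    nlinarith

theorem ndom {m : ℕ} {f : ℕ → ℚ_[p]} {N i : ℕ} (hi : i < m)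
    (h : ∀ k < m, k ≠ i → ‖f k‖ ≤ (p:ℝ)^(-(N:ℤ)) * ‖f i‖) : Apx N (∑ k ∈ Finset.range m, f k) (f i) := by
  rw [Apx, ← Finset.add_sum_erase _ _ (Finset.mem_range.2 hi), add_sub_cancel_left]
  refine nsum_le (mul_nonneg (pN_pos _).le (norm_nonneg _)) (fun k hk => ?_)
  simp at hk
  exact h k hk.2 hk.1

theorem dom_or {m : ℕ} (hm : 0 < m) (f : ℕ → ℚ_[p]) (N : ℕ) :
    (∃ i < m, ∀ k < m, k ≠ i → ‖f k‖ ≤ (p:ℝ)^(-(N:ℤ)) * ‖f i‖) ∨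
    ∃ i < m, ∃ k < m, ∃ e < N, k ≠ i ∧ f i ≠ 0 ∧ f k ≠ 0 ∧ (f k).valuation = (f i).valuation + e := by
  obtain ⟨i, hi, hmax⟩ := Finset.exists_max_image (Finset.range m) (fun i => ‖f i‖) ⟨0, by simpa using hm⟩
  by_cases h : ∀ k < m, k ≠ i → ‖f k‖ ≤ (p:ℝ)^(-(N:ℤ)) * ‖f i‖
  · exact Or.inl ⟨i, by simpa using hi, h⟩
  · right
    push Not at h
    obtain ⟨k, hk, hki, hlt⟩ := h
    have hk0 : f k ≠ 0 := by
      intro h0; rw [h0, norm_zero] at hlt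
      exact absurd hlt (not_lt.2 (mul_nonneg (pN_pos _).le (norm_nonneg _)))
    have h1 := hmax k (by simpa using hk)
    have hi0 : f i ≠ 0 := by
      intro h0; rw [h0, norm_zero] at h1; exact hk0 (by simpa using h1)
    have h2 := (norm_le_iff hk0 hi0).1 h1
    rw [nv hk0, nv hi0, ← zpow_add₀ p0.ne', zpow_lt_zpow_iff_right₀ p1] at hlt
    exact ⟨i, by simpa using hi, k, hk, ((f k).valuation - (f i).valuation).toNat, by omega, hki, hi0, hk0, by omega⟩

open Classical in
theorem poly_T2 (hR : Full T R) {c : Fin n → B → ℤ_[p]} (hc : ∀ i, (fun b => ((c i b : ℤ_[p]):ℚ_[p])) ∈ R)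
    {d : ℕ} {q : B → ℚ_[p][X]} (hq : IsP R d q) (hcov : Cov c q) (j : Fin n) {u : ℕ} (hu : ¬ p ∣ u) :
    (T2 T).Meas (fun z : B × ℕ => if Rg c j u z then (q z.1).eval ((pt (c j) u z : ℤ_[p]) : ℚ_[p]) else 0) := by
  have hu0 : (u:ℚ_[p]) ≠ 0 := by
    intro h; apply hu; have : u = 0 := by exact_mod_cast h
    simp [this]
  have hSR := S_Rg hR hc j hu
  refine Meas_of_apx_fin (fun N hN => ?_)
  obtain ⟨M, hM1, hM⟩ := poly_prep c d N
  set a : ℕ → B → ℚ_[p] := fun i b => (hasseDeriv i (q b)).eval ((c j b : ℤ_[p]):ℚ_[p]) with ha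
  have haR : ∀ i, a i ∈ R := fun i => (hq.hasse i).eval_mem (hc j)
  set P : B × ℕ → ℚ_[p] := fun z => (p:ℚ_[p])^z.2 * (u:ℚ_[p]) with hP
  have hPM : (T2 T).Meas P := Meas_pl u
  have hPn : ∀ z, ‖P z‖ = (p:ℝ)^(-(z.2:ℤ)) := fun z => norm_plK _ hu
  have hP0 : ∀ z, P z ≠ 0 := fun z => mul_ne_zero (pow_ne_zero _ pK0) hu0
  have hPv : ∀ z, (P z).valuation = z.2 := fun z => by
    have h := hPn z
    rw [nv (hP0 z), zpow_right_inj₀ p0 p1.ne'] at h; omega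
  set m : ℕ → B × ℕ → ℚ_[p] := fun i z => a i z.1 * P z ^ i with hm
  have hmM : ∀ i, (T2 T).Meas (m i) := fun i => (Meas_T2 (hR.meas _ (haR i))).mul (hPM.pow i)
  have hmv : ∀ i z, a i z.1 ≠ 0 → (m i z).valuation = (a i z.1).valuation + i * z.2 := by
    intro i z h
    rw [hm]; dsimp only
    rw [v_mul h (pow_ne_zero _ (hP0 z)), Padic.valuation_pow, hPv]
  have hptP : ∀ z, ((pt (c j) u z : ℤ_[p]):ℚ_[p]) = ((c j z.1 : ℤ_[p]):ℚ_[p]) + P z := by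
    intro z; rw [pt]; push_cast; rfl
  have hsum : ∀ z, (q z.1).eval ((pt (c j) u z : ℤ_[p]):ℚ_[p]) = ∑ i ∈ Finset.range (d+1), m i z := by
    intro z
    rw [eval_taylor _ ((c j z.1 : ℤ_[p]):ℚ_[p])]
    have : ((pt (c j) u z : ℤ_[p]):ℚ_[p]) - ((c j z.1 : ℤ_[p]):ℚ_[p]) = P z := by rw [hptP]; ring
    rw [this]
    refine Finset.sum_subset (by intro x; simp; have := hq.2 z.1; omega) (fun x _ hx => ?_)
    have : hasseDeriv x (q z.1) = 0 := hasseDeriv_eq_zero_of_lt_natDegree _ _ (by simpa using hx)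
    simp [this]
  choose w hwR hw using fun (i k e : ℕ) => (show ∃ w ∈ R, i ≠ k → ∀ b (l : ℕ), a i b ≠ 0 → a k b ≠ 0 →
      (a k b).valuation + k * l = (a i b).valuation + i * l + e → w b ≠ 0 ∧ (w b).valuation = l by
    by_cases h : i = k
    · exact ⟨0, R.zero_mem, fun h' => absurd h h'⟩
    · obtain ⟨w, h1, h2⟩ := exists_w hR (haR i) (haR k) h e
      exact ⟨w, h1, fun _ => h2⟩)
  refine ⟨Unit ⊕ (Fin (d+1) ⊕ (Fin (d+1) × Fin (d+1) × Fin N × Fin (p^M))), inferInstance,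
    fun x => match x with
      | .inl _ => fun z => ¬ Rg c j u z
      | .inr (.inl i) => fun z => Rg c j u z ∧ ∀ k : Fin (d+1), k ≠ i → ‖m k z‖ ≤ ‖(p:ℚ_[p])^(N:ℤ) * m i z‖
      | .inr (.inr ⟨i, k, e, y⟩) => fun z => Rg c j u z ∧ Apx M (P z) ((y:ℕ) * w i k e z.1),
    fun x => match x with
      | .inl _ => fun z => 0
      | .inr (.inl i) => m i
      | .inr (.inr ⟨i, k, e, y⟩) => fun z => (q z.1).eval (((c j z.1 : ℤ_[p]):ℚ_[p]) + (y:ℕ) * w i k e z.1),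
    ?_, ?_, ?_, ?_⟩
  · rintro (_ | i | ⟨i, k, e, y⟩)
    · exact hSR.not
    · exact hSR.and (S_forall (fun k => (S_const _).imp ((hmM k).S_le ((Meas_const _).mul (hmM i)))))
    · exact hSR.and (hPM.S_apx ((Meas_const _).mul (Meas_T2 (hR.meas _ (hwR i k e)))) hM1)
  · intro z
    by_cases hz : Rg c j u z
    swap
    · exact ⟨.inl (), hz⟩
    rcases dom_or (Nat.succ_pos d) (fun i => m i z) N with ⟨i, hi, h⟩ | ⟨i, hi, k, hk, e, he, hki, hi0, hk0, hv⟩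
    · refine ⟨.inr (.inl ⟨i, hi⟩), hz, fun k hk => ?_⟩
      rw [norm_mul ((p:ℚ_[p])^(N:ℤ)), npow]
      exact h k k.2 (fun h' => hk (Fin.ext h'))
    · have hai : a i z.1 ≠ 0 := left_ne_zero_of_mul hi0
      have hak : a k z.1 ≠ 0 := left_ne_zero_of_mul hk0
      rw [hmv i z hai, hmv k z hak] at hv
      obtain ⟨w0, wv⟩ := hw i k e hki.symm z.1 z.2 hai hak hv
      have h1 := acz_nonneg M (P z / w i k e z.1)
      have h2 := acz_lt M (P z / w i k e z.1)
      refine ⟨.inr (.inr ⟨⟨i, hi⟩, ⟨k, hk⟩, ⟨e, he⟩, ⟨(acz M (P z / w i k e z.1)).toNat, ?_⟩⟩), hz, ?_⟩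
      · zify; rw [Int.toNat_of_nonneg h1]; exact h2
      · have h3 := acz_apx hM1 (P z / w i k e z.1)
        have h4 : (P z / w i k e z.1).valuation = 0 := by
          rw [div_eq_mul_inv, v_mul (hP0 z) (inv_ne_zero w0), v_inv, wv, hPv]; ring
        rw [h4, zpow_zero, mul_one] at h3
        have h5 := h3.mul (Apx.rfl' (N := M) (x := w i k e z.1))
        rw [div_mul_cancel₀ _ w0] at h5
        convert h5 using 3
        show (((acz M (P z / w i k e z.1)).toNat : ℕ) : ℚ_[p]) = _
        rw [← Int.cast_natCast, Int.toNat_of_nonneg h1]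
  · rintro (_ | i | ⟨i, k, e, y⟩)
    · exact Meas_const 0
    · exact hmM i
    · exact Meas_T2 (hR.meas _ (hq.eval_mem (R.add_mem (hc j) (R.mul_mem (natCast_mem_R _) (hwR i k e)))))
  · rintro (_ | i | ⟨i, k, e, y⟩) z hz
    · dsimp only at hz ⊢; rw [if_neg hz]; exact Apx.rfl'
    · dsimp only at hz ⊢
      rw [if_pos hz.1, hsum]
      refine ndom i.2 (fun k hk hki => ?_)
      have := hz.2 ⟨k, hk⟩ (fun h => hki (by rw [← h]))
      rwa [norm_mul ((p:ℚ_[p])^(N:ℤ)), npow] at this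
    · dsimp only at hz ⊢
      rw [if_pos hz.1]
      have e1 : ‖((pt (c j) u z : ℤ_[p]):ℚ_[p]) - (((c j z.1 : ℤ_[p]):ℚ_[p]) + (y:ℕ) * w i k e z.1)‖ ≤
          (p:ℝ)^(-(M:ℤ)) * (p:ℝ)^(-(z.2:ℤ)) := by
        rw [hptP, add_sub_add_left_eq_sub, ← hPn z, hz.2.norm_eq hM1]
        exact hz.2
      refine (hM q hq.2 hcov z.1 (pt (c j) u z) _ (e1.trans ?_) (fun i => e1.trans ?_)).symm hN
      · have : (p:ℝ)^(-(z.2:ℤ)) ≤ 1 := zpow_le_one_of_nonpos₀ p1.le (by omega)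
        have := pN_pos (p := p) (-(M:ℤ))
        nlinarith
      · gcongr
        exact hz.1 i

open Classical in
theorem That_poly (hR : Full T R) (hn : 0 < n) {c : Fin n → B → ℤ_[p]} (hc : ∀ i, (fun b => ((c i b : ℤ_[p]):ℚ_[p])) ∈ R)
    {d : ℕ} {q : B → ℚ_[p][X]} (hq : IsP R d q) (hcov : Cov c q) :
    (That hR c hc).Meas (fun z : B × ℤ_[p] => (q z.1).eval (z.2 : ℚ_[p])) := by
  have inv : ∀ N : ℕ, ∃ M : ℕ, 1 ≤ M ∧ ∀ (b : B) (t t' : ℤ_[p]), (∀ i, ‖t' - t‖ ≤ (p:ℝ)^(-(M:ℤ)) * ‖t - c i b‖) →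
      Apx N ((q b).eval (t':ℚ_[p])) ((q b).eval (t:ℚ_[p])) := by
    intro N
    obtain ⟨M, h1, h2⟩ := poly_prep c d N
    refine ⟨M, h1, fun b t t' h => ?_⟩
    have e : ‖(t:ℚ_[p]) - (t':ℚ_[p])‖ = ‖t' - t‖ := by
      rw [norm_sub_rev, ← PadicInt.coe_sub, PadicInt.padic_norm_e_of_padicInt]
    refine h2 q hq.2 hcov b t t' ?_ (fun i => by rw [e]; exact h i)
    rw [e]
    refine (h ⟨0, hn⟩).trans ?_
    have := pN_pos (p := p) (-(M:ℤ))
    have := PadicInt.norm_le_one (t - c ⟨0, hn⟩ b)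
    nlinarith
  refine ⟨⟨?_, fun j u hu => ?_⟩, fun N => ⟨?_, fun j u hu => ?_⟩⟩
  · obtain ⟨M, h1, h2⟩ := inv 1
    exact ⟨M, h1, fun b t t' h => (h2 b t t' h).v_eq le_rfl⟩
  · refine mem_congr (poly_T2 hR hc hq hcov j hu).1 (fun z => ?_)
    dsimp only; split_ifs <;> simp
  · obtain ⟨M, h1, h2⟩ := inv (N+1)
    refine ⟨M, h1, fun b t t' h => ?_⟩
    rcases Nat.eq_zero_or_pos N with rfl | hN
    · have := acz_lt 0 ((q b).eval (t:ℚ_[p])); have := acz_nonneg 0 ((q b).eval (t:ℚ_[p]))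
      have := acz_lt 0 ((q b).eval (t':ℚ_[p])); have := acz_nonneg 0 ((q b).eval (t':ℚ_[p]))
      simp at *; omega
    · exact ((h2 b t t' h).mono (by omega)).acz_eq hN
  · refine mem_congr ((poly_T2 hR hc hq hcov j hu).2 N) (fun z => ?_)
    dsimp only; split_ifs
    · rfl
    · rw [acz_zero]

theorem That_lin (hR : Full T R) (hn : 0 < n) {c : Fin n → B → ℤ_[p]}
    (hc : ∀ i, (fun b => ((c i b : ℤ_[p]):ℚ_[p])) ∈ R) (i : Fin n) :
    (That hR c hc).Meas (fun z : B × ℤ_[p] => (z.2 : ℚ_[p]) - ((c i z.1 : ℤ_[p]):ℚ_[p])) := by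
  have hq : IsP R 1 (fun b => (X - C ((c i b : ℤ_[p]):ℚ_[p]) : ℚ_[p][X])) := by
    refine ⟨fun k => ?_, fun b => by simp⟩
    rcases k with _ | _ | k
    · convert R.neg_mem (hc i) using 1
      ext b; simp
    · convert R.one_mem using 1
      ext b; simp
    · convert R.zero_mem using 1
      ext b; simp [coeff_X, coeff_C]
  refine (That_poly hR hn hc hq ?_).congr (fun z => by simp)
  intro b k x hk hx hx1
  rcases k with _ | _ | k
  · refine ⟨i, ?_⟩
    simp at hx
    exact (sub_eq_zero.1 hx).symm
  · simp at hx
  · exfalso; apply hk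
    rw [Function.iterate_add_apply]
    simp

open Classical in
theorem Cn_That (hR : Full T R) {c : Fin n → B → ℤ_[p]} (hc : ∀ i, (fun b => ((c i b : ℤ_[p]):ℚ_[p])) ∈ R)
    {Φ : B × ℤ_[p] → ℚ} (h : Φ ∈ (That hR c hc).Cn p) :
    (∃ M : ℕ, 1 ≤ M ∧ ∀ b t t', (∀ i, ‖t' - t‖ ≤ (p:ℝ)^(-(M:ℤ)) * ‖t - c i b‖) → Φ (b, t') = Φ (b, t)) ∧
    ∀ (j : Fin n) (u : ℕ), ¬ p ∣ u →
      (fun z : B × ℕ => if Rg c j u z then Φ (z.1, pt (c j) u z) else 0) ∈ (T2 T).Cn p := by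
  have hmax : ∀ (f g : B × ℤ_[p] → ℚ), 
      (∃ M : ℕ, 1 ≤ M ∧ ∀ b t t', (∀ i, ‖t' - t‖ ≤ (p:ℝ)^(-(M:ℤ)) * ‖t - c i b‖) → f (b, t') = f (b, t)) →
      (∃ M : ℕ, 1 ≤ M ∧ ∀ b t t', (∀ i, ‖t' - t‖ ≤ (p:ℝ)^(-(M:ℤ)) * ‖t - c i b‖) → g (b, t') = g (b, t)) →
      (∃ M : ℕ, 1 ≤ M ∧ ∀ b t t', (∀ i, ‖t' - t‖ ≤ (p:ℝ)^(-(M:ℤ)) * ‖t - c i b‖) →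
        f (b, t') = f (b, t) ∧ g (b, t') = g (b, t)) := by
    rintro f g ⟨M1, l1, h1⟩ ⟨M2, l2, h2⟩
    refine ⟨max M1 M2, by omega, fun b t t' h => ⟨h1 b t t' (fun i => (h i).trans ?_), h2 b t t' (fun i => (h i).trans ?_)⟩⟩ <;>
    · gcongr
      · exact p1.le
      · omega
  refine Cn_induct (C := fun Φ => 
    (∃ M : ℕ, 1 ≤ M ∧ ∀ b t t', (∀ i, ‖t' - t‖ ≤ (p:ℝ)^(-(M:ℤ)) * ‖t - c i b‖) → Φ (b, t') = Φ (b, t)) ∧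
    ∀ (j : Fin n) (u : ℕ), ¬ p ∣ u →
      (fun z : B × ℕ => if Rg c j u z then Φ (z.1, pt (c j) u z) else 0) ∈ (T2 T).Cn p) ?_ ?_ ?_ ?_ ?_ h
  · rintro κ ⟨⟨M, l, h1⟩, h2⟩
    refine ⟨⟨M, l, fun b t t' h => by dsimp only; rw [h1 b t t' h]⟩, fun j u hu => ?_⟩
    convert Cn_int (p := p) (h2 j u hu) using 2 with z
    split_ifs <;> simp
  · rintro κ ⟨⟨M, l, h1⟩, h2⟩
    refine ⟨⟨M, l, fun b t t' h => by dsimp only; rw [h1 b t t' h]⟩, fun j u hu => ?_⟩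
    convert Cn_ite (S_Rg hR hc j hu) (Cn_pow (p := p) (h2 j u hu)) (Cn_const 0) using 2 with z
    split_ifs <;> simp
  · intro a
    exact ⟨⟨1, le_rfl, fun _ _ _ _ => rfl⟩, fun j u hu => Cn_ite (S_Rg hR hc j hu) (Cn_const a) (Cn_const 0)⟩
  · rintro f g ⟨hf1, hf2⟩ ⟨hg1, hg2⟩
    obtain ⟨M, l, hM⟩ := hmax f g hf1 hg1
    refine ⟨⟨M, l, fun b t t' h => by dsimp only; rw [(hM b t t' h).1, (hM b t t' h).2]⟩, fun j u hu => ?_⟩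
    convert ((T2 T).Cn p).add_mem (hf2 j u hu) (hg2 j u hu) using 1
    ext z; simp only [Pi.add_apply]; split_ifs <;> simp
  · rintro f g ⟨hf1, hf2⟩ ⟨hg1, hg2⟩
    obtain ⟨M, l, hM⟩ := hmax f g hf1 hg1
    refine ⟨⟨M, l, fun b t t' h => by dsimp only; rw [(hM b t t' h).1, (hM b t t' h).2]⟩, fun j u hu => ?_⟩
    convert ((T2 T).Cn p).mul_mem (hf2 j u hu) (hg2 j u hu) using 1
    ext z; simp only [Pi.mul_apply]; split_ifs <;> simp

open Classical in
theorem IT_That (hR : Full T R) (hn : 0 < n) {c : Fin n → B → ℤ_[p]}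
    (hc : ∀ i, (fun b => ((c i b : ℤ_[p]):ℚ_[p])) ∈ R)
    {Φ : B × ℤ_[p] → ℚ} (h : Φ ∈ (That hR c hc).Cn p) (hb : ∀ b, ∃ A : ℝ, ∀ t, |((Φ (b, t) : ℚ):ℝ)| ≤ A) :
    ∃ G ∈ T.Cn p, ∀ b, Integrable (fun t => ((Φ (b, t) : ℚ):ℝ)) (nu p) ∧ ∫ t, ((Φ (b, t) : ℚ):ℝ) ∂(nu p) = (G b : ℝ) := by
  set FN : Fin n → B × ℤ_[p] → Prop := fun j z => (∀ i, ‖z.2 - c j z.1‖ ≤ ‖z.2 - c i z.1‖) ∧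
    ∀ i, i < j → ‖z.2 - c j z.1‖ < ‖z.2 - c i z.1‖ with hFN
  have nrm : ∀ x y : ℤ_[p], ‖(x:ℚ_[p]) - (y:ℚ_[p])‖ = ‖x - y‖ := fun x y => by
    rw [← PadicInt.coe_sub, PadicInt.padic_norm_e_of_padicInt]
  have hS : ∀ j, (That hR c hc).S (FN j) := by
    intro j
    refine S.and (S_forall (fun i => ?_)) (S_forall (fun i => (S_const _).imp ?_))
    · refine ((That_lin hR hn hc j).S_le (That_lin hR hn hc i)).congr (fun z => ?_)
      rw [← nrm, ← nrm]
    · refine ((That_lin hR hn hc j).S_lt (That_lin hR hn hc i)).congr (fun z => ?_)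
      rw [← nrm, ← nrm]
  have hex : ∀ z, ∃! j, FN j z := by
    intro z
    obtain ⟨i0, _, hi0⟩ := Finset.exists_min_image (Finset.univ : Finset (Fin n)) (fun i => ‖z.2 - c i z.1‖)
      ⟨⟨0, hn⟩, Finset.mem_univ _⟩
    obtain ⟨j, hj, hmin⟩ := Finset.exists_min_image ((Finset.univ : Finset (Fin n)).filter
      (fun i => ‖z.2 - c i z.1‖ = ‖z.2 - c i0 z.1‖)) id ⟨i0, by simp⟩
    simp at hj hmin hi0
    have hFj : FN j z := by
      refine ⟨fun i => by rw [hj]; exact hi0 i, fun i hij => ?_⟩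
      rw [hj]
      refine lt_of_le_of_ne (hi0 i) (fun he => ?_)
      exact absurd (hmin i he.symm) (not_le.2 hij)
    refine ⟨j, hFj, fun k hk => ?_⟩
    rcases lt_trichotomy k j with hlt | rfl | hlt
    · exact absurd (hFj.2 k hlt) (not_lt.2 (hk.1 j))
    · rfl
    · exact absurd (hk.2 j hlt) (not_lt.2 (hFj.1 k))
  have main : ∀ j, ∃ G ∈ T.Cn p, ∀ b, Integrable (fun t => (((if FN j (b, t) then Φ (b, t) else 0) : ℚ):ℝ)) (nu p) ∧
      ∫ t, (((if FN j (b, t) then Φ (b, t) else 0) : ℚ):ℝ) ∂(nu p) = (G b : ℝ) := by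
    intro j
    set Ψ : B × ℤ_[p] → ℚ := fun z => if FN j z then Φ z else 0 with hΨ
    have hΨc : Ψ ∈ (That hR c hc).Cn p := by
      convert Cn_ite (hS j) h (Cn_const 0)
    obtain ⟨⟨M, hM1, hM⟩, hT2⟩ := Cn_That hR hc hΨc
    have hsh : ∀ b, Integrable (fun s => ((Ψ (b, c j b + s) : ℚ):ℝ)) (nu p) ∧
        HasSum (fun l : ℕ => ∑ u ∈ UU p M, (p:ℝ)^(-((l+M:ℕ):ℤ)) * ((Ψ (b, c j b + (p:ℤ_[p])^l * (u:ℤ_[p])) : ℚ):ℝ))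
          (∫ s, ((Ψ (b, c j b + s) : ℚ):ℝ) ∂(nu p)) := by
      intro b
      obtain ⟨A, hA⟩ := hb b
      refine shell_sum (C := A) (G := fun s => ((Ψ (b, c j b + s) : ℚ):ℝ)) (fun s => ?_) hM1 (fun l s s' hs hss => ?_)
      · simp only [hΨ]
        split_ifs
        · exact hA _
        · simpa using (abs_nonneg _).trans (hA 0)
      · have key : ∀ s s' : ℤ_[p], ‖s‖ = (p:ℝ)^(-(l:ℤ)) → ‖s - s'‖ ≤ (p:ℝ)^(-((l+M:ℕ):ℤ)) → FN j (b, c j b + s) →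
            Ψ (b, c j b + s') = Ψ (b, c j b + s) := by
          intro s s' hs hss hF
          refine hM b _ _ (fun i => ?_)
          have h1 := hF.1 i
          dsimp only at h1
          rw [add_sub_cancel_left, hs] at h1
          rw [add_sub_add_left_eq_sub, norm_sub_rev]
          refine hss.trans ?_
          have : (p:ℝ)^(-((l+M:ℕ):ℤ)) = (p:ℝ)^(-(M:ℤ)) * (p:ℝ)^(-(l:ℤ)) := by
            rw [← zpow_add₀ p0.ne']; congr 1; push_cast; ring
          rw [this]
          gcongr
        have hs' : ‖s'‖ = (p:ℝ)^(-(l:ℤ)) := norm_shell hM1 hs (by rw [norm_sub_rev]; exact hss)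
        suffices hh : Ψ (b, c j b + s) = Ψ (b, c j b + s') by rw [hh]
        by_cases h1 : FN j (b, c j b + s)
        · exact (key s s' hs hss h1).symm
        by_cases h2 : FN j (b, c j b + s')
        · exact key s' s hs' (by rw [norm_sub_rev]; exact hss) h2
        rw [hΨ]; dsimp only; rw [if_neg h1, if_neg h2]
    set Θ : B × ℕ → ℚ := fun z => ∑ u ∈ UU p M, (p:ℚ)^(-(z.2:ℤ) - M) *
      (if Rg c j u z then Ψ (z.1, pt (c j) u z) else 0) with hΘ
    have hΘc : Θ ∈ (T2 T).Cn p := by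
      refine Cn_sum _ (fun u hu => ?_)
      have hu' : ¬ p ∣ u := (Finset.mem_filter.1 hu).2
      have h1 : (fun z : B × ℕ => -(z.2:ℤ) - M) ∈ (T2 T).V :=
        sub' ((T2 T).neg' _ T2_snd) ((T2 T).const' M)
      exact ((T2 T).Cn p).mul_mem (Cn_pow h1) (hT2 j u hu')
    have hΘe : ∀ b (l : ℕ), ((Θ (b, l) : ℚ) : ℝ) = ∑ u ∈ UU p M, (p:ℝ)^(-((l+M:ℕ):ℤ)) *
        ((Ψ (b, c j b + (p:ℤ_[p])^l * (u:ℤ_[p])) : ℚ):ℝ) := by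
      intro b l
      rw [hΘ]; dsimp only
      push_cast
      refine Finset.sum_congr rfl (fun u hu => ?_)
      have hu' : ¬ p ∣ u := (Finset.mem_filter.1 hu).2
      congr 1
      · congr 1; ring
      · congr 1
        split_ifs with hr
        · rfl
        · rw [hΨ]; dsimp only
          rw [if_neg]
          intro hF
          refine hr (fun i => ?_)
          have := hF.1 i
          dsimp only at this
          rw [add_sub_cancel_left, norm_pl _ hu'] at this
          exact this
    obtain ⟨G, hG, hGs⟩ := sum_T2 hΘc (fun b => by simp_rw [hΘe]; exact (hsh b).2.summable)
    refine ⟨G, hG, fun b => ⟨?_, ?_⟩⟩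
    · have := (hsh b).1.comp_add_left (-(c j b))
      simpa using this
    · have h1 := hGs b
      simp_rw [hΘe] at h1
      rw [h1.unique (hsh b).2]
      exact (integral_add_left_eq_self (μ := nu p) (fun t => ((Ψ (b, t) : ℚ):ℝ)) (c j b)).symm
  choose G hG hG' using main
  have hsum : ∀ b t, ((Φ (b, t) : ℚ):ℝ) = ∑ j, (((if FN j (b, t) then Φ (b, t) else 0) : ℚ):ℝ) := by
    intro b t
    obtain ⟨j, hj, hju⟩ := hex (b, t)
    rw [Finset.sum_eq_single j]
    · rw [if_pos hj]
    · intro k _ hk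
      rw [if_neg (fun hF => hk (hju k hF))]; simp
    · simp
  refine ⟨fun b => ∑ j, G j b, Cn_sum _ (fun j _ => hG j), fun b => ⟨?_, ?_⟩⟩
  · simp_rw [hsum]
    exact integrable_finsetSum _ (fun j _ => (hG' j b).1)
  · simp_rw [hsum]
    rw [integral_finsetSum _ (fun j _ => (hG' j b).1)]
    push_cast
    exact Finset.sum_congr rfl (fun j _ => (hG' j b).2)

/-- generators coming from polynomials over `R₀` in the last variable -/
def PolyQ (T : Tame B) (R₀ : Subring (B → ℚ_[p])) : Set (B × ℤ_[p] → ℤ) :=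
  {κ | (∃ κ0 ∈ T.V, κ = fun z => κ0 z.1) ∨ ∃ d q, IsP R₀ d q ∧
    ((κ = fun z => ((q z.1).eval (z.2:ℚ_[p])).valuation) ∨ ∃ N, κ = fun z => acz N ((q z.1).eval (z.2:ℚ_[p])))}

def PolyT (T : Tame B) (R₀ : Subring (B → ℚ_[p])) : Tame (B × ℤ_[p]) := Gen (PolyQ T R₀)

theorem PolyT_meas {R₀ : Subring (B → ℚ_[p])} {d : ℕ} {q : B → ℚ_[p][X]} (hq : IsP R₀ d q) :
    (PolyT T R₀).Meas (fun z => (q z.1).eval (z.2:ℚ_[p])) :=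
  ⟨subset_Gen _ (Or.inr ⟨d, q, hq, Or.inl rfl⟩), fun N => subset_Gen _ (Or.inr ⟨d, q, hq, Or.inr ⟨N, rfl⟩⟩)⟩

theorem PolyT_fst {R₀ : Subring (B → ℚ_[p])} {κ : B → ℤ} (h : κ ∈ T.V) :
    (fun z => κ z.1) ∈ (PolyT T R₀).V := subset_Gen _ (Or.inl ⟨κ, h, rfl⟩)

open Classical in
/-- integration over one variable -/
theorem IT {R₀ : Subring (B → ℚ_[p])} (h0 : ∀ f ∈ R₀, T.Meas f) {Φ : B × ℤ_[p] → ℚ}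
    (h : Φ ∈ (PolyT T R₀).Cn p) (hb : ∀ b, ∃ A : ℝ, ∀ t, |((Φ (b, t) : ℚ):ℝ)| ≤ A) :
    ∃ G ∈ T.Cn p, ∀ b, Integrable (fun t => ((Φ (b, t) : ℚ):ℝ)) (nu p) ∧
      ∫ t, ((Φ (b, t) : ℚ):ℝ) ∂(nu p) = (G b : ℝ) := by
  obtain ⟨Q', hfin, hsub, hΦ⟩ := Cn_Gen_fin h
  obtain ⟨R, hRR, hR⟩ := exists_full T R₀ h0
  have hL : ∀ κ : Q', ∃ L : Set (B → ℚ_[p]), L.Finite ∧ (∀ c ∈ L, c ∈ R) ∧ ((∃ κ0 ∈ T.V, κ.1 = fun z => κ0 z.1) ∨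
      ∃ d q, IsP R d q ∧ (∀ b i, derivative^[i] (q b) ≠ 0 → ∀ x, (derivative^[i] (q b)).eval x = 0 → ∃ c ∈ L, c b = x) ∧
      ((κ.1 = fun z => ((q z.1).eval (z.2:ℚ_[p])).valuation) ∨ ∃ N, κ.1 = fun z => acz N ((q z.1).eval (z.2:ℚ_[p])))) := by
    intro κ
    rcases hsub κ.2 with h | ⟨d, q, hq, hk⟩
    · exact ⟨∅, Set.finite_empty, by simp, Or.inl h⟩
    · obtain ⟨L, h1, h2, _, h3⟩ := (hR.rt d).all (hq.monoR hRR)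
      exact ⟨L, h1, h2, Or.inr ⟨d, q, hq.monoR hRR, h3, hk⟩⟩
  choose L hL1 hL2 hL3 using hL
  have : Finite Q' := hfin
  set LL : Set (B → ℚ_[p]) := insert 0 (⋃ κ, L κ) with hLL
  have hLLf : LL.Finite := (Set.finite_iUnion hL1).insert 0
  have hLLR : ∀ c ∈ LL, c ∈ R := by
    rintro c (rfl | hc)
    · exact R.zero_mem
    · obtain ⟨κ, hκ⟩ := Set.mem_iUnion.1 hc
      exact hL2 κ c hκ
  have : Finite LL := hLLf
  obtain ⟨n, ⟨e⟩⟩ := Finite.exists_equiv_fin LL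
  have hn : 0 < n := (e ⟨0, Set.mem_insert _ _⟩).pos
  set c : Fin n → B → ℤ_[p] := fun i b => toZp ((e.symm i).1 b) with hcdef
  have hcR : ∀ i, (fun b => ((c i b : ℤ_[p]):ℚ_[p])) ∈ R := by
    intro i
    have hm := hLLR _ (e.symm i).2
    have hS : T.S (fun b => ‖(e.symm i).1 b‖ ≤ 1) := by
      refine ((hR.meas _ hm).S_le (Meas_const (1:ℚ_[p]))).congr (fun b => by simp)
    convert hR.ite hS hm R.zero_mem using 2 with b
    rw [hcdef]; exact toZp_coe _
  have hcov : ∀ (b : B) (x : ℚ_[p]), (∃ f ∈ LL, f b = x) → ‖x‖ ≤ 1 → ∃ i, ((c i b : ℤ_[p]):ℚ_[p]) = x := by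
    rintro b x ⟨f, hf, rfl⟩ hx
    refine ⟨e ⟨f, hf⟩, ?_⟩
    rw [hcdef]; dsimp only
    rw [toZp_of_le (by simpa using hx)]
    simp
  refine IT_That hR hn hcR (Cn_mono (Gen_le ?_) hΦ) hb
  intro κ hκ
  rcases hL3 ⟨κ, hκ⟩ with ⟨κ0, h1, h2⟩ | ⟨d, q, hq, hr, hk⟩
  · have h2' : κ = fun z => κ0 z.1 := h2
    rw [h2']; exact That_fst hR c hcR h1
  · have hC : Cov c q := fun b k x h1 h2 h3 => by
      obtain ⟨f, hf, hfx⟩ := hr b k h1 x h2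
      exact hcov b x ⟨f, Or.inr (Set.mem_iUnion.2 ⟨_, hf⟩), hfx⟩ h3
    have hM := That_poly hR hn hcR hq hC
    rcases hk with h2 | ⟨N, h2⟩
    · have h2' : κ = fun z => ((q z.1).eval (z.2:ℚ_[p])).valuation := h2
      rw [h2']; exact hM.1
    · have h2' : κ = fun z => acz N ((q z.1).eval (z.2:ℚ_[p])) := h2
      rw [h2']; exact hM.2 N

end
end DC


open Filter MeasureTheory Polynomial

set_option linter.unusedVariables false
set_option linter.unusedSectionVars false

namespace DC

open PowerSeries in
/-- quotient part of the preparation theorem -/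
noncomputable def wQ {A : Type*} [CommRing A] (g : ℕ → A[X]) (G0 : A[X]) : ℕ → A[X]
  | 0 => 1
  | n+1 => -((∑ i : Fin (n+1), wQ g G0 i.1 * g (n+1-i.1)) /ₘ G0)
decreasing_by exact i.2

theorem weier {A : Type*} [CommRing A] [Nontrivial A] (g : PowerSeries A[X]) (hg : (PowerSeries.coeff 0 g).Monic) :
    ∃ Q W : PowerSeries A[X], Q * g = W ∧ PowerSeries.coeff 0 Q = 1 ∧
      ∀ n, (PowerSeries.coeff n W).natDegree ≤ (PowerSeries.coeff 0 g).natDegree := by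
  set G0 := PowerSeries.coeff 0 g with hG0
  set Q := PowerSeries.mk (wQ (fun n => PowerSeries.coeff n g) G0) with hQ
  refine ⟨Q, _, rfl, by simp [hQ, wQ], fun n => ?_⟩
  rw [PowerSeries.coeff_mul, Finset.Nat.sum_antidiagonal_eq_sum_range_succ_mk]
  rcases n with _ | n
  · simp [hQ, wQ]; rw [← PowerSeries.coeff_zero_eq_constantCoeff_apply]
  · rw [Finset.sum_range_succ]
    simp only [Nat.sub_self, hQ, PowerSeries.coeff_mk]
    rw [wQ, ← hG0]
    rw [Finset.sum_range (fun k => wQ (fun n => PowerSeries.coeff n g) G0 k * PowerSeries.coeff (n+1-k) g)]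
    set Sm := ∑ i : Fin (n+1), wQ (fun n => PowerSeries.coeff n g) G0 i.1 * PowerSeries.coeff (n+1-i.1) g
    have : Sm + -(Sm /ₘ G0) * G0 = Sm %ₘ G0 := by
      have := modByMonic_add_div Sm G0
      linear_combination -this
    rw [this]
    exact natDegree_modByMonic_le _ hg

section LemmaN
variable {σ : Type*} {R : Type*} [CommRing R]

/-- coefficient series -/
noncomputable def cf (β : σ →₀ ℕ) (F : PowerSeries (MvPolynomial σ R)) : PowerSeries R :=
  PowerSeries.mk (fun n => MvPolynomial.coeff β (PowerSeries.coeff n F))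

theorem cf_coeff (β : σ →₀ ℕ) (F : PowerSeries (MvPolynomial σ R)) (n : ℕ) :
    PowerSeries.coeff n (cf β F) = MvPolynomial.coeff β (PowerSeries.coeff n F) := by simp [cf]

theorem cf_ext {F G : PowerSeries (MvPolynomial σ R)} (h : ∀ β, cf β F = cf β G) : F = G := by
  ext n β
  rw [← cf_coeff, h, cf_coeff]

theorem cf_sum {ι : Type*} (s : Finset ι) (β : σ →₀ ℕ) (F : ι → PowerSeries (MvPolynomial σ R)) :
    cf β (∑ i ∈ s, F i) = ∑ i ∈ s, cf β (F i) := by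
  ext n; simp [cf_coeff, map_sum, MvPolynomial.coeff_sum]

theorem cf_mul (β : σ →₀ ℕ) (h : PowerSeries R) (F : PowerSeries (MvPolynomial σ R)) :
    cf β (PowerSeries.map MvPolynomial.C h * F) = h * cf β F := by
  ext n; simp [cf_coeff, PowerSeries.coeff_mul, MvPolynomial.coeff_sum, MvPolynomial.coeff_C_mul]

theorem lemmaN [IsNoetherianRing R] (F : PowerSeries (MvPolynomial σ R)) :
    ∃ (E : Finset (σ →₀ ℕ)) (h : (σ →₀ ℕ) → PowerSeries R) (e : (σ →₀ ℕ) → PowerSeries (MvPolynomial σ R)),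
      F = ∑ β ∈ E, PowerSeries.map MvPolynomial.C (h β) *
        (PowerSeries.C (MvPolynomial.monomial β 1) + PowerSeries.X * e β) := by
  classical
  set I : Ideal (PowerSeries R) := Ideal.span (Set.range (fun β => cf β F)) with hI
  obtain ⟨k, hk⟩ := Ideal.exists_pow_inf_eq_pow_smul (Ideal.span {(PowerSeries.X : PowerSeries R)}) I
  obtain ⟨E0, hE0⟩ : ∃ E0 : Finset (σ →₀ ℕ), I = Ideal.span ((fun β => cf β F) '' E0) := by
    have hfg : I.FG := IsNoetherian.noetherian I
    obtain ⟨s, hs1, hs2⟩ := Submodule.fg_span_iff_fg_span_finset_subset _ |>.1 hfg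
    rw [← Set.image_univ] at hs1
    obtain ⟨E0, -, hE⟩ := Finset.subset_set_image_iff.1 hs1
    refine ⟨E0, ?_⟩
    rw [hI, Ideal.span, hs2, ← hE, Finset.coe_image]
  set En : ℕ → Finset (σ →₀ ℕ) := fun n => (Finset.range n).biUnion (fun i => (PowerSeries.coeff i F).support) with hEn
  have hEn' : ∀ n β, β ∉ En n → ∀ i < n, PowerSeries.coeff i (cf β F) = 0 := by
    intro n β hβ i hi
    rw [cf_coeff]
    by_contra h0
    exact hβ (Finset.mem_biUnion.2 ⟨i, by simpa using hi, by simpa using h0⟩)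
  set E := E0 ∪ En (k+1) with hE
  have hc : ∀ β, ∃ c : (σ →₀ ℕ) → PowerSeries R, (β ∈ E → c = 0) ∧
      (β ∉ E → cf β F = ∑ γ ∈ E, c γ * cf γ F) ∧ (∀ γ, PowerSeries.coeff 0 (c γ) = 0) ∧
      ∀ n γ, β ∉ En (n + k + 2) → PowerSeries.coeff (n+1) (c γ) = 0 := by
    intro β
    by_cases hβ : β ∈ E
    · exact ⟨0, fun _ => rfl, fun h => absurd hβ h, by simp, by simp⟩
    by_cases h0 : cf β F = 0
    · exact ⟨0, fun _ => rfl, fun h => by simp [h0], by simp, by simp⟩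
    have hex : ∃ n, PowerSeries.coeff n (cf β F) ≠ 0 := by
      by_contra hcon; push Not at hcon
      exact h0 (by ext n; simpa using hcon n)
    set n0 := Nat.find hex with hn0
    have hn1 : PowerSeries.coeff n0 (cf β F) ≠ 0 := Nat.find_spec hex
    have hn2 : ∀ i < n0, PowerSeries.coeff i (cf β F) = 0 := fun i hi => by
      have := Nat.find_min hex hi; push Not at this; exact this
    have hn3 : k + 1 ≤ n0 := by
      by_contra hlt
      exact hn1 (hEn' (k+1) β (fun h' => hβ (Finset.mem_union_right _ h')) n0 (by omega))
    have hmem : cf β F ∈ (Ideal.span {(PowerSeries.X : PowerSeries R)})^n0 • (⊤ : Submodule (PowerSeries R) (PowerSeries R)) ⊓ I := by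
      refine ⟨?_, Ideal.subset_span ⟨β, rfl⟩⟩
      rw [Ideal.smul_eq_mul, Ideal.mul_top, Ideal.span_singleton_pow]
      exact Ideal.mem_span_singleton.2 (PowerSeries.X_pow_dvd_iff.2 hn2)
    rw [hk n0 (by omega)] at hmem
    have hmem2 : cf β F ∈ (Ideal.span {(PowerSeries.X : PowerSeries R)})^(n0-k) * I := by
      refine Ideal.mul_mono_right ?_ hmem
      exact inf_le_right
    rw [Ideal.span_singleton_pow] at hmem2
    obtain ⟨y, hy, hy2⟩ := Ideal.mem_span_singleton_mul.1 hmem2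
    rw [hE0] at hy
    obtain ⟨a, ha⟩ := (Submodule.mem_span_image_finset_iff_exists_fun (PowerSeries R)).1 hy
    refine ⟨fun γ => if h : γ ∈ E0 then PowerSeries.X^(n0-k) * a ⟨γ, h⟩ else 0, fun h => absurd h hβ, fun _ => ?_, fun γ => ?_, fun n γ hn => ?_⟩
    · rw [← hy2, ← ha, Finset.mul_sum]
      rw [← Finset.sum_subset (Finset.subset_union_left (s₁ := E0) (s₂ := En (k+1)))]
      · rw [← Finset.sum_coe_sort E0]
        refine Finset.sum_congr rfl (fun γ hγ => ?_)
        simp [mul_assoc]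
      · intro x _ hx; simp [hx]
    · dsimp only; split_ifs
      · rw [PowerSeries.coeff_X_pow_mul', if_neg (by omega)]
      · simp
    · dsimp only; split_ifs
      · rw [PowerSeries.coeff_X_pow_mul', if_neg]
        have : ¬ n0 < n + k + 2 := fun h => hn1 (hEn' _ β hn n0 h)
        omega
      · simp
  choose c hc1 hc2 hc3 hc4 using hc
  refine ⟨E, fun γ => cf γ F, fun γ => PowerSeries.mk (fun n => ∑ β ∈ En (n+k+2), MvPolynomial.monomial β
    (PowerSeries.coeff (n+1) (c β γ))), cf_ext (fun β => ?_)⟩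
  rw [cf_sum]
  have key : ∀ γ, cf β (PowerSeries.map MvPolynomial.C (cf γ F) * (PowerSeries.C (MvPolynomial.monomial γ 1) +
      PowerSeries.X * PowerSeries.mk (fun n => ∑ β ∈ En (n+k+2), MvPolynomial.monomial β
    (PowerSeries.coeff (n+1) (c β γ))))) = cf γ F * ((if β = γ then 1 else 0) + c β γ) := by
    intro γ
    rw [cf_mul]
    congr 1
    ext n
    rw [cf_coeff]
    rcases n with _ | n
    · simp only [map_add, PowerSeries.coeff_zero_X_mul, hc3]
      simp [MvPolynomial.coeff_monomial, eq_comm]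
    · simp only [map_add, PowerSeries.coeff_succ_X_mul, PowerSeries.coeff_mk, MvPolynomial.coeff_add,
        MvPolynomial.coeff_sum, MvPolynomial.coeff_monomial]
      have e1 : PowerSeries.coeff (n+1) (if β = γ then (1 : PowerSeries R) else 0) = 0 := by
        split_ifs <;> simp [PowerSeries.coeff_one]
      rw [e1, PowerSeries.coeff_C]
      simp
      exact fun h => (hc4 β n γ h).symm
  rw [Finset.sum_congr rfl (fun γ _ => key γ)]
  by_cases hβ : β ∈ E
  · rw [hc1 β hβ]
    simp [hβ]
  · rw [hc2 β hβ]
    refine Finset.sum_congr rfl (fun γ hγ => ?_)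
    have hne : β ≠ γ := fun h => hβ (by rw [h]; exact hγ)
    rw [if_neg hne]; ring

end LemmaN

section EvP
variable {p : ℕ} [hp : Fact p.Prime]

theorem evP_norm (F : PowerSeries ℤ_[p]) (n : ℕ) : ‖PowerSeries.coeff n F * (p:ℤ_[p])^n‖ ≤ ((p:ℝ)⁻¹)^n := by
  rw [norm_mul, norm_pow, PadicInt.norm_p]
  exact mul_le_of_le_one_left (by positivity) (PadicInt.norm_le_one _)

theorem evP_summable (F : PowerSeries ℤ_[p]) : Summable (fun n => ‖PowerSeries.coeff n F * (p:ℤ_[p])^n‖) :=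
  Summable.of_nonneg_of_le (fun _ => norm_nonneg _) (evP_norm F)
    (summable_geometric_of_lt_one (by positivity) (inv_lt_one_of_one_lt₀ (by exact_mod_cast hp.out.one_lt)))

/-- evaluation of power series at `p` -/
noncomputable def evP (p : ℕ) [hp : Fact p.Prime] : PowerSeries ℤ_[p] →+* ℤ_[p] where
  toFun F := ∑' n, PowerSeries.coeff n F * (p:ℤ_[p])^n
  map_zero' := by simp
  map_one' := by
    rw [tsum_eq_single 0]
    · simp
    · intro n hn; simp [PowerSeries.coeff_one, hn]
  map_add' F G := by
    rw [← Summable.tsum_add (evP_summable F).of_norm (evP_summable G).of_norm]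
    congr 1; ext n; simp [add_mul]
  map_mul' F G := by
    rw [tsum_mul_tsum_eq_tsum_sum_antidiagonal_of_summable_norm (evP_summable F) (evP_summable G)]
    refine tsum_congr (fun n => ?_)
    rw [PowerSeries.coeff_mul, Finset.sum_mul]
    refine Finset.sum_congr rfl (fun x hx => ?_)
    rw [← Finset.HasAntidiagonal.mem_antidiagonal.1 hx, pow_add]; ring

theorem evP_apply (F : PowerSeries ℤ_[p]) : evP p F = ∑' n, PowerSeries.coeff n F * (p:ℤ_[p])^n := rfl

@[simp] theorem evP_X : evP p PowerSeries.X = (p : ℤ_[p]) := by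
  rw [evP_apply, tsum_eq_single 1]
  · simp
  · intro n hn; simp [PowerSeries.coeff_X, hn]

@[simp] theorem evP_C (a : ℤ_[p]) : evP p (PowerSeries.C a) = a := by
  rw [evP_apply, tsum_eq_single 0]
  · simp
  · intro n hn; simp [PowerSeries.coeff_C, hn]

theorem evP_trunc (F : PowerSeries ℤ_[p]) (M : ℕ) :
    ‖evP p F - ∑ n ∈ Finset.range M, PowerSeries.coeff n F * (p:ℤ_[p])^n‖ ≤ ((p:ℝ)⁻¹)^M := by
  rw [evP_apply, ← Summable.sum_add_tsum_nat_add M (evP_summable F).of_norm, add_sub_cancel_left]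
  have : ∑' n, PowerSeries.coeff (n+M) F * (p:ℤ_[p])^(n+M) = (p:ℤ_[p])^M * ∑' n, PowerSeries.coeff (n+M) F * (p:ℤ_[p])^n := by
    have hs : Summable (fun n => PowerSeries.coeff (n+M) F * (p:ℤ_[p])^n) := by
      have := (evP_summable (PowerSeries.mk (fun n => PowerSeries.coeff (n+M) F))).of_norm
      simpa using this
    rw [← hs.tsum_mul_left]
    refine tsum_congr (fun n => ?_)
    rw [pow_add]; ring
  rw [this, norm_mul, norm_pow, PadicInt.norm_p]
  exact mul_le_of_le_one_right (by positivity) (PadicInt.norm_le_one _)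

end EvP
end DC


open Filter MeasureTheory Polynomial

set_option linter.unusedVariables false
set_option linter.unusedSectionVars false

namespace DC
open Tame

variable {p : ℕ} [hp : Fact p.Prime] {Λ : Type*}

/-- Closure properties of the coefficient functions. -/
structure BaseRing (T0 : Tame Λ) (D : Subalgebra ℤ_[p] (Λ → ℤ_[p])) : Prop where
  meas : ∀ f ∈ D, T0.Meas (fun l => ((f l : ℤ_[p]) : ℚ_[p]))
  conv : ∀ (ι : Type) [Finite ι] (u : ι → Λ → ℤ_[p]), (∀ i, u i ∈ D) →
    ∀ F : PowerSeries (MvPolynomial ι ℤ_[p]),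
      (fun l => evP p (PowerSeries.map (MvPolynomial.eval (fun i => u i l)) F)) ∈ D
  quot : ∀ f ∈ D, ∀ g ∈ D, (fun l => toZp (((f l : ℤ_[p]) : ℚ_[p]) / ((g l : ℤ_[p]) : ℚ_[p]))) ∈ D

/-- evaluation hom -/
noncomputable def evm {ι : Type} {m : ℕ} (u : ι → ℤ_[p]) (x : Fin m → ℤ_[p]) :
    MvPolynomial (Fin m) (MvPolynomial ι ℤ_[p]) →+* ℤ_[p] :=
  MvPolynomial.eval₂Hom (MvPolynomial.eval u) x

/-- analytic functions with coefficients in `D` -/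
def AF (D : Subalgebra ℤ_[p] (Λ → ℤ_[p])) (m : ℕ) (f : Λ × (Fin m → ℤ_[p]) → ℤ_[p]) : Prop :=
  ∃ (ι : Type) (_ : Finite ι) (u : ι → Λ → ℤ_[p]) (F : PowerSeries (MvPolynomial (Fin m) (MvPolynomial ι ℤ_[p]))),
    (∀ i, u i ∈ D) ∧ ∀ z, f z = evP p (PowerSeries.map (evm (fun i => u i z.1) z.2) F)

theorem map_map_apply {A B C : Type*} [Semiring A] [Semiring B] [Semiring C] (f : A →+* B) (g : B →+* C) (F : PowerSeries A) :
    PowerSeries.map g (PowerSeries.map f F) = PowerSeries.map (g.comp f) F := by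
  ext n; simp

theorem evm_rename {ι ι' : Type} {m : ℕ} (j : ι → ι') (u : ι' → ℤ_[p]) (x : Fin m → ℤ_[p]) :
    (evm u x).comp (MvPolynomial.map (MvPolynomial.rename j : MvPolynomial ι ℤ_[p] →ₐ[ℤ_[p]] MvPolynomial ι' ℤ_[p]).toRingHom)
      = evm (fun i => u (j i)) x := by
  apply MvPolynomial.ringHom_ext
  · intro r
    simp [evm, MvPolynomial.eval_rename]
    rfl
  · intro i
    simp [evm]

variable {D : Subalgebra ℤ_[p] (Λ → ℤ_[p])} {m : ℕ}

theorem AF.pair {f g : Λ × (Fin m → ℤ_[p]) → ℤ_[p]} (hf : AF D m f) (hg : AF D m g) :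
    ∃ (ι : Type) (_ : Finite ι) (u : ι → Λ → ℤ_[p]) (F G : PowerSeries (MvPolynomial (Fin m) (MvPolynomial ι ℤ_[p]))),
    (∀ i, u i ∈ D) ∧ (∀ z, f z = evP p (PowerSeries.map (evm (fun i => u i z.1) z.2) F)) ∧
     ∀ z, g z = evP p (PowerSeries.map (evm (fun i => u i z.1) z.2) G) := by
  obtain ⟨ι, _, u, F, hu, hF⟩ := hf
  obtain ⟨ι', _, u', F', hu', hF'⟩ := hg
  refine ⟨ι ⊕ ι', inferInstance, Sum.elim u u', PowerSeries.map (MvPolynomial.map (MvPolynomial.rename Sum.inl).toRingHom) F,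
    PowerSeries.map (MvPolynomial.map (MvPolynomial.rename Sum.inr).toRingHom) F', ?_, fun z => ?_, fun z => ?_⟩
  · rintro (i | i)
    · exact hu i
    · exact hu' i
  · rw [map_map_apply, evm_rename, hF]; simp
  · rw [map_map_apply, evm_rename, hF']; simp

theorem AF.add {f g : Λ × (Fin m → ℤ_[p]) → ℤ_[p]} (hf : AF D m f) (hg : AF D m g) : AF D m (fun z => f z + g z) := by
  obtain ⟨ι, _, u, F, G, hu, h1, h2⟩ := hf.pair hg
  exact ⟨ι, inferInstance, u, F + G, hu, fun z => by dsimp only; rw [h1, h2]; simp⟩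

theorem AF.mul {f g : Λ × (Fin m → ℤ_[p]) → ℤ_[p]} (hf : AF D m f) (hg : AF D m g) : AF D m (fun z => f z * g z) := by
  obtain ⟨ι, _, u, F, G, hu, h1, h2⟩ := hf.pair hg
  exact ⟨ι, inferInstance, u, F * G, hu, fun z => by dsimp only; rw [h1, h2]; simp⟩

theorem AF.neg {f : Λ × (Fin m → ℤ_[p]) → ℤ_[p]} (hf : AF D m f) : AF D m (fun z => - f z) := by
  obtain ⟨ι, _, u, F, hu, h1⟩ := hf
  exact ⟨ι, inferInstance, u, -F, hu, fun z => by dsimp only; rw [h1]; simp⟩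

theorem AF_const (c : ℤ_[p]) : AF D m (fun _ => c) :=
  ⟨Empty, inferInstance, fun i => i.elim, PowerSeries.C (MvPolynomial.C (MvPolynomial.C c)), fun i => i.elim, fun z => by
    simp [evm]⟩

theorem AF_fst {h : Λ → ℤ_[p]} (hh : h ∈ D) : AF D m (fun z => h z.1) :=
  ⟨Unit, inferInstance, fun i => h, PowerSeries.C (MvPolynomial.C (MvPolynomial.X ())), fun i => hh, fun z => by
    simp [evm]⟩

theorem AF_coord (i : Fin m) : AF D m (fun z => z.2 i) :=
  ⟨Empty, inferInstance, fun i => i.elim, PowerSeries.C (MvPolynomial.X i), fun i => i.elim, fun z => by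
    simp [evm]⟩

/-- ring of analytic functions -/
def AFR (D : Subalgebra ℤ_[p] (Λ → ℤ_[p])) (m : ℕ) : Subring (Λ × (Fin m → ℤ_[p]) → ℚ_[p]) where
  carrier := {g | ∃ f, AF D m f ∧ ∀ z, g z = ((f z : ℤ_[p]) : ℚ_[p])}
  zero_mem' := ⟨_, AF_const 0, fun z => by simp⟩
  one_mem' := ⟨_, AF_const 1, fun z => by simp⟩
  add_mem' := by
    rintro a b ⟨f, hf, h1⟩ ⟨g, hg, h2⟩
    exact ⟨_, hf.add hg, fun z => by simp [h1, h2]⟩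
  mul_mem' := by
    rintro a b ⟨f, hf, h1⟩ ⟨g, hg, h2⟩
    exact ⟨_, hf.mul hg, fun z => by simp [h1, h2]⟩
  neg_mem' := by
    rintro a ⟨f, hf, h1⟩
    exact ⟨_, hf.neg, fun z => by simp [h1]⟩

/-- generators of the tame structure -/
def AFQ (T0 : Tame Λ) (D : Subalgebra ℤ_[p] (Λ → ℤ_[p])) (m : ℕ) : Set (Λ × (Fin m → ℤ_[p]) → ℤ) :=
  {κ | (∃ κ0 ∈ T0.V, κ = fun z => κ0 z.1) ∨ ∃ f, AF D m f ∧
    ((κ = fun z => ((f z : ℤ_[p]) : ℚ_[p]).valuation) ∨ ∃ N, κ = fun z => acz N ((f z : ℤ_[p]) : ℚ_[p]))}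

def AFT (T0 : Tame Λ) (D : Subalgebra ℤ_[p] (Λ → ℤ_[p])) (m : ℕ) : Tame (Λ × (Fin m → ℤ_[p])) := Gen (AFQ T0 D m)

theorem AFT_fst {T0 : Tame Λ} {κ : Λ → ℤ} (h : κ ∈ T0.V) : (fun z => κ z.1) ∈ (AFT T0 D m).V :=
  subset_Gen _ (Or.inl ⟨κ, h, rfl⟩)

theorem AFT_meas {T0 : Tame Λ} {f : Λ × (Fin m → ℤ_[p]) → ℤ_[p]} (hf : AF D m f) :
    (AFT T0 D m).Meas (fun z => ((f z : ℤ_[p]) : ℚ_[p])) :=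
  ⟨subset_Gen _ (Or.inr ⟨f, hf, Or.inl rfl⟩), fun N => subset_Gen _ (Or.inr ⟨f, hf, Or.inr ⟨N, rfl⟩⟩)⟩

theorem AFR_meas {T0 : Tame Λ} {g : Λ × (Fin m → ℤ_[p]) → ℚ_[p]} (hg : g ∈ AFR D m) : (AFT T0 D m).Meas g := by
  obtain ⟨f, hf, h⟩ := hg
  exact (AFT_meas hf).congr h

end DC


open Filter MeasureTheory Polynomial

set_option linter.unusedVariables false
set_option linter.unusedSectionVars false

namespace DC
open Tame

variable {p : ℕ} [hp : Fact p.Prime] {Λ : Type*} {D : Subalgebra ℤ_[p] (Λ → ℤ_[p])} {m : ℕ} {T0 : Tame Λ}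

/-- evaluation with one distinguished variable -/
noncomputable def evt {ι : Type} {m : ℕ} (u : ι → ℤ_[p]) (x : Fin m → ℤ_[p]) (t : ℤ_[p]) :
    (MvPolynomial (Fin m) (MvPolynomial ι ℤ_[p]))[X] →+* ℤ_[p] :=
  Polynomial.eval₂RingHom (evm u x) t

theorem PS_meas {ι : Type} [Finite ι] {u : ι → Λ → ℤ_[p]} (hu : ∀ i, u i ∈ D)
    (W : PowerSeries (MvPolynomial (Fin m) (MvPolynomial ι ℤ_[p]))[X]) {d : ℕ}
    (hW : ∀ n, (PowerSeries.coeff n W).natDegree ≤ d) :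
    (PolyT (AFT T0 D m) (AFR D m)).Meas (fun z =>
      ((evP p (PowerSeries.map (evt (fun i => u i z.1.1) z.1.2 z.2) W) : ℤ_[p]) : ℚ_[p])) := by
  set Wj : ℕ → PowerSeries (MvPolynomial (Fin m) (MvPolynomial ι ℤ_[p])) := fun j =>
    PowerSeries.mk (fun n => (PowerSeries.coeff n W).coeff j) with hWj
  have e1 : W = ∑ j ∈ Finset.range (d+1), PowerSeries.map (Polynomial.C) (Wj j) * PowerSeries.C (X^j) := by
    ext1 n
    rw [map_sum]
    simp only [PowerSeries.coeff_mul_C, PowerSeries.coeff_map, hWj, PowerSeries.coeff_mk]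
    exact as_sum_range_C_mul_X_pow' _ (Nat.lt_succ_of_le (hW n))
  set w : ℕ → Λ × (Fin m → ℤ_[p]) → ℤ_[p] := fun j z => evP p (PowerSeries.map (evm (fun i => u i z.1) z.2) (Wj j)) with hw
  have hwA : ∀ j, AF D m (w j) := fun j => ⟨ι, inferInstance, u, Wj j, hu, fun z => rfl⟩
  have e2 : ∀ z : (Λ × (Fin m → ℤ_[p])) × ℤ_[p], evP p (PowerSeries.map (evt (fun i => u i z.1.1) z.1.2 z.2) W) =
      ∑ j ∈ Finset.range (d+1), w j z.1 * z.2^j := by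
    intro z
    conv_lhs => rw [e1]
    rw [map_sum, map_sum]
    refine Finset.sum_congr rfl (fun j hj => ?_)
    rw [map_mul, map_mul, map_map_apply, PowerSeries.map_C, evP_C]
    congr 2
    · congr 1
      congr 1
      exact RingHom.ext (fun r => by simp [evt])
    · simp [evt]
  have hP : IsP (AFR D m) d (fun z => ∑ j ∈ Finset.range (d+1), C ((w j z : ℤ_[p]) : ℚ_[p]) * X^j) := by
    refine ⟨fun i => ?_, fun z => ?_⟩
    · simp only [finsetSum_coeff, coeff_C_mul, coeff_X_pow]
      by_cases hi : i ∈ Finset.range (d+1)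
      · refine ⟨w i, hwA i, fun z => ?_⟩
        simp only [mul_ite, mul_one, mul_zero, Finset.sum_ite_eq, if_pos hi]
      · refine ⟨_, AF_const 0, fun z => ?_⟩
        simp only [mul_ite, mul_one, mul_zero, Finset.sum_ite_eq, if_neg hi]; simp
    · refine natDegree_sum_le_of_forall_le _ _ (fun j hj => ?_)
      refine (natDegree_C_mul_X_pow_le _ _).trans ?_
      have := Finset.mem_range.1 hj; omega
  refine (PolyT_meas hP).congr (fun z => ?_)
  rw [e2, eval_finsetSum]
  push_cast
  simp

theorem PS_meas_unit {ι : Type} [Finite ι] {u : ι → Λ → ℤ_[p]} (hu : ∀ i, u i ∈ D)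
    (Q : PowerSeries (MvPolynomial (Fin m) (MvPolynomial ι ℤ_[p]))[X]) (hQ : PowerSeries.coeff 0 Q = 1) :
    (PolyT (AFT T0 D m) (AFR D m)).Meas (fun z =>
      ((evP p (PowerSeries.map (evt (fun i => u i z.1.1) z.1.2 z.2) Q) : ℤ_[p]) : ℚ_[p])) ∧
    ∀ z : (Λ × (Fin m → ℤ_[p])) × ℤ_[p], evP p (PowerSeries.map (evt (fun i => u i z.1.1) z.1.2 z.2) Q) ≠ 0 := by
  have hne : ∀ F : PowerSeries ℤ_[p], PowerSeries.coeff 0 F = 1 → ‖evP p F‖ = 1 := by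
    intro F hF
    have h1 := evP_trunc F 1
    simp only [Finset.range_one, Finset.sum_singleton, hF, pow_zero, mul_one, pow_one] at h1
    have h2 : ‖evP p F - 1‖ < 1 := lt_of_le_of_lt h1 (inv_lt_one_of_one_lt₀ (by exact_mod_cast hp.out.one_lt))
    by_contra h3
    have h4 : ‖evP p F‖ < 1 := lt_of_le_of_ne (PadicInt.norm_le_one _) h3
    have h5 : ‖(1:ℤ_[p])‖ < 1 := by
      have : (1:ℤ_[p]) = evP p F + -(evP p F - 1) := by ring
      rw [this]
      refine lt_of_le_of_lt (PadicInt.nonarchimedean _ _) (max_lt h4 (by rw [norm_neg]; exact h2))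
    simp at h5
  refine ⟨?_, fun z h0 => ?_⟩
  · refine Meas_of_apx (fun N hN => ?_)
    set QN : PowerSeries (MvPolynomial (Fin m) (MvPolynomial ι ℤ_[p]))[X] :=
      PowerSeries.mk (fun n => if n < N then PowerSeries.coeff n Q else 0) with hQN
    refine ⟨1, fun _ _ => True, fun _ z => ((evP p (PowerSeries.map (evt (fun i => u i z.1.1) z.1.2 z.2) QN) : ℤ_[p]) : ℚ_[p]),
      fun _ => S_const True, fun _ => ?_, fun b => ⟨0, trivial⟩, fun _ z _ => ?_⟩
    · refine PS_meas hu QN (d := (Finset.range N).sup (fun n => (PowerSeries.coeff n Q).natDegree)) (fun n => ?_)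
      simp only [hQN, PowerSeries.coeff_mk]
      split_ifs with h
      · exact Finset.le_sup (f := fun n => (PowerSeries.coeff n Q).natDegree) (Finset.mem_range.2 h)
      · simp
    · have h1 := evP_trunc (PowerSeries.map (evt (fun i => u i z.1.1) z.1.2 z.2) Q) N
      have h2 := evP_trunc (PowerSeries.map (evt (fun i => u i z.1.1) z.1.2 z.2) QN) N
      have h3 : ∑ n ∈ Finset.range N, PowerSeries.coeff n (PowerSeries.map (evt (fun i => u i z.1.1) z.1.2 z.2) QN) * (p:ℤ_[p])^n
        = ∑ n ∈ Finset.range N, PowerSeries.coeff n (PowerSeries.map (evt (fun i => u i z.1.1) z.1.2 z.2) Q) * (p:ℤ_[p])^n := by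
        refine Finset.sum_congr rfl (fun n hn => ?_)
        rw [PowerSeries.coeff_map, PowerSeries.coeff_map, hQN, PowerSeries.coeff_mk, if_pos (Finset.mem_range.1 hn)]
      rw [h3] at h2
      have h4 : ‖evP p (PowerSeries.map (evt (fun i => u i z.1.1) z.1.2 z.2) QN)‖ = 1 := by
        apply hne
        rw [PowerSeries.coeff_map, hQN, PowerSeries.coeff_mk, if_pos (by omega), hQ, map_one]
      unfold Apx
      rw [PadicInt.norm_def] at h4
      rw [h4, mul_one, ← PadicInt.coe_sub, ← PadicInt.norm_def]
      rw [norm_sub_rev] at h2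
      have h5 := (PadicInt.nonarchimedean _ _).trans (max_le h1 h2)
      rw [sub_add_sub_cancel] at h5
      refine h5.trans (le_of_eq ?_)
      simp
  · have := hne (PowerSeries.map (evt (fun i => u i z.1.1) z.1.2 z.2) Q) (by rw [PowerSeries.coeff_map, hQ, map_one])
    rw [h0] at this
    simp at this

end DC


open Filter MeasureTheory Polynomial

set_option linter.unusedVariables false
set_option linter.unusedSectionVars false

namespace DC
open Tame

variable {p : ℕ} [hp : Fact p.Prime] {Λ : Type*} {D : Subalgebra ℤ_[p] (Λ → ℤ_[p])} {m : ℕ} {T0 : Tame Λ}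

/-- the substitution -/
noncomputable def tau {ι ι' : Type} (p : ℕ) [hp : Fact p.Prime] (m : ℕ) (j : ι → ι') (b : ℕ) :
    MvPolynomial (Fin (m+1)) (MvPolynomial ι ℤ_[p]) →+* (MvPolynomial (Fin m) (MvPolynomial ι' ℤ_[p]))[X] :=
  MvPolynomial.eval₂Hom (Polynomial.C.comp (MvPolynomial.C.comp (MvPolynomial.rename j : MvPolynomial ι ℤ_[p] →ₐ[ℤ_[p]] MvPolynomial ι' ℤ_[p]).toRingHom))
    (Fin.cons X (fun i : Fin m => X^(b^((i:ℕ)+1)) + C (MvPolynomial.X i)))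

theorem evt_tau {ι ι' : Type} (j : ι → ι') (b : ℕ) (u : ι' → ℤ_[p]) (x : Fin m → ℤ_[p]) (t : ℤ_[p]) :
    (evt u x t).comp (tau p m j b) = evm (fun i => u (j i)) (Fin.cons t (fun i => x i + t^(b^((i:ℕ)+1)))) := by
  apply MvPolynomial.ringHom_ext
  · intro r
    simp [evm, evt, tau, MvPolynomial.eval_rename]
    rfl
  · intro i
    refine Fin.cases ?_ (fun i => ?_) i
    · simp [evm, evt, tau]
    · simp [evm, evt, tau, add_comm]

theorem evt_tau_apply {ι ι' : Type} (j : ι → ι') (b : ℕ) (u : ι' → ℤ_[p]) (x : Fin m → ℤ_[p]) (t : ℤ_[p]) (P) :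
    evt u x t (tau p m j b P) = evm (fun i => u (j i)) (Fin.cons t (fun i => x i + t^(b^((i:ℕ)+1)))) P := by
  rw [← evt_tau]; rfl

theorem toZp_quot {x y : ℤ_[p]} (hy : ((y : ℤ_[p]) : ℚ_[p]) ≠ 0) (h : ‖((x : ℤ_[p]) : ℚ_[p])‖ ≤ ‖((y : ℤ_[p]) : ℚ_[p])‖) :
    x = y * toZp (((x : ℤ_[p]) : ℚ_[p]) / ((y : ℤ_[p]) : ℚ_[p])) := by
  apply PadicInt.ext
  rw [PadicInt.coe_mul, toZp_of_le]
  · field_simp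
  · rw [norm_div]; exact div_le_one_of_le₀ h (norm_nonneg _)

theorem toZp_quot_lt {x y : ℤ_[p]} (hy : ((y : ℤ_[p]) : ℚ_[p]) ≠ 0) (h : ‖((x : ℤ_[p]) : ℚ_[p])‖ < ‖((y : ℤ_[p]) : ℚ_[p])‖) :
    x = y * (p * toZp (((x : ℤ_[p]) : ℚ_[p]) / (((p : ℤ_[p]) * y : ℤ_[p]) : ℚ_[p]))) := by
  have h1 := toZp_quot hy h.le
  set c := toZp (((x : ℤ_[p]) : ℚ_[p]) / ((y : ℤ_[p]) : ℚ_[p])) with hc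
  have h2 : ‖c‖ < 1 := by
    rw [PadicInt.norm_def, hc, toZp_of_le, norm_div]
    · exact (div_lt_one (norm_pos_iff.2 hy)).2 h
    · rw [norm_div]; exact div_le_one_of_le₀ h.le (norm_nonneg _)
  obtain ⟨d, hd⟩ := PadicInt.norm_lt_one_iff_dvd c |>.1 h2
  have hpy : (((p : ℤ_[p]) * y : ℤ_[p]) : ℚ_[p]) ≠ 0 := by
    rw [PadicInt.coe_mul]; exact mul_ne_zero (by simpa using hp.out.ne_zero) hy
  have h3 := toZp_quot (x := x) hpy (by
    rw [h1, hd]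
    have : y * (p * d) = (p * y) * d := by ring
    rw [this, PadicInt.coe_mul ((p : ℤ_[p]) * y), norm_mul]
    exact mul_le_of_le_one_right (norm_nonneg _) (PadicInt.norm_le_one d))
  conv_lhs => rw [h3]
  ring

theorem tau_monic {ι ι' : Type} (j : ι → ι') {b : ℕ} (hb : 1 ≤ b) (β : Fin (m+1) →₀ ℕ) :
    (tau p m j b (MvPolynomial.monomial β 1)).Monic ∧
    (tau p m j b (MvPolynomial.monomial β 1)).natDegree = ∑ i, β i * b^(i:ℕ) := by
  have h1 : ∀ i : Fin (m+1), ((Fin.cons X (fun i : Fin m => X^(b^((i:ℕ)+1)) + C (MvPolynomial.X i)) : Fin (m+1) →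
      (MvPolynomial (Fin m) (MvPolynomial ι' ℤ_[p]))[X]) i).Monic ∧ ((Fin.cons X (fun i : Fin m => X^(b^((i:ℕ)+1)) + C (MvPolynomial.X i)) : Fin (m+1) →
      (MvPolynomial (Fin m) (MvPolynomial ι' ℤ_[p]))[X]) i).natDegree = b^(i:ℕ) := by
    intro i
    refine Fin.cases ?_ (fun i => ?_) i
    · simp [monic_X]
    · refine ⟨?_, ?_⟩
      · exact monic_X_pow_add_C _ (by positivity)
      · exact natDegree_X_pow_add_C
  have h2 : tau p m j b (MvPolynomial.monomial β 1) = ∏ i, ((Fin.cons X (fun i : Fin m => X^(b^((i:ℕ)+1)) + C (MvPolynomial.X i)) : Fin (m+1) →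
      (MvPolynomial (Fin m) (MvPolynomial ι' ℤ_[p]))[X]) i)^(β i) := by
    simp only [tau, MvPolynomial.coe_eval₂Hom, MvPolynomial.eval₂_monomial, map_one, one_mul]
    rw [Finsupp.prod_fintype _ _ (by simp)]
  rw [h2]
  refine ⟨monic_prod_of_monic _ _ (fun i _ => (h1 i).1.pow _), ?_⟩
  rw [natDegree_prod_of_monic _ _ (fun i _ => (h1 i).1.pow _)]
  refine Finset.sum_congr rfl (fun i _ => ?_)
  rw [(h1 i).1.natDegree_pow, (h1 i).2]

theorem AF_subst (hB : BaseRing T0 D) {f : Λ × (Fin (m+1) → ℤ_[p]) → ℤ_[p]} (hf : AF D (m+1) f) :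
    ∃ E : Finset (Fin (m+1) →₀ ℕ), ∀ b : ℕ, 1 ≤ b → Set.InjOn (fun β : Fin (m+1) →₀ ℕ => ∑ i, β i * b^(i:ℕ)) E →
      (PolyT (AFT T0 D m) (AFR D m)).Meas (fun z =>
        ((f (z.1.1, Fin.cons z.2 (fun i => z.1.2 i + z.2^(b^((i:ℕ)+1)))) : ℤ_[p]) : ℚ_[p])) := by
  classical
  obtain ⟨ι, _, u, F, hu, hF⟩ := hf
  obtain ⟨E, h, e, hFE⟩ := lemmaN F
  refine ⟨E, fun b hb hinj => ?_⟩
  set w : (Fin (m+1) →₀ ℕ) → ℕ := fun β => ∑ i, β i * b^(i:ℕ) with hw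
  set H : (Fin (m+1) →₀ ℕ) → Λ → ℤ_[p] := fun β l =>
    evP p (PowerSeries.map (MvPolynomial.eval (fun i => u i l)) (h β)) with hH
  have hHD : ∀ β, H β ∈ D := fun β => hB.conv ι u hu (h β)
  have hHm : ∀ β, T0.Meas (fun l => ((H β l : ℤ_[p]) : ℚ_[p])) := fun β => hB.meas _ (hHD β)
  have hHm2 : ∀ β, (PolyT (AFT T0 D m) (AFR D m)).Meas (fun z => ((H β z.1.1 : ℤ_[p]) : ℚ_[p])) := fun β =>
    ⟨PolyT_fst (AFT_fst (hHm β).1), fun N => PolyT_fst (AFT_fst ((hHm β).2 N))⟩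
  have hfe : ∀ l x, f (l, x) = ∑ β : E, H β l * (evm (fun i => u i l) x (MvPolynomial.monomial β.1 1) +
      p * evP p (PowerSeries.map (evm (fun i => u i l) x) (e β))) := by
    intro l x
    rw [hF]
    conv_lhs => rw [hFE]
    rw [map_sum, map_sum, ← Finset.sum_coe_sort E]
    refine Finset.sum_congr rfl (fun β _ => ?_)
    rw [map_mul, map_mul, map_add, map_add, map_mul, map_mul, PowerSeries.map_C, evP_C, PowerSeries.map_X, evP_X,
      map_map_apply]
    congr 3
    congr 1
    exact RingHom.ext (fun r => by simp [evm])
  refine Meas_glue (ι := Option E) (X := fun o z => match o with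
    | none => ∀ β : E, ((H β z.1.1 : ℤ_[p]) : ℚ_[p]) = 0
    | some β' => (¬ ((H β' z.1.1 : ℤ_[p]) : ℚ_[p]) = 0) ∧ ∀ β : E, ‖((H β z.1.1 : ℤ_[p]) : ℚ_[p])‖ ≤ ‖((H β' z.1.1 : ℤ_[p]) : ℚ_[p])‖ ∧
        (w β' < w β → ‖((H β z.1.1 : ℤ_[p]) : ℚ_[p])‖ < ‖((H β' z.1.1 : ℤ_[p]) : ℚ_[p])‖)) ?_ ?_ ?_
  · rintro (_ | β')
    · exact S_forall (fun β => (hHm2 β).S_zero)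
    · exact (hHm2 β').S_zero.not.and (S_forall (fun β => ((hHm2 β).S_le (hHm2 β')).and
        ((S_const _).imp ((hHm2 β).S_lt (hHm2 β')))))
  · intro z
    by_cases hz : ∀ β : E, ((H β z.1.1 : ℤ_[p]) : ℚ_[p]) = 0
    · exact ⟨none, hz⟩
    · push Not at hz
      obtain ⟨β0, hβ0⟩ := hz
      obtain ⟨β1, hβ1, hm1⟩ := Finset.exists_max_image E (fun β => ‖((H β z.1.1 : ℤ_[p]) : ℚ_[p])‖) ⟨β0, β0.2⟩
      obtain ⟨β2, hβ2, hm2⟩ := Finset.exists_max_image (E.filter (fun β => ‖((H β z.1.1 : ℤ_[p]) : ℚ_[p])‖ = ‖((H β1 z.1.1 : ℤ_[p]) : ℚ_[p])‖)) w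
        ⟨β1, by simp [hβ1]⟩
      rw [Finset.mem_filter] at hβ2
      refine ⟨some ⟨β2, hβ2.1⟩, fun h0 => ?_, fun β => ⟨?_, fun hlt => ?_⟩⟩
      · have := hm1 β0 β0.2
        rw [← hβ2.2] at this
        dsimp only at h0
        rw [h0, norm_zero] at this
        exact hβ0 (norm_le_zero_iff.1 this)
      · dsimp only; rw [hβ2.2]; exact hm1 β β.2
      · dsimp only; rw [hβ2.2]
        refine lt_of_le_of_ne (hm1 β β.2) (fun heq => ?_)
        have := hm2 β (Finset.mem_filter.2 ⟨β.2, heq⟩)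
        dsimp only at hlt
        omega
  rintro (_ | βs)
  · refine ⟨fun _ => 0, Meas_const 0, fun z hz => ?_⟩
    rw [hfe]
    have : ∀ β : E, H β z.1.1 = 0 := fun β => PadicInt.ext (by simpa using hz β)
    simp [this]
  set y : E → Λ → ℤ_[p] := fun β => if w βs < w β then
    (fun l => toZp (((H β l : ℤ_[p]) : ℚ_[p]) / ((((p:ℤ_[p]) * H βs l : ℤ_[p])) : ℚ_[p]))) else
    (fun l => toZp (((H β l : ℤ_[p]) : ℚ_[p]) / ((H βs l : ℤ_[p]) : ℚ_[p]))) with hy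
  have hyD : ∀ β, y β ∈ D := by
    intro β
    simp only [hy]
    split_ifs
    · refine hB.quot _ (hHD β) (fun l => (p:ℤ_[p]) * H βs l) ?_
      have := D.mul_mem (D.algebraMap_mem (p:ℤ_[p])) (hHD βs)
      convert this using 1
      funext l; simp
    · exact hB.quot _ (hHD β) _ (hHD βs)
  set u' : ι ⊕ E → Λ → ℤ_[p] := Sum.elim u y with hu'
  have hu'D : ∀ i, u' i ∈ D := by
    rintro (i | i)
    · exact hu i
    · exact hyD i
  set zc : E → PowerSeries (MvPolynomial (Fin m) (MvPolynomial (ι ⊕ E) ℤ_[p]))[X] := fun β =>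
    if β = βs then 1 else if w βs < w β then PowerSeries.X * PowerSeries.C (C (MvPolynomial.C (MvPolynomial.X (Sum.inr β))))
      else PowerSeries.C (C (MvPolynomial.C (MvPolynomial.X (Sum.inr β)))) with hzc
  set g := ∑ β : E, zc β * (PowerSeries.C (tau p m (Sum.inl : ι → ι ⊕ E) b (MvPolynomial.monomial β.1 1)) +
    PowerSeries.X * PowerSeries.map (tau p m (Sum.inl : ι → ι ⊕ E) b) (e β)) with hg
  have hgm : (PowerSeries.coeff 0 g).Monic := by
    have e1 : PowerSeries.coeff 0 g = ∑ β : E, PowerSeries.coeff 0 (zc β) * tau p m (Sum.inl : ι → ι ⊕ E) b (MvPolynomial.monomial β.1 1) := by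
      rw [hg, map_sum]
      refine Finset.sum_congr rfl (fun β _ => ?_)
      simp
    rw [e1, ← Finset.add_sum_erase _ _ (Finset.mem_univ βs)]
    have e2 : zc βs = 1 := by simp [hzc]
    rw [e2, PowerSeries.coeff_zero_one, one_mul]
    refine (tau_monic (p := p) (Sum.inl : ι → ι ⊕ E) hb βs.1).1.add_of_left ?_
    have hdeg : ∀ β : E, (tau p m (Sum.inl : ι → ι ⊕ E) b (MvPolynomial.monomial β.1 1)).degree = (w β : WithBot ℕ) := by
      intro β
      rw [degree_eq_natDegree (tau_monic _ hb β.1).1.ne_zero, (tau_monic _ hb β.1).2]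
    rw [hdeg, ← mem_degreeLT]
    refine Submodule.sum_mem _ (fun β hβ => mem_degreeLT.2 ?_)
    have hne : β ≠ βs := (Finset.mem_erase.1 hβ).1
    simp only [hzc, if_neg hne]
    by_cases hlt : w βs < w β
    · rw [if_pos hlt]; simp
    · rw [if_neg hlt]
      rw [PowerSeries.coeff_zero_C]
      refine lt_of_le_of_lt ((degree_mul_le _ _).trans (add_le_add_left degree_C_le _)) ?_
      rw [hdeg, zero_add]
      have : w β ≠ w βs := fun heq => hne (Subtype.ext (hinj β.2 βs.2 heq))
      exact_mod_cast lt_of_le_of_ne (not_lt.1 hlt) this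
  obtain ⟨Q, W, hQW, hQ0, hWd⟩ := weier g hgm
  obtain ⟨hQm, hQne⟩ := PS_meas_unit (T0 := T0) hu'D Q hQ0
  refine ⟨_, ((hHm2 βs).mul (PS_meas (T0 := T0) hu'D W hWd)).mul hQm.inv, fun z hz => ?_⟩
  obtain ⟨hz0, hz1⟩ := hz
  have hze : ∀ β : E, H β z.1.1 = H βs z.1.1 * evP p (PowerSeries.map (evt (fun i => u' i z.1.1) z.1.2 z.2) (zc β)) := by
    intro β
    by_cases h1 : β = βs
    · simp [hzc, h1]
    by_cases h2 : w βs < w β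
    · simp only [hzc, if_neg h1, if_pos h2]
      rw [map_mul, map_mul, PowerSeries.map_C, evP_C, PowerSeries.map_X, evP_X]
      have : evt (fun i => u' i z.1.1) z.1.2 z.2 (C (MvPolynomial.C (MvPolynomial.X (Sum.inr β)))) = y β z.1.1 := by
        simp [evt, evm, hu']
      rw [this]
      simp only [hy, if_pos h2]
      exact toZp_quot_lt hz0 ((hz1 β).2 h2)
    · simp only [hzc, if_neg h1, if_neg h2]
      rw [PowerSeries.map_C, evP_C]
      have : evt (fun i => u' i z.1.1) z.1.2 z.2 (C (MvPolynomial.C (MvPolynomial.X (Sum.inr β)))) = y β z.1.1 := by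
        simp [evt, evm, hu']
      rw [this]
      simp only [hy, if_neg h2]
      exact toZp_quot hz0 (hz1 β).1
  have hfg : f (z.1.1, Fin.cons z.2 (fun i => z.1.2 i + z.2^(b^((i:ℕ)+1)))) =
      H βs z.1.1 * evP p (PowerSeries.map (evt (fun i => u' i z.1.1) z.1.2 z.2) g) := by
    rw [hfe, hg, map_sum, map_sum, Finset.mul_sum]
    refine Finset.sum_congr rfl (fun β _ => ?_)
    rw [map_mul, map_mul, ← mul_assoc, ← hze, map_add, map_add, map_mul, map_mul, PowerSeries.map_C, evP_C, PowerSeries.map_X, evP_X,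
      map_map_apply, evt_tau, evt_tau_apply]
    rfl
  have hQWz : evP p (PowerSeries.map (evt (fun i => u' i z.1.1) z.1.2 z.2) Q) * evP p (PowerSeries.map (evt (fun i => u' i z.1.1) z.1.2 z.2) g)
      = evP p (PowerSeries.map (evt (fun i => u' i z.1.1) z.1.2 z.2) W) := by
    rw [← map_mul, ← map_mul, hQW]
  have hq0 : ((evP p (PowerSeries.map (evt (fun i => u' i z.1.1) z.1.2 z.2) Q) : ℤ_[p]) : ℚ_[p]) ≠ 0 := by
    exact fun h0 => hQne z (PadicInt.ext (by simpa using h0))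
  rw [hfg, ← hQWz]
  push_cast
  field_simp

end DC


open Filter MeasureTheory Polynomial

set_option linter.unusedVariables false
set_option linter.unusedSectionVars false

namespace DC
open Tame

variable {p : ℕ} [hp : Fact p.Prime] {Λ : Type*} {D : Subalgebra ℤ_[p] (Λ → ℤ_[p])} {m : ℕ} {T0 : Tame Λ}

theorem inj_weights (n b : ℕ) (E : Finset (Fin n →₀ ℕ)) (hE : ∀ β ∈ E, ∀ i, β i < b) :
    Set.InjOn (fun β : Fin n →₀ ℕ => ∑ i, β i * b^(i:ℕ)) E := by
  intro β hβ γ hγ h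
  have h1 : finFunctionFinEquiv (fun i => (⟨β i, hE β hβ i⟩ : Fin b)) = finFunctionFinEquiv (fun i => (⟨γ i, hE γ hγ i⟩ : Fin b)) := by
    apply Fin.ext
    rw [finFunctionFinEquiv_apply, finFunctionFinEquiv_apply]
    exact h
  have h2 := finFunctionFinEquiv.injective h1
  ext i
  have := congrFun h2 i
  simpa using this

theorem meas_of_apx {g : ℚ_[p] → ℤ} {N : ℕ} (hg : ∀ x y : ℚ_[p], Apx N x y → g x = g y) :
    Measurable (fun x : ℤ_[p] => g (x : ℚ_[p])) := by
  refine measurable_of_continuousOn_compl_singleton 0 (fun x hx => ContinuousAt.continuousWithinAt ?_)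
  have hx0 : ((x : ℤ_[p]) : ℚ_[p]) ≠ 0 := fun h => hx (PadicInt.ext (by simpa using h))
  have hr : 0 < (p:ℝ)^(-(N:ℤ)) * ‖((x : ℤ_[p]) : ℚ_[p])‖ := mul_pos (pN_pos _) (norm_pos_iff.2 hx0)
  refine continuousAt_const.congr (f := fun _ => g (x : ℚ_[p])) ?_
  filter_upwards [Metric.ball_mem_nhds x hr] with y hy
  refine (hg _ _ ?_).symm
  rw [Metric.mem_ball, dist_eq_norm, PadicInt.norm_def, PadicInt.coe_sub] at hy
  exact hy.le

theorem measurable_v : Measurable (fun x : ℤ_[p] => ((x : ℤ_[p]) : ℚ_[p]).valuation) :=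
  meas_of_apx (g := fun x => x.valuation) (N := 1) (fun x y h => h.v_eq le_rfl)

theorem measurable_acz (N : ℕ) : Measurable (fun x : ℤ_[p] => acz N ((x : ℤ_[p]) : ℚ_[p])) := by
  rcases Nat.eq_zero_or_pos N with rfl | hN
  · have : (fun x : ℤ_[p] => acz 0 ((x : ℤ_[p]) : ℚ_[p])) = fun _ => 0 := by
      funext x
      have h1 := acz_nonneg 0 ((x : ℤ_[p]) : ℚ_[p])
      have h2 := acz_lt 0 ((x : ℤ_[p]) : ℚ_[p])
      simp at h2; omega
    rw [this]; exact measurable_const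
  · exact meas_of_apx (g := fun x => acz N x) (N := N) (fun x y h => h.acz_eq hN)

theorem AF.continuous {f : Λ × (Fin m → ℤ_[p]) → ℤ_[p]} (hf : AF D m f) (l : Λ) : Continuous (fun x => f (l, x)) := by
  obtain ⟨ι, _, u, F, hu, hF⟩ := hf
  simp only [hF, evP_apply]
  refine continuous_tsum (u := fun n => ((p:ℝ)⁻¹)^n) (fun n => ?_) (summable_geometric_of_lt_one (by positivity) (inv_lt_one_of_one_lt₀ (by exact_mod_cast hp.out.one_lt)))
    (fun n x => evP_norm _ n)
  simp only [PowerSeries.coeff_map]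
  refine Continuous.mul ?_ continuous_const
  simp only [evm, MvPolynomial.coe_eval₂Hom, MvPolynomial.eval₂_eq_eval_map]
  exact MvPolynomial.continuous_eval _

/-- fiberwise measurable functions -/
def FM (Λ : Type*) (Y : Type*) [MeasurableSpace Y] : Tame (Λ × Y) where
  V := {κ | ∀ l, Measurable (fun x => κ (l, x))}
  const' n l := measurable_const
  add' _ _ h1 h2 l := (h1 l).add (h2 l)
  neg' _ h l := (h l).neg
  ite' κ₁ _ _ h1 h2 h3 l := Measurable.ite (measurableSet_le measurable_const (h1 l)) (h2 l) (h3 l)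
  div' κ n h hn l := (measurable_from_top (f := fun k : ℤ => k / (n:ℤ))).comp (h l)

theorem AFT_le_FM : AFT T0 D m ≤ FM Λ (Fin m → ℤ_[p]) := by
  refine Gen_le ?_
  rintro κ (⟨κ0, _, rfl⟩ | ⟨f, hf, rfl | ⟨N, rfl⟩⟩) l
  · exact measurable_const (a := κ0 l)
  · exact measurable_v.comp (hf.continuous l).measurable
  · exact (measurable_acz N).comp (hf.continuous l).measurable

theorem Cn_FM {Y : Type*} [MeasurableSpace Y] {Φ : Λ × Y → ℚ} (h : Φ ∈ (FM Λ Y).Cn p) (l : Λ) : Measurable (fun x => ((Φ (l, x) : ℚ):ℝ)) := by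
  refine Cn_induct (C := fun Φ => Measurable (fun x => ((Φ (l, x) : ℚ):ℝ))) ?_ ?_ ?_ ?_ ?_ h
  · intro κ hκ
    exact (measurable_from_top (f := fun k : ℤ => (((k:ℚ)):ℝ))).comp (hκ l)
  · intro κ hκ
    exact (measurable_from_top (f := fun k : ℤ => ((((p:ℚ)^k):ℚ):ℝ))).comp (hκ l)
  · intro c; exact measurable_const
  · intro f g h1 h2
    push_cast; exact h1.add h2
  · intro f g h1 h2
    push_cast; exact h1.mul h2

theorem AFT_subst (hB : BaseRing T0 D) {Φ : Λ × (Fin (m+1) → ℤ_[p]) → ℚ} (h : Φ ∈ (AFT T0 D (m+1)).Cn p) :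
    ∃ b : ℕ, (fun z : (Λ × (Fin m → ℤ_[p])) × ℤ_[p] => Φ (z.1.1, Fin.cons z.2 (fun i => z.1.2 i + z.2^(b^((i:ℕ)+1)))))
      ∈ (PolyT (AFT T0 D m) (AFR D m)).Cn p := by
  classical
  obtain ⟨Q', hfin, hsub, hΦ⟩ := Cn_Gen_fin h
  have hex : ∀ κ : Q', ∃ E : Finset (Fin (m+1) →₀ ℕ), ∀ b : ℕ, 1 ≤ b → Set.InjOn (fun β : Fin (m+1) →₀ ℕ => ∑ i, β i * b^(i:ℕ)) E →
      (fun z : (Λ × (Fin m → ℤ_[p])) × ℤ_[p] => κ.1 (z.1.1, Fin.cons z.2 (fun i => z.1.2 i + z.2^(b^((i:ℕ)+1)))))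
      ∈ (PolyT (AFT T0 D m) (AFR D m)).V := by
    rintro ⟨κ, hκ⟩
    rcases hsub hκ with ⟨κ0, h0, rfl⟩ | ⟨f, hf, hh⟩
    · exact ⟨∅, fun b _ _ => PolyT_fst (AFT_fst h0)⟩
    · obtain ⟨E, hE⟩ := AF_subst hB hf
      refine ⟨E, fun b hb hi => ?_⟩
      rcases hh with rfl | ⟨N, rfl⟩
      · exact (hE b hb hi).1
      · exact (hE b hb hi).2 N
  choose E hE using hex
  have := hfin.fintype
  set EE := Finset.univ.biUnion E with hEE
  set b := EE.sup (fun β => Finset.univ.sup (fun i => β i)) + 1 with hb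
  refine ⟨b, Cn_pull (T := Gen Q') (φ := fun z : (Λ × (Fin m → ℤ_[p])) × ℤ_[p] => ((z.1.1, Fin.cons z.2 (fun i => z.1.2 i + z.2^(b^((i:ℕ)+1)))) : Λ × (Fin (m+1) → ℤ_[p]))) ?_ hΦ⟩
  have hle : Gen Q' ≤ (PolyT (AFT T0 D m) (AFR D m)).pull (fun z : (Λ × (Fin m → ℤ_[p])) × ℤ_[p] => ((z.1.1, Fin.cons z.2 (fun i => z.1.2 i + z.2^(b^((i:ℕ)+1)))) : Λ × (Fin (m+1) → ℤ_[p]))) := by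
    refine Gen_le (fun κ hκ => ?_)
    refine hE ⟨κ, hκ⟩ b (by omega) (inj_weights _ _ _ (fun β hβ i => ?_))
    have h1 : β i ≤ Finset.univ.sup (fun i => β i) := Finset.le_sup (f := fun i => β i) (Finset.mem_univ i)
    have h2 : Finset.univ.sup (fun i => β i) ≤ EE.sup (fun β => Finset.univ.sup (fun i => β i)) :=
      Finset.le_sup (f := fun β : Fin (m+1) →₀ ℕ => Finset.univ.sup (fun i => β i)) (Finset.mem_biUnion.2 ⟨_, Finset.mem_univ _, hβ⟩)
    omega
  exact fun κ hκ => hle hκ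

/-- integration over all analytic variables -/
theorem AF_int (hB : BaseRing T0 D) : ∀ (m : ℕ) (Φ : Λ × (Fin m → ℤ_[p]) → ℚ), Φ ∈ (AFT T0 D m).Cn p →
    (∀ l, ∃ A : ℝ, ∀ x, |((Φ (l, x) : ℚ):ℝ)| ≤ A) →
    ∃ G ∈ T0.Cn p, ∀ l, ∫ x, ((Φ (l, x) : ℚ):ℝ) ∂(Measure.pi (fun _ : Fin m => nu p)) = (G l : ℝ) := by
  intro m
  induction m with
  | zero =>
    intro Φ hΦ _
    refine ⟨fun l => Φ (l, default), Cn_pull (φ := fun l : Λ => ((l, default) : Λ × (Fin 0 → ℤ_[p]))) ?_ hΦ, fun l => ?_⟩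
    · have hle : AFT T0 D 0 ≤ T0.pull (fun l : Λ => ((l, default) : Λ × (Fin 0 → ℤ_[p]))) := by
        refine Gen_le ?_
        have key : ∀ f, AF D 0 f → T0.Meas (fun l => ((f (l, default) : ℤ_[p]) : ℚ_[p])) := by
          rintro f ⟨ι, _, u, F, hu, hF⟩
          have := hB.meas _ (hB.conv ι u hu (PowerSeries.map (MvPolynomial.eval₂Hom (RingHom.id _) (fun i : Fin 0 => i.elim0)) F))
          refine this.congr (fun l => ?_)
          rw [hF, map_map_apply]
          congr 4
          apply MvPolynomial.ringHom_ext
          · intro r; simp [evm]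
          · intro i; exact i.elim0
        rintro κ (⟨κ0, h0, rfl⟩ | ⟨f, hf, rfl | ⟨N, rfl⟩⟩)
        · exact h0
        · exact (key f hf).1
        · exact (key f hf).2 N
      exact fun κ hκ => hle hκ
    · rw [integral_unique]; simp; congr 2; exact Subsingleton.elim _ _
  | succ m ih =>
    intro Φ hΦ hbd
    obtain ⟨b, hb⟩ := AFT_subst hB hΦ
    obtain ⟨G, hG, hGi⟩ := IT (fun f hf => AFR_meas hf) hb (fun z => by
      obtain ⟨A, hA⟩ := hbd z.1
      exact ⟨A, fun t => hA _⟩)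
    obtain ⟨G', hG', hG'i⟩ := ih G hG (fun l => by
      obtain ⟨A, hA⟩ := hbd l
      refine ⟨A, fun x => ?_⟩
      rw [← (hGi (l, x)).2, ← Real.norm_eq_abs]
      refine (norm_integral_le_of_norm_le_const (C := A) (Filter.Eventually.of_forall (fun t => hA _))).trans ?_
      simp)
    refine ⟨G', hG', fun l => ?_⟩
    rw [← hG'i]
    have hmeas : Measurable (fun x => ((Φ (l, x) : ℚ):ℝ)) := Cn_FM (Cn_mono AFT_le_FM hΦ) l
    obtain ⟨A, hA⟩ := hbd l
    set μ := (Measure.pi (fun _ : Fin m => nu p)) with hμ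
    have e1 := (measurePreserving_piFinSuccAbove (fun _ : Fin (m+1) => nu p) 0).symm.integral_comp'
      (g := fun x => ((Φ (l, x) : ℚ):ℝ))
    rw [← e1]
    have e2 : ∀ y : ℤ_[p] × (Fin m → ℤ_[p]), (MeasurableEquiv.piFinSuccAbove (fun _ : Fin (m+1) => ℤ_[p]) 0).symm y = Fin.cons y.1 y.2 := by
      intro y
      simp [MeasurableEquiv.piFinSuccAbove]
      rfl
    simp only [e2]
    have hm2 : Measurable (fun y : ℤ_[p] × (Fin m → ℤ_[p]) => (Fin.cons y.1 y.2 : Fin (m+1) → ℤ_[p])) := by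
      have := (MeasurableEquiv.piFinSuccAbove (fun _ : Fin (m+1) => ℤ_[p]) 0).symm.measurable
      convert this using 1
      funext y; exact (e2 y).symm
    have hm3 : Measurable (fun y : ℤ_[p] × (Fin m → ℤ_[p]) => (y.1, (fun i => y.2 i + y.1^(b^((i:ℕ)+1)) : Fin m → ℤ_[p]))) := by
      apply Continuous.measurable
      fun_prop
    have hi1 : Integrable (fun y : ℤ_[p] × (Fin m → ℤ_[p]) => ((Φ (l, Fin.cons y.1 y.2) : ℚ):ℝ)) ((nu p).prod μ) :=
      Integrable.of_bound (hmeas.comp hm2).aestronglyMeasurable A (Filter.Eventually.of_forall (fun y => hA _))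
    have hi2 : Integrable (fun y : ℤ_[p] × (Fin m → ℤ_[p]) => ((Φ (l, Fin.cons y.1 (fun i => y.2 i + y.1^(b^((i:ℕ)+1)))) : ℚ):ℝ)) ((nu p).prod μ) :=
      Integrable.of_bound ((hmeas.comp hm2).comp hm3).aestronglyMeasurable A (Filter.Eventually.of_forall (fun y => hA _))
    rw [show (Measure.pi fun j : Fin m => nu p) = μ from rfl]
    rw [integral_prod _ hi1]
    have e3 : ∀ t : ℤ_[p], ∫ x, ((Φ (l, Fin.cons t x) : ℚ):ℝ) ∂μ = ∫ x, ((Φ (l, Fin.cons t (fun i => x i + t^(b^((i:ℕ)+1)))) : ℚ):ℝ) ∂μ := by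
      intro t
      exact (integral_add_right_eq_self (fun x => ((Φ (l, Fin.cons t x) : ℚ):ℝ)) (fun i : Fin m => t^(b^((i:ℕ)+1)))).symm
    simp only [e3]
    rw [integral_integral_swap hi2]
    refine integral_congr_ae (Filter.Eventually.of_forall (fun x => ?_))
    exact (hGi (l, x)).2

end DC


open Filter MeasureTheory Polynomial

set_option linter.unusedVariables false
set_option linter.unusedSectionVars false

namespace DC
open Tame

variable {p : ℕ} [hp : Fact p.Prime] {m : ℕ}

/-- `D`-functions, with `p` implicit -/
def DF (f : (Fin m → ℚ_[p]) → ℚ_[p]) : Prop := PadicSub.IsDFunction p f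

theorem DF.congr {f g : (Fin m → ℚ_[p]) → ℚ_[p]} (h : DF f) (e : ∀ x, g x = f x) : DF g := by
  have : g = f := funext e
  rw [this]; exact h

theorem DF_const (c : ℚ_[p]) : DF (fun _ : Fin m → ℚ_[p] => c) :=
  DF.congr (PadicSub.IsDFunction.poly (MvPolynomial.C c)) (fun x => by simp)

theorem DF_coord (i : Fin m) : DF (fun x : Fin m → ℚ_[p] => x i) :=
  DF.congr (PadicSub.IsDFunction.poly (MvPolynomial.X i)) (fun x => by simp)

theorem DF_comp {n : ℕ} {f : (Fin n → ℚ_[p]) → ℚ_[p]} (hf : DF f)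
    {g : Fin n → (Fin m → ℚ_[p]) → ℚ_[p]} (hg : ∀ i, DF (g i)) :
    DF (fun x => f (fun i => g i x)) :=
  PadicSub.IsDFunction.comp f g hf hg

theorem DF.add {f g : (Fin m → ℚ_[p]) → ℚ_[p]} (hf : DF f) (hg : DF g) :
    DF (fun x => f x + g x) :=
  DF.congr (DF_comp (n := 2) (PadicSub.IsDFunction.poly (MvPolynomial.X 0 + MvPolynomial.X 1))
    (g := ![f, g]) (fun i => by fin_cases i; exacts [hf, hg])) (fun x => by simp)

theorem DF.mul {f g : (Fin m → ℚ_[p]) → ℚ_[p]} (hf : DF f) (hg : DF g) :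
    DF (fun x => f x * g x) :=
  DF.congr (DF_comp (n := 2) (PadicSub.IsDFunction.poly (MvPolynomial.X 0 * MvPolynomial.X 1))
    (g := ![f, g]) (fun i => by fin_cases i; exacts [hf, hg])) (fun x => by simp)

theorem DF.inv {f : (Fin m → ℚ_[p]) → ℚ_[p]} (hf : DF f) : DF (fun x => (f x)⁻¹) :=
  DF.congr (DF_comp (n := 1) PadicSub.IsDFunction.inv (g := fun _ => f) (fun i => hf))
    (fun x => by simp)

theorem DF.neg {f : (Fin m → ℚ_[p]) → ℚ_[p]} (hf : DF f) : DF (fun x => - f x) :=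
  DF.congr ((DF_const (-1)).mul hf) (fun x => by simp)

theorem DF.sub {f g : (Fin m → ℚ_[p]) → ℚ_[p]} (hf : DF f) (hg : DF g) :
    DF (fun x => f x - g x) := DF.congr (hf.add hg.neg) (fun x => sub_eq_add_neg _ _)

theorem DF.pow {f : (Fin m → ℚ_[p]) → ℚ_[p]} (hf : DF f) (n : ℕ) : DF (fun x => f x ^ n) := by
  induction n with
  | zero => exact DF.congr (DF_const 1) (fun x => by simp)
  | succ n ih => exact DF.congr (ih.mul hf) (fun x => pow_succ _ _)

/-- truncation: `z` if `‖z‖ ≤ 1` and `0` otherwise -/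
theorem DF.trunc {f : (Fin m → ℚ_[p]) → ℚ_[p]} (hf : DF f) :
    DF (fun x => if ‖f x‖ ≤ 1 then f x else 0) := by
  classical
  have h1 : PadicSub.IsRestrictedCoeffs p
      (fun i : Fin 1 → ℕ => if i = (fun _ => 1) then (1 : ℚ_[p]) else 0) := by
    refine tendsto_const_nhds.congr' ?_
    rw [EventuallyEq, Filter.eventually_cofinite]
    refine (Set.finite_singleton (fun _ : Fin 1 => (1:ℕ))).subset (fun i hi => ?_)
    by_contra hc
    exact hi (by simp only [Set.mem_singleton_iff] at hc; simp [hc])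
  refine DF.congr (DF_comp (n := 1) (PadicSub.IsDFunction.ranal _ h1) (g := fun _ => f)
    (fun i => hf)) (fun x => ?_)
  simp only [PadicSub.ranalFn]
  rw [tsum_eq_single (fun _ => 1)]
  · simp
  · intro b hb
    simp [hb]

theorem DF.truncOne {f : (Fin m → ℚ_[p]) → ℚ_[p]} (hf : DF f) :
    DF (fun x => if ‖f x‖ ≤ 1 then (1 : ℚ_[p]) else 0) := by
  classical
  have h1 : PadicSub.IsRestrictedCoeffs p
      (fun i : Fin 1 → ℕ => if i = (fun _ => 0) then (1 : ℚ_[p]) else 0) := by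
    refine tendsto_const_nhds.congr' ?_
    rw [EventuallyEq, Filter.eventually_cofinite]
    refine (Set.finite_singleton (fun _ : Fin 1 => (0:ℕ))).subset (fun i hi => ?_)
    by_contra hc
    exact hi (by simp only [Set.mem_singleton_iff] at hc; simp [hc])
  refine DF.congr (DF_comp (n := 1) (PadicSub.IsDFunction.ranal _ h1) (g := fun _ => f)
    (fun i => hf)) (fun x => ?_)
  simp only [PadicSub.ranalFn]
  rw [tsum_eq_single (fun _ => 0)]
  · simp
  · intro b hb
    simp [hb]

/-- subanalytic conditions as an inductive predicate -/
inductive SA : ((Fin m → ℚ_[p]) → Prop) → Prop where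
  | zero (f : (Fin m → ℚ_[p]) → ℚ_[p]) : DF f → SA (fun x => f x = 0)
  | pow (f : (Fin m → ℚ_[p]) → ℚ_[p]) (n : ℕ) : DF f → 0 < n →
      SA (fun x => f x ∈ PadicSub.Pset p n)
  | or (P Q : (Fin m → ℚ_[p]) → Prop) : SA P → SA Q → SA (fun x => P x ∨ Q x)
  | and (P Q : (Fin m → ℚ_[p]) → Prop) : SA P → SA Q → SA (fun x => P x ∧ Q x)

theorem SA.congr {P Q : (Fin m → ℚ_[p]) → Prop} (h : SA P) (e : ∀ x, Q x ↔ P x) : SA Q := by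
  have : Q = P := funext fun x => propext (e x)
  rw [this]; exact h

theorem SA_const (P : Prop) : SA (fun _ : Fin m → ℚ_[p] => P) := by
  by_cases h : P
  · exact (SA.zero _ (DF_const 0)).congr (fun x => by simp [h])
  · exact (SA.zero _ (DF_const 1)).congr (fun x => by simp [h])

theorem SA_exists {ι : Type*} [Finite ι] {P : ι → (Fin m → ℚ_[p]) → Prop} (h : ∀ i, SA (P i)) :
    SA (fun b => ∃ i, P i b) := by
  classical
  cases nonempty_fintype ι
  have : ∀ s : Finset ι, SA (fun b => ∃ i ∈ s, P i b) := by
    intro s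
    induction s using Finset.induction_on with
    | empty => exact (SA_const False).congr (fun b => by simp)
    | insert a s ha ih => exact (SA.or _ _ (h a) ih).congr (fun b => by simp)
  exact (this Finset.univ).congr (fun b => by simp)

/-- basic subanalytic conditions -/
def BS (P : (Fin m → ℚ_[p]) → Prop) : Prop :=
  (∃ f, DF f ∧ P = fun x => f x = 0) ∨
    (∃ f n, DF f ∧ 0 < n ∧ P = fun x => f x ∈ PadicSub.Pset p n)

theorem SA_dnf {P : (Fin m → ℚ_[p]) → Prop} (h : SA P) :
    ∃ L : List (List ((Fin m → ℚ_[p]) → Prop)), (∀ l ∈ L, ∀ Q ∈ l, BS Q) ∧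
      ∀ x, P x ↔ ∃ l ∈ L, ∀ Q ∈ l, Q x := by
  induction h with
  | zero f hf =>
    refine ⟨[[fun x => f x = 0]], ?_, fun x => by simp⟩
    simp only [List.mem_singleton, forall_eq]
    exact Or.inl ⟨f, hf, rfl⟩
  | pow f n hf hn =>
    refine ⟨[[fun x => f x ∈ PadicSub.Pset p n]], ?_, fun x => by simp⟩
    simp only [List.mem_singleton, forall_eq]
    exact Or.inr ⟨f, n, hf, hn, rfl⟩
  | or P Q _ _ hP hQ =>
    obtain ⟨L1, h1, e1⟩ := hP
    obtain ⟨L2, h2, e2⟩ := hQ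
    refine ⟨L1 ++ L2, fun l hl => ?_, fun x => ?_⟩
    · rcases List.mem_append.1 hl with hl | hl
      exacts [h1 l hl, h2 l hl]
    · dsimp only
      rw [e1, e2]
      simp only [List.mem_append]
      constructor
      · rintro (⟨l, hl, h⟩ | ⟨l, hl, h⟩)
        exacts [⟨l, Or.inl hl, h⟩, ⟨l, Or.inr hl, h⟩]
      · rintro ⟨l, hl | hl, h⟩
        exacts [Or.inl ⟨l, hl, h⟩, Or.inr ⟨l, hl, h⟩]
  | and P Q _ _ hP hQ =>
    obtain ⟨L1, h1, e1⟩ := hP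
    obtain ⟨L2, h2, e2⟩ := hQ
    refine ⟨(List.product L1 L2).map (fun z => z.1 ++ z.2), fun l hl => ?_, fun x => ?_⟩
    · simp only [List.mem_map, Prod.exists] at hl
      obtain ⟨l1, l2, hl, rfl⟩ := hl
      rw [List.pair_mem_product] at hl
      intro Q hQ
      rcases List.mem_append.1 hQ with hQ | hQ
      exacts [h1 _ hl.1 _ hQ, h2 _ hl.2 _ hQ]
    · dsimp only
      rw [e1, e2]
      constructor
      · rintro ⟨⟨l1, hl1, h1⟩, ⟨l2, hl2, h2⟩⟩
        refine ⟨l1 ++ l2, List.mem_map.2 ⟨(l1, l2), List.pair_mem_product.2 ⟨hl1, hl2⟩, rfl⟩, ?_⟩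
        intro Q hQ
        rcases List.mem_append.1 hQ with hQ | hQ
        exacts [h1 _ hQ, h2 _ hQ]
      · rintro ⟨l, hl, h⟩
        simp only [List.mem_map, Prod.exists] at hl
        obtain ⟨l1, l2, hl, rfl⟩ := hl
        rw [List.pair_mem_product] at hl
        exact ⟨⟨l1, hl.1, fun Q hQ => h Q (List.mem_append_left _ hQ)⟩,
          ⟨l2, hl.2, fun Q hQ => h Q (List.mem_append_right _ hQ)⟩⟩

theorem SA.isSubanalytic {P : (Fin m → ℚ_[p]) → Prop} (h : SA P) :
    PadicSub.IsSubanalytic p {x | P x} := by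
  obtain ⟨L, hL, e⟩ := SA_dnf h
  -- a bound for the lengths
  obtain ⟨s, hs⟩ : ∃ s, ∀ l ∈ L, l.length ≤ s :=
    ⟨(L.map List.length).sum, fun l hl => List.le_sum_of_mem (List.mem_map.2 ⟨l, hl, rfl⟩)⟩
  have htriv : BS (fun _ : Fin m → ℚ_[p] => (0 : ℚ_[p]) = 0) := Or.inl ⟨_, DF_const 0, rfl⟩
  refine ⟨L.length, s, fun i j => {x | ((L.get i).getD j (fun _ => (0:ℚ_[p]) = 0)) x}, ?_, ?_⟩
  · intro i j
    have hb : BS ((L.get i).getD j (fun _ => (0:ℚ_[p]) = 0)) := by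
      by_cases hj : (j:ℕ) < (L.get i).length
      · rw [List.getD_eq_getElem _ _ hj]
        exact hL _ (List.get_mem _ _) _ (List.getElem_mem _)
      · rw [List.getD_eq_default _ _ (by omega)]
        exact htriv
    rcases hb with ⟨f, hf, hP⟩ | ⟨f, n, hf, hn, hP⟩
    · exact Or.inl ⟨f, hf, by dsimp only; rw [hP]⟩
    · exact Or.inr ⟨f, n, hf, hn, by dsimp only; rw [hP]⟩
  · ext x
    simp only [Set.mem_ofPred_eq, Set.mem_iUnion, Set.mem_iInter]
    rw [e]
    constructor
    · rintro ⟨l, hl, h⟩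
      obtain ⟨i, rfl⟩ := List.get_of_mem hl
      refine ⟨i, fun j => ?_⟩
      by_cases hj : (j:ℕ) < (L.get i).length
      · rw [List.getD_eq_getElem _ _ hj]
        exact h _ (List.getElem_mem _)
      · rw [List.getD_eq_default _ _ (by omega)]; trivial
    · rintro ⟨i, h⟩
      refine ⟨L.get i, List.get_mem _ _, fun Q hQ => ?_⟩
      obtain ⟨j, rfl⟩ := List.get_of_mem hQ
      have := h ⟨j, lt_of_lt_of_le j.2 (hs _ (List.get_mem _ _))⟩
      rw [List.getD_eq_getElem _ _ j.2] at this
      exact this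

/-- pulling back along a map with `D`-function coordinates -/
theorem SA.pull {n : ℕ} {P : (Fin n → ℚ_[p]) → Prop} (h : SA P)
    {g : Fin n → (Fin m → ℚ_[p]) → ℚ_[p]} (hg : ∀ i, DF (g i)) :
    SA (fun x => P (fun i => g i x)) := by
  induction h with
  | zero f hf => exact SA.zero _ (DF_comp hf hg)
  | pow f n hf hn => exact SA.pow _ n (DF_comp hf hg) hn
  | or P Q _ _ hP hQ => exact SA.or _ _ hP hQ
  | and P Q _ _ hP hQ => exact SA.and _ _ hP hQ

theorem SA_ne {f : (Fin m → ℚ_[p]) → ℚ_[p]} (hf : DF f) : SA (fun x => f x ≠ 0) :=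
  (SA.pow f 1 hf one_pos).congr (fun x => by simp [PadicSub.Pset])

theorem SA_normle {f : (Fin m → ℚ_[p]) → ℚ_[p]} (hf : DF f) : SA (fun x => ‖f x‖ ≤ 1) :=
  (SA_ne hf.truncOne).congr (fun x => by simp)

/-- every condition invariant under multiplication by nonzero `n`-th powers is subanalytic -/
theorem SA_inv {f : (Fin m → ℚ_[p]) → ℚ_[p]} (hf : DF f) {n : ℕ} (hn : 0 < n)
    (P : ℚ_[p] → Prop) (hP : ∀ x y, y ≠ 0 → (P (x * y ^ n) ↔ P x)) :
    SA (fun x => f x ≠ 0 ∧ P (f x)) := by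
  have hn0 : n ≠ 0 := hn.ne'
  set M := n + 1
  set K := M + n + 1
  have key : ∀ x : ℚ_[p], x ≠ 0 → ∃ (i : Fin n) (c : Fin (p ^ K)),
      ((c:ℕ):ℚ_[p]) * (p:ℚ_[p]) ^ (i:ℕ) ≠ 0 ∧
      (((c:ℕ):ℚ_[p]) * (p:ℚ_[p]) ^ (i:ℕ))⁻¹ * x ∈ PadicSub.Pset p n := by
    intro x hx
    have hpK : (p:ℚ_[p]) ≠ 0 := pK0
    have hi0 : 0 ≤ x.valuation % (n:ℤ) := Int.emod_nonneg _ (by exact_mod_cast hn0)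
    have hi1 : x.valuation % (n:ℤ) < n := Int.emod_lt_of_pos _ (by exact_mod_cast hn)
    set i := (x.valuation % (n:ℤ)).toNat with hidef
    have hi : ((i:ℕ):ℤ) = x.valuation % (n:ℤ) := Int.toNat_of_nonneg hi0
    set z := x * (p:ℚ_[p]) ^ (-(i:ℤ)) with hz
    have hz0 : z ≠ 0 := mul_ne_zero hx (zpow_ne_zero _ hpK)
    have hzv : (n:ℤ) ∣ z.valuation := by
      rw [hz, v_mul hx (zpow_ne_zero _ hpK), v_pow_p, hi]
      exact ⟨x.valuation / n, by have := Int.emod_add_mul_ediv x.valuation n; linarith⟩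
    obtain ⟨θ, hθ0, hθ, -⟩ := exists_root (M := M) hn0 le_rfl hz0 hzv
    have hc0 := acz_nonneg K z
    have hc1 := acz_lt K z
    refine ⟨⟨i, by omega⟩, ⟨(acz K z).toNat, ?_⟩, ?_⟩
    · zify; rw [Int.toNat_of_nonneg hc0]; exact hc1
    · have hcc : (((acz K z).toNat : ℕ) : ℚ_[p]) = ((acz K z : ℤ) : ℚ_[p]) := by
        have := Int.toNat_of_nonneg hc0
        exact_mod_cast congrArg (fun t : ℤ => (t : ℚ_[p])) this
      have hcne : ((acz K z : ℤ) : ℚ_[p]) ≠ 0 := by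
        rw [← norm_pos_iff, norm_acz (by omega) hz0]; exact one_pos
      simp only [hcc]
      refine ⟨mul_ne_zero hcne (pow_ne_zero _ hpK), θ, hθ0, ?_⟩
      rw [hθ, hz, zpow_neg, zpow_natCast]
      field_simp
      rfl
  refine SA.congr (SA_exists (ι := {q : Fin n × Fin (p ^ K) //
      ((q.2:ℕ):ℚ_[p]) * (p:ℚ_[p]) ^ (q.1:ℕ) ≠ 0 ∧ P (((q.2:ℕ):ℚ_[p]) * (p:ℚ_[p]) ^ (q.1:ℕ))})
    (P := fun q x => (((q.1.2:ℕ):ℚ_[p]) * (p:ℚ_[p]) ^ (q.1.1:ℕ))⁻¹ * f x ∈ PadicSub.Pset p n)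
    (fun q => SA.pow _ n ((DF_const _).mul hf) hn)) (fun x => ?_)
  constructor
  · rintro ⟨h0, hPx⟩
    obtain ⟨i, c, hne, y, hy0, hy⟩ := key _ h0
    refine ⟨⟨(i, c), hne, ?_⟩, y, hy0, hy⟩
    rw [← hP _ y hy0]
    dsimp only
    rw [hy, mul_inv_cancel_left₀ hne]
    exact hPx
  · rintro ⟨⟨q, hne, hq⟩, y, hy0, hy⟩
    have e : f x = (((q.2:ℕ):ℚ_[p]) * (p:ℚ_[p]) ^ (q.1:ℕ)) * y ^ n := by
      rw [hy, mul_inv_cancel_left₀ hne]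
    rw [e]
    exact ⟨mul_ne_zero hne (pow_ne_zero _ hy0), (hP _ y hy0).2 hq⟩

theorem SA.not {P : (Fin m → ℚ_[p]) → Prop} (h : SA P) : SA (fun x => ¬ P x) := by
  induction h with
  | zero f hf => exact SA_ne hf
  | pow f n hf hn =>
    refine (SA.or _ _ (SA.zero f hf) (SA_inv hf hn (fun x => x ∉ PadicSub.Pset p n) ?_)).congr
      (fun x => ?_)
    · intro x y hy
      refine not_congr ⟨?_, ?_⟩
      · rintro ⟨z, hz, e⟩
        exact ⟨z / y, div_ne_zero hz hy, by rw [div_pow, e]; field_simp⟩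
      · rintro ⟨z, hz, e⟩
        exact ⟨z * y, mul_ne_zero hz hy, by rw [mul_pow, e]⟩
    · by_cases h0 : f x = 0
      · simp only [h0, true_or, iff_true]
        rintro ⟨y, hy, e⟩
        exact hy (pow_eq_zero_iff hn.ne' |>.1 e)
      · simp [h0]
  | or P Q _ _ hP hQ => exact (SA.and _ _ hP hQ).congr (fun x => by tauto)
  | and P Q _ _ hP hQ => exact (SA.or _ _ hP hQ).congr (fun x => by tauto)

theorem SA_dvd {f : (Fin m → ℚ_[p]) → ℚ_[p]} (hf : DF f) {n : ℕ} (hn : 0 < n) (k : ℤ) :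
    SA (fun x => f x ≠ 0 ∧ (n:ℤ) ∣ (f x).valuation - k) := by
  refine (SA_inv hf hn (fun x => x ≠ 0 ∧ (n:ℤ) ∣ x.valuation - k) ?_).congr (fun x => by tauto)
  intro x y hy
  have hyn := pow_ne_zero n hy
  by_cases hx : x = 0
  · simp [hx]
  · rw [v_mul hx hyn, Padic.valuation_pow]
    have : x.valuation + (n:ℤ) * y.valuation - k = x.valuation - k + (n:ℤ) * y.valuation := by ring
    rw [this, Int.dvd_add_left (dvd_mul_right _ _)]
    simp [hx, hy]

theorem SA_acz {f : (Fin m → ℚ_[p]) → ℚ_[p]} (hf : DF f) (N : ℕ) (c : ℤ) :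
    SA (fun x => acz N (f x) = c) := by
  have hφ : 0 < Nat.totient (p ^ N) := Nat.totient_pos.2 (pow_pos hp.1.pos _)
  refine (SA.or _ _ (SA.and _ _ (SA.zero f hf) (SA_const ((0:ℤ) = c)))
    (SA_inv hf hφ (fun x => acz N x = c) ?_)).congr (fun x => ?_)
  · intro x y hy
    have : acz N (x * y ^ Nat.totient (p ^ N)) = acz N x := by
      rw [acz_eq_iff, ac_mul, ac_pow]
      have h1 : ‖(ac y) ^ Nat.totient (p ^ N) - 1‖ ≤ (p:ℝ) ^ (-(N:ℤ)) := by
        have hu : ‖ac y‖ = 1 := norm_ac hy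
        let u : ℤ_[p] := ⟨ac y, hu.le⟩
        have huu : IsUnit u := PadicInt.isUnit_iff.2 hu
        have hz : PadicInt.toZModPow N (u ^ Nat.totient (p ^ N) - 1) = 0 := by
          rw [map_sub, map_pow, map_one]
          obtain ⟨w, hw⟩ := huu.map (PadicInt.toZModPow N)
          rw [← hw, ← Units.val_pow_eq_pow_val, ZMod.pow_totient]
          simp
        rw [← RingHom.mem_ker, PadicInt.ker_toZModPow, ← PadicInt.norm_le_pow_iff_mem_span_pow] at hz
        rw [PadicInt.norm_def] at hz
        exact hz
      have h2 : ac x * (ac y) ^ Nat.totient (p ^ N) - ac x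
          = ac x * ((ac y) ^ Nat.totient (p ^ N) - 1) := by ring
      rw [h2, norm_mul]
      calc ‖ac x‖ * _ ≤ 1 * _ := by gcongr; exact norm_ac_le x
        _ ≤ _ := by rw [one_mul]; exact h1
    rw [this]
  · by_cases h0 : f x = 0
    · simp [h0, acz_zero]
    · simp [h0]

end DC


open Filter MeasureTheory Polynomial

set_option linter.unusedVariables false
set_option linter.unusedSectionVars false

namespace DC
open Tame

variable {p : ℕ} [hp : Fact p.Prime] {m : ℕ}

/-- on `X`, the function `κ` is piecewise `1/N` times the valuation of a `D`-function -/
def SVon (X : (Fin m → ℚ_[p]) → Prop) (κ : (Fin m → ℚ_[p]) → ℤ) : Prop :=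
  ∃ (ι : Type) (_ : Finite ι) (Y : ι → (Fin m → ℚ_[p]) → Prop), (∀ i, SA (Y i)) ∧
    (∀ l, X l → ∃ i, Y i l) ∧
    ∀ i, ∃ (N : ℕ) (f : (Fin m → ℚ_[p]) → ℚ_[p]), 0 < N ∧ DF f ∧
      ∀ l, X l → Y i l → f l ≠ 0 ∧ (N:ℤ) * κ l = (f l).valuation

theorem SVon_base {X : (Fin m → ℚ_[p]) → Prop} {κ : (Fin m → ℚ_[p]) → ℤ} {N : ℕ}
    {f : (Fin m → ℚ_[p]) → ℚ_[p]} (hN : 0 < N) (hf : DF f)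
    (h : ∀ l, X l → f l ≠ 0 ∧ (N:ℤ) * κ l = (f l).valuation) : SVon X κ :=
  ⟨Unit, inferInstance, fun _ _ => True, fun _ => SA_const _, fun _ _ => ⟨(), trivial⟩,
    fun _ => ⟨N, f, hN, hf, fun l hl _ => h l hl⟩⟩

theorem SVon_glue {X : (Fin m → ℚ_[p]) → Prop} {κ : (Fin m → ℚ_[p]) → ℤ} {ι : Type} [Finite ι]
    {Y : ι → (Fin m → ℚ_[p]) → Prop} (hY : ∀ i, SA (Y i)) (hc : ∀ l, X l → ∃ i, Y i l)
    (h : ∀ i, SVon (fun l => X l ∧ Y i l) κ) : SVon X κ := by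
  choose J hJ Z hZ hZc hf using h
  refine ⟨Σ i, J i, inferInstance, fun q l => Y q.1 l ∧ Z q.1 q.2 l,
    fun q => SA.and _ _ (hY _) (hZ _ _), fun l hl => ?_, fun q => ?_⟩
  · obtain ⟨i, hi⟩ := hc l hl
    obtain ⟨j, hj⟩ := hZc i l ⟨hl, hi⟩
    exact ⟨⟨i, j⟩, hi, hj⟩
  · obtain ⟨N, f, hN, hfd, h⟩ := hf q.1 q.2
    exact ⟨N, f, hN, hfd, fun l hl hy => h l ⟨hl, hy.1⟩ hy.2⟩

theorem SVon_bind {X : (Fin m → ℚ_[p]) → Prop} {κ κ' : (Fin m → ℚ_[p]) → ℤ} (h : SVon X κ)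
    (h' : ∀ (Y : (Fin m → ℚ_[p]) → Prop) (N : ℕ) (f : (Fin m → ℚ_[p]) → ℚ_[p]), 0 < N → DF f →
      (∀ l, Y l → X l) → (∀ l, Y l → f l ≠ 0 ∧ (N:ℤ) * κ l = (f l).valuation) → SVon Y κ') :
    SVon X κ' := by
  obtain ⟨ι, _, Y, hY, hc, hf⟩ := h
  refine SVon_glue hY hc (fun i => ?_)
  obtain ⟨N, f, hN, hfd, h⟩ := hf i
  exact h' _ N f hN hfd (fun l hl => hl.1) (fun l hl => h l hl.1 hl.2)

theorem SVon.mono {X X' : (Fin m → ℚ_[p]) → Prop} {κ : (Fin m → ℚ_[p]) → ℤ} (h : SVon X κ)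
    (hX : ∀ l, X' l → X l) : SVon X' κ := by
  obtain ⟨ι, _, Y, hY, hc, hf⟩ := h
  refine ⟨ι, inferInstance, Y, hY, fun l hl => hc l (hX l hl), fun i => ?_⟩
  obtain ⟨N, f, hN, hfd, h⟩ := hf i
  exact ⟨N, f, hN, hfd, fun l hl => h l (hX l hl)⟩

theorem SVon.congr {X : (Fin m → ℚ_[p]) → Prop} {κ κ' : (Fin m → ℚ_[p]) → ℤ} (h : SVon X κ)
    (e : ∀ l, X l → κ' l = κ l) : SVon X κ' :=
  SVon_bind h (fun Y N f hN hf hYX hY => SVon_base hN hf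
    (fun l hl => by rw [e l (hYX l hl)]; exact hY l hl))

theorem SVon_const (X : (Fin m → ℚ_[p]) → Prop) (n : ℤ) : SVon X (fun _ => n) :=
  SVon_base one_pos (DF_const ((p:ℚ_[p]) ^ n))
    (fun l _ => ⟨zpow_ne_zero _ pK0, by rw [v_pow_p]; simp⟩)

theorem SVon_two {X Y : (Fin m → ℚ_[p]) → Prop} {κ : (Fin m → ℚ_[p]) → ℤ} (hY : SA Y)
    (h1 : SVon (fun l => X l ∧ Y l) κ) (h2 : SVon (fun l => X l ∧ ¬ Y l) κ) : SVon X κ := by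
  refine SVon_glue (ι := Bool) (Y := fun b l => if b then Y l else ¬ Y l) (fun b => ?_)
    (fun l _ => ?_) (fun b => ?_)
  · cases b
    · simpa using hY.not
    · simpa using hY
  · by_cases h : Y l
    · exact ⟨true, by simpa using h⟩
    · exact ⟨false, by simpa using h⟩
  · cases b
    · simpa using h2
    · simpa using h1

/-- the tame structure of subanalytic functions `ℚ_p^m → ℤ` -/
def T0 (p : ℕ) [hp : Fact p.Prime] (m : ℕ) : Tame (Fin m → ℚ_[p]) where
  V := {κ | SVon (fun _ => True) κ}
  const' n := SVon_const _ n
  add' κ₁ κ₂ h1 h2 := by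
    refine SVon_bind h1 (fun Y N f hN hf hYX hY => ?_)
    refine SVon_bind (h2.mono (fun _ _ => trivial)) (fun Z N' f' hN' hf' hZX hZ => ?_)
    refine SVon_base (Nat.mul_pos hN hN') ((hf.pow N').mul (hf'.pow N)) (fun l hl => ?_)
    obtain ⟨a1, b1⟩ := hY l (hZX l hl)
    obtain ⟨a2, b2⟩ := hZ l hl
    refine ⟨mul_ne_zero (pow_ne_zero _ a1) (pow_ne_zero _ a2), ?_⟩
    rw [v_mul (pow_ne_zero _ a1) (pow_ne_zero _ a2), Padic.valuation_pow, Padic.valuation_pow,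
      ← b1, ← b2]
    push_cast; ring
  neg' κ h := by
    refine SVon_bind h (fun Y N f hN hf hYX hY => SVon_base hN hf.inv (fun l hl => ?_))
    obtain ⟨a1, b1⟩ := hY l hl
    refine ⟨inv_ne_zero a1, ?_⟩
    rw [v_inv, ← b1]; ring
  ite' κ₁ κ₂ κ₃ h1 h2 h3 := by
    refine SVon_bind h1 (fun Y N f hN hf hYX hY => ?_)
    have key : ∀ l, Y l → (‖f l‖ ≤ 1 ↔ 0 ≤ κ₁ l) := by
      intro l hl
      obtain ⟨a1, b1⟩ := hY l hl
      have h0 := norm_le_iff (p := p) a1 one_ne_zero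
      rw [norm_one, Padic.valuation_one, ← b1] at h0
      rw [h0]
      have : (0:ℤ) < N := by exact_mod_cast hN
      constructor
      · intro h; exact nonneg_of_mul_nonneg_right h this
      · intro h; exact mul_nonneg this.le h
    refine SVon_two (SA_normle hf) ?_ ?_
    · exact (h2.mono (fun _ _ => trivial)).congr
        (fun l hl => by simp [(key l hl.1).1 hl.2])
    · refine (h3.mono (fun _ _ => trivial)).congr (fun l hl => ?_)
      have := (not_congr (key l hl.1)).1 hl.2
      simp [this]
  div' κ n h hn := by
    refine SVon_bind h (fun Y N f hN hf hYX hY => ?_)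
    have hN' : (0:ℤ) < N := by exact_mod_cast hN
    have hn' : (0:ℤ) < n := by exact_mod_cast hn
    refine SVon_glue (ι := Fin n)
      (fun r => SA_dvd hf (Nat.mul_pos hN hn) ((N:ℤ) * (r:ℕ))) (fun l hl => ?_) (fun r => ?_)
    · obtain ⟨a1, b1⟩ := hY l hl
      have h0 := Int.emod_nonneg (κ l) hn'.ne'
      have h1 := Int.emod_lt_of_pos (κ l) hn'
      refine ⟨⟨(κ l % n).toNat, by omega⟩, a1, κ l / n, ?_⟩
      dsimp only
      rw [Int.toNat_of_nonneg h0, ← b1]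
      push_cast
      have := Int.emod_add_mul_ediv (κ l) n
      linear_combination -(N:ℤ) * this
    · refine SVon_base (Nat.mul_pos hN hn)
        (hf.mul (DF_const ((p:ℚ_[p]) ^ (-((N:ℤ) * (r:ℕ)))))) (fun l hl => ?_)
      obtain ⟨hl, hne, t, ht⟩ := hl
      obtain ⟨a1, b1⟩ := hY l hl
      refine ⟨mul_ne_zero a1 (zpow_ne_zero _ pK0), ?_⟩
      rw [v_mul a1 (zpow_ne_zero _ pK0), v_pow_p]
      push_cast at ht
      have hk : κ l = r + n * t := by
        rw [← b1] at ht
        have : (N:ℤ) * κ l = N * (r + n * t) := by linear_combination ht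
        exact mul_left_cancel₀ hN'.ne' this
      have hr : κ l / (n:ℤ) = t := by
        rw [hk, Int.add_mul_ediv_left _ _ hn'.ne',
          Int.ediv_eq_zero_of_lt (by positivity) (by exact_mod_cast r.2), zero_add]
      rw [hr]
      push_cast
      linear_combination -ht

theorem DF.meas {f : (Fin m → ℚ_[p]) → ℚ_[p]} (hf : DF f) : (T0 p m).Meas f := by
  refine ⟨?_, fun N => ?_⟩
  · refine SVon_two (SA.zero f hf) ?_ ?_
    · exact (SVon_const _ 0).congr (fun l hl => by simp [hl.2])
    · exact SVon_base one_pos hf (fun l hl => ⟨hl.2, by simp⟩)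
  · refine SVon_glue (ι := Fin (p ^ N)) (Y := fun c l => acz N (f l) = ((c:ℕ):ℤ))
      (fun c => SA_acz hf N _) (fun l _ => ?_) (fun c => ?_)
    · have h0 := acz_nonneg N (f l)
      have h1 := acz_lt N (f l)
      refine ⟨⟨(acz N (f l)).toNat, ?_⟩, ?_⟩
      · zify; rw [Int.toNat_of_nonneg h0]; exact h1
      · exact (Int.toNat_of_nonneg h0).symm
    · exact (SVon_const _ ((c:ℕ):ℤ)).congr (fun l hl => hl.2)

/-! ### constructible functions -/

theorem SA.lift {P : (Fin m → ℚ_[p]) → Prop} (h : SA P) :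
    SA (fun z : Fin (m+1) → ℚ_[p] => P (fun i => z i.castSucc)) :=
  h.pull (g := fun i z => z i.castSucc) (fun i => DF_coord _)

theorem DF.lift {f : (Fin m → ℚ_[p]) → ℚ_[p]} (h : DF f) :
    DF (fun z : Fin (m+1) → ℚ_[p] => f (fun i => z i.castSucc)) :=
  DF_comp h (g := fun i z => z i.castSucc) (fun i => DF_coord _)

theorem subfn_of {h : (Fin m → ℚ_[p]) → ℚ_[p]}
    (H : SA (fun z : Fin (m+1) → ℚ_[p] => h (fun i => z i.castSucc) = z (Fin.last m))) :
    PadicSub.IsSubanalyticFn p h := by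
  have := H.isSubanalytic
  unfold PadicSub.IsSubanalyticFn PadicSub.IsSubanalyticFnOn PadicSub.graphFun
  simpa using this

theorem DF.subfn {h : (Fin m → ℚ_[p]) → ℚ_[p]} (hd : DF h) : PadicSub.IsSubanalyticFn p h :=
  subfn_of ((SA.zero _ (hd.lift.sub (DF_coord (Fin.last m)))).congr
    (fun z => sub_eq_zero.symm))

open Classical in
theorem CA_ind {P : (Fin m → ℚ_[p]) → Prop} (h : SA P) :
    (fun l => if P l then (1:ℚ) else 0) ∈ PadicSub.ConstructibleAlg p m := by
  refine Algebra.subset_adjoin (Or.inr ⟨fun l => if P l then 1 else 0, subfn_of ?_, ?_⟩)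
  · refine (SA.or _ _
      (SA.and _ _ h.lift (SA.zero _ ((DF_const 1).sub (DF_coord (Fin.last m)))))
      (SA.and _ _ h.lift.not (SA.zero _ ((DF_const 0).sub (DF_coord (Fin.last m)))))).congr
      (fun z => ?_)
    by_cases hz : P (fun i => z i.castSucc)
    · simp [hz, sub_eq_zero]
    · simp [hz, sub_eq_zero, eq_comm]
  · funext l
    by_cases hP : P l <;> simp [hP]

open Classical in
theorem CA_glue {ι : Type} [Finite ι] {Y : ι → (Fin m → ℚ_[p]) → Prop} (hY : ∀ i, SA (Y i))
    (hc : ∀ l, ∃ i, Y i l) {g : (Fin m → ℚ_[p]) → ℚ}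
    (h : ∀ i, ∃ g' ∈ PadicSub.ConstructibleAlg p m, ∀ l, Y i l → g l = g' l) :
    g ∈ PadicSub.ConstructibleAlg p m := by
  cases nonempty_fintype ι
  choose g' h1 h2 using h
  have : ∀ s : Finset ι, (fun b => if ∃ i ∈ s, Y i b then g b else 0) ∈
      PadicSub.ConstructibleAlg p m := by
    intro s
    induction s using Finset.induction_on with
    | empty => convert Subalgebra.zero_mem _ using 1; ext b; simp
    | insert a s ha ih =>
      convert Subalgebra.add_mem _ (Subalgebra.mul_mem _ (CA_ind (hY a)) (h1 a))
        (Subalgebra.mul_mem _ (CA_ind (hY a).not) ih) using 1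
      ext b
      by_cases hb : Y a b
      · simp [hb, h2 a b hb]
      · simp [hb]
  convert this Finset.univ using 1
  ext b
  rw [if_pos]; simpa using hc b

open Classical in
/-- norms of `N`-th roots -/
theorem CA_root {f : (Fin m → ℚ_[p]) → ℚ_[p]} (hf : DF f) {N : ℕ} (hN : 0 < N) :
    ∃ g ∈ PadicSub.ConstructibleAlg p m, ∀ l, f l ≠ 0 → ∀ k : ℤ, (N:ℤ) * k = (f l).valuation →
      (p:ℚ) ^ k = g l := by
  have hN0 : N ≠ 0 := hN.ne'
  set M := N + 1 with hM
  let C : ℚ_[p] → Prop := fun x => x ≠ 0 ∧ (N:ℤ) ∣ x.valuation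
  have hex : ∀ x : ℚ_[p], C x → ∃ θ ≠ 0, θ^N = x/((acz (M+N+1) x : ℤ):ℚ_[p]) ∧
      ‖ac θ - 1‖ ≤ (p:ℝ)^(-(M:ℤ)) := fun x hx => exists_root hN0 le_rfl hx.1 hx.2
  let th : ℚ_[p] → ℚ_[p] := fun x => if h : C x then (hex x h).choose else 0
  have hth : ∀ x, C x → th x ≠ 0 ∧ (th x)^N = x/((acz (M+N+1) x : ℤ):ℚ_[p]) ∧
      ‖ac (th x) - 1‖ ≤ (p:ℝ)^(-(M:ℤ)) := by
    intro x hx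
    simp only [th, dif_pos hx]
    exact (hex x hx).choose_spec
  have hth0 : ∀ x, ¬ C x → th x = 0 := fun x hx => by simp only [th, dif_neg hx]
  have huniq : ∀ x, C x → ∀ y : ℚ_[p], th x = y ↔
      (x - ((acz (M+N+1) x : ℤ):ℚ_[p]) * y ^ N = 0 ∧ acz M y = acz M (1:ℚ_[p])) := by
    intro x hx y
    obtain ⟨h1, h2, h3⟩ := hth x hx
    have hc : ((acz (M+N+1) x : ℤ):ℚ_[p]) ≠ 0 := by
      rw [← norm_pos_iff, norm_acz (by omega) hx.1]; exact one_pos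
    rw [acz_eq_iff, ac_one]
    constructor
    · rintro rfl
      refine ⟨?_, h3⟩
      rw [h2]; field_simp; ring
    · rintro ⟨h4, h5⟩
      have h6 : (th x) ^ N = y ^ N := by
        rw [h2, div_eq_iff hc]; linear_combination h4
      have h7 : (ac (th x)) ^ N = (ac y) ^ N := by rw [← ac_pow, ← ac_pow, h6]
      have h8 := pow_near hN0 h3 h5
      rw [h7, sub_self, norm_zero] at h8
      have h9 : ac (th x) = ac y := by
        have hpos : (0:ℝ) < (p:ℝ) ^ (-(N:ℤ)) := pN_pos _
        have : ‖ac (th x) - ac y‖ ≤ 0 := by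
          by_contra hcon
          push Not at hcon
          have := mul_pos hpos hcon
          linarith
        exact sub_eq_zero.1 (norm_le_zero_iff.1 this)
      have h10 : (th x).valuation = y.valuation := by
        have := congrArg Padic.valuation h6
        rw [Padic.valuation_pow, Padic.valuation_pow] at this
        exact mul_left_cancel₀ (by exact_mod_cast hN0) this
      rw [ac_spec (th x), ac_spec y, h9, h10]
  have hsub : SA (fun z : Fin (m+1) → ℚ_[p] =>
      th (f (fun i => z i.castSucc)) = z (Fin.last m)) := by
    have hC := (SA_dvd hf.lift hN 0)
    refine (SA.or _ _ (SA.and _ _ hC.not (SA.zero _ (DF_coord (Fin.last m))))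
      (SA.and _ _ hC (SA_exists (ι := Fin (p ^ (M+N+1)))
        (P := fun c z => acz (M+N+1) (f (fun i => z i.castSucc)) = ((c:ℕ):ℤ) ∧
          (f (fun i => z i.castSucc) - (((c:ℕ):ℤ):ℚ_[p]) * (z (Fin.last m)) ^ N = 0 ∧
            acz M (z (Fin.last m)) = acz M (1:ℚ_[p]))) (fun c =>
          SA.and _ _ (SA_acz hf.lift _ _) (SA.and _ _
            (SA.zero _ (hf.lift.sub ((DF_const _).mul ((DF_coord (Fin.last m)).pow N))))
            (SA_acz (DF_coord (Fin.last m)) _ _)))))).congr (fun z => ?_)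
    set x := f (fun i => z i.castSucc)
    have eC : (x ≠ 0 ∧ (N:ℤ) ∣ x.valuation - 0) ↔ C x := by simp [C]
    rw [eC]
    by_cases hx : C x
    · rw [huniq x hx]
      simp only [hx, not_true_eq_false, false_and, true_and, false_or]
      constructor
      · intro h
        have h0 := acz_nonneg (M+N+1) x
        have h1 := acz_lt (M+N+1) x
        refine ⟨⟨(acz (M+N+1) x).toNat, ?_⟩, ?_⟩
        · zify; rw [Int.toNat_of_nonneg h0]; exact h1
        · dsimp only
          rw [Int.toNat_of_nonneg h0]
          exact ⟨rfl, h⟩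
      · rintro ⟨c, hc, h⟩
        rw [hc]; exact h
    · rw [hth0 x hx]
      simp [hx, eq_comm]
  have hval : ∀ x, C x → ∀ k : ℤ, (N:ℤ) * k = x.valuation → (th x).valuation = k := by
    intro x hx k hk
    obtain ⟨h1, h2, h3⟩ := hth x hx
    have hn := norm_acz (p := p) (N := M+N+1) (by omega) hx.1
    have hc : ((acz (M+N+1) x : ℤ):ℚ_[p]) ≠ 0 := by
      rw [← norm_pos_iff, hn]; exact one_pos
    have h4 : ‖(th x) ^ N‖ = ‖x‖ := by rw [h2, norm_div, hn, div_one]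
    have h5 := (norm_eq_iff (pow_ne_zero N h1) hx.1).1 h4
    rw [Padic.valuation_pow, ← hk] at h5
    exact mul_left_cancel₀ (by exact_mod_cast hN0) h5
  -- the inverse of the norm of the root
  let h : (Fin m → ℚ_[p]) → ℚ_[p] := fun l => (th (f l))⁻¹
  have hsubh : SA (fun z : Fin (m+1) → ℚ_[p] =>
      h (fun i => z i.castSucc) = z (Fin.last m)) := by
    have hpull := hsub.pull (m := m+1)
      (g := Fin.lastCases (motive := fun _ => (Fin (m+1) → ℚ_[p]) → ℚ_[p])
        (fun z => (z (Fin.last m))⁻¹) (fun i z => z i.castSucc)) (fun i => by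
          refine Fin.lastCases ?_ (fun j => ?_) i
          · simpa using (DF_coord (Fin.last m)).inv
          · simpa using DF_coord _)
    refine hpull.congr (fun z => ?_)
    simp only [h, Fin.lastCases_castSucc, Fin.lastCases_last]
    exact inv_eq_iff_eq_inv
  refine ⟨fun l => (padicNormE (h l) : ℚ), Algebra.subset_adjoin (Or.inr ⟨h, subfn_of hsubh, rfl⟩),
    fun l hl k hk => ?_⟩
  have hCx : C (f l) := ⟨hl, k, hk.symm⟩
  have h1 := hval _ hCx k hk
  have h2 : ‖h l‖ = (p:ℝ) ^ k := by
    simp only [h]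
    rw [norm_inv, nv (hth _ hCx).1, h1, zpow_neg, inv_inv]
  have h3 : ((padicNormE (h l) : ℚ) : ℝ) = ‖h l‖ := by
    rfl
  have : (((p:ℚ) ^ k : ℚ) : ℝ) = ((padicNormE (h l) : ℚ) : ℝ) := by
    rw [h3, h2]; push_cast; rfl
  exact_mod_cast this

theorem CA_val {f : (Fin m → ℚ_[p]) → ℚ_[p]} (hf : DF f) :
    (fun l => ((f l).valuation : ℚ)) ∈ PadicSub.ConstructibleAlg p m := by
  refine Algebra.subset_adjoin (Or.inl ⟨fun l => f l + (1 - f l * (f l)⁻¹),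
    (hf.add ((DF_const 1).sub (hf.mul hf.inv))).subfn, fun l => ?_, ?_⟩)
  · by_cases h : f l = 0
    · simp [h]
    · simp [h]
  · funext l
    by_cases h : f l = 0
    · simp [h]
    · simp [h]

theorem CA_const (c : ℚ) : (fun _ : Fin m → ℚ_[p] => c) ∈ PadicSub.ConstructibleAlg p m :=
  (PadicSub.ConstructibleAlg p m).algebraMap_mem c

theorem Cn_le_CA : (T0 p m).Cn p ≤ PadicSub.ConstructibleAlg p m := by
  refine Algebra.adjoin_le ?_
  rintro g (⟨κ, hκ, rfl⟩ | ⟨κ, hκ, rfl⟩)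
  · obtain ⟨ι, _, Y, hY, hc, hf⟩ := hκ
    refine CA_glue hY (fun l => hc l trivial) (fun i => ?_)
    obtain ⟨N, f, hN, hfd, h⟩ := hf i
    refine ⟨_, Subalgebra.mul_mem _ (CA_const ((N:ℚ)⁻¹)) (CA_val hfd), fun l hl => ?_⟩
    obtain ⟨h1, h2⟩ := h l trivial hl
    have hN' : (N:ℚ) ≠ 0 := by exact_mod_cast hN.ne'
    simp only [Pi.mul_apply]
    rw [← h2]; push_cast; field_simp
  · obtain ⟨ι, _, Y, hY, hc, hf⟩ := hκ
    refine CA_glue hY (fun l => hc l trivial) (fun i => ?_)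
    obtain ⟨N, f, hN, hfd, h⟩ := hf i
    obtain ⟨g, hg, e⟩ := CA_root hfd hN
    refine ⟨g, hg, fun l hl => ?_⟩
    obtain ⟨h1, h2⟩ := h l trivial hl
    exact e l h1 _ h2

end DC


open Filter MeasureTheory Polynomial

set_option linter.unusedVariables false
set_option linter.unusedSectionVars false

namespace DC
open Tame

variable {p : ℕ} [hp : Fact p.Prime] {m : ℕ}

theorem evP_small {F : PowerSeries ℤ_[p]} {M : ℕ} (h : ∀ n < M, PowerSeries.coeff n F = 0) :
    ‖evP p F‖ ≤ ((p:ℝ)⁻¹)^M := by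
  have h1 := evP_trunc F M
  rwa [Finset.sum_eq_zero (fun n hn => by rw [h n (Finset.mem_range.1 hn), zero_mul]),
    sub_zero] at h1

theorem pinv_lt {ε : ℝ} (hε : 0 < ε) : ∃ M : ℕ, ((p:ℝ)⁻¹)^M < ε :=
  exists_pow_lt_of_lt_one hε (inv_lt_one_of_one_lt₀ (by exact_mod_cast hp.out.one_lt))

open Classical in
/-- the multi-indices occurring in the first `M` coefficients -/
noncomputable def suppM {k : ℕ} (G : PowerSeries (MvPolynomial (Fin k) ℤ_[p])) (M : ℕ) :
    Finset (Fin k → ℕ) :=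
  (Finset.range M).biUnion (fun n => ((PowerSeries.coeff n G).support).image (fun α : Fin k →₀ ℕ => (⇑α : Fin k → ℕ)))

theorem suppM_not {k : ℕ} {G : PowerSeries (MvPolynomial (Fin k) ℤ_[p])} {M : ℕ} {α : Fin k → ℕ}
    (h : α ∉ suppM G M) {n : ℕ} (hn : n < M) :
    MvPolynomial.coeff (Finsupp.equivFunOnFinite.symm α) (PowerSeries.coeff n G) = 0 := by
  classical
  by_contra hc
  refine h (Finset.mem_biUnion.2 ⟨n, Finset.mem_range.2 hn, Finset.mem_image.2
    ⟨_, MvPolynomial.mem_support_iff.2 hc, ?_⟩⟩)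
  simp

/-- the coefficients of the restricted power series defined by `G` -/
noncomputable def cG {k : ℕ} (G : PowerSeries (MvPolynomial (Fin k) ℤ_[p])) (α : Fin k → ℕ) :
    ℤ_[p] := evP p (cf (Finsupp.equivFunOnFinite.symm α) G)

theorem cG_tendsto {k : ℕ} (G : PowerSeries (MvPolynomial (Fin k) ℤ_[p])) :
    Tendsto (cG G) cofinite (nhds 0) := by
  rw [Metric.tendsto_nhds]
  intro ε hε
  obtain ⟨M, hM⟩ := pinv_lt (p := p) hε
  rw [Filter.eventually_cofinite]
  refine (suppM G M).finite_toSet.subset (fun α hα => ?_)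
  by_contra hc
  refine hα ?_
  rw [dist_zero_right]
  refine lt_of_le_of_lt (evP_small (fun n hn => ?_)) hM
  rw [cf_coeff]
  exact suppM_not (by simpa using hc) hn

theorem cG_hasSum {k : ℕ} (G : PowerSeries (MvPolynomial (Fin k) ℤ_[p])) (x : Fin k → ℤ_[p]) :
    HasSum (fun α : Fin k → ℕ => cG G α * ∏ j, x j ^ α j)
      (evP p (PowerSeries.map (MvPolynomial.eval x) G)) := by
  classical
  rw [HasSum, SummationFilter.unconditional_filter, Metric.tendsto_nhds]
  intro ε hε
  obtain ⟨M, hM⟩ := pinv_lt (p := p) hε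
  filter_upwards [Filter.eventually_ge_atTop (suppM G M)] with S hS
  rw [dist_eq_norm]
  have e : ∑ α ∈ S, cG G α * ∏ j, x j ^ α j - evP p (PowerSeries.map (MvPolynomial.eval x) G)
      = evP p (∑ α ∈ S, cf (Finsupp.equivFunOnFinite.symm α) G * PowerSeries.C (∏ j, x j ^ α j)
        - PowerSeries.map (MvPolynomial.eval x) G) := by
    rw [map_sub, map_sum]
    simp [cG]
  rw [e]
  refine lt_of_le_of_lt (evP_small (fun n hn => ?_)) hM
  rw [map_sub, map_sum, PowerSeries.coeff_map, sub_eq_zero, MvPolynomial.eval_eq']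
  simp only [PowerSeries.coeff_mul_C, cf_coeff]
  have e2 : ∑ α ∈ S, MvPolynomial.coeff (Finsupp.equivFunOnFinite.symm α) (PowerSeries.coeff n G)
        * ∏ j, x j ^ α j
      = ∑ d ∈ S.map (Finsupp.equivFunOnFinite (α := Fin k) (M := ℕ)).symm.toEmbedding,
        MvPolynomial.coeff d (PowerSeries.coeff n G) * ∏ j, x j ^ d j := by
    rw [Finset.sum_map]; simp
  rw [e2]
  symm
  refine Finset.sum_subset (fun d hd => ?_) (fun d _ hd => ?_)
  · refine Finset.mem_map.2 ⟨⇑d, hS (Finset.mem_biUnion.2 ⟨n, Finset.mem_range.2 hn,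
      Finset.mem_image.2 ⟨d, hd, rfl⟩⟩), ?_⟩
    ext; simp
  · rw [MvPolynomial.notMem_support_iff.1 hd, zero_mul]

/-- every restricted power series over `ℤ_p` arises in this way -/
theorem exists_cG {k : ℕ} {a : (Fin k → ℕ) → ℤ_[p]} (ha : Tendsto a cofinite (nhds 0)) :
    ∃ G : PowerSeries (MvPolynomial (Fin k) ℤ_[p]), ∀ α, cG G α = a α := by
  classical
  have hfin : ∀ n : ℕ, {α | a α ≠ 0 ∧ (a α).valuation = n}.Finite := by
    intro n
    rw [Metric.tendsto_nhds] at ha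
    have h1 := ha ((p:ℝ) ^ (-(n:ℤ))) (pN_pos _)
    rw [Filter.eventually_cofinite] at h1
    refine h1.subset (fun α hα => ?_)
    have hα' : a α ≠ 0 ∧ (a α).valuation = n := hα
    show ¬ (dist (a α) 0 < (p:ℝ) ^ (-(n:ℤ)))
    rw [dist_zero_right, PadicInt.norm_eq_zpow_neg_valuation hα'.1, hα'.2]
    exact lt_irrefl _
  let b : (Fin k → ℕ) → ℤ_[p] := fun α => if h : a α ≠ 0 then (PadicInt.unitCoeff h : ℤ_[p]) else 0
  have hb : ∀ α, a α ≠ 0 → a α = b α * (p:ℤ_[p]) ^ (a α).valuation := by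
    intro α h
    simp only [b, dif_pos h]
    exact PadicInt.unitCoeff_spec h
  let G : PowerSeries (MvPolynomial (Fin k) ℤ_[p]) := PowerSeries.mk (fun n =>
    ∑ α ∈ (hfin n).toFinset, MvPolynomial.monomial (Finsupp.equivFunOnFinite.symm α) (b α))
  refine ⟨G, fun α => ?_⟩
  have hcoeff : ∀ n, PowerSeries.coeff n (cf (Finsupp.equivFunOnFinite.symm α) G)
      = if a α ≠ 0 ∧ (a α).valuation = n then b α else 0 := by
    intro n
    rw [cf_coeff]
    simp only [G, PowerSeries.coeff_mk, MvPolynomial.coeff_sum, MvPolynomial.coeff_monomial,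
      EmbeddingLike.apply_eq_iff_eq]
    rw [Finset.sum_ite_eq' ]
    simp
  rw [cG, evP_apply]
  by_cases h : a α = 0
  · simp [hcoeff, h]
  · rw [tsum_eq_single (a α).valuation]
    · rw [hcoeff, if_pos ⟨h, rfl⟩]; exact (hb α h).symm
    · intro n hn
      rw [hcoeff, if_neg (fun hc => hn hc.2.symm), zero_mul]

/-- the ring of integral `D`-functions -/
def D0 (p : ℕ) [hp : Fact p.Prime] (m : ℕ) :
    Subalgebra ℤ_[p] ((Fin m → ℚ_[p]) → ℤ_[p]) where
  carrier := {g | DF (fun l => ((g l : ℤ_[p]) : ℚ_[p]))}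
  mul_mem' {f g} hf hg := DF.congr (DF.mul hf hg) (fun x => by simp)
  add_mem' {f g} hf hg := DF.congr (DF.add hf hg) (fun x => by simp)
  algebraMap_mem' r := DF.congr (DF_const (r : ℚ_[p])) (fun x => by simp)

theorem D0_conv {k : ℕ} {u : Fin k → (Fin m → ℚ_[p]) → ℤ_[p]} (hu : ∀ i, u i ∈ D0 p m)
    (G : PowerSeries (MvPolynomial (Fin k) ℤ_[p])) :
    (fun l => evP p (PowerSeries.map (MvPolynomial.eval (fun i => u i l)) G)) ∈ D0 p m := by
  have hr : PadicSub.IsRestrictedCoeffs p (fun α => ((cG G α : ℤ_[p]) : ℚ_[p])) := by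
    have h1 := (continuous_subtype_val.tendsto (0 : ℤ_[p])).comp (cG_tendsto G)
    exact h1
  have h2 := DF_comp (PadicSub.IsDFunction.ranal _ hr) (g := fun i l => ((u i l : ℤ_[p]) : ℚ_[p]))
    (fun i => hu i)
  refine DF.congr h2 (fun l => ?_)
  dsimp only
  rw [PadicSub.ranalFn, if_pos (show ∀ j, ‖((u j l : ℤ_[p]) : ℚ_[p])‖ ≤ 1 from
    fun j => (u j l).2)]
  have h3 := (cG_hasSum G (fun i => u i l)).map (PadicInt.Coe.ringHom (p := p))
    continuous_subtype_val
  have h4 := h3.tsum_eq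
  rw [show ((evP p (PowerSeries.map (MvPolynomial.eval (fun i => u i l)) G) : ℤ_[p]) : ℚ_[p])
    = PadicInt.Coe.ringHom (evP p (PowerSeries.map (MvPolynomial.eval (fun i => u i l)) G)) from rfl,
    ← h4]
  refine tsum_congr (fun α => ?_)
  simp only [Function.comp, map_mul, map_prod, map_pow]
  rfl

theorem D0_base : BaseRing (T0 p m) (D0 p m) where
  meas f hf := DF.meas hf
  conv := by
    intro ι _ u hu F
    obtain ⟨k, ⟨e⟩⟩ := Finite.exists_equiv_fin ι
    have h := D0_conv (u := fun i => u (e.symm i)) (fun i => hu _)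
      (PowerSeries.map (MvPolynomial.rename e : MvPolynomial ι ℤ_[p] →ₐ[ℤ_[p]] _).toRingHom F)
    convert h using 1
    funext l
    rw [map_map_apply]
    congr 2
    ext i n
    simp [MvPolynomial.eval_rename, Function.comp_def]
  quot f hf g hg := by
    refine DF.congr ((DF.mul hf (DF.inv hg)).trunc) (fun l => ?_)
    rw [toZp_coe, div_eq_mul_inv]

theorem D0_coord (i : Fin m) : (fun l : Fin m → ℚ_[p] => toZp (l i)) ∈ D0 p m :=
  DF.congr (DF_coord i).trunc (fun l => toZp_coe _)

/-- integral restricted power series give elements of `AF` -/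
theorem AF_of_coeffs {s : ℕ} {a : (Fin (s + m) → ℕ) → ℤ_[p]} (ha : Tendsto a cofinite (nhds 0)) :
    ∃ f : (Fin s → ℚ_[p]) × (Fin m → ℤ_[p]) → ℤ_[p], AF (D0 p s) m f ∧
      ∀ lam : Fin s → ℚ_[p], (∀ j, ‖lam j‖ ≤ 1) → ∀ x : Fin m → ℤ_[p],
        ((f (lam, x) : ℤ_[p]) : ℚ_[p]) = ∑' α : Fin (s + m) → ℕ,
          (a α : ℚ_[p]) * ∏ j, Fin.append lam (fun i => ((x i : ℤ_[p]) : ℚ_[p])) j ^ α j := by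
  obtain ⟨G, hG⟩ := exists_cG ha
  let ψ : MvPolynomial (Fin (s + m)) ℤ_[p] →+*
      MvPolynomial (Fin m) (MvPolynomial (Fin s) ℤ_[p]) :=
    MvPolynomial.eval₂Hom (MvPolynomial.C.comp MvPolynomial.C)
      (Fin.append (fun i => MvPolynomial.C (MvPolynomial.X i)) (fun j => MvPolynomial.X j))
  have hψ : ∀ (u : Fin s → ℤ_[p]) (x : Fin m → ℤ_[p]),
      (evm u x).comp ψ = MvPolynomial.eval (Fin.append u x) := by
    intro u x
    ext i
    · simp [ψ, evm]
    · refine Fin.addCases (fun i => ?_) (fun i => ?_) i <;> simp [ψ, evm]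
  refine ⟨fun z => evP p (PowerSeries.map (evm (fun i => toZp (z.1 i)) z.2) (PowerSeries.map ψ G)),
    ⟨Fin s, inferInstance, fun i l => toZp (l i), PowerSeries.map ψ G, fun i => D0_coord i,
      fun z => rfl⟩, fun lam hlam x => ?_⟩
  dsimp only
  rw [map_map_apply, hψ]
  have h3 := (cG_hasSum G (Fin.append (fun i => toZp (lam i)) x)).map (PadicInt.Coe.ringHom (p := p))
    continuous_subtype_val
  have h4 := h3.tsum_eq
  refine h4.symm.trans (tsum_congr (fun α => ?_))
  simp only [Function.comp, map_mul, map_prod, map_pow, hG]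
  congr 1
  refine Finset.prod_congr rfl (fun j _ => ?_)
  congr 1
  refine Fin.addCases (fun i => ?_) (fun i => ?_) j
  · rw [Fin.append_left, Fin.append_left]; exact toZp_of_le (hlam i)
  · rw [Fin.append_right, Fin.append_right]; rfl

end DC


open Filter MeasureTheory Polynomial

set_option linter.unusedVariables false
set_option linter.unusedSectionVars false

namespace DC
open Tame

variable {p : ℕ} [hp : Fact p.Prime] {m : ℕ}

/-- the inclusion `ℤ_p^m → ℚ_p^m` -/
def eZ (p : ℕ) [hp : Fact p.Prime] (m : ℕ) : (Fin m → ℤ_[p]) →+ (Fin m → ℚ_[p]) where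
  toFun x i := ((x i : ℤ_[p]) : ℚ_[p])
  map_zero' := by ext i; simp
  map_add' x y := by ext i; simp

theorem eZ_range : Set.range (eZ p m) = PadicSub.ZpSet p m := by
  ext x
  constructor
  · rintro ⟨y, rfl⟩ j
    exact (y j).2
  · intro hx
    exact ⟨fun j => ⟨x j, hx j⟩, rfl⟩

theorem eZ_open : Topology.IsOpenEmbedding (eZ p m) := by
  refine Topology.IsOpenEmbedding.of_isEmbedding_isOpenMap ?_ ?_ 
  · exact Topology.IsEmbedding.piMap (fun i : Fin m => PadicInt.isOpenEmbedding_coe.isEmbedding)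
  · exact IsOpenMap.piMap (fun i : Fin m => PadicInt.isOpenEmbedding_coe.isOpenMap) (by simp)

theorem int_eZ (μ : Measure (Fin m → ℚ_[p])) (hμ : μ.IsAddHaarMeasure)
    (hμ1 : μ (PadicSub.ZpSet p m) = 1) (F : (Fin m → ℚ_[p]) → ℝ) :
    ∫ x in PadicSub.ZpSet p m, F x ∂μ = ∫ y, F (eZ p m y) ∂(Measure.pi (fun _ : Fin m => nu p)) := by
  have he : MeasurableEmbedding (eZ p m) := eZ_open.measurableEmbedding
  have h1 : (μ.comap (eZ p m)).IsAddHaarMeasure := Measure.IsAddHaarMeasure.comap (mH := inferInstance) μ eZ_open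
  have h2 : IsProbabilityMeasure (μ.comap (eZ p m)) := ⟨by
    rw [he.comap_apply, Set.image_univ, eZ_range, hμ1]⟩
  have h3 : μ.comap (eZ p m) = Measure.pi (fun _ : Fin m => nu p) :=
    Measure.isAddHaarMeasure_eq_of_isProbabilityMeasure _ _
  rw [← h3, ← eZ_range, ← he.map_comap, he.integral_map]

open Classical in
/-- the rational norm -/
noncomputable def qn (x : ℤ_[p]) : ℚ :=
  if ((x : ℤ_[p]) : ℚ_[p]) = 0 then 0 else (p:ℚ) ^ (-((x : ℤ_[p]) : ℚ_[p]).valuation)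

theorem qn_norm (x : ℤ_[p]) : ((qn x : ℚ) : ℝ) = ‖((x : ℤ_[p]) : ℚ_[p])‖ := by
  unfold qn
  split_ifs with h
  · simp [h]
  · rw [nv h]; push_cast; rfl

theorem main_int {s r : ℕ} (hr : 0 < r) {f : Fin r → (Fin s → ℚ_[p]) × (Fin m → ℤ_[p]) → ℤ_[p]}
    (hf : ∀ i, AF (D0 p s) m (f i)) :
    ∃ G ∈ (T0 p s).Cn p, ∀ l, ∫ x, (⨆ i, ‖((f i (l, x) : ℤ_[p]) : ℚ_[p])‖)
      ∂(Measure.pi (fun _ : Fin m => nu p)) = (G l : ℝ) := by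
  classical
  haveI : Nonempty (Fin r) := ⟨⟨0, hr⟩⟩
  let T := AFT (T0 p s) (D0 p s) m
  have hm : ∀ i, T.Meas (fun z => ((f i z : ℤ_[p]) : ℚ_[p])) := fun i => AFT_meas (hf i)
  let X : Fin r → (Fin s → ℚ_[p]) × (Fin m → ℤ_[p]) → Prop := fun i z =>
    ∀ j, ‖((f j z : ℤ_[p]) : ℚ_[p])‖ ≤ ‖((f i z : ℤ_[p]) : ℚ_[p])‖
  have hX : ∀ i, T.S (X i) := fun i => S_forall (fun j => (hm j).S_le (hm i))
  have hc : ∀ z, ∃ i, X i z := fun z =>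
    Finite.exists_max (fun i => ‖((f i z : ℤ_[p]) : ℚ_[p])‖)
  choose I hI using hc
  let Φ : (Fin s → ℚ_[p]) × (Fin m → ℤ_[p]) → ℚ := fun z => qn (f (I z) z)
  have hsup : ∀ z, ((Φ z : ℚ) : ℝ) = ⨆ i, ‖((f i z : ℤ_[p]) : ℚ_[p])‖ := by
    intro z
    rw [show ((Φ z : ℚ) : ℝ) = ‖((f (I z) z : ℤ_[p]) : ℚ_[p])‖ from qn_norm _]
    exact le_antisymm (le_ciSup (f := fun i => ‖((f i z : ℤ_[p]) : ℚ_[p])‖)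
      (Set.finite_range _).bddAbove (I z)) (ciSup_le (hI z))
  have hΦ : Φ ∈ T.Cn p := by
    refine Cn_glue hX (fun z => ⟨I z, hI z⟩) (fun i => ⟨fun z => qn (f i z), ?_, fun z hz => ?_⟩)
    · unfold qn
      convert Cn_ite (hm i).S_zero (Cn_const (p := p) 0) (Cn_pow (T.neg' _ (hm i).1)) using 1
    · have : ((qn (f (I z) z) : ℚ) : ℝ) = ((qn (f i z) : ℚ) : ℝ) := by
        rw [qn_norm, qn_norm]
        exact le_antisymm (hz _) (hI z _)
      exact_mod_cast this
  obtain ⟨G, hG, h⟩ := AF_int D0_base m Φ hΦ (fun l => ⟨1, fun x => by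
    rw [show ((Φ (l, x) : ℚ) : ℝ) = ‖((f (I (l, x)) (l, x) : ℤ_[p]) : ℚ_[p])‖ from qn_norm _,
      abs_norm]
    exact (f (I (l, x)) (l, x)).2⟩)
  refine ⟨G, hG, fun l => ?_⟩
  rw [← h l]
  simp only [hsup]

end DC

open PadicSub in
/-- **Denef's conjecture** (Theorem 1 of the paper).  For restricted power series
`f₁, …, f_r` over `ℤ_p` in the variables `(λ, x) = (λ₁, …, λ_s, x₁, …, x_m)`, the
parametrized integral `I(λ) = ∫_{ℤ_p^m} |f(λ,x)| |dx|` (where `|f| = max_i |f_i|`) is the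
restriction to `ℤ_p^s` of a subanalytic constructible function on `ℚ_p^s`. -/
theorem parametrized_analytic_integral_is_constructible
    (p : ℕ) [Fact p.Prime] (s m r : ℕ) (hr : 0 < r)
    (a : Fin r → (Fin (s + m) → ℕ) → ℤ_[p])
    (ha : ∀ i, Filter.Tendsto (a i) Filter.cofinite (nhds 0))
    (μ : MeasureTheory.Measure (Fin m → ℚ_[p]))
    (hμ : μ.IsAddHaarMeasure) (hμ1 : μ (ZpSet p m) = 1) :
    ∃ G ∈ ConstructibleAlg p s, ∀ lam ∈ ZpSet p s,
      (∫ x in ZpSet p m,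
        ⨆ i : Fin r, ‖∑' ι : Fin (s + m) → ℕ,
          ((a i ι : ℚ_[p]) * ∏ j, Fin.append lam x j ^ ι j)‖ ∂μ) = (G lam : ℝ) := by
  choose f hf he using fun i => DC.AF_of_coeffs (s := s) (m := m) (ha i)
  obtain ⟨G, hG, h⟩ := DC.main_int hr hf
  refine ⟨G, DC.Cn_le_CA hG, fun lam hlam => ?_⟩
  rw [DC.int_eZ μ hμ hμ1, ← h lam]
  refine integral_congr_ae (ae_of_all _ (fun x => ?_))
  dsimp only
  congr 1
  funext i
  rw [he i lam hlam x]
  rfl
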